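/- Finiteness of Lagrangian cohomology: let H : (ℂ^{2n},0) → (ℂⁿ,0) be a moment map germ defining a pyramidal reduced Lagrangian complete intersection, and let F : (ℂ^k×ℂ^{2n},0) → (ℂⁿ,0) be an integrable Lagrangian deformation of H. Then for every j ≥ 0 the cohomology H^j(C·_F) of the Lagrange complex of F is a finitely generated module over 𝒪_k = 𝒪_{ℂ^k,0}. -/

import Mathlib

open Filter Topology
open scoped Classical

/-- The ring of germs at `0` of holomorphic (analytic) functions on `E`. -/
def Og (E : Type*) [NormedAddCommGroup E] [NormedSpace ℂ E] :
    Subring (Germ (𝓝 (0 : E)) ℂ) where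
  carrier := {F | ∃ g : E → ℂ, AnalyticAt ℂ g 0 ∧ F = ↑g}
  one_mem' := ⟨fun _ => 1, analyticAt_const, rfl⟩
  zero_mem' := ⟨fun _ => 0, analyticAt_const, rfl⟩
  mul_mem' := by
    rintro F G ⟨f, hf, rfl⟩ ⟨g, hg, rfl⟩
    exact ⟨f * g, hf.mul hg, (Germ.coe_mul _ _).symm⟩
  add_mem' := by
    rintro F G ⟨f, hf, rfl⟩ ⟨g, hg, rfl⟩
    exact ⟨f + g, hf.add hg, (Germ.coe_add _ _).symm⟩
  neg_mem' := by
    rintro F ⟨f, hf, rfl⟩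
    exact ⟨-f, hf.neg, (Germ.coe_neg _).symm⟩

variable {E F G : Type*} [NormedAddCommGroup E] [NormedSpace ℂ E]
  [NormedAddCommGroup F] [NormedSpace ℂ F] [NormedAddCommGroup G] [NormedSpace ℂ G]

/-- A canonical analytic representative of a germ in `Og E`. -/
noncomputable def Og.rep (f : Og E) : E → ℂ :=
  Classical.choose (f.2 : ∃ g : E → ℂ, AnalyticAt ℂ g 0 ∧ f.1 = ↑g)

lemma Og.rep_spec (f : Og E) : AnalyticAt ℂ (Og.rep f) 0 ∧ f.1 = ↑(Og.rep f) :=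
  Classical.choose_spec (f.2 : ∃ g : E → ℂ, AnalyticAt ℂ g 0 ∧ f.1 = ↑g)

/-- Evaluation at the origin. -/
noncomputable def Og.ev0 (f : Og E) : ℂ := Og.rep f 0

/-- The germ of an analytic function (junk value `0` if not analytic at `0`). -/
noncomputable def Og.mk (g : E → ℂ) : Og E :=
  if h : AnalyticAt ℂ g 0 then ⟨↑g, g, h, rfl⟩ else 0

/-- The constant germ. -/
noncomputable def Og.const (c : ℂ) : Og E := Og.mk (fun _ => c)

/-- Directional derivative of a germ along the vector `v`. -/
noncomputable def Og.pd (v : E) (f : Og E) : Og E :=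
  ⟨↑(fun z => fderiv ℂ (Og.rep f) z v),
   fun z => fderiv ℂ (Og.rep f) z v,
   ((ContinuousLinearMap.apply ℂ ℂ v).analyticAt _).comp (Og.rep_spec f).1.fderiv, rfl⟩

/-- Pull-back of a germ under an analytic map preserving the origin
(junk value `0` otherwise). -/
noncomputable def Og.pull (u : E → F) (f : Og F) : Og E :=
  if h : AnalyticAt ℂ u 0 ∧ u 0 = 0 then
    ⟨↑(fun z => Og.rep f (u z)), fun z => Og.rep f (u z),
      ((h.2.symm ▸ (Og.rep_spec f).1 : AnalyticAt ℂ (Og.rep f) (u 0))).comp h.1, rfl⟩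
  else 0

/-- Composition `ψ ∘ f` of a one-variable germ `ψ` with a germ `f` such that `f(0) = 0`
(junk value `0` if `f(0) ≠ 0`). -/
noncomputable def Og.comp (ψ : Og ℂ) (f : Og E) : Og E :=
  if h : Og.ev0 f = 0 then
    have hψ0 : AnalyticAt ℂ (Og.rep ψ) (0 : ℂ) := (Og.rep_spec ψ).1
    ⟨↑(fun z => Og.rep ψ (Og.rep f z)), fun z => Og.rep ψ (Og.rep f z),
      (by
        have : Og.rep f 0 = 0 := h
        rw [← this] at hψ0
        exact hψ0.comp (Og.rep_spec f).1 : AnalyticAt ℂ (fun z => Og.rep ψ (Og.rep f z)) 0),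
      rfl⟩
  else 0

/-! ### Lagrangian deformation theory -/

/-- The phase space `ℂ^{2n}` with coordinates `(q,p)`. -/
abbrev PhaseC (n : ℕ) := (Fin n → ℂ) × (Fin n → ℂ)

/-- The `∂_{q_i}` direction. -/
noncomputable def qdir {n : ℕ} (i : Fin n) : PhaseC n := (Pi.single i 1, 0)
/-- The `∂_{p_i}` direction. -/
noncomputable def pdir {n : ℕ} (i : Fin n) : PhaseC n := (0, Pi.single i 1)

/-- The Poisson bracket `{g,h} = Σ_i (∂_{q_i}g ∂_{p_i}h - ∂_{p_i}g ∂_{q_i}h)` on germs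
on `ℂ^{2n}`. -/
noncomputable def poisG {n : ℕ} (g h : Og (PhaseC n)) : Og (PhaseC n) :=
  ∑ i, (Og.pd (qdir i) g * Og.pd (pdir i) h - Og.pd (pdir i) g * Og.pd (qdir i) h)

/-- The relative Poisson bracket on germs on `Λ × ℂ^{2n}`, the derivatives being taken
in the `(q,p)`-variables only. -/
noncomputable def poisP {Λ : Type*} [NormedAddCommGroup Λ] [NormedSpace ℂ Λ] {n : ℕ}
    (g h : Og (Λ × PhaseC n)) : Og (Λ × PhaseC n) :=
  ∑ i, (Og.pd (0, qdir i) g * Og.pd (0, pdir i) h -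
        Og.pd (0, pdir i) g * Og.pd (0, qdir i) h)

/-- A moment map germ `(ℂ^{2n},0) → (ℂⁿ,0)`: `n` Poisson-commuting germs vanishing
at the origin. -/
def IsMomentMap {n : ℕ} (H : Fin n → Og (PhaseC n)) : Prop :=
  (∀ i, Og.ev0 (H i) = 0) ∧ ∀ i j, poisG (H i) (H j) = 0

/-- The ideal `(H₁, …, H_n)`. -/
noncomputable def momentIdeal {n : ℕ} (H : Fin n → Og (PhaseC n)) : Ideal (Og (PhaseC n)) :=
  Ideal.span (Set.range H)

/-- `H` defines a reduced Lagrangian complete intersection: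
`𝒪_{2n}/(H₁,…,H_n)` is reduced of Krull dimension `n`. -/
def IsReducedLagrangianCI {n : ℕ} (H : Fin n → Og (PhaseC n)) : Prop :=
  IsReduced (Og (PhaseC n) ⧸ momentIdeal H) ∧
    ringKrullDim (Og (PhaseC n) ⧸ momentIdeal H) = (n : WithBot (WithTop ℕ))

/-- The standard basis directions of `ℂ^{2n}`. -/
noncomputable def phaseDir {n : ℕ} : Fin n ⊕ Fin n → PhaseC n := Sum.elim qdir pdir

/-- The ideal `I_m(DH)` of `m × m` minors of the Jacobian matrix of `H`. -/
noncomputable def minorsIdeal {n : ℕ} (H : Fin n → Og (PhaseC n)) (m : ℕ) :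
    Ideal (Og (PhaseC n)) :=
  Ideal.span {x | ∃ (r : Fin m → Fin n) (c : Fin m → (Fin n ⊕ Fin n)),
    x = Matrix.det (Matrix.of fun a b => Og.pd (phaseDir (c b)) (H (r a)))}

/-- `H` is pyramidal: for every `k < n` the Krull dimension of
`𝒪_{2n}/((H) + I_{k+1}(DH))` is at most `k`. -/
def IsPyramidal {n : ℕ} (H : Fin n → Og (PhaseC n)) : Prop :=
  ∀ m : ℕ, m < n →
    ringKrullDim (Og (PhaseC n) ⧸ (momentIdeal H ⊔ minorsIdeal H (m + 1))) ≤
      (m : WithBot (WithTop ℕ))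

/-- Restriction of a germ on `Λ × ℂ^{2n}` to `{0} × ℂ^{2n}`. -/
noncomputable def slice0 {Λ : Type*} [NormedAddCommGroup Λ] [NormedSpace ℂ Λ] {n : ℕ}
    (G : Og (Λ × PhaseC n)) : Og (PhaseC n) :=
  Og.pull (fun z : PhaseC n => ((0 : Λ), z)) G

/-- `F` is an integrable Lagrangian deformation of the moment map `H` over `(Λ,0)`:
`F(0,·) = H` and the components of `F` Poisson-commute in the `(q,p)`-variables. -/
def IsIntegrableDef {Λ : Type*} [NormedAddCommGroup Λ] [NormedSpace ℂ Λ] {n : ℕ}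
    (H : Fin n → Og (PhaseC n)) (F : Fin n → Og (Λ × PhaseC n)) : Prop :=
  (∀ i, slice0 (F i) = H i) ∧ ∀ i j, poisP (F i) (F j) = 0

/-- Pull-back of a germ on the parameter space `Λ` to `Λ × ℂ^{2n}`. -/
noncomputable def lift1 {Λ : Type*} [NormedAddCommGroup Λ] [NormedSpace ℂ Λ] {n : ℕ}
    (c : Og Λ) : Og (Λ × PhaseC n) :=
  Og.pull (Prod.fst : Λ × PhaseC n → Λ) c

/-- The ideal `(F₁, …, F_n)` of the deformation. -/
noncomputable def defIdeal {Λ : Type*} [NormedAddCommGroup Λ] [NormedSpace ℂ Λ] {n : ℕ}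
    (F : Fin n → Og (Λ × PhaseC n)) : Ideal (Og (Λ × PhaseC n)) :=
  Ideal.span (Set.range F)

/-- Degree-one cocycles of the relative Lagrange complex of `F`: tuples
`(m₁,…,m_n)` with `{m_i,F_j} - {m_j,F_i} = 0` in `𝒪_F = 𝒪/(F₁,…,F_n)`. -/
def lagCocycle1 {Λ : Type*} [NormedAddCommGroup Λ] [NormedSpace ℂ Λ] {n : ℕ}
    (F : Fin n → Og (Λ × PhaseC n)) : Set (Fin n → Og (Λ × PhaseC n)) :=
  {m | ∀ i j, poisP (m i) (F j) - poisP (m j) (F i) ∈ defIdeal F}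

/-- Degree-one coboundaries (in `𝒪_F`) of the relative Lagrange complex:
tuples of the form `({h,F₁},…,{h,F_n})` modulo `(F₁,…,F_n)`. -/
def lagCoboundary1 {Λ : Type*} [NormedAddCommGroup Λ] [NormedSpace ℂ Λ] {n : ℕ}
    (F : Fin n → Og (Λ × PhaseC n)) : Set (Fin n → Og (Λ × PhaseC n)) :=
  {m | ∃ h : Og (Λ × PhaseC n), ∀ i, m i - poisP h (F i) ∈ defIdeal F}

/-- Absolute (`Λ = 0`) degree-one cocycles of the Lagrange complex of a moment map. -/
def lagCocycle1Abs {n : ℕ} (H : Fin n → Og (PhaseC n)) : Set (Fin n → Og (PhaseC n)) :=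
  {m | ∀ i j, poisG (m i) (H j) - poisG (m j) (H i) ∈ momentIdeal H}

/-- Absolute degree-one coboundaries of the Lagrange complex of a moment map. -/
def lagCoboundary1Abs {n : ℕ} (H : Fin n → Og (PhaseC n)) :
    Set (Fin n → Og (PhaseC n)) :=
  {m | ∃ h : Og (PhaseC n), ∀ i, m i - poisG h (H i) ∈ momentIdeal H}

/-- Restriction of a germ on `ℂ^k × ℂ^{2n}` to the line `D = ℂ·v` in the parameter
space: the germ `(t, z) ↦ G (t • v, z)` on `ℂ × ℂ^{2n}`. -/
noncomputable def restrLine {k n : ℕ} (v : Fin k → ℂ) (G : Og ((Fin k → ℂ) × PhaseC n)) :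
    Og (ℂ × PhaseC n) :=
  Og.pull (fun p : ℂ × PhaseC n => (p.1 • v, p.2)) G

/-- Degree-`j` term of the Lagrange complex of a deformation over `Λ`:
`C^j = 𝒪 ⊗ Λ^j ℂⁿ`, realized as functions on the `j`-element subsets of `{1,…,n}`. -/
abbrev LagC (Λ : Type*) [NormedAddCommGroup Λ] [NormedSpace ℂ Λ] (n j : ℕ) :=
  {s : Finset (Fin n) // s.card = j} → Og (Λ × PhaseC n)

/-- The differential of the Lagrange complex,
`δ(m ⊗ v) = Σ_i {m, F_i} ⊗ e_i ∧ v`. -/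
noncomputable def lagDiff {Λ : Type*} [NormedAddCommGroup Λ] [NormedSpace ℂ Λ]
    {n j : ℕ} (F : Fin n → Og (Λ × PhaseC n)) (m : LagC Λ n j) : LagC Λ n (j + 1) :=
  fun s => ∑ i ∈ s.1.attach,
    ((-1 : ℤ) ^ (s.1.filter (· < i.1)).card) •
      poisP (m ⟨s.1.erase i.1, by rw [Finset.card_erase_of_mem i.2, s.2]; rfl⟩) (F i.1)

/-- Degree-`j` cocycles of the Lagrange complex (in `𝒪_F`, i.e. modulo `(F)`). -/
def lagCocycle {Λ : Type*} [NormedAddCommGroup Λ] [NormedSpace ℂ Λ] {n : ℕ}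
    (F : Fin n → Og (Λ × PhaseC n)) (j : ℕ) : Set (LagC Λ n j) :=
  {m | ∀ s, lagDiff F m s ∈ defIdeal F}

/-- Degree-`j` coboundaries of the Lagrange complex (in `𝒪_F`): in degree `0` these
are the elements of `(F)`, in degree `j+1` the images of the differential modulo
`(F)`. -/
def lagCoboundary {Λ : Type*} [NormedAddCommGroup Λ] [NormedSpace ℂ Λ] {n : ℕ}
    (F : Fin n → Og (Λ × PhaseC n)) : (j : ℕ) → Set (LagC Λ n j)
  | 0 => {m | ∀ s, m s ∈ defIdeal F}
  | (j + 1) => {m | ∃ w : LagC Λ n j, ∀ s, m s - lagDiff F w s ∈ defIdeal F}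

set_option linter.unusedSectionVars false

namespace LagFin

open scoped ENNReal NNReal

/-! ### Weighted norms and Neumann series -/

/-- The weighted `ℓ¹`-norm of a family of complex numbers. -/
noncomputable def wnorm {X : Type*} (ω : X → ℝ≥0) (f : X → ℂ) : ℝ≥0∞ := ∑' x, ‖f x‖ₑ * ω x

section wnorm

variable {X : Type*} (ω : X → ℝ≥0)

lemma wnorm_add_le (f g : X → ℂ) : wnorm ω (f + g) ≤ wnorm ω f + wnorm ω g := by
  unfold wnorm
  rw [← ENNReal.tsum_add]
  refine ENNReal.tsum_le_tsum fun x => ?_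
  rw [← add_mul]
  exact mul_le_mul_left (enorm_add_le _ _) _

lemma wnorm_neg (f : X → ℂ) : wnorm ω (-f) = wnorm ω f := by
  simp [wnorm]

lemma wnorm_sub_le (f g : X → ℂ) : wnorm ω (f - g) ≤ wnorm ω f + wnorm ω g := by
  rw [sub_eq_add_neg, ← wnorm_neg ω g]
  exact wnorm_add_le _ _ _

@[simp] lemma wnorm_zero : wnorm ω (0 : X → ℂ) = 0 := by simp [wnorm]

lemma le_wnorm (f : X → ℂ) (x : X) : ‖f x‖ₑ * ω x ≤ wnorm ω f :=
  ENNReal.le_tsum (f := fun x => ‖f x‖ₑ * ω x) x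

lemma wnorm_mono {ω ω' : X → ℝ≥0} (h : ∀ x, ω x ≤ ω' x) (f : X → ℂ) :
    wnorm ω f ≤ wnorm ω' f :=
  ENNReal.tsum_le_tsum fun x => mul_le_mul_right (by exact_mod_cast h x) _

lemma wnorm_mono_left {f g : X → ℂ} (h : ∀ x, ‖f x‖ₑ ≤ ‖g x‖ₑ) : wnorm ω f ≤ wnorm ω g :=
  ENNReal.tsum_le_tsum fun x => mul_le_mul_left (h x) _

lemma wnorm_sum_le {κ : Type*} (s : Finset κ) (f : κ → X → ℂ) :
    wnorm ω (∑ k ∈ s, f k) ≤ ∑ k ∈ s, wnorm ω (f k) := by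
  induction s using Finset.induction_on with
  | empty => simp
  | insert a s ha ih =>
    rw [Finset.sum_insert ha, Finset.sum_insert ha]
    exact (wnorm_add_le _ _ _).trans (by gcongr)

/-- Neumann series: `u = f + T u` is solvable when `T` contracts the weighted norm. -/
theorem neumann {ω : X → ℝ≥0} (hω : ∀ x, 0 < ω x) (T : (X → ℂ) →+ (X → ℂ))
    (hT : ∀ f, wnorm ω f ≠ ⊤ → wnorm ω (T f) ≤ 2⁻¹ * wnorm ω f) (f : X → ℂ)
    (hf : wnorm ω f ≠ ⊤) :
    ∃ u, wnorm ω u ≠ ⊤ ∧ u = f + T u := by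
  have hit : ∀ k : ℕ, wnorm ω (T^[k] f) ≤ 2⁻¹ ^ k * wnorm ω f := by
    intro k
    induction k with
    | zero => simp
    | succ k ih =>
      rw [Function.iterate_succ_apply', pow_succ', mul_assoc]
      exact (hT _ (ne_top_of_le_ne_top (ENNReal.mul_ne_top (by simp) hf) ih)).trans (by gcongr)
  have hsum : ∑' k, wnorm ω (T^[k] f) ≠ ⊤ := by
    refine ne_top_of_le_ne_top ?_ (ENNReal.tsum_le_tsum hit)
    rw [ENNReal.tsum_mul_right, ENNReal.tsum_geometric, ENNReal.one_sub_inv_two, inv_inv]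
    exact ENNReal.mul_ne_top (by simp) hf
  have htail : ∀ K : ℕ, wnorm ω (fun x => ∑' k, (T^[k + K] f) x) ≤
      ∑' k, wnorm ω (T^[k + K] f) := by
    intro K
    unfold wnorm
    rw [ENNReal.tsum_comm]
    refine ENNReal.tsum_le_tsum fun x => ?_
    rw [ENNReal.tsum_mul_right]
    exact mul_le_mul_left enorm_tsum_le_tsum_enorm _
  have hsm : ∀ x, Summable fun k => (T^[k] f) x := by
    intro x
    refine Summable.of_enorm fun h => hsum ?_
    rw [eq_top_iff]
    calc (⊤ : ℝ≥0∞) = (∑' k, ‖(T^[k] f) x‖ₑ) * ω x := by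
          rw [h, ENNReal.top_mul (by simpa using (hω x).ne')]
      _ = ∑' k, ‖(T^[k] f) x‖ₑ * ω x := ENNReal.tsum_mul_right.symm
      _ ≤ _ := ENNReal.tsum_le_tsum fun k => le_wnorm ω _ x
  set t : ℕ → X → ℂ := fun K x => ∑' k, (T^[k + K] f) x with ht
  have hstep : ∀ K, t K = T^[K] f + t (K + 1) := by
    intro K
    funext x
    simp only [ht, Pi.add_apply]
    have := ((summable_nat_add_iff (f := fun k => (T^[k] f) x) K).2 (hsm x)).tsum_eq_zero_add
    simp only [zero_add] at this
    rw [this]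
    congr 1
    refine tsum_congr fun k => ?_
    rw [add_assoc, add_comm 1 K]
  have htop : ∀ K, wnorm ω (t K) ≠ ⊤ := fun K => by
    refine ne_top_of_le_ne_top ?_ (htail K)
    refine ne_top_of_le_ne_top hsum ?_
    exact ENNReal.tsum_comp_le_tsum_of_injective (add_left_injective K) _
  have hlim : Tendsto (fun K => wnorm ω (t K)) atTop (𝓝 0) :=
    tendsto_of_tendsto_of_tendsto_of_le_of_le tendsto_const_nhds
      (ENNReal.tendsto_sum_nat_add _ hsum) (fun _ => zero_le) htail
  have hd : ∀ K, t 0 - f - T (t 0) = t (K + 1) - T (t K) := by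
    intro K
    induction K with
    | zero => rw [hstep 0]; simp
    | succ K ih =>
      rw [ih, hstep (K + 1), hstep K, map_add, ← Function.iterate_succ_apply' T K f, hstep (K + 1)]
      abel
  have hb : ∀ K, wnorm ω (t 0 - f - T (t 0)) ≤ wnorm ω (t (K + 1)) + wnorm ω (t K) := by
    intro K
    rw [hd K]
    refine (wnorm_sub_le _ _ _).trans (by
      gcongr
      refine (hT _ (htop K)).trans ?_
      exact mul_le_of_le_one_left' (by simp))
  have hz : wnorm ω (t 0 - f - T (t 0)) = 0 := by
    refine le_antisymm (ge_of_tendsto' (x := atTop) ?_ hb) zero_le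
    simpa using ((tendsto_add_atTop_iff_nat 1).2 hlim).add hlim
  refine ⟨t 0, htop 0, ?_⟩
  have h0 : t 0 - f - T (t 0) = 0 := by
    funext x
    have := le_wnorm ω (t 0 - f - T (t 0)) x
    rw [hz] at this
    have h2 := le_antisymm this zero_le
    rw [mul_eq_zero] at h2
    rcases h2 with h2 | h2
    · simpa using h2
    · exact absurd h2 (by simpa using (hω x).ne')
  rw [sub_sub, sub_eq_zero] at h0
  exact h0

end wnorm

end LagFin

namespace LagFin

open scoped ENNReal NNReal

/-! ### Weighted norms of power series -/

section pnorm

variable {ι : Type*} [Fintype ι]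

/-- The weight of a monomial. -/
noncomputable def wt (w : ι → ℝ≥0) (α : ι →₀ ℕ) : ℝ≥0 := ∏ i, w i ^ α i

lemma wt_add (w : ι → ℝ≥0) (α β : ι →₀ ℕ) : wt w (α + β) = wt w α * wt w β := by
  simp [wt, pow_add, Finset.prod_mul_distrib]

@[simp] lemma wt_zero (w : ι → ℝ≥0) : wt w 0 = 1 := by simp [wt]

@[simp] lemma wt_single (w : ι → ℝ≥0) (i : ι) (m : ℕ) : wt w (Finsupp.single i m) = w i ^ m := by
  unfold wt
  rw [Finset.prod_eq_single i]
  · simp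
  · intro b _ hb
    simp [Ne.symm hb]
  · simp

lemma wt_pos {w : ι → ℝ≥0} (hw : ∀ i, 0 < w i) (α : ι →₀ ℕ) : 0 < wt w α :=
  Finset.prod_pos fun i _ => pow_pos (hw i) _

lemma wt_mono {w w' : ι → ℝ≥0} (h : ∀ i, w i ≤ w' i) (α : ι →₀ ℕ) : wt w α ≤ wt w' α :=
  Finset.prod_le_prod' fun i _ => pow_le_pow_left' (h i) _

/-- The weighted `ℓ¹`-norm of a power series. -/
noncomputable def pnorm (w : ι → ℝ≥0) (f : MvPowerSeries ι ℂ) : ℝ≥0∞ :=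
  wnorm (wt w) (fun α => MvPowerSeries.coeff α f)

variable (w : ι → ℝ≥0)

lemma pnorm_add_le (f g : MvPowerSeries ι ℂ) : pnorm w (f + g) ≤ pnorm w f + pnorm w g :=
  wnorm_add_le _ _ _

lemma pnorm_neg (f : MvPowerSeries ι ℂ) : pnorm w (-f) = pnorm w f := wnorm_neg _ _

@[simp] lemma pnorm_zero : pnorm w (0 : MvPowerSeries ι ℂ) = 0 := wnorm_zero _

lemma pnorm_sum_le {κ : Type*} (s : Finset κ) (f : κ → MvPowerSeries ι ℂ) :
    pnorm w (∑ k ∈ s, f k) ≤ ∑ k ∈ s, pnorm w (f k) :=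
  wnorm_sum_le _ s _

lemma pnorm_mono {w w' : ι → ℝ≥0} (h : ∀ i, w i ≤ w' i) (f : MvPowerSeries ι ℂ) :
    pnorm w f ≤ pnorm w' f :=
  wnorm_mono (wt_mono h) _

lemma pnorm_monomial (α : ι →₀ ℕ) (c : ℂ) :
    pnorm w (MvPowerSeries.monomial α c) = ‖c‖ₑ * wt w α := by
  unfold pnorm wnorm
  rw [tsum_eq_single α]
  · simp
  · intro β hβ
    simp [MvPowerSeries.coeff_monomial, hβ]

lemma pnorm_mul_le (f g : MvPowerSeries ι ℂ) : pnorm w (f * g) ≤ pnorm w f * pnorm w g := by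
  unfold pnorm wnorm
  calc ∑' α, ‖MvPowerSeries.coeff α (f * g)‖ₑ * (wt w α : ℝ≥0∞)
      ≤ ∑' α, ∑' p : Finset.HasAntidiagonal.antidiagonal α,
          (‖MvPowerSeries.coeff p.1.1 f‖ₑ * wt w p.1.1) *
            (‖MvPowerSeries.coeff p.1.2 g‖ₑ * wt w p.1.2) := by
        refine ENNReal.tsum_le_tsum fun α => ?_
        rw [MvPowerSeries.coeff_mul, Finset.tsum_subtype (Finset.HasAntidiagonal.antidiagonal α)
          (fun p => (‖MvPowerSeries.coeff p.1 f‖ₑ * (wt w p.1 : ℝ≥0∞)) *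
            (‖MvPowerSeries.coeff p.2 g‖ₑ * wt w p.2))]
        refine (mul_le_mul_left (enorm_sum_le _ _) _).trans ?_
        rw [Finset.sum_mul]
        refine Finset.sum_le_sum fun p hp => ?_
        rw [← Finset.HasAntidiagonal.mem_antidiagonal.1 hp, wt_add, enorm_mul, ENNReal.coe_mul]
        exact le_of_eq (by ring)
    _ = ∑' p : (ι →₀ ℕ) × (ι →₀ ℕ), (‖MvPowerSeries.coeff p.1 f‖ₑ * (wt w p.1 : ℝ≥0∞)) *
            (‖MvPowerSeries.coeff p.2 g‖ₑ * wt w p.2) := by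
        rw [← Finset.HasAntidiagonal.sigmaAntidiagonalEquivProd.tsum_eq, ENNReal.tsum_sigma']
        rfl
    _ = _ := by
        rw [ENNReal.tsum_prod']
        simp_rw [ENNReal.tsum_mul_left, ENNReal.tsum_mul_right]

lemma pnorm_le_of_coeff {f g : MvPowerSeries ι ℂ}
    (h : ∀ α, ‖MvPowerSeries.coeff α f‖ₑ ≤ ‖MvPowerSeries.coeff α g‖ₑ) :
    pnorm w f ≤ pnorm w g :=
  wnorm_mono_left _ h

lemma pneumann {w : ι → ℝ≥0} (hw : ∀ i, 0 < w i) (T : MvPowerSeries ι ℂ →+ MvPowerSeries ι ℂ)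
    (hT : ∀ f, pnorm w f ≠ ⊤ → pnorm w (T f) ≤ 2⁻¹ * pnorm w f) (f : MvPowerSeries ι ℂ)
    (hf : pnorm w f ≠ ⊤) : ∃ u, pnorm w u ≠ ⊤ ∧ u = f + T u :=
  neumann (wt_pos hw) T hT f hf

/-- A power series with finite norm for some positive weight. -/
def IsConv (f : MvPowerSeries ι ℂ) : Prop := ∃ w : ι → ℝ≥0, (∀ i, 0 < w i) ∧ pnorm w f ≠ ⊤

variable {w}

lemma exists_common_weight {κ : Type*} (s : Finset κ) {f : κ → MvPowerSeries ι ℂ}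
    (h : ∀ k ∈ s, IsConv (f k)) :
    ∃ w : ι → ℝ≥0, (∀ i, 0 < w i) ∧ ∀ k ∈ s, pnorm w (f k) ≠ ⊤ := by
  induction s using Finset.induction_on with
  | empty => exact ⟨1, by simp, by simp⟩
  | insert a s ha ih =>
    obtain ⟨w, hw, hs⟩ := ih fun k hk => h k (Finset.mem_insert_of_mem hk)
    obtain ⟨w', hw', hs'⟩ := h a (Finset.mem_insert_self a s)
    refine ⟨fun i => min (w i) (w' i), fun i => lt_min (hw i) (hw' i), fun k hk => ?_⟩
    rcases Finset.mem_insert.1 hk with rfl | hk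
    · exact ne_top_of_le_ne_top hs' (pnorm_mono (fun i => min_le_right _ _) _)
    · exact ne_top_of_le_ne_top (hs k hk) (pnorm_mono (fun i => min_le_left _ _) _)

lemma IsConv.exists_weight_pair {f g : MvPowerSeries ι ℂ} (hf : IsConv f) (hg : IsConv g) :
    ∃ w : ι → ℝ≥0, (∀ i, 0 < w i) ∧ pnorm w f ≠ ⊤ ∧ pnorm w g ≠ ⊤ := by
  obtain ⟨w, hw, h⟩ := exists_common_weight (Finset.univ : Finset Bool)
    (f := fun b => bif b then f else g) (by simp [hf, hg])
  exact ⟨w, hw, h true (by simp), h false (by simp)⟩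

variable (ι) in
/-- The algebra of convergent power series. -/
noncomputable def Cv : Subalgebra ℂ (MvPowerSeries ι ℂ) where
  carrier := {f | IsConv f}
  mul_mem' := by
    intro f g hf hg
    obtain ⟨w, hw, h1, h2⟩ := IsConv.exists_weight_pair hf hg
    exact ⟨w, hw, ne_top_of_le_ne_top (ENNReal.mul_ne_top h1 h2) (pnorm_mul_le w f g)⟩
  add_mem' := by
    intro f g hf hg
    obtain ⟨w, hw, h1, h2⟩ := IsConv.exists_weight_pair hf hg
    exact ⟨w, hw, ne_top_of_le_ne_top (ENNReal.add_ne_top.2 ⟨h1, h2⟩) (pnorm_add_le w f g)⟩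
  algebraMap_mem' := by
    intro c
    refine ⟨1, by simp, ?_⟩
    have : algebraMap ℂ (MvPowerSeries ι ℂ) c = MvPowerSeries.monomial 0 c := rfl
    rw [this, pnorm_monomial]
    exact ENNReal.mul_ne_top (by simp) (by simp)

lemma monomial_mem_Cv (α : ι →₀ ℕ) (c : ℂ) : MvPowerSeries.monomial α c ∈ Cv ι :=
  ⟨1, by simp, by rw [pnorm_monomial]; exact ENNReal.mul_ne_top (by simp) (by simp)⟩

lemma mem_Cv_of_coeff {f g : MvPowerSeries ι ℂ} (hg : g ∈ Cv ι)
    (h : ∀ α, ‖MvPowerSeries.coeff α f‖ₑ ≤ ‖MvPowerSeries.coeff α g‖ₑ) : f ∈ Cv ι := by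
  obtain ⟨w, hw, hg⟩ := hg
  exact ⟨w, hw, ne_top_of_le_ne_top hg (pnorm_le_of_coeff w h)⟩

/-- Division with remainder by power series `x^γ - e_γ` whose tails `e_γ` are small. -/
theorem division {w : ι → ℝ≥0} (hw : ∀ i, 0 < w i) (L : Finset (ι →₀ ℕ))
    (e : (ι →₀ ℕ) → MvPowerSeries ι ℂ)
    (he : ∀ γ ∈ L, pnorm w (e γ) ≤ 2⁻¹ * wt w γ) (f : MvPowerSeries ι ℂ) (hf : pnorm w f ≠ ⊤) :
    ∃ (r : MvPowerSeries ι ℂ) (q : (ι →₀ ℕ) → MvPowerSeries ι ℂ),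
      pnorm w r ≠ ⊤ ∧ (∀ γ, pnorm w (q γ) ≠ ⊤) ∧
      (∀ γ ∈ L, ∀ α, γ ≤ α → MvPowerSeries.coeff α r = 0) ∧
      f = r + ∑ γ ∈ L, (MvPowerSeries.monomial γ 1 - e γ) * q γ := by
  have hc : ∃ c : (ι →₀ ℕ) → Option (ι →₀ ℕ), (∀ α γ, c α = some γ → γ ∈ L ∧ γ ≤ α) ∧
      ∀ α, c α = none → ∀ γ ∈ L, ¬ γ ≤ α := by
    refine ⟨fun α => if h : ∃ γ ∈ L, γ ≤ α then some h.choose else none, ?_, ?_⟩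
    · intro α γ h
      dsimp only at h
      by_cases h' : ∃ γ ∈ L, γ ≤ α
      · rw [dif_pos h'] at h
        rw [← Option.some.inj h]
        exact h'.choose_spec
      · rw [dif_neg h'] at h; cases h
    · intro α h γ hγ hle
      dsimp only at h
      have h' : ∃ γ ∈ L, γ ≤ α := ⟨γ, hγ, hle⟩
      rw [dif_pos h'] at h
      cases h
  obtain ⟨c, hc1, hc2⟩ := hc
  set Q : (ι →₀ ℕ) → MvPowerSeries ι ℂ → MvPowerSeries ι ℂ := fun γ f =>
    fun α => if c (α + γ) = some γ then MvPowerSeries.coeff (α + γ) f else 0 with hQ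
  have hQc : ∀ γ f α, MvPowerSeries.coeff α (Q γ f) =
      if c (α + γ) = some γ then MvPowerSeries.coeff (α + γ) f else 0 := fun _ _ _ => rfl
  have hQadd : ∀ γ f g, Q γ (f + g) = Q γ f + Q γ g := by
    intro γ f g
    ext α
    rw [map_add, hQc, hQc, hQc, map_add]
    split_ifs <;> simp
  have hQn : ∀ f, ∑ γ ∈ L, wt w γ * pnorm w (Q γ f) ≤ pnorm w f := by
    intro f
    have h1 : ∀ γ, wt w γ * pnorm w (Q γ f) ≤
        ∑' α, if c α = some γ then ‖MvPowerSeries.coeff α f‖ₑ * (wt w α : ℝ≥0∞) else 0 := by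
      intro γ
      unfold pnorm wnorm
      rw [← ENNReal.tsum_mul_left]
      refine le_trans (le_of_eq ?_) (ENNReal.tsum_comp_le_tsum_of_injective
        (add_left_injective γ) _)
      refine tsum_congr fun α => ?_
      simp only [hQc, wt_add]
      split_ifs
      · push_cast; ring
      · simp
    refine (Finset.sum_le_sum fun γ _ => h1 γ).trans ?_
    rw [← Summable.tsum_finsetSum (fun _ _ => ENNReal.summable)]
    refine ENNReal.tsum_le_tsum fun α => ?_
    rcases hcα : c α with _ | γ0
    · simp
    · simp only [Option.some.injEq]
      rw [Finset.sum_ite_eq]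
      split_ifs
      · exact le_rfl
      · exact zero_le
  let T : MvPowerSeries ι ℂ →+ MvPowerSeries ι ℂ :=
    { toFun := fun f => ∑ γ ∈ L, e γ * Q γ f
      map_zero' := by
        have : ∀ γ, Q γ 0 = 0 := fun γ => by
          have := hQadd γ 0 0
          simpa using this
        simp [this]
      map_add' := by
        intro f g
        simp only [hQadd, mul_add, Finset.sum_add_distrib] }
  obtain ⟨u', hu, hueq⟩ := pneumann hw T (by
    intro f _
    show pnorm w (∑ γ ∈ L, e γ * Q γ f) ≤ 2⁻¹ * pnorm w f
    refine (pnorm_sum_le _ _ _).trans ?_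
    refine le_trans (Finset.sum_le_sum fun γ hγ => (pnorm_mul_le w _ _).trans
      (mul_le_mul_left (he γ hγ) _)) ?_
    simp_rw [mul_assoc]
    rw [← Finset.mul_sum]
    exact mul_le_mul_right (hQn f) _) f hf
  have hu' : f = u' - ∑ γ ∈ L, e γ * Q γ u' := eq_sub_of_add_eq hueq.symm
  let r : MvPowerSeries ι ℂ := fun α => if c α = none then MvPowerSeries.coeff α u' else 0
  have hrc : ∀ α, MvPowerSeries.coeff α r = if c α = none then MvPowerSeries.coeff α u' else 0 :=
    fun _ => rfl
  have hur : u' = r + ∑ γ ∈ L, MvPowerSeries.monomial γ 1 * Q γ u' := by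
    ext α
    rw [map_add, map_sum, hrc]
    have hm : ∀ γ ∈ L, MvPowerSeries.coeff α (MvPowerSeries.monomial γ 1 * Q γ u') =
        if c α = some γ then MvPowerSeries.coeff α u' else 0 := by
      intro γ _
      by_cases hle : γ ≤ α
      · obtain ⟨β, rfl⟩ := exists_add_of_le hle
        rw [MvPowerSeries.coeff_add_monomial_mul, hQc, one_mul, add_comm]
      · rw [MvPowerSeries.coeff_monomial_mul, if_neg hle, if_neg fun h => hle (hc1 _ _ h).2]
    rw [Finset.sum_congr rfl hm]
    rcases hcα : c α with _ | γ0
    · simp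
    · simp [(hc1 _ _ hcα).1]
  refine ⟨r, fun γ => if γ ∈ L then Q γ u' else 0, ?_, ?_, ?_, ?_⟩
  · refine ne_top_of_le_ne_top hu (pnorm_le_of_coeff w fun α => ?_)
    rw [hrc]
    split_ifs
    · exact le_rfl
    · simp
  · intro γ
    dsimp only
    split_ifs with hγ
    · have h1 := (Finset.single_le_sum (f := fun γ => (wt w γ : ℝ≥0∞) * pnorm w (Q γ u'))
        (fun _ _ => zero_le) hγ).trans (hQn u')
      intro htop
      rw [htop, ENNReal.mul_top (by simpa using (wt_pos hw γ).ne')] at h1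
      exact hu (top_le_iff.1 h1)
    · simp
  · intro γ hγ α hle
    rw [hrc]
    split_ifs with h
    · exact absurd hle (hc2 α h γ hγ)
    · rfl
  · rw [hu']
    nth_rewrite 1 [hur]
    rw [add_sub_assoc, ← Finset.sum_sub_distrib]
    congr 1
    refine Finset.sum_congr rfl fun γ hγ => ?_
    simp only [if_pos hγ]
    ring

end pnorm

end LagFin

namespace LagFin

open scoped ENNReal NNReal

/-! ### The ring of convergent power series -/

section Cv

variable {ι : Type*} [Fintype ι]

/-- Coefficients of a convergent power series. -/
noncomputable def cf (α : ι →₀ ℕ) : Cv ι →ₗ[ℂ] ℂ :=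
  (MvPowerSeries.coeff α).comp (Cv ι).val.toLinearMap

lemma cf_apply (α : ι →₀ ℕ) (f : Cv ι) : cf α f = MvPowerSeries.coeff α f.1 := rfl

lemma Cv_ext {f g : Cv ι} (h : ∀ α, cf α f = cf α g) : f = g :=
  Subtype.ext (MvPowerSeries.ext h)

/-- Constructing a convergent power series from its coefficients. -/
lemma exists_cf {c : (ι →₀ ℕ) → ℂ} {f : Cv ι} (h : ∀ α, ‖c α‖ₑ ≤ ‖cf α f‖ₑ) :
    ∃ g : Cv ι, ∀ α, cf α g = c α :=
  ⟨⟨c, mem_Cv_of_coeff f.2 h⟩, fun _ => rfl⟩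

/-- Monomials. -/
noncomputable def mon (α : ι →₀ ℕ) : Cv ι := ⟨MvPowerSeries.monomial α 1, monomial_mem_Cv α 1⟩

/-- Variables. -/
noncomputable def vr (i : ι) : Cv ι := mon (Finsupp.single i 1)

lemma cf_mon (α β : ι →₀ ℕ) : cf α (mon β) = if α = β then 1 else 0 :=
  MvPowerSeries.coeff_monomial _ _ _

lemma mon_add (α β : ι →₀ ℕ) : (mon (α + β) : Cv ι) = mon α * mon β :=
  Subtype.ext (by simp [mon, MvPowerSeries.monomial_mul_monomial])

@[simp] lemma mon_zero : (mon 0 : Cv ι) = 1 := rfl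

lemma cf_mul (α : ι →₀ ℕ) (f g : Cv ι) :
    cf α (f * g) = ∑ p ∈ Finset.HasAntidiagonal.antidiagonal α, cf p.1 f * cf p.2 g :=
  MvPowerSeries.coeff_mul α f.1 g.1

lemma cf_mon_mul (α β : ι →₀ ℕ) (f : Cv ι) :
    cf α (mon β * f) = if β ≤ α then cf (α - β) f else 0 := by
  have := MvPowerSeries.coeff_monomial_mul α β f.1 (1 : ℂ)
  simpa [cf_apply, mon] using this

@[simp] lemma cf_zero_one : cf (0 : ι →₀ ℕ) 1 = 1 := by
  rw [← mon_zero, cf_mon, if_pos rfl]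

/-- The constant coefficient as a ring homomorphism. -/
noncomputable def cst : Cv ι →ₐ[ℂ] ℂ :=
  AlgHom.ofLinearMap (cf 0) cf_zero_one (by
    intro f g
    rw [cf_mul]
    simp)

lemma cst_apply (f : Cv ι) : cst f = cf 0 f := rfl

instance : IsDomain (MvPowerSeries ι ℂ) := NoZeroDivisors.to_isDomain _

instance : IsDomain (Cv ι) := Subalgebra.isDomain (Cv ι)

theorem divisionCv {w : ι → ℝ≥0} (hw : ∀ i, 0 < w i) (L : Finset (ι →₀ ℕ))
    (g : (ι →₀ ℕ) → Cv ι)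
    (hg : ∀ γ ∈ L, pnorm w (mon γ - g γ : Cv ι).1 ≤ 2⁻¹ * wt w γ) (f : Cv ι)
    (hf : pnorm w f.1 ≠ ⊤) :
    ∃ (r : Cv ι) (q : (ι →₀ ℕ) → Cv ι),
      (∀ γ ∈ L, ∀ α, γ ≤ α → cf α r = 0) ∧ f = r + ∑ γ ∈ L, g γ * q γ := by
  obtain ⟨r, q, hr, hq, h1, h2⟩ := division hw L (fun γ => (mon γ - g γ : Cv ι).1) hg f.1 hf
  refine ⟨⟨r, w, hw, hr⟩, fun γ => ⟨q γ, w, hw, hq γ⟩, h1, Subtype.ext ?_⟩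
  rw [h2]
  push_cast
  congr 1
  refine Finset.sum_congr rfl fun γ _ => ?_
  simp [mon]

/-- The exponents supported in `I`. -/
def expOn (I : Set ι) : Set (ι →₀ ℕ) := {α | ∀ i, i ∉ I → α i = 0}

lemma mem_expOn {I : Set ι} {α : ι →₀ ℕ} : α ∈ expOn I ↔ ∀ i, i ∉ I → α i = 0 := Iff.rfl

lemma zero_mem_expOn (I : Set ι) : (0 : ι →₀ ℕ) ∈ expOn I := fun _ _ => rfl

lemma add_mem_expOn {I : Set ι} {α β : ι →₀ ℕ} :
    α + β ∈ expOn I ↔ α ∈ expOn I ∧ β ∈ expOn I := by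
  simp only [mem_expOn, Finsupp.add_apply, add_eq_zero]
  exact ⟨fun h => ⟨fun i hi => (h i hi).1, fun i hi => (h i hi).2⟩,
    fun h i hi => ⟨h.1 i hi, h.2 i hi⟩⟩

lemma single_mem_expOn {I : Set ι} {i : ι} (hi : i ∈ I) (m : ℕ) :
    Finsupp.single i m ∈ expOn I := by
  intro j hj
  rw [Finsupp.single_apply, if_neg]
  rintro rfl
  exact hj hi

lemma expOn_mono {I I' : Set ι} (h : I ⊆ I') : expOn I ⊆ expOn I' :=
  fun _ hα i hi => hα i fun hi' => hi (h hi')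

/-- The power series in the variables from `I`. -/
noncomputable def Rs (I : Set ι) : Subalgebra ℂ (Cv ι) where
  carrier := {f | ∀ α, α ∉ expOn I → cf α f = 0}
  mul_mem' := by
    intro f g hf hg α hα
    rw [cf_mul]
    refine Finset.sum_eq_zero fun p hp => ?_
    rw [← Finset.HasAntidiagonal.mem_antidiagonal.1 hp, add_mem_expOn, not_and_or] at hα
    rcases hα with h | h
    · rw [hf _ h, zero_mul]
    · rw [hg _ h, mul_zero]
  add_mem' := by
    intro f g hf hg α hα
    rw [map_add, hf _ hα, hg _ hα, add_zero]
  algebraMap_mem' := by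
    intro c α hα
    rw [Algebra.algebraMap_eq_smul_one, map_smul, ← mon_zero, cf_mon, if_neg, smul_zero]
    rintro rfl
    exact hα (zero_mem_expOn I)

lemma mem_Rs {I : Set ι} {f : Cv ι} : f ∈ Rs I ↔ ∀ α, α ∉ expOn I → cf α f = 0 := Iff.rfl

lemma Rs_mono {I I' : Set ι} (h : I ⊆ I') : Rs I ≤ Rs I' :=
  fun _ hf α hα => hf α fun h' => hα (expOn_mono h h')

lemma mon_mem_Rs {I : Set ι} {α : ι →₀ ℕ} (hα : α ∈ expOn I) : mon α ∈ Rs I := by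
  intro β hβ
  rw [cf_mon, if_neg]
  rintro rfl
  exact hβ hα

lemma vr_mem_Rs {I : Set ι} {i : ι} (hi : i ∈ I) : vr i ∈ Rs I :=
  mon_mem_Rs (single_mem_expOn hi 1)

/-- The retraction onto the power series in the variables from `I`, setting the other
variables to zero. -/
noncomputable def rho (I : Set ι) : Cv ι →ₐ[ℂ] Cv ι :=
  AlgHom.ofLinearMap
    { toFun := fun f => ⟨fun α => if α ∈ expOn I then cf α f else 0,
        mem_Cv_of_coeff f.2 (fun α => by
          show ‖(if α ∈ expOn I then cf α f else 0)‖ₑ ≤ _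
          split_ifs
          · exact le_rfl
          · simp)⟩
      map_add' := by
        intro f g
        refine Cv_ext fun α => ?_
        show (if α ∈ expOn I then cf α (f + g) else 0) =
          (if α ∈ expOn I then cf α f else 0) + if α ∈ expOn I then cf α g else 0
        split_ifs <;> simp
      map_smul' := by
        intro c f
        refine Cv_ext fun α => ?_
        show (if α ∈ expOn I then cf α (c • f) else 0) =
          c • (if α ∈ expOn I then cf α f else 0)
        split_ifs <;> simp }
    (by
      refine Cv_ext fun α => ?_
      show (if α ∈ expOn I then cf α 1 else 0) = _
      split_ifs with h
      · rfl
      · rw [← mon_zero, cf_mon, if_neg]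
        rintro rfl
        exact h (zero_mem_expOn I))
    (by
      intro f g
      refine Cv_ext fun α => ?_
      rw [cf_mul]
      show (if α ∈ expOn I then cf α (f * g) else 0) =
        ∑ p ∈ Finset.HasAntidiagonal.antidiagonal α,
        (if p.1 ∈ expOn I then cf p.1 f else 0) * (if p.2 ∈ expOn I then cf p.2 g else 0)
      split_ifs with h
      · rw [cf_mul]
        refine Finset.sum_congr rfl fun p hp => ?_
        rw [← Finset.HasAntidiagonal.mem_antidiagonal.1 hp, add_mem_expOn] at h
        rw [if_pos h.1, if_pos h.2]
      · refine (Finset.sum_eq_zero fun p hp => ?_).symm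
        rw [← Finset.HasAntidiagonal.mem_antidiagonal.1 hp, add_mem_expOn, not_and_or] at h
        rcases h with h | h
        · rw [if_neg h, zero_mul]
        · rw [if_neg h, mul_zero])

lemma cf_rho (I : Set ι) (α : ι →₀ ℕ) (f : Cv ι) :
    cf α (rho I f) = if α ∈ expOn I then cf α f else 0 := rfl

lemma rho_mem (I : Set ι) (f : Cv ι) : rho I f ∈ Rs I := by
  intro α hα
  rw [cf_rho, if_neg hα]

lemma rho_of_mem {I : Set ι} {f : Cv ι} (hf : f ∈ Rs I) : rho I f = f := by
  refine Cv_ext fun α => ?_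
  rw [cf_rho]
  split_ifs with h
  · rfl
  · rw [hf α h]

/-- A finite weight shared by finitely many convergent power series. -/
lemma exists_common_weightCv (s : Finset (Cv ι)) :
    ∃ w : ι → ℝ≥0, (∀ i, 0 < w i) ∧ ∀ f ∈ s, pnorm w f.1 ≠ ⊤ :=
  exists_common_weight s fun f _ => f.2

lemma vr_pow (i : ι) (m : ℕ) : vr i ^ m = mon (Finsupp.single i m) := by
  induction m with
  | zero => simp
  | succ m ih => rw [pow_succ, ih, vr, ← mon_add, ← Finsupp.single_add]

lemma sub_rho_mem_span (I : Set ι) (f : Cv ι) :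
    f - rho Iᶜ f ∈ Ideal.span (vr '' I) := by
  obtain ⟨w, hw, hf⟩ := (f - rho Iᶜ f).2
  obtain ⟨r, q, hr, h⟩ := divisionCv hw
    (Finset.univ.filter (fun i => i ∈ I) |>.image fun i => Finsupp.single i 1) mon
    (fun γ _ => by simp) (f - rho Iᶜ f) hf
  have hmem : ∑ γ ∈ (Finset.univ.filter (fun i => i ∈ I)).image fun i => Finsupp.single i 1,
      mon γ * q γ ∈ Ideal.span (vr '' I) := by
    refine Ideal.sum_mem _ fun γ hγ => ?_
    obtain ⟨i, hi, rfl⟩ := Finset.mem_image.1 hγ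
    exact Ideal.mul_mem_right _ _ (Ideal.subset_span ⟨i, (Finset.mem_filter.1 hi).2, rfl⟩)
  have hker : ∀ x ∈ Ideal.span (vr '' I), rho Iᶜ x = 0 := by
    intro x hx
    have : Ideal.span (vr '' I) ≤ RingHom.ker (rho Iᶜ : Cv ι →ₐ[ℂ] Cv ι) := by
      rw [Ideal.span_le]
      rintro _ ⟨i, hi, rfl⟩
      show rho Iᶜ (vr i) = 0
      refine Cv_ext fun α => ?_
      rw [cf_rho, vr, cf_mon]
      split_ifs with h1 h2
      · exfalso
        have := h1 i (by simpa using hi)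
        rw [h2] at this
        simp at this
      · simp
      · simp
    exact this hx
  have hr0 : r = 0 := by
    have hrr : r = rho Iᶜ r := by
      refine Cv_ext fun α => ?_
      rw [cf_rho]
      split_ifs with hα
      · rfl
      · simp only [mem_expOn, Set.mem_compl_iff, not_not, not_forall] at hα
        obtain ⟨i, hi, hαi⟩ := hα
        refine hr (Finsupp.single i 1) (Finset.mem_image.2 ⟨i, by simpa using hi, rfl⟩) α ?_
        rw [Finsupp.single_le_iff]
        omega
    have h2 := congrArg (rho Iᶜ) h
    rw [map_add, hker _ hmem, ← hrr, map_sub, rho_of_mem (rho_mem _ _), sub_self, add_zero] at h2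
    exact h2.symm
  rw [h, hr0, zero_add]
  exact hmem

lemma rho_eq_zero_of_mem_span {I : Set ι} {x : Cv ι} (hx : x ∈ Ideal.span (vr '' I)) :
    rho Iᶜ x = 0 := by
  have : Ideal.span (vr '' I) ≤ RingHom.ker (rho Iᶜ : Cv ι →ₐ[ℂ] Cv ι) := by
    rw [Ideal.span_le]
    rintro _ ⟨i, hi, rfl⟩
    show rho Iᶜ (vr i) = 0
    refine Cv_ext fun α => ?_
    rw [cf_rho, vr, cf_mon]
    split_ifs with h1 h2
    · exfalso
      have := h1 i (by simpa using hi)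
      rw [h2] at this
      simp at this
    · simp
    · simp
  exact this hx

lemma mem_span_vr_iff {I : Set ι} {f : Cv ι} : f ∈ Ideal.span (vr '' I) ↔ rho Iᶜ f = 0 :=
  ⟨rho_eq_zero_of_mem_span, fun h => by simpa [h] using sub_rho_mem_span I f⟩

lemma rho_empty (f : Cv ι) : rho ∅ f = algebraMap ℂ _ (cst f) := by
  refine Cv_ext fun α => ?_
  rw [cf_rho, Algebra.algebraMap_eq_smul_one, map_smul, ← mon_zero, cf_mon, cst_apply]
  have : α ∈ expOn (∅ : Set ι) ↔ α = 0 := by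
    simp [mem_expOn, Finsupp.ext_iff]
  simp only [this]
  split_ifs with h
  · simp [h]
  · simp

lemma cst_eq_zero_iff {f : Cv ι} : cst f = 0 ↔ f ∈ Ideal.span (Set.range (vr : ι → Cv ι)) := by
  rw [← Set.image_univ, mem_span_vr_iff, Set.compl_univ, rho_empty]
  exact (map_eq_zero_iff _ (algebraMap ℂ (Cv ι)).injective).symm

/-- Shrink the weights of the variables in `I` by the factor `t`. -/
noncomputable def shrink (I : Set ι) (t : ℝ≥0) (w : ι → ℝ≥0) : ι → ℝ≥0 :=
  fun i => if i ∈ I then t * w i else w i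

lemma shrink_of_mem {I : Set ι} {i : ι} (hi : i ∈ I) (t : ℝ≥0) (w : ι → ℝ≥0) :
    shrink I t w i = t * w i := if_pos hi

lemma shrink_of_notMem {I : Set ι} {i : ι} (hi : i ∉ I) (t : ℝ≥0) (w : ι → ℝ≥0) :
    shrink I t w i = w i := if_neg hi

lemma shrink_pos {I : Set ι} {t : ℝ≥0} {w : ι → ℝ≥0} (ht : 0 < t) (hw : ∀ i, 0 < w i) (i : ι) :
    0 < shrink I t w i := by
  unfold shrink
  split_ifs
  · exact mul_pos ht (hw i)
  · exact hw i

lemma shrink_le {I : Set ι} {t : ℝ≥0} {w : ι → ℝ≥0} (ht : t ≤ 1) (i : ι) :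
    shrink I t w i ≤ w i := by
  unfold shrink
  split_ifs
  · exact mul_le_of_le_one_left' ht
  · exact le_rfl

/-- Shrinking weights makes a power series without constant term small. -/
lemma pnorm_smul_weight {w : ι → ℝ≥0} {t : ℝ≥0} (ht : t ≤ 1) {f : MvPowerSeries ι ℂ}
    {I : Set ι} (hf : ∀ α ∈ expOn Iᶜ, MvPowerSeries.coeff α f = 0) :
    pnorm (shrink I t w) f ≤ t * pnorm w f := by
  unfold pnorm wnorm
  rw [← ENNReal.tsum_mul_left]
  refine ENNReal.tsum_le_tsum fun α => ?_
  by_cases hα : α ∈ expOn Iᶜ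
  · simp [hf α hα]
  · simp only [mem_expOn, Set.mem_compl_iff, not_not, not_forall] at hα
    obtain ⟨i, hi, hαi⟩ := hα
    rw [mul_left_comm]
    refine mul_le_mul_right ?_ _
    rw [← ENNReal.coe_mul]
    norm_cast
    unfold wt
    rw [← Finset.mul_prod_erase _ _ (Finset.mem_univ i), ← Finset.mul_prod_erase _ _
      (Finset.mem_univ i), ← mul_assoc, shrink_of_mem hi, mul_pow]
    refine mul_le_mul' (mul_le_mul' ?_ le_rfl) (Finset.prod_le_prod' fun j _ => ?_)
    · exact pow_le_of_le_one (by positivity) ht hαi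
    · exact pow_le_pow_left' (shrink_le ht j) _

lemma exists_scale {c : ℝ≥0∞} (hc : c ≠ ⊤) {ε : ℝ≥0} (hε : 0 < ε) :
    ∃ t : ℝ≥0, 0 < t ∧ t ≤ 1 ∧ t * c ≤ ε := by
  lift c to ℝ≥0 using hc
  refine ⟨min 1 (ε / (c + 1)), lt_min one_pos (by positivity), min_le_left _ _, ?_⟩
  norm_cast
  calc min 1 (ε / (c + 1)) * c ≤ ε / (c + 1) * (c + 1) := by
        gcongr
        · exact min_le_right _ _
        · exact le_self_add
    _ = ε := by field_simp

lemma isUnit_of_cst_ne_zero {f : Cv ι} (hf : cst f ≠ 0) : IsUnit f := by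
  set g : Cv ι := algebraMap ℂ _ (cst f)⁻¹ * f with hg
  have hg1 : cst g = 1 := by
    simp [hg, hf]
  obtain ⟨w, hw, hwf⟩ := (1 - g).2
  obtain ⟨t, ht0, ht1, htc⟩ := exists_scale hwf (ε := 2⁻¹) (by positivity)
  have hle := pnorm_smul_weight (w := w) ht1 (f := (1 - g : Cv ι).1) (I := Set.univ) (by
    intro α hα
    have : α = 0 := by
      ext i
      exact hα i (by simp)
    subst this
    show cf 0 (1 - g) = 0
    rw [← cst_apply, map_sub, hg1, map_one, sub_self])
  obtain ⟨r, q, hr, h⟩ := divisionCv (w := shrink Set.univ t w) (shrink_pos ht0 hw) {0} (fun _ => g) (by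
      intro γ hγ
      rw [Finset.mem_singleton.1 hγ, mon_zero, wt_zero, ENNReal.coe_one, mul_one]
      refine hle.trans (htc.trans ?_)
      rw [ENNReal.coe_inv (by norm_num)]
      simp) 1 (by
      rw [← mon_zero]
      show pnorm _ (MvPowerSeries.monomial 0 1) ≠ ⊤
      rw [pnorm_monomial]
      exact ENNReal.mul_ne_top (by simp) (by simp))
  have hr0 : r = 0 := Cv_ext fun α => by
    rw [hr 0 (by simp) α zero_le, map_zero]
  rw [hr0, zero_add, Finset.sum_singleton] at h
  refine IsUnit.of_mul_eq_one (algebraMap ℂ _ (cst f)⁻¹ * q 0) ?_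
  rw [h, hg]
  ring

lemma isUnit_iff_cst {f : Cv ι} : IsUnit f ↔ cst f ≠ 0 :=
  ⟨fun h => (h.map cst).ne_zero, isUnit_of_cst_ne_zero⟩

instance : IsLocalRing (Cv ι) :=
  IsLocalRing.of_nonunits_add (by
    intro a b ha hb
    rw [mem_nonunits_iff, isUnit_iff_cst, not_not] at *
    rw [map_add, ha, hb, add_zero])

lemma mem_maximalIdeal_iff {f : Cv ι} : f ∈ IsLocalRing.maximalIdeal (Cv ι) ↔ cst f = 0 := by
  rw [IsLocalRing.mem_maximalIdeal, mem_nonunits_iff, isUnit_iff_cst, not_not]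

lemma maximalIdeal_eq_span :
    IsLocalRing.maximalIdeal (Cv ι) = Ideal.span (Set.range (vr : ι → Cv ι)) := by
  ext f
  rw [mem_maximalIdeal_iff, cst_eq_zero_iff]

end Cv

end LagFin

namespace LagFin

open scoped ENNReal NNReal

section Noetherian

variable {ι : Type*} [Fintype ι]

/-- Distinct primes attached to the variables. -/
noncomputable def prm (i : ι) : ℕ := Nat.nth Nat.Prime (Fintype.equivFin ι i)

lemma prm_prime (i : ι) : (prm i).Prime := Nat.nth_mem_of_infinite Nat.infinite_setOfPred_prime _

lemma prm_injective : Function.Injective (prm : ι → ℕ) := fun i j h => by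
  have := Nat.nth_injective Nat.infinite_setOfPred_prime h
  exact (Fintype.equivFin ι).injective (Fin.ext this)

/-- The natural number coding an exponent. -/
noncomputable def code (α : ι →₀ ℕ) : ℕ := ∏ i, prm i ^ α i

lemma code_injective : Function.Injective (code : (ι →₀ ℕ) → ℕ) := by
  have h1 : ∀ α : ι →₀ ℕ, code α = (Finsupp.mapDomain prm α).prod fun x1 x2 => x1 ^ x2 := by
    intro α
    rw [Finsupp.prod_mapDomain_index (fun b => pow_zero b) (fun b m n => pow_add b m n)]
    unfold code Finsupp.prod
    symm
    refine Finset.prod_subset (Finset.subset_univ _) fun i _ hi => ?_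
    simp [Finsupp.notMem_support_iff.1 hi]
  have h2 : ∀ α : ι →₀ ℕ, (code α).factorization = Finsupp.mapDomain prm α := by
    intro α
    rw [h1]
    refine Nat.prod_pow_factorization_eq_self fun p hp => ?_
    have := Finsupp.mapDomain_support hp
    obtain ⟨i, _, rfl⟩ := Finset.mem_image.1 this
    exact prm_prime i
  intro α β h
  refine Finsupp.mapDomain_injective prm_injective ?_
  rw [← h2, ← h2, h]

lemma code_pos (α : ι →₀ ℕ) : 0 < code α := Finset.prod_pos fun i _ => pow_pos (prm_prime i).pos _

/-- Negative powers of the primes as weights. -/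
noncomputable def prmW (s : ℕ) : ι → ℝ≥0 := fun i => ((prm i : ℝ≥0) ^ s)⁻¹

lemma prmW_pos (s : ℕ) (i : ι) : 0 < prmW s i := by
  have : 0 < (prm i : ℝ≥0) := by exact_mod_cast (prm_prime i).pos
  unfold prmW
  positivity

lemma wt_prmW (s : ℕ) (α : ι →₀ ℕ) : wt (prmW s) α = ((code α : ℝ≥0) ^ s)⁻¹ := by
  unfold wt prmW code
  push_cast
  rw [← Finset.prod_pow, ← Finset.prod_inv_distrib]
  refine Finset.prod_congr rfl fun i _ => ?_
  rw [inv_pow, ← pow_mul, ← pow_mul, mul_comm]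

lemma prmW_anti {s t : ℕ} (h : s ≤ t) (i : ι) : prmW t i ≤ prmW s i := by
  unfold prmW
  have h1 : (1 : ℝ≥0) ≤ (prm i : ℝ≥0) := by exact_mod_cast (prm_prime i).one_lt.le
  have h2 : 0 < (prm i : ℝ≥0) := lt_of_lt_of_le one_pos h1
  exact inv_anti₀ (by positivity) (pow_le_pow_right₀ h1 h)

lemma exists_prmW_le {w : ι → ℝ≥0} (hw : ∀ i, 0 < w i) : ∃ s, ∀ i, prmW s i ≤ w i := by
  have h : ∀ i, ∀ᶠ s : ℕ in atTop, prmW s i ≤ w i := by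
    intro i
    have h1 : (prm i : ℝ≥0)⁻¹ < 1 := inv_lt_one_of_one_lt₀ (by exact_mod_cast (prm_prime i).one_lt)
    have := NNReal.tendsto_pow_atTop_nhds_zero_of_lt_one h1
    filter_upwards [this.eventually_le_const (hw i)] with s hs
    unfold prmW
    rwa [← inv_pow]
  exact (eventually_all.2 h).exists

lemma eventually_prmW_small {e : MvPowerSeries ι ℂ} {γ : ι →₀ ℕ} {s₀ : ℕ}
    (he : pnorm (prmW s₀) e ≠ ⊤)
    (hlt : ∀ α, MvPowerSeries.coeff α e ≠ 0 → code γ < code α) :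
    ∀ᶠ t : ℕ in atTop, pnorm (prmW (s₀ + t)) e ≤ 2⁻¹ * wt (prmW (s₀ + t)) γ := by
  set ν : ℝ≥0 := (code γ : ℝ≥0) with hν
  have hν0 : 0 < ν := by simpa [hν] using code_pos γ
  lift pnorm (prmW s₀) e to ℝ≥0 using he with c hc
  have hb : ∀ t : ℕ, pnorm (prmW (s₀ + t)) e ≤ (((ν + 1) ^ t)⁻¹ * c : ℝ≥0) := by
    intro t
    rw [ENNReal.coe_mul, hc]
    unfold pnorm wnorm
    rw [← ENNReal.tsum_mul_left]
    refine ENNReal.tsum_le_tsum fun α => ?_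
    by_cases h : MvPowerSeries.coeff α e = 0
    · simp [h]
    · rw [mul_left_comm]
      refine mul_le_mul_right ?_ _
      rw [← ENNReal.coe_mul]
      norm_cast
      rw [wt_prmW, wt_prmW, pow_add, mul_inv, mul_comm]
      have h3 : ν + 1 ≤ code α := by
        rw [hν]; exact_mod_cast hlt α h
      gcongr
  have hlim : Tendsto (fun t : ℕ => (ν / (ν + 1)) ^ t * (c * ν ^ s₀)) atTop (𝓝 0) := by
    have h1 : ν / (ν + 1) < 1 := by
      rw [div_lt_one (by positivity)]
      exact lt_add_one ν
    simpa using (NNReal.tendsto_pow_atTop_nhds_zero_of_lt_one h1).mul_const (c * ν ^ s₀)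
  filter_upwards [hlim.eventually_le_const (show (0 : ℝ≥0) < 2⁻¹ by positivity)] with t ht
  refine (hb t).trans ?_
  rw [wt_prmW, ← hν]
  rw [show (2⁻¹ : ℝ≥0∞) = ((2⁻¹ : ℝ≥0) : ℝ≥0∞) by
    rw [ENNReal.coe_inv (by norm_num)]; simp, ← ENNReal.coe_mul]
  norm_cast
  calc ((ν + 1) ^ t)⁻¹ * c = (ν / (ν + 1)) ^ t * (c * ν ^ s₀) * (ν ^ (s₀ + t))⁻¹ := by
        rw [div_pow, pow_add]
        field_simp
    _ ≤ _ := by gcongr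

instance : IsNoetherianRing (Cv ι) := by
  rw [isNoetherianRing_iff_ideal_fg]
  intro 𝔞
  set E : Set (ι →₀ ℕ) := {γ | ∃ g ∈ 𝔞, cf γ g = 1 ∧ ∀ α, α ≠ γ → cf α g ≠ 0 → code γ < code α}
    with hE
  have hEpwo : E.IsPWO := Set.isPWO_of_wellQuasiOrderedLE E
  have hfin : {γ | Minimal (· ∈ E) γ}.Finite :=
    WellQuasiOrderedLE.finite_of_isAntichain (setOfPred_minimal_antichain _)
  set L : Finset (ι →₀ ℕ) := hfin.toFinset with hL
  have hLE : ∀ γ ∈ L, γ ∈ E := fun γ hγ => by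
    rw [hL, Set.Finite.mem_toFinset] at hγ
    exact hγ.prop
  have hin : ∀ f ∈ 𝔞, f ≠ 0 → ∃ γ ∈ E, cf γ f ≠ 0 := by
    intro f hf hf0
    have hne : {m | ∃ α, cf α f ≠ 0 ∧ code α = m}.Nonempty := by
      by_contra hcon
      refine hf0 (Cv_ext fun α => ?_)
      by_contra h
      exact hcon ⟨_, α, by simpa using h, rfl⟩
    obtain ⟨γ, hγ, hγm⟩ := Nat.sInf_mem hne
    refine ⟨γ, ⟨algebraMap ℂ _ (cf γ f)⁻¹ * f, 𝔞.mul_mem_left _ hf, ?_, ?_⟩, hγ⟩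
    · rw [← Algebra.smul_def, map_smul, smul_eq_mul, inv_mul_cancel₀ hγ]
    · intro α hα hαf
      rw [← Algebra.smul_def, map_smul, smul_eq_mul] at hαf
      have h1 : code γ ≤ code α := by
        rw [hγm]
        exact Nat.sInf_le ⟨α, right_ne_zero_of_mul hαf, rfl⟩
      exact lt_of_le_of_ne h1 fun h => hα (code_injective h).symm
  have hg : ∀ γ : ι →₀ ℕ, ∃ g ∈ 𝔞, γ ∈ L →
      (cf γ g = 1 ∧ ∀ α, α ≠ γ → cf α g ≠ 0 → code γ < code α) := by
    intro γ
    by_cases hγ : γ ∈ L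
    · obtain ⟨g, h1, h2⟩ := hLE γ hγ
      exact ⟨g, h1, fun _ => h2⟩
    · exact ⟨0, 𝔞.zero_mem, fun h => absurd h hγ⟩
  choose g hga hgL using hg
  refine ⟨L.image g, le_antisymm ?_ ?_⟩
  · rw [Submodule.span_le]
    intro x hx
    obtain ⟨γ, _, rfl⟩ := Finset.mem_image.1 (Finset.mem_coe.1 hx)
    exact hga γ
  · intro f hf
    obtain ⟨w, hw, hfin⟩ := exists_common_weightCv (insert f (L.image fun γ => mon γ - g γ))
    obtain ⟨s₀, hs₀⟩ := exists_prmW_le hw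
    have hev : ∀ᶠ t : ℕ in atTop, ∀ γ ∈ L,
        pnorm (prmW (s₀ + t)) (mon γ - g γ : Cv ι).1 ≤ 2⁻¹ * wt (prmW (s₀ + t)) γ := by
      rw [Filter.eventually_all_finset]
      intro γ hγ
      refine eventually_prmW_small (ne_top_of_le_ne_top (hfin _ (Finset.mem_insert_of_mem
        (Finset.mem_image_of_mem _ hγ))) (pnorm_mono hs₀ _)) fun α hα => ?_
      change cf α (mon γ - g γ) ≠ 0 at hα
      rw [map_sub, cf_mon] at hα
      by_cases hαγ : α = γ
      · subst hαγ
        rw [(hgL _ hγ).1] at hα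
        simp at hα
      · rw [if_neg hαγ, zero_sub, neg_ne_zero] at hα
        exact (hgL _ hγ).2 α hαγ hα
    obtain ⟨t, ht⟩ := hev.exists
    obtain ⟨r, q, hr, hfr⟩ := divisionCv (prmW_pos (s₀ + t)) L g ht f
      (ne_top_of_le_ne_top (hfin f (Finset.mem_insert_self _ _)) (pnorm_mono (fun i =>
        (prmW_anti (Nat.le_add_right _ _) i).trans (hs₀ i)) _))
    have hr0 : r = 0 := by
      by_contra hne
      have hra : r ∈ 𝔞 := by
        have : r = f - ∑ γ ∈ L, g γ * q γ := by rw [hfr]; ring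
        rw [this]
        exact 𝔞.sub_mem hf (𝔞.sum_mem fun γ _ => 𝔞.mul_mem_right _ (hga γ))
      obtain ⟨γ, hγE, hγ⟩ := hin r hra hne
      obtain ⟨δ, hδγ, hδ⟩ := hEpwo.exists_le_minimal hγE
      exact hγ (hr δ (by rw [hL, Set.Finite.mem_toFinset]; exact hδ) γ hδγ)
    rw [hfr, hr0, zero_add]
    refine Ideal.sum_mem _ fun γ hγ => Ideal.mul_mem_right _ _ (Ideal.subset_span ?_)
    simpa using ⟨γ, hγ, rfl⟩

instance (I : Set ι) : IsNoetherianRing (Rs I) := by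
  let φ : Cv ι →+* Rs I := (rho I : Cv ι →ₐ[ℂ] Cv ι).toRingHom.codRestrict (Rs I) (rho_mem I)
  refine isNoetherianRing_of_surjective (Cv ι) (Rs I) φ fun y => ⟨y.1, Subtype.ext ?_⟩
  exact rho_of_mem y.2

lemma exists_shift (f : Cv ι) (β : ι →₀ ℕ) : ∃ g : Cv ι, ∀ α, cf α g = cf (α + β) f := by
  obtain ⟨w, hw, hf⟩ := f.2
  refine ⟨⟨fun α => cf (α + β) f, w, hw, ?_⟩, fun _ => rfl⟩
  have h : wt w β * pnorm w (fun α => cf (α + β) f : MvPowerSeries ι ℂ) ≤ pnorm w f.1 := by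
    unfold pnorm wnorm
    rw [← ENNReal.tsum_mul_left]
    refine le_trans (le_of_eq ?_) (ENNReal.tsum_comp_le_tsum_of_injective
      (add_left_injective β) _)
    refine tsum_congr fun α => ?_
    rw [wt_add]
    change _ * (‖cf (α + β) f‖ₑ * _) = ‖cf (α + β) f‖ₑ * _
    push_cast
    ring
  intro htop
  rw [htop, ENNReal.mul_top (by simpa using (wt_pos hw β).ne')] at h
  exact hf (top_le_iff.1 h)

/-- The exponents off `I` with all entries below `N`. -/
noncomputable def boxOff (I : Set ι) (N : ℕ) : Finset (ι →₀ ℕ) :=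
  ((Finset.univ : Finset (ι → Fin N)).image
    (fun b => Finsupp.equivFunOnFinite.symm fun i => (b i : ℕ))).filter (· ∈ expOn Iᶜ)

lemma mem_boxOff {I : Set ι} {N : ℕ} (hN : 0 < N) {β : ι →₀ ℕ} :
    β ∈ boxOff I N ↔ β ∈ expOn Iᶜ ∧ ∀ i, i ∉ I → β i < N := by
  simp only [boxOff, Finset.mem_filter, Finset.mem_image, Finset.mem_univ, true_and]
  constructor
  · rintro ⟨⟨b, rfl⟩, h⟩
    exact ⟨h, fun i _ => by simp⟩
  · rintro ⟨h1, h2⟩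
    refine ⟨⟨fun i => ⟨β i, ?_⟩, by ext; simp⟩, h1⟩
    by_cases hi : i ∈ I
    · rw [h1 i (by simpa using hi)]
      exact hN
    · exact h2 i hi

/-- Finiteness: if the variables outside `I` are nilpotent modulo `𝔧` and the variables from `I`,
then the ring is finite over the power series in the variables from `I`, modulo `𝔧`. -/
theorem finite_mod (I : Set ι) (𝔧 : Ideal (Cv ι)) (N : ℕ)
    (h : IsLocalRing.maximalIdeal (Cv ι) ^ N ≤ 𝔧 ⊔ Ideal.span (vr '' I)) (f : Cv ι) :
    ∃ r : (ι →₀ ℕ) → Cv ι, (∀ β, r β ∈ Rs I) ∧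
      f - ∑ β ∈ boxOff I (N + 1), r β * mon β ∈ 𝔧 := by
  have hx : ∀ i : ι, ∃ g ∈ 𝔧, vr i ^ (N + 1) - g ∈ Ideal.span (vr '' I) := by
    intro i
    have h1 : vr i ^ (N + 1) ∈ 𝔧 ⊔ Ideal.span (vr '' I) := by
      refine h (Ideal.pow_le_pow_right (Nat.le_succ N) (Ideal.pow_mem_pow ?_ _))
      rw [maximalIdeal_eq_span]
      exact Ideal.subset_span ⟨i, rfl⟩
    obtain ⟨g, hg, e, he, hge⟩ := Submodule.mem_sup.1 h1
    exact ⟨g, hg, by rw [← hge]; simpa using he⟩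
  choose g hg hge using hx
  obtain ⟨w, hw, hfin⟩ := exists_common_weightCv
    (insert f (Finset.univ.image fun i => vr i ^ (N + 1) - g i))
  have hsc : ∃ t : ℝ≥0, 0 < t ∧ t ≤ 1 ∧ ∀ i : ι,
      t * pnorm w (vr i ^ (N + 1) - g i : Cv ι).1 ≤ (2⁻¹ * w i ^ (N + 1) : ℝ≥0) := by
    have : ∀ i : ι, ∃ t : ℝ≥0, 0 < t ∧ t ≤ 1 ∧
        t * pnorm w (vr i ^ (N + 1) - g i : Cv ι).1 ≤ (2⁻¹ * w i ^ (N + 1) : ℝ≥0) := fun i =>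
      exists_scale (hfin _ (Finset.mem_insert_of_mem (Finset.mem_image_of_mem _
        (Finset.mem_univ i)))) (mul_pos (by positivity) (pow_pos (hw i) _))
    choose t ht0 ht1 ht using this
    have hne : ((insert 1 (Finset.univ.image t)) : Finset ℝ≥0).Nonempty := ⟨1, by simp⟩
    refine ⟨(insert 1 (Finset.univ.image t)).min' hne, ?_, ?_, fun i => ?_⟩
    · have := Finset.min'_mem _ hne
      rcases Finset.mem_insert.1 this with h | h
      · rw [h]; exact one_pos
      · obtain ⟨i, _, hi⟩ := Finset.mem_image.1 h
        rw [← hi]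
        exact ht0 i
    · exact Finset.min'_le _ _ (by simp)
    · refine le_trans (mul_le_mul_left ?_ _) (ht i)
      exact_mod_cast Finset.min'_le _ _ (by simp)
  obtain ⟨t, ht0, ht1, ht⟩ := hsc
  set L : Finset (ι →₀ ℕ) := (Finset.univ.filter fun i => i ∉ I).image
    fun i => Finsupp.single i (N + 1) with hL
  have hG : ∃ G : (ι →₀ ℕ) → Cv ι, ∀ i, G (Finsupp.single i (N + 1)) = g i := by
    refine ⟨fun γ => if h : ∃ i, γ = Finsupp.single i (N + 1) then g h.choose else 0,
      fun i => ?_⟩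
    have h : ∃ j, (Finsupp.single i (N + 1) : ι →₀ ℕ) = Finsupp.single j (N + 1) := ⟨i, rfl⟩
    dsimp only
    rw [dif_pos h]
    congr 1
    exact (Finsupp.single_left_injective (Nat.succ_ne_zero N) h.choose_spec).symm
  obtain ⟨G, hG⟩ := hG
  obtain ⟨r, q, hr, hfr⟩ := divisionCv (w := shrink I t w) (shrink_pos ht0 hw) L G (by
    intro γ hγ
    obtain ⟨i, hi, rfl⟩ := Finset.mem_image.1 hγ
    have hi : i ∉ I := (Finset.mem_filter.1 hi).2
    rw [hG, wt_single, shrink_of_notMem hi, ← vr_pow]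
    refine (pnorm_smul_weight ht1 fun α hα => ?_).trans ((ht i).trans (le_of_eq ?_))
    · have h1 : rho Iᶜ (vr i ^ (N + 1) - g i) = 0 := mem_span_vr_iff.1 (hge i)
      have h2 := cf_rho Iᶜ α (vr i ^ (N + 1) - g i)
      rw [h1, if_pos hα, map_zero] at h2
      exact h2.symm
    · rw [ENNReal.coe_mul, ENNReal.coe_inv (by norm_num)]
      simp) f
    (ne_top_of_le_ne_top (hfin f (Finset.mem_insert_self _ _)) (pnorm_mono (shrink_le ht1) _))
  have hs : ∀ β : ι →₀ ℕ, ∃ s : Cv ι, ∀ α, cf α s = cf (α + β) r := exists_shift r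
  choose s hs using hs
  refine ⟨fun β => rho I (s β), fun β => rho_mem _ _, ?_⟩
  have hrs : r = ∑ β ∈ boxOff I (N + 1), rho I (s β) * mon β := by
    refine Cv_ext fun α => ?_
    rw [map_sum]
    have hterm : ∀ β ∈ boxOff I (N + 1), cf α (rho I (s β) * mon β) =
        if β = α.filter (· ∉ I) then cf α r else 0 := by
      intro β hβ
      have hβ1 := ((mem_boxOff (Nat.succ_pos N)).1 hβ).1
      rw [mul_comm, cf_mon_mul]
      by_cases hle : β ≤ α
      · obtain ⟨δ, rfl⟩ := exists_add_of_le hle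
        rw [if_pos hle, add_tsub_cancel_left, cf_rho, hs, add_comm δ β]
        refine if_congr ?_ rfl rfl
        rw [mem_expOn, Finsupp.ext_iff]
        refine forall_congr' fun i => ?_
        rw [Finsupp.filter_apply, Finsupp.add_apply]
        by_cases hi : i ∈ I
        · simp [hi, hβ1 i (by simpa using hi)]
        · simp [hi]
      · rw [if_neg hle, if_neg]
        rintro rfl
        refine hle fun i => ?_
        rw [Finsupp.filter_apply]
        split_ifs
        · exact Nat.zero_le _
        · exact le_rfl
    rw [Finset.sum_congr rfl hterm, Finset.sum_ite_eq']
    split_ifs with hmem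
    · rfl
    · rw [mem_boxOff (Nat.succ_pos N)] at hmem
      have h1 : α.filter (· ∉ I) ∈ expOn Iᶜ := fun i hi => by
        rw [Finsupp.filter_apply, if_neg (by simpa using hi)]
      have h2 : ¬ ∀ i, i ∉ I → α.filter (· ∉ I) i < N + 1 := fun h => hmem ⟨h1, h⟩
      push Not at h2
      obtain ⟨i, hi, h3⟩ := h2
      rw [Finsupp.filter_apply, if_pos hi] at h3
      exact hr (Finsupp.single i (N + 1)) (Finset.mem_image.2 ⟨i, by simpa using hi, rfl⟩) α
        (Finsupp.single_le_iff.2 h3)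
  rw [← hrs, hfr, add_sub_cancel_left]
  refine 𝔧.sum_mem fun γ hγ => 𝔧.mul_mem_right _ ?_
  obtain ⟨i, _, rfl⟩ := Finset.mem_image.1 hγ
  rw [hG]
  exact hg i

/-! ### Differentiation and integration -/

lemma exists_deriv (i : ι) (f : Cv ι) : MvPowerSeries.pderiv ℂ i f.1 ∈ Cv ι := by
  obtain ⟨w, hw, hf⟩ := f.2
  refine ⟨fun j => 2⁻¹ * w j, fun j => mul_pos (by positivity) (hw j), ?_⟩
  have h : w i * pnorm (fun j => 2⁻¹ * w j) (MvPowerSeries.pderiv ℂ i f.1) ≤ pnorm w f.1 := by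
    unfold pnorm wnorm
    rw [← ENNReal.tsum_mul_left]
    refine le_trans (ENNReal.tsum_le_tsum fun α => ?_)
      (ENNReal.tsum_comp_le_tsum_of_injective (add_left_injective (Finsupp.single i 1)) _)
    dsimp only
    rw [MvPowerSeries.coeff_pderiv, wt_add, wt_single, pow_one, enorm_mul]
    have h1 : ‖((α i : ℂ) + 1)‖ₑ = ((α i + 1 : ℕ) : ℝ≥0) := by
      rw [enorm_eq_nnnorm]
      congr 1
      rw [← NNReal.coe_inj, coe_nnnorm]
      have : ((α i : ℂ) + 1) = ((α i + 1 : ℕ) : ℂ) := by push_cast; rfl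
      rw [this, Complex.norm_natCast]
      simp
    have h2 : ((α i + 1 : ℕ) : ℝ≥0) * wt (fun j => 2⁻¹ * w j) α ≤ wt w α := by
      unfold wt
      rw [← Finset.mul_prod_erase _ _ (Finset.mem_univ i), ← Finset.mul_prod_erase _ _
        (Finset.mem_univ i), ← mul_assoc]
      refine mul_le_mul' ?_ (Finset.prod_le_prod' fun j _ => pow_le_pow_left' ?_ _)
      · rw [mul_pow, ← mul_assoc]
        refine mul_le_of_le_one_left' ?_
        rw [inv_pow, ← div_eq_mul_inv, div_le_one (by positivity)]
        exact_mod_cast Nat.lt_two_pow_self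
      · exact mul_le_of_le_one_left' (by
          rw [inv_le_one₀ (by norm_num)]; norm_num)
    rw [h1]
    calc _ = ‖(MvPowerSeries.coeff (α + Finsupp.single i 1)) f.1‖ₑ *
          ((((α i + 1 : ℕ) : ℝ≥0) * wt (fun j => 2⁻¹ * w j) α : ℝ≥0) : ℝ≥0∞) * w i := by
          rw [ENNReal.coe_mul]; ring
      _ ≤ ‖(MvPowerSeries.coeff (α + Finsupp.single i 1)) f.1‖ₑ * (wt w α : ℝ≥0∞) * w i := by
          gcongr
      _ = _ := by rw [ENNReal.coe_mul]; ring
  intro htop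
  rw [htop, ENNReal.mul_top (by simpa using (hw i).ne')] at h
  exact hf (top_le_iff.1 h)

/-- Partial derivatives of convergent power series. -/
noncomputable def dd (i : ι) : Derivation ℂ (Cv ι) (Cv ι) where
  toFun f := ⟨MvPowerSeries.pderiv ℂ i f.1, exists_deriv i f⟩
  map_add' f g := Subtype.ext (by simp)
  map_smul' c f := Subtype.ext (by simp)
  map_one_eq_zero' := Subtype.ext (by simp)
  leibniz' f g := Subtype.ext (by simp)

lemma cf_dd (i : ι) (α : ι →₀ ℕ) (f : Cv ι) :
    cf α (dd i f) = cf (α + Finsupp.single i 1) f * (α i + 1) :=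
  MvPowerSeries.coeff_pderiv f.1 α

lemma dd_comm (i j : ι) (f : Cv ι) : dd i (dd j f) = dd j (dd i f) := by
  refine Cv_ext fun α => ?_
  simp only [cf_dd, Finsupp.add_apply]
  rw [add_right_comm]
  by_cases h : i = j
  · subst h; rfl
  · simp only [Finsupp.single_apply, if_neg h, if_neg (Ne.symm h)]
    push_cast
    ring

lemma dd_vr (i j : ι) : dd i (vr j) = if i = j then 1 else 0 := by
  have := MvPowerSeries.pderiv_X (R := ℂ) i j
  refine Subtype.ext (this.trans ?_)
  by_cases h : i = j
  · subst h; simp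
  · simp [h, Ne.symm h]

lemma dd_mem_Rs (i : ι) {I : Set ι} {f : Cv ι} (hf : f ∈ Rs I) : dd i f ∈ Rs I := by
  intro α hα
  rw [cf_dd, hf _ fun h => hα (add_mem_expOn.1 h).1, zero_mul]

lemma dd_eq_zero {i : ι} {I : Set ι} (hi : i ∉ I) {f : Cv ι} (hf : f ∈ Rs I) : dd i f = 0 := by
  refine Cv_ext fun α => ?_
  rw [cf_dd, hf _ fun h => ?_, zero_mul, map_zero]
  have := h i hi
  simp at this

lemma dd_rho {i : ι} {I : Set ι} (hi : i ∈ I) (f : Cv ι) : dd i (rho I f) = rho I (dd i f) := by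
  refine Cv_ext fun α => ?_
  rw [cf_dd, cf_rho, cf_rho, cf_dd, add_mem_expOn]
  simp [single_mem_expOn hi]

lemma exists_primitive (i : ι) {I : Set ι} (hi : i ∈ I) {f : Cv ι} (hf : f ∈ Rs I) :
    ∃ g ∈ Rs I, dd i g = f := by
  obtain ⟨c, hc⟩ := exists_cf (c := fun α => ((α i : ℂ))⁻¹ * cf α (vr i * f)) (f := vr i * f)
    (fun α => by
      rw [enorm_mul]
      refine mul_le_of_le_one_left' ?_
      rw [enorm_eq_nnnorm]
      refine ENNReal.coe_le_one_iff.2 ?_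
      rw [← NNReal.coe_le_coe, coe_nnnorm, norm_inv, Complex.norm_natCast]
      exact Nat.cast_inv_le_one _)
  have hm : vr i * f ∈ Rs I := (Rs I).mul_mem (vr_mem_Rs hi) hf
  refine ⟨c, fun α hα => by rw [hc, hm α hα, mul_zero], Cv_ext fun α => ?_⟩
  rw [cf_dd, hc, vr, cf_mon_mul, if_pos (by simp), add_tsub_cancel_right]
  have : ((α i : ℂ) + 1) ≠ 0 := by exact_mod_cast (α i).succ_ne_zero
  simp only [Finsupp.add_apply, Finsupp.single_eq_same]
  push_cast
  field_simp

end Noetherian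

end LagFin

namespace LagFin

open scoped ENNReal NNReal

/-! ### A first order differential operator in one variable -/

section Coker

variable {ι : Type*} [Fintype ι]

/-- Division by a monomial, discarding the terms which are not divisible. -/
noncomputable def shiftF (β : ι →₀ ℕ) : MvPowerSeries ι ℂ →ₗ[ℂ] MvPowerSeries ι ℂ where
  toFun f := fun α => MvPowerSeries.coeff (α + β) f
  map_add' _ _ := rfl
  map_smul' _ _ := rfl

/-- Division of the coefficient at `α` by `α j + N`. -/
noncomputable def scaleF (j : ι) (N : ℕ) : MvPowerSeries ι ℂ →ₗ[ℂ] MvPowerSeries ι ℂ where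
  toFun f := fun α => ((α j + N : ℕ) : ℂ)⁻¹ * MvPowerSeries.coeff α f
  map_add' _ _ := funext fun _ => mul_add _ _ _
  map_smul' _ _ := funext fun _ => mul_left_comm _ _ _

lemma coeff_shiftF (α β : ι →₀ ℕ) (f : MvPowerSeries ι ℂ) :
    MvPowerSeries.coeff α (shiftF β f) = MvPowerSeries.coeff (α + β) f := rfl

lemma coeff_scaleF (j : ι) (N : ℕ) (α : ι →₀ ℕ) (f : MvPowerSeries ι ℂ) :
    MvPowerSeries.coeff α (scaleF j N f) =
      ((α j + N : ℕ) : ℂ)⁻¹ * MvPowerSeries.coeff α f := rfl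

lemma pnorm_shiftF (w : ι → ℝ≥0) (β : ι →₀ ℕ) (f : MvPowerSeries ι ℂ) :
    wt w β * pnorm w (shiftF β f) ≤ pnorm w f := by
  unfold pnorm wnorm
  rw [← ENNReal.tsum_mul_left]
  refine le_trans (le_of_eq ?_) (ENNReal.tsum_comp_le_tsum_of_injective
    (add_left_injective β) _)
  refine tsum_congr fun α => ?_
  dsimp only
  rw [wt_add, coeff_shiftF]
  push_cast
  ring

lemma pnorm_scaleF (w : ι → ℝ≥0) (j : ι) (N : ℕ) (f : MvPowerSeries ι ℂ) :
    (N + 1 : ℝ≥0∞) * pnorm w (scaleF j (N + 1) f) ≤ pnorm w f := by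
  unfold pnorm wnorm
  rw [← ENNReal.tsum_mul_left]
  refine ENNReal.tsum_le_tsum fun α => ?_
  dsimp only
  rw [coeff_scaleF, enorm_mul, ← mul_assoc, ← mul_assoc]
  refine mul_le_mul_left ?_ _
  refine mul_le_of_le_one_left' ?_
  have h : (N + 1 : ℝ≥0∞) = ((N + 1 : ℝ≥0) : ℝ≥0∞) := by push_cast; rfl
  rw [enorm_eq_nnnorm, h, ← ENNReal.coe_mul]
  refine ENNReal.coe_le_one_iff.2 ?_
  rw [← NNReal.coe_le_coe, NNReal.coe_mul, coe_nnnorm, norm_inv, Complex.norm_natCast,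
    ← div_eq_mul_inv]
  push_cast
  rw [div_le_one (by positivity)]
  have : (0 : ℝ) ≤ (α j : ℝ) := Nat.cast_nonneg _
  linarith

variable {L : Type*} [Fintype L]

lemma wnorm_prod (w : ι → ℝ≥0) (f : L × (ι →₀ ℕ) → ℂ) :
    wnorm (fun x : L × (ι →₀ ℕ) => wt w x.2) f =
      ∑ l, pnorm w (fun α => f (l, α) : MvPowerSeries ι ℂ) := by
  exact (ENNReal.tsum_prod (f := fun l α => ‖f (l, α)‖ₑ * (wt w α : ℝ≥0∞))).trans
    (tsum_fintype _)

lemma exists_small_factor {a b : ℝ≥0∞} (ha : a ≠ ⊤) (hb : b ≠ ⊤) {ε : ℝ≥0} (hε : 0 < ε) :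
    ∃ (N : ℕ) (t : ℝ≥0), 0 < t ∧ t ≤ 1 ∧ t * a + b * (N + 1 : ℝ≥0∞)⁻¹ ≤ ε := by
  obtain ⟨t, ht0, ht1, ht⟩ := exists_scale ha (half_pos hε)
  lift b to ℝ≥0 using hb
  obtain ⟨N, hN⟩ := exists_nat_gt (b / (ε / 2))
  refine ⟨N, t, ht0, ht1, ?_⟩
  have h1 : (b : ℝ≥0∞) * (N + 1 : ℝ≥0∞)⁻¹ ≤ ((ε / 2 : ℝ≥0) : ℝ≥0∞) := by
    rw [← div_eq_mul_inv]
    refine ENNReal.div_le_of_le_mul ?_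
    have h2 : b ≤ (ε / 2) * (N + 1) := by
      rw [div_lt_iff₀ (half_pos hε)] at hN
      refine hN.le.trans ?_
      rw [mul_comm]
      gcongr
      exact le_self_add
    calc (b : ℝ≥0∞) ≤ (((ε / 2) * (N + 1) : ℝ≥0) : ℝ≥0∞) := by exact_mod_cast h2
      _ = _ := by push_cast; rfl
  calc _ ≤ ((ε / 2 : ℝ≥0) : ℝ≥0∞) + ((ε / 2 : ℝ≥0) : ℝ≥0∞) := add_le_add ht h1
    _ = ε := by rw [← ENNReal.coe_add, add_halves]

/-- Solving `(y ^ μ + W₁) ∂v + b v = g` up to terms of bounded degree in `y`. -/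
lemma exists_solution_of_weight (j : ι) {w : ι → ℝ≥0} (hw : ∀ i, 0 < w i) (μ : ℕ) {W₁ : Cv ι}
    (hW₁ : W₁ ∈ Ideal.span (vr '' {j}ᶜ)) (b : L → L → Cv ι) (hW₁w : pnorm w W₁.1 ≠ ⊤)
    (hbw : ∀ l m, pnorm w (b l m).1 ≠ ⊤) :
    ∃ (M : ℕ) (t : ℝ≥0), 0 < t ∧ t ≤ 1 ∧ ∀ g : L → Cv ι,
      (∀ l, pnorm (shrink {j}ᶜ t w) (g l).1 ≠ ⊤) → ∃ v : L → Cv ι, ∀ l α, M ≤ α j →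
        cf α (g l - ((vr j ^ μ + W₁) * dd j (v l) + ∑ m, b l m * v m)) = 0 := by
  set B : ℝ≥0∞ := ∑ l, ∑ m, pnorm w (b l m).1 with hB
  have hBt : B ≠ ⊤ := ENNReal.sum_ne_top.2 fun l _ => ENNReal.sum_ne_top.2 fun m _ => hbw l m
  have hε : 0 < 2⁻¹ * w j ^ μ := mul_pos (by positivity) (pow_pos (hw j) _)
  obtain ⟨N, t, ht0, ht1, hNt⟩ := exists_small_factor
    (a := Fintype.card L * pnorm w W₁.1) (b := B * w j)
    (ENNReal.mul_ne_top (by simp) hW₁w) (ENNReal.mul_ne_top hBt (by simp)) hε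
  refine ⟨N + μ, t, ht0, ht1, fun g hg => ?_⟩
  set w' := shrink {j}ᶜ t w with hw'
  have hw'0 : ∀ i, 0 < w' i := shrink_pos ht0 hw
  have hw'j : w' j = w j := shrink_of_notMem (by simp) _ _
  set Y : MvPowerSeries ι ℂ := (vr j : Cv ι).1 with hY
  have hYn : pnorm w' Y = w j := by
    rw [hY, vr, mon, pnorm_monomial, wt_single, hw'j]
    simp
  let K : (L → MvPowerSeries ι ℂ) →+ (L → MvPowerSeries ι ℂ) :=
    { toFun := fun h l => -shiftF (Finsupp.single j μ)
        (W₁.1 * h l + ∑ m, (b l m).1 * (Y * scaleF j (N + 1) (h m)))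
      map_zero' := by funext l; simp
      map_add' := fun h h' => by
        funext l
        simp only [Pi.add_apply, map_add, mul_add, Finset.sum_add_distrib]
        abel }
  have hK : ∀ h l, wt w' (Finsupp.single j μ) * pnorm w' (K h l) ≤
      pnorm w' W₁.1 * pnorm w' (h l) +
        ∑ m, pnorm w' (b l m).1 * (w j * ((N + 1 : ℝ≥0∞)⁻¹ * pnorm w' (h m))) := by
    intro h l
    change _ * pnorm w' (-_) ≤ _
    rw [pnorm_neg]
    refine (pnorm_shiftF _ _ _).trans ((pnorm_add_le _ _ _).trans (add_le_add
      (pnorm_mul_le _ _ _) ((pnorm_sum_le _ _ _).trans (Finset.sum_le_sum fun m _ => ?_))))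
    refine (pnorm_mul_le _ _ _).trans (mul_le_mul_right ((pnorm_mul_le _ _ _).trans ?_) _)
    rw [hYn]
    refine mul_le_mul_right ?_ _
    rw [mul_comm, ← div_eq_mul_inv, ENNReal.le_div_iff_mul_le (by simp) (by simp), mul_comm]
    exact pnorm_scaleF _ _ _ _
  have hW₁' : pnorm w' W₁.1 ≤ t * pnorm w W₁.1 := by
    refine pnorm_smul_weight ht1 fun α hα => ?_
    have h2 := cf_rho {j}ᶜᶜ α W₁
    rw [mem_span_vr_iff.1 hW₁, if_pos hα, map_zero] at h2
    exact h2.symm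
  have hsum : ∀ h : L → MvPowerSeries ι ℂ,
      ∑ l, pnorm w' (K h l) ≤ 2⁻¹ * ∑ l, pnorm w' (h l) := by
    intro h
    set Sh := ∑ l, pnorm w' (h l) with hSh
    have hle : ∀ l, pnorm w' (h l) ≤ Sh := fun l =>
      Finset.single_le_sum (f := fun l => pnorm w' (h l)) (fun _ _ => zero_le)
        (Finset.mem_univ l)
    have h1 : wt w' (Finsupp.single j μ) * ∑ l, pnorm w' (K h l) ≤
        (t * (Fintype.card L * pnorm w W₁.1) + B * w j * (N + 1 : ℝ≥0∞)⁻¹) * Sh := by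
      rw [Finset.mul_sum]
      calc _ ≤ ∑ l, (t * pnorm w W₁.1 * Sh +
            ∑ m, pnorm w (b l m).1 * (w j * ((N + 1 : ℝ≥0∞)⁻¹ * Sh))) := by
            refine Finset.sum_le_sum fun l _ => (hK h l).trans ?_
            gcongr with m _
            · exact hle l
            · exact pnorm_mono (shrink_le ht1) _
            · exact hle m
        _ = _ := by
            rw [Finset.sum_add_distrib, Finset.sum_const, Finset.card_univ, nsmul_eq_mul, hB]
            simp only [← Finset.sum_mul]
            ring
    have h2 := h1.trans (mul_le_mul_left hNt Sh)
    rw [wt_single, hw'j] at h2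
    have hp : ((w j ^ μ : ℝ≥0) : ℝ≥0∞) ≠ 0 := by
      simpa using (pow_pos (hw j) μ).ne'
    rw [← ENNReal.mul_le_mul_iff_right hp (by simp)]
    refine h2.trans (le_of_eq ?_)
    rw [ENNReal.coe_mul, ENNReal.coe_inv (by norm_num)]
    push_cast
    ring
  let T : (L × (ι →₀ ℕ) → ℂ) →+ (L × (ι →₀ ℕ) → ℂ) :=
    { toFun := fun f x => MvPowerSeries.coeff x.2 (K (fun l α => f (l, α)) x.1)
      map_zero' := by
        funext x
        exact congrArg (MvPowerSeries.coeff x.2) (congrFun (map_zero K) x.1)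
      map_add' := fun f f' => by
        funext x
        exact congrArg (MvPowerSeries.coeff x.2)
          (congrFun (map_add K (fun l α => f (l, α)) (fun l α => f' (l, α))) x.1) }
  set M := N + μ with hM
  obtain ⟨U, hUn, hU⟩ := neumann (ω := fun x : L × (ι →₀ ℕ) => wt w' x.2)
    (fun x => wt_pos hw'0 _) T (fun f _ => by
      rw [wnorm_prod, wnorm_prod]
      exact hsum fun l α => f (l, α)) (fun x => cf (x.2 + Finsupp.single j M) (g x.1)) (by
      rw [wnorm_prod]
      refine ENNReal.sum_ne_top.2 fun l _ htop => ?_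
      have := pnorm_shiftF w' (Finsupp.single j M) (g l).1
      change _ * pnorm w' (fun α => cf (α + Finsupp.single j M) (g l)) ≤ _ at this
      rw [htop, ENNReal.mul_top (ENNReal.coe_ne_zero.2 (wt_pos hw'0 _).ne')] at this
      exact hg l (top_le_iff.1 this))
  rw [wnorm_prod] at hUn
  set u : L → Cv ι := fun l => ⟨fun α => U (l, α), w', hw'0, ENNReal.sum_ne_top.1 hUn l
    (Finset.mem_univ l)⟩ with hu
  have hc : ∀ l α, ‖MvPowerSeries.coeff α (scaleF j (N + 1) (u l).1)‖ₑ ≤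
      ‖MvPowerSeries.coeff α (u l).1‖ₑ := by
    intro l α
    rw [coeff_scaleF, enorm_mul]
    refine mul_le_of_le_one_left' ?_
    rw [enorm_eq_nnnorm]
    refine ENNReal.coe_le_one_iff.2 ?_
    rw [← NNReal.coe_le_coe, coe_nnnorm, norm_inv, Complex.norm_natCast]
    exact Nat.cast_inv_le_one _
  set s : L → Cv ι := fun l => ⟨scaleF j (N + 1) (u l).1, mem_Cv_of_coeff (u l).2 (hc l)⟩
    with hs
  have hds : ∀ l, dd j (vr j ^ (N + 1) * s l) = vr j ^ N * u l := by
    intro l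
    refine Cv_ext fun α => ?_
    rw [cf_dd, vr_pow, vr_pow, cf_mon_mul, cf_mon_mul]
    have h1 : (Finsupp.single j (N + 1) ≤ α + Finsupp.single j 1) ↔ Finsupp.single j N ≤ α := by
      rw [Finsupp.single_add, add_le_add_iff_right]
    by_cases h : Finsupp.single j N ≤ α
    · rw [if_pos (h1.2 h), if_pos h, Finsupp.single_add, add_tsub_add_eq_tsub_right]
      obtain ⟨γ, rfl⟩ := exists_add_of_le h
      rw [add_tsub_cancel_left]
      change ((γ j + (N + 1) : ℕ) : ℂ)⁻¹ * cf γ (u l) * _ = _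
      have : ((γ j : ℂ) + (N + 1)) ≠ 0 := by
        exact_mod_cast (Nat.succ_ne_zero (γ j + N))
      simp only [Finsupp.add_apply, Finsupp.single_eq_same]
      push_cast
      field_simp
      ring
    · rw [if_neg (fun h' => h (h1.1 h')), if_neg h, zero_mul]
  refine ⟨fun l => vr j ^ (N + 1) * s l, fun l α hα => ?_⟩
  have hα' : Finsupp.single j M ≤ α := Finsupp.single_le_iff.2 hα
  obtain ⟨γ, rfl⟩ := exists_add_of_le hα'
  have hP : (vr j ^ μ + W₁) * dd j (vr j ^ (N + 1) * s l) +
      ∑ m, b l m * (vr j ^ (N + 1) * s m) =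
      mon (Finsupp.single j N) * (mon (Finsupp.single j μ) * u l +
        (W₁ * u l + ∑ m, b l m * (vr j * s m))) := by
    rw [hds, ← vr_pow, ← vr_pow, mul_add, mul_add, Finset.mul_sum, add_mul, add_assoc]
    congr 1
    · ring
    · congr 1
      · ring
      · exact Finset.sum_congr rfl fun m _ => by ring
  have hUl : U (l, γ) = cf (γ + Finsupp.single j M) (g l) -
      cf (γ + Finsupp.single j μ) (W₁ * u l + ∑ m, b l m * (vr j * s m)) := by
    have := congrFun hU (l, γ)
    rw [this, sub_eq_add_neg, Pi.add_apply]
    congr 1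
    change MvPowerSeries.coeff γ (-shiftF _ _) = _
    rw [map_neg, coeff_shiftF, cf_apply]
    congr 2
    push_cast
    rfl
  rw [map_sub, hP, cf_mon_mul, if_pos (by
    rw [hM, Finsupp.single_add, add_assoc]; exact le_self_add)]
  have e1 : Finsupp.single j M + γ - Finsupp.single j N = γ + Finsupp.single j μ := by
    rw [hM, Finsupp.single_add, add_assoc, add_tsub_cancel_left, add_comm]
  rw [e1, map_add, cf_mon_mul, if_pos (by exact le_add_self), add_tsub_cancel_right]
  change _ - (U (l, γ) + _) = 0
  rw [hUl, add_comm (Finsupp.single j M) γ]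
  ring

end Coker

end LagFin

namespace LagFin

open Polynomial

/-! ### Finite kernels and cokernels -/

section Abstract

variable {S R : Type*} [CommRing S] [CommRing R] [Algebra S R]

/-- The cokernel of a map is finitely generated. -/
def CokFin (S : Type*) [CommRing S] {A B : Type*} [AddCommGroup B] [Module S B] (f : A → B) :
    Prop :=
  ∃ G : Submodule S B, G.FG ∧ ∀ x, ∃ g ∈ G, ∃ a, x = g + f a

lemma CokFin.finite_quotient {A B : Type*} [AddCommGroup A] [Module S A] [AddCommGroup B]
    [Module S B] {f : A →ₗ[S] B} (h : CokFin S f) : Module.Finite S (B ⧸ LinearMap.range f) := by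
  obtain ⟨G, hG, h⟩ := h
  have : Module.Finite S G := Module.Finite.iff_fg.2 hG
  refine Module.Finite.of_surjective ((LinearMap.range f).mkQ ∘ₗ G.subtype) fun x => ?_
  obtain ⟨x, rfl⟩ := Submodule.mkQ_surjective _ x
  obtain ⟨g, hg, a, rfl⟩ := h x
  refine ⟨⟨g, hg⟩, ?_⟩
  simp only [LinearMap.comp_apply, Submodule.subtype_apply, map_add]
  rw [left_eq_add, Submodule.mkQ_apply, Submodule.Quotient.mk_eq_zero]
  exact ⟨a, rfl⟩

/-- The properties of a ring of power series `R` over the power series ring `S` in one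
variable less, with coordinate `y` and derivation `D = ∂/∂y`. -/
structure IsOneVar (y : R) (D : Derivation S R R) : Prop where
  noethS : IsNoetherianRing S
  noethR : IsNoetherianRing R
  domain : IsDomain R
  natUnit : ∀ k : ℕ, k ≠ 0 → IsUnit (k : R)
  deriv_y : D y = 1
  separated : ∀ x : R, (∀ k : ℕ, y ^ k ∣ x) → x = 0
  monic_ne_zero : ∀ W : S[X], W.Monic → aeval y W ≠ 0
  division : ∀ W : S[X], W.Monic → CokFin S fun r : R => aeval y W * r
  coker : ∀ W : S[X], W.Monic → ∀ (a : ℕ) (b : Matrix (Fin a) (Fin a) R),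
    CokFin S fun (v : Fin a → R) l => aeval y W * D (v l) + ∑ m, b l m * v m

variable {y : R} {D : Derivation S R R}
variable {A B : Type*} [AddCommGroup A] [Module R A] [Module S A] [IsScalarTower S R A]
  [AddCommGroup B] [Module R B] [Module S B] [IsScalarTower S R B]

lemma IsOneVar.cokFin_smul (h : IsOneVar y D) {W : S[X]} (hW : W.Monic) [Module.Finite R A] :
    CokFin S fun a : A => aeval y W • a := by
  obtain ⟨T, hT, hdiv⟩ := h.division W hW
  obtain ⟨n, f, hf⟩ := Module.Finite.exists_fin' R A
  refine ⟨⨆ l, T.map ((LinearMap.toSpanSingleton R A (f (Pi.single l 1))).restrictScalars S),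
    Submodule.fg_iSup _ fun l => hT.map _, fun x => ?_⟩
  obtain ⟨r, rfl⟩ := hf x
  choose t ht r' hr using fun l => hdiv (r l)
  have key : ∀ r : Fin n → R, f r = ∑ l, r l • f (Pi.single l 1) := by
    intro r
    conv_lhs => rw [pi_eq_sum_univ' r]
    simp only [map_sum, map_smul]
  refine ⟨∑ l, t l • f (Pi.single l 1), Submodule.sum_mem _ fun l _ =>
    Submodule.mem_iSup_of_mem l ⟨t l, ht l, rfl⟩, ∑ l, r' l • f (Pi.single l 1), ?_⟩
  dsimp only at hr ⊢
  rw [key, Finset.smul_sum, ← Finset.sum_add_distrib]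
  refine Finset.sum_congr rfl fun l _ => ?_
  rw [smul_smul, ← add_smul, ← hr]

lemma IsOneVar.fg_of_smul_eq_zero (h : IsOneVar y D) {W : S[X]} (hW : W.Monic) [Module.Finite R B]
    (N : Submodule R B) (hN : ∀ x ∈ N, aeval y W • x = 0) : (N.restrictScalars S).FG := by
  have := h.noethR
  have : IsNoetherian R B := isNoetherian_of_isNoetherianRing_of_finite R B
  have : Module.Finite R N := Module.Finite.iff_fg.2 (IsNoetherian.noetherian N)
  obtain ⟨G, hG, hG'⟩ := h.cokFin_smul (A := N) hW
  have : G.map ((N.subtype).restrictScalars S) = N.restrictScalars S := by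
    refine le_antisymm ?_ fun x hx => ?_
    · rintro _ ⟨x, _, rfl⟩
      exact x.2
    · obtain ⟨g, hg, a, ha⟩ := hG' ⟨x, hx⟩
      refine ⟨g, hg, ?_⟩
      have h0 : aeval y W • a = 0 := Subtype.ext (hN _ a.2)
      dsimp only at ha
      rw [h0, add_zero] at ha
      rw [← ha]
      rfl
  rw [← this]
  exact hG.map _

/-- Operators satisfying the Leibniz rule relative to a map with finite cokernel lift to
differential operators on a free module. -/
lemma IsOneVar.exists_lift_of_leibniz (h : IsOneVar y D) [Module.Finite R A] [Module.Finite R B]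
    (i : A →ₗ[R] B)
    (hi : CokFin S i) (d : A →ₗ[S] B) (hd : ∀ (r : R) a, d (r • a) = D r • i a + r • d a) :
    ∃ (W : S[X]) (n : ℕ) (f : (Fin n → R) →ₗ[R] A) (b : Matrix (Fin n) (Fin n) R),
      W.Monic ∧ Function.Surjective f ∧ (∀ x : B, ∃ a, i a = aeval y W • x) ∧
      ∀ v : Fin n → R, aeval y W • d (f v) =
        i (f fun l => aeval y W * D (v l) + ∑ m, b l m * v m) := by
  have := h.noethS
  have := h.noethR
  have hi' : CokFin S (i.restrictScalars S) := hi
  have : Module.Finite S (B ⧸ LinearMap.range i) := hi'.finite_quotient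
  obtain ⟨W, hW, hW0⟩ := LinearMap.exists_monic_and_aeval_eq_zero S
    ((LinearMap.lsmul R (B ⧸ LinearMap.range i) y).restrictScalars S)
  have hWi : ∀ x : B, ∃ a, i a = aeval y W • x := by
    intro x
    have h1 : ∀ (p : S[X]) (z : B ⧸ LinearMap.range i),
        aeval ((LinearMap.lsmul R (B ⧸ LinearMap.range i) y).restrictScalars S) p z =
          aeval y p • z := by
      intro p z
      induction p using Polynomial.induction_on' with
      | add p q hp hq => simp only [map_add, LinearMap.add_apply, hp, hq, add_smul]
      | monomial k s =>
        rw [aeval_monomial, aeval_monomial, Module.End.mul_apply, Module.algebraMap_end_apply,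
          ← Algebra.smul_def, smul_assoc]
        congr 1
        induction k with
        | zero => simp
        | succ k ih => rw [pow_succ', Module.End.mul_apply, ih, pow_succ', mul_smul]; rfl
    have h2 := h1 W ((LinearMap.range i).mkQ x)
    have h3 : (LinearMap.range i).mkQ (aeval y W • x) = 0 := by
      rw [map_smul, ← h2]
      exact LinearMap.congr_fun hW0 _
    rw [Submodule.mkQ_apply, Submodule.Quotient.mk_eq_zero] at h3
    exact h3
  obtain ⟨n, f, hf⟩ := Module.Finite.exists_fin' R A
  have key : ∀ r : Fin n → R, f r = ∑ l, r l • f (Pi.single l 1) := by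
    intro r
    conv_lhs => rw [pi_eq_sum_univ' r]
    simp only [map_sum, map_smul]
  choose c hc using fun l => hWi (d (f (Pi.single l 1)))
  choose b hb using fun l => hf (c l)
  refine ⟨W, n, f, fun l m => b m l, hW, hf, hWi, fun v => ?_⟩
  have e1 : (fun l => aeval y W * D (v l) + ∑ m, b m l * v m) =
      aeval y W • (fun l => D (v l)) + ∑ m, v m • b m := by
    funext l
    simp [Finset.sum_apply, mul_comm]
  rw [e1, map_add, map_smul, map_sum, map_add, map_smul, map_sum, key v, map_sum,
    Finset.smul_sum, key fun l => D (v l), map_sum, Finset.smul_sum, ← Finset.sum_add_distrib]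
  refine Finset.sum_congr rfl fun m _ => ?_
  rw [hd, smul_add, map_smul, map_smul, map_smul, hb, hc]
  congr 1
  rw [smul_comm]

/-- Operators satisfying the Leibniz rule relative to a map with finite cokernel have finite
cokernel. -/
theorem IsOneVar.cokFin_of_leibniz (h : IsOneVar y D) [Module.Finite R A] [Module.Finite R B]
    (i : A →ₗ[R] B)
    (hi : CokFin S i) (d : A →ₗ[S] B) (hd : ∀ (r : R) a, d (r • a) = D r • i a + r • d a) :
    CokFin S d := by
  have := h.noethS
  have := h.noethR
  obtain ⟨W, n, f, b, hW, hf, hWi, hP⟩ := h.exists_lift_of_leibniz i hi d hd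
  obtain ⟨N, hN, hN'⟩ := h.coker W hW n b
  set N' : Submodule S B := N.map ((i ∘ₗ f).restrictScalars S) with hN'def
  set T : Submodule S B := N'.comap (((LinearMap.lsmul R B (aeval y W))).restrictScalars S) with hT
  refine ⟨T, ?_, fun x => ?_⟩
  · have hNfg : N'.FG := hN.map _
    have : Module.Finite S N' := Module.Finite.iff_fg.2 hNfg
    have : IsNoetherian S N' := isNoetherian_of_isNoetherianRing_of_finite S N'
    refine Submodule.fg_of_fg_map_of_fg_inf_ker
      (((LinearMap.lsmul R B (aeval y W))).restrictScalars S) ?_ ?_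
    · exact Submodule.FG.of_le hNfg (Submodule.map_comap_le _ _)
    · have := h.fg_of_smul_eq_zero hW (LinearMap.ker (LinearMap.lsmul R B (aeval y W)))
        fun x hx => hx
      refine (congrArg Submodule.FG ?_).mp this
      ext x
      simp only [Submodule.restrictScalars_mem, LinearMap.mem_ker, Submodule.mem_inf, hT,
        Submodule.mem_comap, LinearMap.coe_restrictScalars]
      refine ⟨fun hx => ⟨?_, hx⟩, fun hx => hx.2⟩
      rw [hx]
      exact N'.zero_mem
  · obtain ⟨a, ha⟩ := hWi x
    obtain ⟨g, rfl⟩ := hf a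
    obtain ⟨s, hs, v, hv⟩ := hN' g
    refine ⟨x - d (f v), ⟨s, hs, ?_⟩, f v, (sub_add_cancel _ _).symm⟩
    change i (f s) = aeval y W • (x - d (f v))
    rw [smul_sub, ← ha, hP, ← map_sub, ← map_sub, hv]
    congr 2
    exact (add_sub_cancel_right _ _).symm

lemma IsOneVar.fg_ker (h : IsOneVar y D) {W : S[X]} (hW : W.Monic) {n : ℕ}
    (P : (Fin n → R) →ₗ[S] (Fin n → R))
    (hP : ∀ (r : R) v, P (r • v) = (aeval y W * D r) • v + r • P v) :
    (LinearMap.ker P).FG := by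
  have := h.noethS
  have := h.noethR
  have := h.domain
  set K := LinearMap.ker P with hK
  set M : Submodule R (Fin n → R) := Submodule.span R (K : Set (Fin n → R)) with hM
  have hstar : ∀ v ∈ M, ∃ u ∈ M, P v = aeval y W • u := by
    intro v hv
    induction hv using Submodule.span_induction with
    | mem x hx => exact ⟨0, M.zero_mem, by rw [smul_zero]; exact hx⟩
    | zero => exact ⟨0, M.zero_mem, by simp⟩
    | add x z _ _ hx hz =>
      obtain ⟨u, hu, h1⟩ := hx
      obtain ⟨u', hu', h2⟩ := hz
      exact ⟨u + u', M.add_mem hu hu', by rw [map_add, h1, h2, smul_add]⟩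
    | smul r x hx0 hx =>
      obtain ⟨u, hu, h1⟩ := hx
      refine ⟨D r • x + r • u, M.add_mem (M.smul_mem _ hx0) (M.smul_mem _ hu), ?_⟩
      rw [hP, h1, smul_add, smul_smul, smul_smul, smul_smul, mul_comm r]
  have hDy : ∀ k : ℕ, D (y ^ (k + 1)) = ((k + 1 : ℕ) : R) * y ^ k := by
    intro k
    rw [Derivation.leibniz_pow, h.deriv_y]
    simp
  have hy0 : y ≠ 0 := by
    have := h.monic_ne_zero X monic_X
    simpa using this
  have hdivy : ∀ k : ℕ, ∀ u ∈ K, ∀ v ∈ M, u = y ^ (k + 1) • v → ∃ v' ∈ M, v = y • v' := by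
    intro k u hu v hv huv
    obtain ⟨w, hw, hPv⟩ := hstar v hv
    have h0 : P u = 0 := hu
    rw [huv, hP, hPv, hDy] at h0
    obtain ⟨c, hc⟩ := h.natUnit (k + 1) (Nat.succ_ne_zero k)
    have h1 : (aeval y W * y ^ k) • (((k + 1 : ℕ) : R) • v + y • w) = 0 := by
      rw [← h0, smul_add, smul_smul, smul_smul, smul_smul]
      congr 2
      · ring
      · ring
    have h2 := (smul_eq_zero.1 h1).resolve_left
      (mul_ne_zero (h.monic_ne_zero W hW) (pow_ne_zero _ hy0))
    refine ⟨-((↑c⁻¹ : R) • w), M.neg_mem (M.smul_mem _ hw), ?_⟩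
    have h3 : ((k + 1 : ℕ) : R) • v = -(y • w) := eq_neg_of_add_eq_zero_left h2
    calc v = (↑c⁻¹ : R) • ((k + 1 : ℕ) : R) • v := by rw [← hc, smul_smul, Units.inv_mul, one_smul]
      _ = _ := by rw [h3, smul_neg, smul_neg, smul_comm]
  have hinj : ∀ u ∈ K, (∃ v ∈ M, u = y • v) → u = 0 := by
    intro u hu huv
    have hall : ∀ k : ℕ, ∃ v ∈ M, u = y ^ (k + 1) • v := by
      intro k
      induction k with
      | zero => simpa using huv
      | succ k ih =>
        obtain ⟨v, hv, h1⟩ := ih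
        obtain ⟨v', hv', h2⟩ := hdivy k u hu v hv h1
        exact ⟨v', hv', by rw [h1, h2, smul_smul, ← pow_succ]⟩
    funext l
    refine h.separated _ fun k => ?_
    obtain ⟨v, _, hv⟩ := hall k
    rw [hv]
    exact Dvd.dvd.mul_right (pow_dvd_pow _ (Nat.le_succ k)) (v l)
  have : Module.Finite R M := Module.Finite.iff_fg.2 (IsNoetherian.noetherian M)
  have hcok : CokFin S ((LinearMap.lsmul R M y).restrictScalars S) := by
    have := h.cokFin_smul (A := M) monic_X
    simp only [aeval_X] at this
    exact this
  have := hcok.finite_quotient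
  have : IsNoetherian S (M ⧸ LinearMap.range ((LinearMap.lsmul R M y).restrictScalars S)) :=
    isNoetherian_of_isNoetherianRing_of_finite _ _
  let j : K →ₗ[S] M :=
    { toFun := fun u => ⟨u, Submodule.subset_span u.2⟩
      map_add' := fun _ _ => rfl
      map_smul' := fun _ _ => rfl }
  refine Module.Finite.iff_fg.1 (Module.Finite.of_injective
    ((LinearMap.range ((LinearMap.lsmul R M y).restrictScalars S)).mkQ ∘ₗ j) ?_)
  rw [← LinearMap.ker_eq_bot, LinearMap.ker_eq_bot']
  intro u hu
  rw [LinearMap.comp_apply, Submodule.mkQ_apply, Submodule.Quotient.mk_eq_zero] at hu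
  obtain ⟨v, hv⟩ := hu
  exact Subtype.ext (hinj u.1 u.2 ⟨v.1, v.2, (congrArg Subtype.val hv).symm⟩)

lemma fg_range_of_fg_map_ker {X Y Z : Type*} [AddCommGroup X] [Module S X] [AddCommGroup Y]
    [Module S Y] [AddCommGroup Z] [Module S Z] (f : X →ₗ[S] Y) (g : X →ₗ[S] Z)
    (hf : (LinearMap.range f).FG) (hg : ((LinearMap.ker f).map g).FG) :
    (LinearMap.range g).FG := by
  have hX : ∃ X₀ : Submodule S X, X₀.FG ∧ X₀.map f = LinearMap.range f := by
    obtain ⟨s, hs⟩ := hf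
    have hs' : ∀ z ∈ s, ∃ x, f x = z := fun z hz => by
      have : z ∈ LinearMap.range f := hs ▸ Submodule.subset_span hz
      exact this
    choose! x hx using hs'
    refine ⟨Submodule.span S (s.image x), ⟨_, rfl⟩, ?_⟩
    rw [Submodule.map_span, ← hs, Finset.coe_image, Set.image_image]
    congr 1
    ext z
    constructor
    · rintro ⟨z', hz', rfl⟩
      dsimp only
      rwa [hx z' hz']
    · intro hz
      exact ⟨z, hz, hx z hz⟩
  obtain ⟨X₀, hX₀, hX₀f⟩ := hX
  have : LinearMap.range g = X₀.map g ⊔ (LinearMap.ker f).map g := by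
    rw [← Submodule.map_sup]
    refine le_antisymm ?_ LinearMap.map_le_range
    rintro _ ⟨x, rfl⟩
    obtain ⟨x₀, hx₀, hx⟩ : f x ∈ X₀.map f := hX₀f ▸ ⟨x, rfl⟩
    refine ⟨x, Submodule.mem_sup.2 ⟨x₀, hx₀, x - x₀, ?_, add_sub_cancel _ _⟩, rfl⟩
    rw [LinearMap.mem_ker, map_sub, hx, sub_self]
  rw [this]
  exact (hX₀.map _).sup hg

/-- Operators satisfying the Leibniz rule relative to a map with finite kernel and cokernel have
finite kernel. -/
theorem IsOneVar.fg_ker_of_leibniz (h : IsOneVar y D) [Module.Finite R A] [Module.Finite R B]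
    (i : A →ₗ[R] B)
    (hi : CokFin S i) (hik : ((LinearMap.ker i).restrictScalars S).FG)
    (d : A →ₗ[S] B) (hd : ∀ (r : R) a, d (r • a) = D r • i a + r • d a) :
    (LinearMap.ker d).FG := by
  have := h.noethS
  have := h.noethR
  obtain ⟨W, n, f, b, hW, hf, hWi, hP⟩ := h.exists_lift_of_leibniz i hi d hd
  let P : (Fin n → R) →ₗ[S] (Fin n → R) :=
    { toFun := fun v l => aeval y W * D (v l) + ∑ m, b l m * v m
      map_add' := fun u v => by
        funext l
        simp only [Pi.add_apply, map_add, mul_add, Finset.sum_add_distrib]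
        ring
      map_smul' := fun c v => by
        funext l
        simp only [Pi.smul_apply, RingHom.id_apply, smul_add, Finset.smul_sum, Derivation.map_smul,
          mul_smul_comm] }
  have hPr : ∀ (r : R) v, P (r • v) = (aeval y W * D r) • v + r • P v := by
    intro r v
    funext l
    simp only [P, LinearMap.coe_mk, AddHom.coe_mk, Pi.smul_apply, Pi.add_apply, smul_eq_mul,
      Derivation.leibniz, mul_add, Finset.mul_sum]
    rw [Finset.sum_congr rfl fun m _ => mul_left_comm (b l m) r (v m)]
    ring
  replace hP : ∀ v, aeval y W • d (f v) = i (f (P v)) := hP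
  have hK := h.fg_ker hW P hPr
  set Q : Submodule R (Fin n → R) := LinearMap.ker f with hQ
  set Q' : Submodule R (Fin n → R) := LinearMap.ker (i ∘ₗ f) with hQ'
  have hQQ' : Q ≤ Q' := fun v hv => by
    rw [hQ', LinearMap.mem_ker, LinearMap.comp_apply, LinearMap.mem_ker.1 hv, map_zero]
  have hPQ : ∀ v ∈ Q, P v ∈ Q' := fun v hv => by
    rw [hQ', LinearMap.mem_ker, LinearMap.comp_apply, ← hP, LinearMap.mem_ker.1 hv, map_zero,
      smul_zero]
  let i' : Q →ₗ[R] Q' := aeval y W • Submodule.inclusion hQQ'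
  let d' : Q →ₗ[S] Q' :=
    { toFun := fun v => ⟨P v, hPQ v v.2⟩
      map_add' := fun u v => Subtype.ext (map_add P _ _)
      map_smul' := fun c v => Subtype.ext (map_smul P _ _) }
  have : Module.Finite R Q := Module.Finite.iff_fg.2 (IsNoetherian.noetherian Q)
  have : Module.Finite R Q' := Module.Finite.iff_fg.2 (IsNoetherian.noetherian Q')
  have hi' : CokFin S i' := by
    obtain ⟨G, hG, hG'⟩ := h.cokFin_smul (A := Q) hW
    obtain ⟨t, ht⟩ := hik
    have hlift : ∀ a ∈ t, ∃ v : Q', f v = a := fun a ha => by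
      have ha' : a ∈ (LinearMap.ker i).restrictScalars S := ht ▸ Submodule.subset_span ha
      obtain ⟨v, rfl⟩ := hf a
      exact ⟨⟨v, ha'⟩, rfl⟩
    choose! v hv using hlift
    refine ⟨Submodule.span S (t.image v) ⊔ G.map ((Submodule.inclusion hQQ').restrictScalars S),
      Submodule.FG.sup ⟨_, rfl⟩ (hG.map _), fun x => ?_⟩
    have hx : f x ∈ (Submodule.span S (t.image v : Set Q')).map
        ((f ∘ₗ Q'.subtype).restrictScalars S) := by
      have hx' : f x ∈ (LinearMap.ker i).restrictScalars S := x.2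
      rw [← ht] at hx'
      refine Submodule.span_le.2 (fun a ha => ?_) hx'
      refine ⟨v a, Submodule.subset_span ?_, hv a ha⟩
      rw [Finset.coe_image]
      exact ⟨a, ha, rfl⟩
    obtain ⟨x₀, hx₀, hx₀f⟩ := hx
    have hq : (x - x₀ : Q').1 ∈ Q := by
      rw [hQ, LinearMap.mem_ker, Submodule.coe_sub, map_sub, ← hx₀f]
      exact sub_self _
    obtain ⟨g, hg, q, hq'⟩ := hG' ⟨(x - x₀ : Q').1, hq⟩
    refine ⟨x₀ + Submodule.inclusion hQQ' g, Submodule.add_mem_sup hx₀ ⟨g, hg, rfl⟩, q, ?_⟩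
    have hq'' := congrArg Subtype.val hq'
    refine Subtype.ext ?_
    change x.1 = x₀.1 + g.1 + aeval y W • q.1
    have e : x.1 - x₀.1 = g.1 + aeval y W • q.1 := hq''
    rw [add_assoc, ← e, add_sub_cancel]
  have hcok := h.cokFin_of_leibniz i' hi' d' fun r a => Subtype.ext <| by
    change P (r • a.1) = D r • aeval y W • a.1 + r • P a.1
    rw [hPr, smul_smul, mul_comm]
  have := hcok.finite_quotient
  set T : Submodule S (Fin n → R) := (Q'.restrictScalars S).comap P with hT
  let p : T →ₗ[S] Q' :=
    { toFun := fun v => ⟨P v, v.2⟩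
      map_add' := fun u v => Subtype.ext (map_add P _ _)
      map_smul' := fun c v => Subtype.ext (map_smul P _ _) }
  have hfg := fg_range_of_fg_map_ker ((LinearMap.range d').mkQ ∘ₗ p)
    ((f.restrictScalars S) ∘ₗ T.subtype)
    (IsNoetherian.noetherian _) (by
      refine (congrArg Submodule.FG ?_).mp (hK.map (f.restrictScalars S))
      ext a
      constructor
      · rintro ⟨v, hv, rfl⟩
        have hv' : P v = 0 := hv
        have hvT : v ∈ T := by
          rw [hT, Submodule.mem_comap, hv']
          exact Submodule.zero_mem _
        refine ⟨⟨v, hvT⟩, ?_, rfl⟩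
        have : p ⟨v, hvT⟩ = 0 := Subtype.ext hv'
        change _ = _
        rw [LinearMap.comp_apply, this, map_zero]
      · rintro ⟨v, hv, rfl⟩
        have hv' : ((LinearMap.range d').mkQ (p v)) = 0 := hv
        rw [Submodule.mkQ_apply, Submodule.Quotient.mk_eq_zero] at hv'
        obtain ⟨q, hq⟩ := hv'
        refine ⟨v.1 - q.1, ?_, ?_⟩
        · change P (v.1 - q.1) = 0
          rw [map_sub, sub_eq_zero]
          exact (congrArg Subtype.val hq).symm
        · change f (v.1 - q.1) = f v.1
          rw [map_sub, LinearMap.mem_ker.1 q.2, sub_zero])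
  refine Submodule.FG.of_le hfg fun a ha => ?_
  obtain ⟨v, rfl⟩ := hf a
  refine ⟨⟨v, ?_⟩, rfl⟩
  change i (f (P v)) = 0
  rw [← hP, LinearMap.mem_ker.1 ha, smul_zero]

end Abstract

end LagFin

namespace LagFin

open Polynomial
open scoped ENNReal NNReal

/-! ### The rings of convergent power series in nested sets of variables -/

section Concrete

variable {ι : Type*} [Fintype ι]

noncomputable instance (I : Set ι) (j : ι) : Algebra (Rs I) (Rs (insert j I)) :=
  (Subalgebra.inclusion (Rs_mono (Set.subset_insert j I))).toRingHom.toAlgebra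

noncomputable instance (I : Set ι) (j : ι) : Module (Rs I) (Rs (insert j I)) := Algebra.toModule

noncomputable instance (I : Set ι) (j : ι) : SMul (Rs I) (Rs (insert j I)) := Algebra.toSMul

lemma coe_smul_Rs (I : Set ι) (j : ι) (s : Rs I) (r : Rs (insert j I)) :
    ((s • r : Rs (insert j I)) : Cv ι) = s * r := rfl

instance (I : Set ι) (j : ι) (M : Type*) [AddCommGroup M] [Module (Cv ι) M] :
    IsScalarTower (Rs I) (Rs (insert j I)) M where
  smul_assoc s r x := mul_smul (s : Cv ι) (r : Cv ι) x

/-- The variable `X_j` as an element of the ring of series in the variables `insert j I`. -/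
noncomputable def vrIn (I : Set ι) (j : ι) : Rs (insert j I) :=
  ⟨vr j, vr_mem_Rs (Set.mem_insert j I)⟩

/-- The derivation `∂/∂X_j` of the ring of series in the variables `insert j I`. -/
noncomputable def ddIn {I : Set ι} {j : ι} (hj : j ∉ I) :
    Derivation (Rs I) (Rs (insert j I)) (Rs (insert j I)) where
  toFun r := ⟨dd j r, dd_mem_Rs j r.2⟩
  map_add' r s := Subtype.ext (map_add (dd j) _ _)
  map_smul' s r := Subtype.ext <| by
    change dd j ((s : Cv ι) * r) = s * dd j r
    rw [Derivation.leibniz, dd_eq_zero hj s.2]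
    simp
  map_one_eq_zero' := Subtype.ext (Derivation.map_one_eq_zero (dd j))
  leibniz' r s := Subtype.ext (Derivation.leibniz (dd j) _ _)

lemma coe_ddIn {I : Set ι} {j : ι} (hj : j ∉ I) (r : Rs (insert j I)) :
    ((ddIn hj r : Rs (insert j I)) : Cv ι) = dd j r := rfl

lemma coe_aeval_vrIn (I : Set ι) (j : ι) (W : (Rs I)[X]) :
    ((aeval (vrIn I j) W : Rs (insert j I)) : Cv ι) = aeval (vr j) W := by
  rw [aeval_def, aeval_def]
  exact hom_eval₂ W _ ((Rs (insert j I)).val : Rs (insert j I) →+* Cv ι) _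

lemma rho_singleton_of_mem {I : Set ι} {j : ι} (hj : j ∉ I) {s : Cv ι} (hs : s ∈ Rs I) :
    rho {j} s = algebraMap ℂ _ (cst s) := by
  rw [← rho_empty]
  refine Cv_ext fun α => ?_
  rw [cf_rho, cf_rho]
  by_cases h0 : α ∈ expOn (∅ : Set ι)
  · rw [if_pos h0, if_pos (expOn_mono (Set.empty_subset _) h0)]
  · rw [if_neg h0, ite_eq_right_iff]
    intro h1
    refine hs α fun h2 => h0 fun i _ => ?_
    by_cases hi : i ∈ I
    · exact h1 i fun h => hj (h ▸ hi)
    · exact h2 i hi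

lemma exists_unit_mul_of_monic {I : Set ι} {j : ι} (hj : j ∉ I) {W : (Rs I)[X]} (hW : W.Monic) :
    ∃ (μ : ℕ) (u v W₁ : Cv ι), u * v = 1 ∧ u ∈ Rs {j} ∧ W₁ ∈ Ideal.span (vr '' {j}ᶜ) ∧
      aeval (vr j) W = u * (vr j ^ μ + W₁) := by
  set c : Rs I →+* ℂ := (cst : Cv ι →ₐ[ℂ] ℂ).toRingHom.comp (algebraMap (Rs I) (Cv ι)) with hc
  have hp : (W.map c) ≠ 0 := (hW.map c).ne_zero
  have h1 : rho {j} (aeval (vr j) W) = aeval (vr j) (W.map c) := by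
    have hyj : rho {j} (vr j : Cv ι) = vr j := rho_of_mem (vr_mem_Rs rfl)
    have h2 := hom_eval₂ W (algebraMap (Rs I) (Cv ι)) (rho {j} : Cv ι →ₐ[ℂ] Cv ι).toRingHom (vr j)
    have h3 : (rho {j} : Cv ι →ₐ[ℂ] Cv ι).toRingHom.comp (algebraMap (Rs I) (Cv ι)) =
        (algebraMap ℂ (Cv ι)).comp c := RingHom.ext fun s => rho_singleton_of_mem hj s.2
    rw [h3] at h2
    rw [aeval_def, aeval_def, eval₂_map]
    refine h2.trans ?_
    change eval₂ _ (rho {j} (vr j)) W = _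
    rw [hyj]
  obtain ⟨q, hq, hq0⟩ := exists_eq_pow_rootMultiplicity_mul_and_not_dvd (W.map c) hp 0
  set μ := rootMultiplicity 0 (W.map c)
  rw [C_0, sub_zero] at hq hq0
  rw [X_dvd_iff] at hq0
  have hu : IsUnit (aeval (vr j : Cv ι) q) := by
    refine isUnit_of_cst_ne_zero ?_
    have : cst (aeval (vr j : Cv ι) q) = aeval (cst (vr j : Cv ι)) q := (aeval_algHom_apply _ _ _).symm
    have h0 : cst (vr j : Cv ι) = 0 := by
      rw [cst_apply, vr, cf_mon, if_neg (by simp [eq_comm])]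
    rw [this, h0, ← coeff_zero_eq_aeval_zero]
    exact hq0
  obtain ⟨v, hv⟩ := hu.exists_right_inv
  refine ⟨μ, aeval (vr j) q, v, v * (aeval (vr j) W - rho {j} (aeval (vr j) W)), hv, ?_, ?_, ?_⟩
  · have : aeval (vr j : Cv ι) q = (Rs {j}).val (aeval ⟨vr j, vr_mem_Rs rfl⟩ q) :=
      aeval_algHom_apply (Rs {j}).val ⟨vr j, vr_mem_Rs rfl⟩ q
    rw [this]
    exact Subtype.prop _
  · refine Ideal.mul_mem_left _ _ ?_
    have := sub_rho_mem_span ({j}ᶜ : Set ι) (aeval (vr j) W)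
    rwa [compl_compl] at this
  · rw [mul_add, ← mul_assoc, hv, one_mul, h1, hq, map_mul, map_pow, aeval_X]
    ring

lemma cokFin_mul_monic {I : Set ι} {j : ι} (hj : j ∉ I) {W : (Rs I)[X]} (hW : W.Monic) :
    CokFin (Rs I) fun r : Rs (insert j I) => aeval (vrIn I j) W * r := by
  obtain ⟨μ, u, v, W₁, huv, -, hW₁, hWu⟩ := exists_unit_mul_of_monic hj hW
  set Wy : Cv ι := aeval (vr j) W with hWy
  set 𝔧 : Ideal (Cv ι) := Ideal.span {Wy} ⊔ Ideal.span (vr '' (insert j I)ᶜ) with h𝔧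
  have hi : ∀ i, i ≠ j → vr i ∈ 𝔧 ⊔ Ideal.span (vr '' I) := by
    intro i hij
    by_cases hiI : i ∈ I
    · exact Ideal.mem_sup_right (Ideal.subset_span ⟨i, hiI, rfl⟩)
    · refine Ideal.mem_sup_left (Ideal.mem_sup_right (Ideal.subset_span ⟨i, ?_, rfl⟩))
      simp [hij, hiI]
  have hm : IsLocalRing.maximalIdeal (Cv ι) ≤ (𝔧 ⊔ Ideal.span (vr '' I)).radical := by
    rw [maximalIdeal_eq_span, Ideal.span_le]
    rintro _ ⟨i, rfl⟩
    by_cases hij : i = j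
    · subst hij
      refine ⟨μ, ?_⟩
      have : (vr i : Cv ι) ^ μ = v * Wy - W₁ := by
        rw [hWu]
        linear_combination (-(vr i ^ μ + W₁)) * huv
      rw [this]
      refine Ideal.sub_mem _ (Ideal.mem_sup_left (Ideal.mem_sup_left
        (Ideal.mul_mem_left _ _ (Ideal.mem_span_singleton_self _)))) ?_
      refine (Ideal.span_le.2 ?_ : Ideal.span (vr '' {i}ᶜ) ≤ _) hW₁
      rintro _ ⟨l, hl, rfl⟩
      exact hi l hl
    · exact Ideal.le_radical (hi i hij)
  obtain ⟨N, hN⟩ := Ideal.exists_pow_le_of_le_radical_of_fg hm (IsNoetherian.noetherian _)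
  refine ⟨Submodule.span (Rs I) ((boxOff I (N + 1)).image fun β =>
    (⟨rho (insert j I) (mon β), rho_mem _ _⟩ : Rs (insert j I))), ⟨_, rfl⟩, fun x => ?_⟩
  obtain ⟨r, hr, hx⟩ := finite_mod I 𝔧 N hN x.1
  obtain ⟨y, hy, z, hz, hyz⟩ := Submodule.mem_sup.1 hx
  obtain ⟨q, rfl⟩ := Ideal.mem_span_singleton'.1 hy
  have hWR : rho (insert j I) Wy = Wy := by
    refine rho_of_mem ?_
    rw [hWy, ← coe_aeval_vrIn]
    exact Subtype.prop _
  refine ⟨∑ β ∈ boxOff I (N + 1), (⟨r β, hr β⟩ : Rs I) •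
    (⟨rho (insert j I) (mon β), rho_mem _ _⟩ : Rs (insert j I)),
    Submodule.sum_mem _ fun β hβ => Submodule.smul_mem _ _ (Submodule.subset_span ?_),
    ⟨rho (insert j I) q, rho_mem _ _⟩, Subtype.ext ?_⟩
  · rw [Finset.coe_image]
    exact ⟨β, hβ, rfl⟩
  · have h1 := congrArg (rho (insert j I)) hyz
    have h2 : rho (insert j I) z = 0 := by
      have := rho_eq_zero_of_mem_span hz
      rwa [compl_compl] at this
    rw [map_add, map_mul, hWR, h2, add_zero, map_sub, rho_of_mem x.2, map_sum] at h1
    rw [eq_comm, sub_eq_iff_eq_add'] at h1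
    rw [h1]
    simp only [Subalgebra.coe_add, AddSubmonoidClass.coe_finsetSum, coe_smul_Rs, MulMemClass.coe_mul,
      coe_aeval_vrIn]
    rw [mul_comm _ Wy]
    congr 1
    refine Finset.sum_congr rfl fun β _ => ?_
    rw [map_mul, rho_of_mem (Rs_mono (Set.subset_insert j I) (hr β))]

/-- Series of bounded degree in `X_j` are combinations of powers of `X_j`. -/
lemma mem_span_of_cf_eq_zero {a : ℕ} (j : ι) (M : ℕ) (x : Fin a → Cv ι)
    (hx : ∀ l α, M ≤ α j → cf α (x l) = 0) :
    x ∈ Submodule.span (Rs ({j}ᶜ : Set ι))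
      (Set.range fun p : Fin M × Fin a => (Pi.single p.2 (vr j ^ (p.1 : ℕ)) : Fin a → Cv ι)) := by
  choose s hs using fun (l : Fin a) (m : ℕ) => exists_shift (x l) (Finsupp.single j m)
  have key : x = ∑ l, ∑ m : Fin M, (⟨rho {j}ᶜ (s l m), rho_mem _ _⟩ : Rs ({j}ᶜ : Set ι)) •
      (Pi.single l (vr j ^ (m : ℕ)) : Fin a → Cv ι) := by
    funext l
    rw [Finset.sum_apply, Finset.sum_eq_single l]
    · rw [Finset.sum_apply]
      refine Cv_ext fun α => ?_
      simp only [Pi.smul_apply, Pi.single_eq_same, Subalgebra.smul_def, smul_eq_mul, vr_pow]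
      rw [map_sum]
      simp only [mul_comm _ (mon _), cf_mon_mul, cf_rho, hs]
      by_cases hα : α j < M
      · rw [Finset.sum_eq_single (⟨α j, hα⟩ : Fin M)]
        · have h1 : Finsupp.single j (α j) ≤ α := by
            rw [Finsupp.single_le_iff]
          rw [if_pos h1, if_pos, tsub_add_cancel_of_le h1]
          intro i hi
          have : i = j := by simpa using hi
          subst this
          simp
        · intro m _ hm
          rw [ite_eq_right_iff]
          intro h1
          rw [if_neg]
          intro h2
          have h3 := h2 j (by simp)
          rw [Finsupp.single_le_iff] at h1
          simp at h3
          exact hm (Fin.ext (by simp; omega))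
        · simp
      · rw [hx l α (not_lt.1 hα), eq_comm]
        refine Finset.sum_eq_zero fun m _ => ?_
        rw [ite_eq_right_iff]
        intro h1
        rw [if_neg]
        intro h2
        have h3 := h2 j (by simp)
        rw [Finsupp.single_le_iff] at h1
        simp at h3
        have := m.2
        omega
    · intro l' _ hl'
      rw [Finset.sum_apply]
      refine Finset.sum_eq_zero fun m _ => ?_
      rw [Pi.smul_apply, Pi.single_eq_of_ne hl'.symm, smul_zero]
    · simp
  rw [key]
  exact Submodule.sum_mem _ fun l _ => Submodule.sum_mem _ fun m _ =>
    Submodule.smul_mem _ _ (Submodule.subset_span ⟨(m, l), rfl⟩)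

/-- Regular singular operators in one variable have finite cokernel. -/
lemma exists_solution_mod {a : ℕ} (j : ι) (μ : ℕ) {W₁ : Cv ι}
    (hW₁ : W₁ ∈ Ideal.span (vr '' {j}ᶜ)) (b : Fin a → Fin a → Cv ι) :
    ∃ M : ℕ, ∀ g : Fin a → Cv ι, ∃ v : Fin a → Cv ι,
      (fun l => g l - ((vr j ^ μ + W₁) * dd j (v l) + ∑ m, b l m * v m)) ∈
      Submodule.span (Rs ({j}ᶜ : Set ι))
      (Set.range fun p : Fin M × Fin a => (Pi.single p.2 (vr j ^ (p.1 : ℕ)) : Fin a → Cv ι)) := by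
  let P : (Fin a → Cv ι) →ₗ[Rs ({j}ᶜ : Set ι)] (Fin a → Cv ι) :=
    { toFun := fun v l => (vr j ^ μ + W₁) * dd j (v l) + ∑ m, b l m * v m
      map_add' := fun u v => by
        funext l
        simp only [Pi.add_apply, map_add, mul_add, Finset.sum_add_distrib]
        ring
      map_smul' := fun c v => by
        funext l
        have hc : dd j (c : Cv ι) = 0 := dd_eq_zero (by simp) c.2
        simp only [Pi.smul_apply, RingHom.id_apply, smul_add, Finset.smul_sum, Subalgebra.smul_def,
          smul_eq_mul, Derivation.leibniz, hc, mul_zero, add_zero]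
        rw [Finset.sum_congr rfl fun m _ => mul_left_comm (b l m) (c : Cv ι) (v m)]
        ring }
  have hstep : ∀ w : ι → ℝ≥0, (∀ i, 0 < w i) → pnorm w W₁.1 ≠ ⊤ → (∀ l m, pnorm w (b l m).1 ≠ ⊤) →
      ∃ (M : ℕ) (t : ℝ≥0), 0 < t ∧ t ≤ 1 ∧ ∀ g : Fin a → Cv ι,
        (∀ l, pnorm (shrink {j}ᶜ t w) (g l).1 ≠ ⊤) →
        g ∈ LinearMap.range P ⊔ Submodule.span (Rs ({j}ᶜ : Set ι)) (Set.range
          fun p : Fin M × Fin a => (Pi.single p.2 (vr j ^ (p.1 : ℕ)) : Fin a → Cv ι)) := by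
    intro w hw h1 h2
    obtain ⟨M, t, ht, ht1, h⟩ := exists_solution_of_weight j hw μ hW₁ b h1 h2
    refine ⟨M, t, ht, ht1, fun g hg => ?_⟩
    obtain ⟨v, hv⟩ := h g hg
    have := mem_span_of_cf_eq_zero j M (fun l => g l - P v l) hv
    refine Submodule.mem_sup.2 ⟨P v, ⟨v, rfl⟩, _, this, ?_⟩
    funext l
    simp
  set s₀ : Finset (Cv ι) := insert W₁ (Finset.univ.image fun p : Fin a × Fin a => b p.1 p.2)
    with hs₀
  have hbs : ∀ l m, b l m ∈ s₀ := fun l m =>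
    Finset.mem_insert_of_mem (Finset.mem_image.2 ⟨(l, m), Finset.mem_univ _, rfl⟩)
  obtain ⟨w₀, hw₀, hs⟩ := exists_common_weightCv s₀
  obtain ⟨M, t, ht, ht1, hM⟩ := hstep w₀ hw₀ (hs _ (Finset.mem_insert_self _ _))
    fun l m => hs _ (hbs l m)
  refine ⟨M, fun g => ?_⟩
  obtain ⟨w₁, hw₁, hs₁⟩ := exists_common_weightCv (s₀ ∪ Finset.univ.image g)
  obtain ⟨M₁, t₁, ht₁, ht₁1, hM₁⟩ := hstep w₁ hw₁
    (hs₁ _ (Finset.mem_union_left _ (Finset.mem_insert_self _ _)))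
    fun l m => hs₁ _ (Finset.mem_union_left _ (hbs l m))
  have hg : g ∈ LinearMap.range P ⊔ Submodule.span (Rs ({j}ᶜ : Set ι)) (Set.range
      fun p : Fin M × Fin a => (Pi.single p.2 (vr j ^ (p.1 : ℕ)) : Fin a → Cv ι)) := by
    have hfin : ∀ l, pnorm (shrink {j}ᶜ t₁ w₁) (g l).1 ≠ ⊤ := fun l =>
      ne_top_of_le_ne_top (hs₁ (g l) (Finset.mem_union_right _
        (Finset.mem_image.2 ⟨l, Finset.mem_univ _, rfl⟩))) (pnorm_mono (fun i => shrink_le ht₁1 i) _)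
    obtain ⟨x, hx, z, hz, rfl⟩ := Submodule.mem_sup.1 (hM₁ g hfin)
    refine Submodule.add_mem _ (Submodule.mem_sup_left hx) (Submodule.span_le.2 ?_ hz)
    rintro _ ⟨p, rfl⟩
    refine hM _ fun l => ?_
    dsimp only
    by_cases hl : l = p.2
    · subst hl
      rw [Pi.single_eq_same, vr_pow]
      change pnorm _ (MvPowerSeries.monomial _ 1) ≠ ⊤
      rw [pnorm_monomial]
      exact ENNReal.mul_ne_top (by simp) (by simp)
    · rw [Pi.single_eq_of_ne hl]
      change pnorm _ 0 ≠ ⊤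
      rw [pnorm_zero]
      simp
  obtain ⟨_, ⟨v, rfl⟩, x, hx, hgx⟩ := Submodule.mem_sup.1 hg
  refine ⟨v, ?_⟩
  have : (fun l => g l - P v l) = x := by
    rw [← hgx]
    funext l
    simp
  exact this ▸ hx

lemma cokFin_monic_deriv {I : Set ι} {j : ι} (hj : j ∉ I) {W : (Rs I)[X]} (hW : W.Monic)
    (a : ℕ) (b : Matrix (Fin a) (Fin a) (Rs (insert j I))) :
    CokFin (Rs I) fun (v : Fin a → Rs (insert j I)) l =>
      aeval (vrIn I j) W * ddIn hj (v l) + ∑ m, b l m * v m := by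
  obtain ⟨μ, u, v, W₁, huv, hu, hW₁, hWu⟩ := exists_unit_mul_of_monic hj hW
  have huR : u ∈ Rs (insert j I) := Rs_mono (by simp) hu
  set rh := rho (insert j I) with hrh
  obtain ⟨M, hM⟩ := exists_solution_mod j μ hW₁ fun l m => v * (b l m : Cv ι)
  set G : Submodule (Rs I) (Fin a → Rs (insert j I)) := Submodule.span (Rs I) (Set.range
    fun p : Fin M × Fin a => (Pi.single p.2 ((⟨u, huR⟩ : Rs (insert j I)) * vrIn I j ^ (p.1 : ℕ)) :
      Fin a → Rs (insert j I))) with hG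
  refine ⟨G, ⟨Finset.univ.image fun p : Fin M × Fin a => (Pi.single p.2
    ((⟨u, huR⟩ : Rs (insert j I)) * vrIn I j ^ (p.1 : ℕ)) : Fin a → Rs (insert j I)), by
      simp [hG]⟩, fun g => ?_⟩
  have hretr : ∀ x ∈ Submodule.span (Rs ({j}ᶜ : Set ι)) (Set.range
      fun p : Fin M × Fin a => (Pi.single p.2 (vr j ^ (p.1 : ℕ)) : Fin a → Cv ι)),
      (fun l => (⟨u * rh (x l), mul_mem huR (rho_mem _ _)⟩ : Rs (insert j I))) ∈ G := by
    intro x hx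
    induction hx using Submodule.span_induction with
    | mem x hx =>
      obtain ⟨p, rfl⟩ := hx
      refine Submodule.subset_span ⟨p, ?_⟩
      funext l
      refine Subtype.ext ?_
      dsimp only
      by_cases hl : l = p.2
      · subst hl
        simp only [Pi.single_eq_same]
        rw [map_pow, hrh, rho_of_mem (vr_mem_Rs (Set.mem_insert j I))]
        rfl
      · simp [Pi.single_eq_of_ne hl]
    | zero =>
      convert G.zero_mem using 1
      funext l
      exact Subtype.ext (by simp)
    | add x z _ _ hx hz =>
      convert G.add_mem hx hz using 1
      funext l
      exact Subtype.ext (by simp [mul_add])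
    | smul c x _ hx =>
      have hc : rh c ∈ Rs I := by
        intro α hα
        rw [hrh, cf_rho]
        split_ifs with h1
        · refine c.2 α fun h2 => hα fun i hi => ?_
          by_cases hij : i = j
          · exact h2 i (by simp [hij])
          · exact h1 i (by simp [hij, hi])
        · rfl
      convert G.smul_mem (⟨rh c, hc⟩ : Rs I) hx using 1
      funext l
      refine Subtype.ext ?_
      change u * rh ((c : Cv ι) * x l) = rh c * (u * rh (x l))
      rw [map_mul]
      ring
  obtain ⟨f, hf⟩ := hM fun l => v * (g l : Cv ι)
  have hvR : rh v = v := by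
    have h1 : u * rh v = 1 := by
      have := congrArg rh huv
      rwa [map_mul, map_one, hrh, rho_of_mem huR] at this
    calc rh v = v * (u * rh v) := by rw [← mul_assoc, mul_comm v u, huv, one_mul]
      _ = v := by rw [h1, mul_one]
  have hWR : rh (aeval (vr j) W) = aeval (vr j) W := by
    refine rho_of_mem ?_
    rw [← coe_aeval_vrIn]
    exact Subtype.prop _
  refine ⟨_, hretr _ hf, fun l => ⟨rh (f l), rho_mem _ _⟩, ?_⟩
  funext l
  refine Subtype.ext ?_
  simp only [Pi.add_apply, Subalgebra.coe_add, AddSubmonoidClass.coe_finsetSum, coe_ddIn,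
    MulMemClass.coe_mul, coe_aeval_vrIn]
  have hW' : (vr j ^ μ + W₁ : Cv ι) = v * aeval (vr j) W := by
    rw [hWu]
    linear_combination (-(vr j ^ μ + W₁)) * huv
  rw [hW', map_sub, map_add, map_sum, map_mul, map_mul, map_mul, hvR, hWR, rho_of_mem (g l).2, hrh,
    dd_rho (Set.mem_insert j I), ← hrh]
  have h3 : ∀ m, rh (v * (b l m : Cv ι) * f m) = v * (b l m * rh (f m)) := fun m => by
    rw [map_mul, map_mul, hvR, hrh, rho_of_mem (b l m).2, mul_assoc]
  rw [Finset.sum_congr rfl fun m _ => h3 m, ← Finset.mul_sum]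
  linear_combination ((aeval (vr j) W * rh (dd j (f l)) + ∑ m, (b l m : Cv ι) * rh (f m))
    - (g l : Cv ι)) * huv

theorem isOneVar {I : Set ι} {j : ι} (hj : j ∉ I) : IsOneVar (S := Rs I) (R := Rs (insert j I)) (vrIn I j) (ddIn hj) where
  noethS := inferInstance
  noethR := inferInstance
  domain := inferInstance
  natUnit k hk := by
    have := (IsUnit.mk0 (k : ℂ) (Nat.cast_ne_zero.2 hk)).map (algebraMap ℂ (Rs (insert j I)))
    rwa [map_natCast] at this
  deriv_y := Subtype.ext ((dd_vr j j).trans (if_pos rfl))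
  separated x hx := by
    refine Subtype.ext (Cv_ext fun α => ?_)
    obtain ⟨z, hz⟩ := hx (α j + 1)
    have h1 : (x : Cv ι) = mon (Finsupp.single j (α j + 1)) * z := by
      rw [hz, ← vr_pow]
      rfl
    rw [h1, cf_mon_mul, if_neg]
    · exact (map_zero _).symm
    · rw [Finsupp.single_le_iff]
      omega
  monic_ne_zero W hW h0 := by
    obtain ⟨μ, u, v, W₁, huv, -, hW₁, hWu⟩ := exists_unit_mul_of_monic hj hW
    have h1 : aeval (vr j : Cv ι) W = 0 := by
      rw [← coe_aeval_vrIn, h0]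
      rfl
    have h2 : (vr j ^ μ + W₁ : Cv ι) = 0 := by
      have : (vr j ^ μ + W₁ : Cv ι) = v * (u * (vr j ^ μ + W₁)) := by
        linear_combination (-(vr j ^ μ + W₁)) * huv
      rw [this, ← hWu, h1, mul_zero]
    have h3 := congrArg (rho ({j}ᶜᶜ : Set ι)) h2
    rw [map_add, rho_eq_zero_of_mem_span hW₁, map_pow, map_zero, add_zero, rho_of_mem
      (vr_mem_Rs (by simp)), vr_pow] at h3
    have h4 := congrArg (cf (Finsupp.single j μ)) h3
    rw [cf_mon, if_pos rfl, map_zero] at h4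
    exact one_ne_zero h4
  division W hW := cokFin_mul_monic hj hW
  coker W hW a b := cokFin_monic_deriv hj hW a b

end Concrete

end LagFin

namespace LagFin

/-! ### Koszul complexes of commuting operators -/

section Koszul

variable {n : ℕ} {M M' : Type*} [AddCommGroup M] [AddCommGroup M']

/-- The Koszul sign of `i` in `s`. -/
def ksgn (i : Fin n) (s : Finset (Fin n)) : ℤ := (-1) ^ (s.filter (· < i)).card

lemma ksgn_mul_self (i : Fin n) (s : Finset (Fin n)) : ksgn i s * ksgn i s = 1 := by
  rw [ksgn, ← mul_pow]
  simp

lemma ksgn_erase_of_le {i l : Fin n} (h : i ≤ l) (s : Finset (Fin n)) :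
    ksgn i (s.erase l) = ksgn i s := by
  rw [ksgn, ksgn, Finset.filter_erase, Finset.erase_eq_of_notMem]
  simp [h]

lemma ksgn_erase_of_lt {i l : Fin n} (h : i < l) {s : Finset (Fin n)} (hi : i ∈ s) :
    ksgn l (s.erase i) = -ksgn l s := by
  have hm : i ∈ s.filter (· < l) := Finset.mem_filter.2 ⟨hi, h⟩
  rw [ksgn, ksgn, Finset.filter_erase, ← Finset.card_erase_add_one hm, pow_succ]
  ring

lemma ksgn_mul_swap {i l : Fin n} {s : Finset (Fin n)} (hi : i ∈ s) (hl : l ∈ s) (h : i ≠ l) :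
    ksgn i s * ksgn l (s.erase i) = -(ksgn l s * ksgn i (s.erase l)) := by
  rcases lt_or_gt_of_ne h with h | h
  · rw [ksgn_erase_of_lt h hi, ksgn_erase_of_le h.le]
    ring
  · rw [ksgn_erase_of_lt h hl, ksgn_erase_of_le h.le]
    ring

/-- The Koszul differential of a family of operators. -/
def kos (φ : Fin n → M →+ M) : (Finset (Fin n) → M) →+ (Finset (Fin n) → M) where
  toFun u s := ∑ i ∈ s, ksgn i s • φ i (u (s.erase i))
  map_zero' := by
    funext s
    simp
  map_add' u v := by
    funext s
    simp [Finset.sum_add_distrib]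

lemma kos_apply (φ : Fin n → M →+ M) (u : Finset (Fin n) → M) (s : Finset (Fin n)) :
    kos φ u s = ∑ i ∈ s, ksgn i s • φ i (u (s.erase i)) := rfl

lemma kos_map {φ : Fin n → M →+ M} {φ' : Fin n → M' →+ M'} (g : M →+ M')
    (hg : ∀ i x, g (φ i x) = φ' i (g x)) (u : Finset (Fin n) → M) :
    kos φ' (fun s => g (u s)) = fun s => g (kos φ u s) := by
  funext s
  rw [kos_apply, kos_apply, map_sum]
  refine Finset.sum_congr rfl fun i _ => ?_
  rw [map_zsmul, hg]

lemma kos_kos [Module ℂ M] {φ : Fin n → M →+ M}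
    (hφ : ∀ i l x, φ i (φ l x) = φ l (φ i x)) (u : Finset (Fin n) → M) :
    kos φ (kos φ u) = 0 := by
  funext s
  set Φ : Fin n → Fin n → M := fun i l => if i = l then 0 else
    (ksgn i s * ksgn l (s.erase i)) • φ i (φ l (u ((s.erase i).erase l))) with hΦ
  have h1 : kos φ (kos φ u) s = ∑ i ∈ s, ∑ l ∈ s, Φ i l := by
    rw [kos_apply]
    refine Finset.sum_congr rfl fun i hi => ?_
    rw [kos_apply, map_sum, Finset.smul_sum, ← Finset.add_sum_erase s (Φ i) hi]
    have : Φ i i = 0 := if_pos rfl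
    rw [this, zero_add]
    refine Finset.sum_congr rfl fun l hl => ?_
    have hne : i ≠ l := (Finset.ne_of_mem_erase hl).symm
    simp only [hΦ, if_neg hne]
    rw [map_zsmul, smul_smul]
  have h2 : ∑ i ∈ s, ∑ l ∈ s, Φ i l = -∑ i ∈ s, ∑ l ∈ s, Φ i l := by
    conv_lhs => rw [Finset.sum_comm]
    rw [← Finset.sum_neg_distrib]
    refine Finset.sum_congr rfl fun i hi => ?_
    rw [← Finset.sum_neg_distrib]
    refine Finset.sum_congr rfl fun l hl => ?_
    simp only [hΦ]
    by_cases h : i = l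
    · simp [h]
    · rw [if_neg h, if_neg (Ne.symm h), ksgn_mul_swap hl hi (Ne.symm h), hφ l i,
        Finset.erase_right_comm, neg_smul]
  rw [h1]
  have h3 : (2 : ℂ) • ∑ i ∈ s, ∑ l ∈ s, Φ i l = 0 := by
    rw [two_smul]
    nth_rewrite 1 [h2]
    exact neg_add_cancel _
  exact (smul_eq_zero.1 h3).resolve_left two_ne_zero

/-- The contraction of a Koszul cochain by a basis vector. -/
def kcon (j : Fin n) (u : Finset (Fin n) → M) : Finset (Fin n) → M := fun s =>
  if j ∈ s then 0 else ksgn j s • u (insert j s)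

lemma kcon_kos_add (φ : Fin n → M →+ M) (j : Fin n) (u : Finset (Fin n) → M) :
    kcon j (kos φ u) + kos φ (kcon j u) = fun s => φ j (u s) := by
  funext s
  rw [Pi.add_apply]
  by_cases hj : j ∈ s
  · rw [kcon, if_pos hj, zero_add, kos_apply, Finset.sum_eq_single_of_mem j hj]
    · rw [kcon, if_neg (Finset.notMem_erase j s), Finset.insert_erase hj,
        ksgn_erase_of_le le_rfl, map_zsmul, smul_smul, ksgn_mul_self, one_smul]
    · intro i _ hij
      rw [kcon, if_pos (Finset.mem_erase.2 ⟨hij.symm, hj⟩), map_zero, smul_zero]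
  · rw [kcon, if_neg hj, kos_apply, Finset.sum_insert hj, Finset.erase_insert hj, smul_add,
      smul_smul, kos_apply]
    have e1 : ksgn j (insert j s) = ksgn j s := by
      rw [← ksgn_erase_of_le le_rfl (insert j s), Finset.erase_insert hj]
    rw [e1, ksgn_mul_self, one_smul, add_assoc, add_eq_left, Finset.smul_sum,
      ← Finset.sum_add_distrib]
    refine Finset.sum_eq_zero fun i hi => ?_
    have hij : j ≠ i := fun h => hj (h ▸ hi)
    rw [kcon, if_neg (fun h => hj (Finset.mem_of_mem_erase h)), map_zsmul, smul_smul, smul_smul,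
      Finset.erase_insert_of_ne hij, ← add_smul]
    have h2 := ksgn_mul_swap (Finset.mem_insert_self j s) (Finset.mem_insert_of_mem hi) hij
    have e2 : ksgn j ((insert j s).erase i) = ksgn j (s.erase i) := by
      rw [Finset.erase_insert_of_ne hij, ← ksgn_erase_of_le le_rfl (insert j _),
        Finset.erase_insert (fun h => hj (Finset.mem_of_mem_erase h))]
    rw [Finset.erase_insert hj, e1, e2] at h2
    rcases lt_or_gt_of_ne hij with h | h
    · have e3 : ksgn i (insert j s) = -ksgn i s := by
        have := ksgn_erase_of_lt h (Finset.mem_insert_self j s)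
        rw [Finset.erase_insert hj] at this
        rw [this, neg_neg]
      have e4 : ksgn j (s.erase i) = ksgn j s := ksgn_erase_of_le h.le s
      rw [e3, e4]
      convert zero_smul ℤ _ using 2
      ring
    · have e3 : ksgn i (insert j s) = ksgn i s := by
        have := ksgn_erase_of_le h.le (insert j s)
        rw [Finset.erase_insert hj] at this
        exact this.symm
      have e4 : ksgn j (s.erase i) = -ksgn j s := ksgn_erase_of_lt h hi
      rw [e3, e4]
      convert zero_smul ℤ _ using 2
      ring

end Koszul

end LagFin

namespace LagFin

/-! ### Differential operators with values in an algebra -/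

section DiffOp

variable {ι : Type*} [Fintype ι]

/-- Iterated partial derivatives. -/
noncomputable def dpow (α : ι →₀ ℕ) : Cv ι →ₗ[ℂ] Cv ι :=
  haveI : LeftCommutative (fun a (T : Cv ι →ₗ[ℂ] Cv ι) =>
      ((dd a : Derivation ℂ (Cv ι) (Cv ι)) : Cv ι →ₗ[ℂ] Cv ι) ∘ₗ T) :=
    ⟨fun a b T => LinearMap.ext fun f => dd_comm a b (T f)⟩
  Multiset.foldr (fun a (T : Cv ι →ₗ[ℂ] Cv ι) => ((dd a : Derivation ℂ (Cv ι) (Cv ι)) : Cv ι →ₗ[ℂ] Cv ι) ∘ₗ T)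
    LinearMap.id (Finsupp.toMultiset α)

lemma dpow_zero : dpow (0 : ι →₀ ℕ) = LinearMap.id := by
  simp [dpow]

lemma dpow_single_add (a : ι) (α : ι →₀ ℕ) (f : Cv ι) :
    dpow (Finsupp.single a 1 + α) f = dd a (dpow α f) := by
  rw [dpow, map_add, Finsupp.toMultiset_single, one_smul, Multiset.singleton_add,
    Multiset.foldr_cons]
  rfl

lemma exp_induction {P : (ι →₀ ℕ) → Prop} (h0 : P 0)
    (h1 : ∀ a α, P α → P (Finsupp.single a 1 + α)) (α : ι →₀ ℕ) : P α := by
  rw [← Finsupp.toMultiset_toFinsupp α]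
  induction Finsupp.toMultiset α using Multiset.induction_on with
  | empty => simpa using h0
  | cons a s ih =>
    rw [← Multiset.singleton_add, map_add, Multiset.toFinsupp_singleton]
    exact h1 a _ ih

lemma dpow_dd (a : ι) (α : ι →₀ ℕ) (f : Cv ι) : dpow α (dd a f) = dd a (dpow α f) := by
  induction α using exp_induction with
  | h0 => simp [dpow_zero]
  | h1 b α ih => rw [dpow_single_add, dpow_single_add, ih, dd_comm]

lemma cf_dpow (α : ι →₀ ℕ) : ∀ γ : ι →₀ ℕ, ∃ k : ℂ, k ≠ 0 ∧
    ∀ f : Cv ι, cf γ (dpow α f) = cf (γ + α) f * k := by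
  induction α using exp_induction with
  | h0 => exact fun γ => ⟨1, one_ne_zero, fun f => by simp [dpow_zero]⟩
  | h1 a α ih =>
    intro γ
    obtain ⟨k, hk, h⟩ := ih (γ + Finsupp.single a 1)
    refine ⟨k * (γ a + 1), mul_ne_zero hk (Nat.cast_add_one_ne_zero (γ a)), fun f => ?_⟩
    rw [dpow_single_add, cf_dd, h, add_assoc, mul_assoc]

lemma dpow_mon_eq_zero {α β : ι →₀ ℕ} (h : ¬ α ≤ β) : dpow α (mon β) = 0 := by
  refine Cv_ext fun γ => ?_
  obtain ⟨k, -, hk⟩ := cf_dpow α γ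
  rw [hk, cf_mon, if_neg, zero_mul, map_zero]
  rintro rfl
  exact h le_add_self

lemma dpow_mon_self (β : ι →₀ ℕ) : ∃ k : ℂ, k ≠ 0 ∧ dpow β (mon β) = k • (1 : Cv ι) := by
  obtain ⟨k, hk0, -⟩ := cf_dpow β 0
  obtain ⟨k, hk0, hk⟩ := cf_dpow β 0
  refine ⟨k, hk0, Cv_ext fun γ => ?_⟩
  obtain ⟨k', -, hk'⟩ := cf_dpow β γ
  rw [map_smul, ← mon_zero, cf_mon]
  rcases eq_or_ne γ 0 with rfl | hγ
  · rw [hk, cf_mon]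
    simp
  · rw [hk', cf_mon, if_neg, if_neg hγ]
    · simp
    · intro h
      exact hγ (by simpa using h)

/-- Linear maps from convergent power series to `B`. -/
def VV (ι B : Type*) [Fintype ι] [CommRing B] [Algebra ℂ B] : Type _ := Cv ι →ₗ[ℂ] B

variable {B : Type*} [CommRing B] [Algebra ℂ B]

noncomputable instance : AddCommGroup (VV ι B) :=
  inferInstanceAs (AddCommGroup (Cv ι →ₗ[ℂ] B))

noncomputable instance : Module ℂ (VV ι B) :=
  inferInstanceAs (Module ℂ (Cv ι →ₗ[ℂ] B))

/-- Evaluation of an element of `VV ι B`. -/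
def VV.app (u : VV ι B) : Cv ι →ₗ[ℂ] B := u

lemma VV.ext {u v : VV ι B} (h : ∀ f, u.app f = v.app f) : u = v := LinearMap.ext h

@[simp] lemma VV.app_add (u v : VV ι B) (f : Cv ι) : (u + v).app f = u.app f + v.app f := rfl

@[simp] lemma VV.app_zero (f : Cv ι) : (0 : VV ι B).app f = 0 := rfl

@[simp] lemma VV.app_neg (u : VV ι B) (f : Cv ι) : (-u).app f = -u.app f := rfl

@[simp] lemma VV.app_sub (u v : VV ι B) (f : Cv ι) : (u - v).app f = u.app f - v.app f := rfl

/-- Precomposition with multiplication operators. -/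
noncomputable instance : Module (Cv ι) (VV ι B) where
  smul r u := (VV.app u) ∘ₗ LinearMap.mulLeft ℂ r
  one_smul u := VV.ext fun f => congrArg u.app (one_mul f)
  mul_smul r s u := VV.ext fun f => congrArg u.app (by
    change r * s * f = s * (r * f)
    ring)
  smul_zero r := rfl
  smul_add r u v := rfl
  add_smul r s u := VV.ext fun f => by
    change u.app ((r + s) * f) = u.app (r * f) + u.app (s * f)
    rw [add_mul, map_add]
  zero_smul u := VV.ext fun f => by
    change u.app (0 * f) = 0
    rw [zero_mul, map_zero]

lemma VV.smul_app (r : Cv ι) (u : VV ι B) (f : Cv ι) : (r • u).app f = u.app (r * f) := rfl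

instance : IsScalarTower ℂ (Cv ι) (VV ι B) := ⟨fun c r u => VV.ext fun f => by
  change u.app (c • r * f) = c • u.app (r * f)
  rw [smul_mul_assoc, map_smul]⟩

/-- Precomposition with a partial derivative. -/
noncomputable def theta (a : ι) : VV ι B →ₗ[ℂ] VV ι B where
  toFun u := u.app ∘ₗ ((dd a : Derivation ℂ (Cv ι) (Cv ι)) : Cv ι →ₗ[ℂ] Cv ι)
  map_add' _ _ := rfl
  map_smul' _ _ := rfl

lemma theta_app (a : ι) (u : VV ι B) (f : Cv ι) : (theta a u).app f = u.app (dd a f) := rfl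

lemma smul_theta (a : ι) (r : Cv ι) (u : VV ι B) :
    r • theta a u = dd a r • u + theta a (r • u) := VV.ext fun f => by
  rw [VV.smul_app, theta_app, VV.app_add, VV.smul_app, theta_app, VV.smul_app,
    Derivation.leibniz, map_add, add_comm, smul_eq_mul, smul_eq_mul, mul_comm f]

/-- Precomposition with a restriction. -/
noncomputable def res (I : Set ι) : VV ι B →ₗ[ℂ] VV ι B where
  toFun u := u.app ∘ₗ (rho I).toLinearMap
  map_add' _ _ := rfl
  map_smul' _ _ := rfl

lemma res_app (I : Set ι) (u : VV ι B) (f : Cv ι) : (res I u).app f = u.app (rho I f) := rfl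

lemma rho_rho_of_superset {I I' : Set ι} (h : I ⊆ I') (f : Cv ι) :
    rho I' (rho I f) = rho I f :=
  rho_of_mem (Rs_mono h (rho_mem I f))

lemma res_res {I I' : Set ι} (h : I ⊆ I') (u : VV ι B) : res I (res I' u) = res I u :=
  VV.ext fun f => by rw [res_app, res_app, rho_rho_of_superset h, res_app]

lemma smul_res (I : Set ι) (r : Cv ι) (u : VV ι B) : r • res I u = res I (rho I r • u) :=
  VV.ext fun f => by
    rw [VV.smul_app, res_app, res_app, VV.smul_app, map_mul]

lemma res_smul_of_mem {I : Set ι} {r : Cv ι} (hr : r ∈ Rs I) (u : VV ι B) :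
    res I (r • u) = r • res I u := by
  rw [smul_res, rho_of_mem hr]

lemma theta_res {I : Set ι} {a : ι} (ha : a ∈ I) (u : VV ι B) :
    theta a (res I u) = res I (theta a u) := VV.ext fun f => by
  rw [theta_app, res_app, res_app, theta_app, dd_rho ha]

variable (π : Cv ι →ₐ[ℂ] B)

/-- The action of operators on differential operators along an exponent. -/
noncomputable def ev :
    MvPolynomial ι B →ₗ[B] (Cv ι →ₗ[ℂ] B) :=
  (MvPolynomial.basisMonomials ι B).constr B
    fun α => π.toLinearMap ∘ₗ dpow α

/-- The differential operator with symbol `p`. -/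
noncomputable def evV : MvPolynomial ι B →+ VV ι B := (ev π).toAddMonoidHom

lemma evV_monomial_app (α : ι →₀ ℕ) (b : B) (f : Cv ι) :
    (evV π (MvPolynomial.monomial α b)).app f = b * π (dpow α f) := by
  have : MvPolynomial.monomial α b = b • (MvPolynomial.basisMonomials ι B) α := by
    rw [MvPolynomial.coe_basisMonomials, MvPolynomial.smul_monomial, smul_eq_mul, mul_one]
  change ev π (MvPolynomial.monomial α b) f = _
  rw [this, map_smul, ev, Module.Basis.constr_basis]
  rfl

lemma evV_app (p : MvPolynomial ι B) (f : Cv ι) :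
    (evV π p).app f = ∑ α ∈ p.support, p.coeff α * π (dpow α f) := by
  conv_lhs => rw [p.as_sum, map_sum]
  have : ∀ (s : Finset (ι →₀ ℕ)) (u : (ι →₀ ℕ) → VV ι B),
      (∑ α ∈ s, u α).app f = ∑ α ∈ s, (u α).app f := fun s u =>
    LinearMap.sum_apply s _ f
  rw [this]
  exact Finset.sum_congr rfl fun α _ => evV_monomial_app _ _ _ _

/-- Polynomials whose exponents lie in a given set. -/
def Pol {R : Type*} [CommRing R] (S : Set (ι →₀ ℕ)) : Submodule R (MvPolynomial ι R) where
  carrier := {p | ∀ β, p.coeff β ≠ 0 → β ∈ S}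
  zero_mem' β h := absurd (MvPolynomial.coeff_zero β) h
  add_mem' {p q} hp hq β h := by
    by_cases h1 : p.coeff β = 0
    · refine hq β fun h2 => h ?_
      rw [MvPolynomial.coeff_add, h1, h2, add_zero]
    · exact hp β h1
  smul_mem' b p hp β h := hp β fun h1 => h (by rw [MvPolynomial.coeff_smul, h1, smul_zero])

section Pol

variable {R : Type*} [CommRing R]

lemma mem_Pol {S : Set (ι →₀ ℕ)} {p : MvPolynomial ι R} :
    p ∈ Pol (R := R) S ↔ ∀ β, p.coeff β ≠ 0 → β ∈ S := Iff.rfl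

lemma coeff_eq_zero_of_mem_Pol {S : Set (ι →₀ ℕ)} {p : MvPolynomial ι R} (hp : p ∈ Pol (R := R) S)
    {β : ι →₀ ℕ} (hβ : β ∉ S) : p.coeff β = 0 := by
  by_contra h
  exact hβ (hp β h)

lemma monomial_mem_Pol {S : Set (ι →₀ ℕ)} {α : ι →₀ ℕ} (h : α ∈ S) (b : R) :
    MvPolynomial.monomial α b ∈ Pol (R := R) S := by
  intro β hβ
  rw [MvPolynomial.coeff_monomial] at hβ
  split_ifs at hβ with h1
  · exact h1 ▸ h
  · exact absurd rfl hβ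

lemma Pol_mono {S S' : Set (ι →₀ ℕ)} (h : S ⊆ S') : Pol (R := R) S ≤ Pol S' :=
  fun _ hp β hβ => h (hp β hβ)

lemma Pol_induction {S : Set (ι →₀ ℕ)} {P : MvPolynomial ι R → Prop} (h0 : P 0)
    (hadd : ∀ p q, P p → P q → P (p + q))
    (hm : ∀ α ∈ S, ∀ b : R, P (MvPolynomial.monomial α b)) {p : MvPolynomial ι R}
    (hp : p ∈ Pol (R := R) S) : P p := by
  rw [p.as_sum]
  refine Finset.sum_induction _ P hadd h0 fun α hα => hm α ?_ _
  exact hp α (MvPolynomial.mem_support_iff.1 hα)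

lemma X_mul_mem_Pol {S S' : Set (ι →₀ ℕ)} {a : ι} (h : ∀ α ∈ S, Finsupp.single a 1 + α ∈ S')
    {p : MvPolynomial ι R} (hp : p ∈ Pol (R := R) S) : MvPolynomial.X a * p ∈ Pol (R := R) S' := by
  refine Pol_induction (P := fun p => MvPolynomial.X a * p ∈ Pol (R := R) S') ?_ ?_ ?_ hp
  · simp
  · intro p q h1 h2
    rw [mul_add]
    exact add_mem h1 h2
  · intro α hα b
    rw [MvPolynomial.X, MvPolynomial.monomial_mul]
    exact monomial_mem_Pol (h α hα) _

lemma C_mul_mem_Pol {S : Set (ι →₀ ℕ)} (b : R) {p : MvPolynomial ι R} (hp : p ∈ Pol (R := R) S) :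
    MvPolynomial.C b * p ∈ Pol (R := R) S := by
  rw [← MvPolynomial.smul_eq_C_mul]
  exact Submodule.smul_mem _ _ hp

lemma Pol_fg {S : Set (ι →₀ ℕ)} (hS : S.Finite) : (Pol (R := R) S).FG := by
  refine ⟨hS.toFinset.image fun α => MvPolynomial.monomial α 1, le_antisymm ?_ ?_⟩
  · rw [Submodule.span_le]
    intro p hp
    obtain ⟨α, hα, rfl⟩ := Finset.mem_image.1 (Finset.mem_coe.1 hp)
    exact monomial_mem_Pol (hS.mem_toFinset.1 hα) _
  · intro p hp
    refine Pol_induction (P := fun p => p ∈ Submodule.span R _) (zero_mem _)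
      (fun p q h1 h2 => add_mem h1 h2) (fun α hα b => ?_) hp
    · have : MvPolynomial.monomial α b = b • MvPolynomial.monomial α (1 : R) := by
        rw [MvPolynomial.smul_monomial, smul_eq_mul, mul_one]
      rw [this]
      exact Submodule.smul_mem _ _ (Submodule.subset_span
        (Finset.mem_coe.2 (Finset.mem_image_of_mem _ (hS.mem_toFinset.2 hα))))

end Pol

lemma evV_X_mul (a : ι) (p : MvPolynomial ι B) :
    evV π (MvPolynomial.X a * p) = theta a (evV π p) := by
  induction p using MvPolynomial.induction_on' with
  | monomial α b =>
    refine VV.ext fun f => ?_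
    rw [MvPolynomial.X, MvPolynomial.monomial_mul, one_mul, evV_monomial_app, theta_app,
      evV_monomial_app, dpow_single_add, dpow_dd]
  | add p q hp hq => rw [mul_add, map_add, hp, hq, map_add, map_add]

lemma eq_zero_of_res_evV π {T I : Set ι} (hTI : T ⊆ I) {p : MvPolynomial ι B}
    (hp : p ∈ Pol (R := B) (expOn T)) (h : res I (evV π p) = 0) : p = 0 := by
  refine MvPolynomial.ext _ _ fun β => ?_
  rw [MvPolynomial.coeff_zero]
  induction β using WellFoundedLT.induction with
  | _ β ih =>
    by_cases hβ : β ∈ expOn T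
    · have h1 : (evV π p).app (mon β) = 0 := by
        have := congrArg (fun u : VV ι B => u.app (mon β)) h
        simp only [res_app, VV.app_zero] at this
        rwa [rho_of_mem (mon_mem_Rs (expOn_mono hTI hβ))] at this
      obtain ⟨k, hk, hk'⟩ := dpow_mon_self β
      rw [evV_app] at h1
      have h2 : ∑ α ∈ p.support, p.coeff α * π (dpow α (mon β)) =
          p.coeff β * π (dpow β (mon β)) := by
        refine Finset.sum_eq_single β (fun α hα hne => ?_) (fun hβ' => ?_)
        · by_cases hle : α ≤ β
          · rw [ih α (lt_of_le_of_ne hle hne), zero_mul]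
          · rw [dpow_mon_eq_zero hle, map_zero, mul_zero]
        · rw [MvPolynomial.notMem_support_iff.1 hβ', zero_mul]
      rw [h2, hk'] at h1
      have h3 : π (k • (1 : Cv ι)) = k • 1 := by rw [map_smul, map_one]
      rw [h3, mul_smul_comm, mul_one] at h1
      exact (smul_eq_zero.1 h1).resolve_left hk
    · exact coeff_eq_zero_of_mem_Pol hp hβ

lemma smul_evV_monomial (α : ι →₀ ℕ) : ∀ (r : Cv ι) (b : B),
    ∃ q ∈ Pol (R := B) {β | β < α}, r • evV π (MvPolynomial.monomial α b) =
      evV π (MvPolynomial.monomial α (π r * b) + q) := by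
  induction α using exp_induction with
  | h0 =>
    refine fun r b => ⟨0, zero_mem _, VV.ext fun f => ?_⟩
    rw [add_zero, VV.smul_app, evV_monomial_app, evV_monomial_app, dpow_zero, LinearMap.id_apply,
      LinearMap.id_apply, map_mul]
    ring
  | h1 a α ih =>
    intro r b
    have hX : ∀ b : B, MvPolynomial.monomial (Finsupp.single a 1 + α) b =
        MvPolynomial.X a * MvPolynomial.monomial α b := fun b => by
      rw [MvPolynomial.X, MvPolynomial.monomial_mul, one_mul]
    obtain ⟨q, hq, h⟩ := ih r b
    obtain ⟨q', hq', h'⟩ := ih (dd a r) b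
    have hlt : α < Finsupp.single a 1 + α := by
      refine lt_of_le_of_ne le_add_self fun h => ?_
      have := congrArg (fun β : ι →₀ ℕ => β a) h
      simp at this
    refine ⟨MvPolynomial.monomial α (π (dd a r) * b) + q' +
      MvPolynomial.X a * q, add_mem (add_mem (monomial_mem_Pol hlt _)
        (Pol_mono (fun β hβ => lt_trans hβ hlt) hq')) (X_mul_mem_Pol (fun β hβ => ?_) hq), ?_⟩
    · have hβ' : β < α := hβ
      exact add_lt_add_of_le_of_lt le_rfl hβ'
    · rw [hX, evV_X_mul, smul_theta, h, h', ← evV_X_mul, ← map_add, hX]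
      congr 1
      ring

end DiffOp

end LagFin

namespace LagFin

/-! ### Finiteness of homology along a one-variable extension -/

section Homology

variable {S R : Type*} [CommRing S] [CommRing R] [Algebra S R]

lemma exists_fg_map_eq {X Y : Type*} [AddCommGroup X] [Module S X] [AddCommGroup Y]
    [Module S Y] (f : X →ₗ[S] Y) (N : Submodule S X) (hf : (N.map f).FG) :
    ∃ X₀ : Submodule S X, X₀.FG ∧ X₀ ≤ N ∧ X₀.map f = N.map f := by
  obtain ⟨s, hs⟩ := hf
  have hs' : ∀ z ∈ s, ∃ x ∈ N, f x = z := fun z hz => by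
    have : z ∈ N.map f := hs ▸ Submodule.subset_span hz
    exact this
  choose! p hpN hp using hs'
  refine ⟨Submodule.span S (s.image p : Finset X), ⟨_, rfl⟩, ?_, ?_⟩
  · rw [Submodule.span_le]
    intro x hx
    obtain ⟨z, hz, rfl⟩ := Finset.mem_image.1 (Finset.mem_coe.1 hx)
    exact hpN z hz
  · rw [Submodule.map_span, ← hs]
    congr 1
    ext z
    simp only [Finset.coe_image, Set.mem_image, Finset.mem_coe]
    constructor
    · rintro ⟨_, ⟨y, hy, rfl⟩, rfl⟩
      rwa [hp y hy]
    · exact fun hz => ⟨_, ⟨z, hz, rfl⟩, hp z hz⟩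

lemma fg_of_le_fg [IsNoetherianRing S] {X : Type*} [AddCommGroup X] [Module S X]
    {N G : Submodule S X} (hG : G.FG) (h : N ≤ G) : N.FG := by
  have : Module.Finite S G := Module.Finite.iff_fg.2 hG
  have : IsNoetherian S G := isNoetherian_of_isNoetherianRing_of_finite S G
  have h1 := IsNoetherian.noetherian (N.comap G.subtype)
  have h2 := h1.map G.subtype
  rwa [Submodule.map_comap_subtype, inf_eq_right.2 h] at h2

lemma finite_of_injective_of_range_le [IsNoetherianRing S] {X Y : Type*} [AddCommGroup X]
    [Module S X] [AddCommGroup Y] [Module S Y] (f : X →ₗ[S] Y) (hf : Function.Injective f)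
    {G : Submodule S Y} (hG : G.FG) (h : LinearMap.range f ≤ G) : Module.Finite S X := by
  have h1 := fg_of_le_fg hG h
  have : Module.Finite S (LinearMap.range f) := Module.Finite.iff_fg.2 h1
  exact Module.Finite.equiv (LinearEquiv.ofInjective f hf).symm

lemma cokFin_of_ker_le [IsNoetherianRing S] {A X Y : Type*} [AddCommGroup A]
    [AddCommGroup X] [Module S X] [AddCommGroup Y] [Module S Y] (i : A → X) (f : X →ₗ[S] Y)
    (hf : ∀ x, f x = 0 → ∃ a, i a = x) {G : Submodule S Y} (hG : G.FG)
    (h : LinearMap.range f ≤ G) : CokFin S i := by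
  have h1 := fg_of_le_fg hG h
  rw [LinearMap.range_eq_map] at h1
  obtain ⟨X₀, hX, -, h2⟩ := exists_fg_map_eq f ⊤ h1
  refine ⟨X₀, hX, fun x => ?_⟩
  have h3 : f x ∈ X₀.map f := h2 ▸ Submodule.mem_map_of_mem trivial
  obtain ⟨g, hg, hgx⟩ := h3
  obtain ⟨a, ha⟩ := hf (x - g) (by rw [map_sub, hgx, sub_self])
  exact ⟨g, hg, a, by rw [ha]; abel⟩

variable {M : Type*} [AddCommGroup M] [Module R M] [Module S M] [IsScalarTower S R M]

/-- The homology of `K` with respect to `δ` is finitely generated over `S`. -/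
def HFin (S : Type*) [CommRing S] {M : Type*} [AddCommGroup M] [Module S M]
    {R : Type*} [CommRing R] [Module R M] (K : Submodule R M) (δ : M →ₗ[R] M) : Prop :=
  ∃ G : Submodule S M, G.FG ∧ ∀ z ∈ K, δ z = 0 → ∃ g ∈ G, ∃ w ∈ K, z = g + δ w

/-- The homology of the quotient of `K'` by `K` is finitely generated over `S`. -/
def RelFin (S : Type*) [CommRing S] {M : Type*} [AddCommGroup M] [Module S M]
    {R : Type*} [CommRing R] [Module R M] (K K' : Submodule R M) (δ : M →ₗ[R] M) : Prop :=
  ∃ G : Submodule S M, G.FG ∧ ∀ z ∈ K', δ z ∈ K →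
    ∃ g ∈ G, ∃ k ∈ K, ∃ w ∈ K', z = g + k + δ w

/-- Cycles. -/
abbrev Zc (K : Submodule R M) (δ : M →ₗ[R] M) : Submodule R M := K ⊓ LinearMap.ker δ

/-- Boundaries inside the cycles. -/
abbrev Wc (K : Submodule R M) (δ : M →ₗ[R] M) : Submodule R (Zc K δ) :=
  (K.map δ).comap (Zc K δ).subtype

/-- Homology. -/
abbrev Hm (K : Submodule R M) (δ : M →ₗ[R] M) : Type _ := Zc K δ ⧸ Wc K δ

lemma HFin.finite [IsNoetherianRing S] {K : Submodule R M} {δ : M →ₗ[R] M} (h : HFin S K δ) :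
    Module.Finite S (Hm K δ) := by
  obtain ⟨G, hG, h⟩ := h
  set f : Hm K δ →ₗ[R] M ⧸ K.map δ := Submodule.mapQ _ _ (Zc K δ).subtype le_rfl with hf
  refine finite_of_injective_of_range_le (f.restrictScalars S) ?_
    (hG.map ((K.map δ).mkQ.restrictScalars S)) ?_
  · change Function.Injective f
    rw [← LinearMap.ker_eq_bot, hf, Submodule.ker_mapQ]
    exact Submodule.mkQ_map_self _
  · rintro _ ⟨x, rfl⟩
    obtain ⟨⟨z, hzK, hzδ⟩, rfl⟩ := Submodule.mkQ_surjective _ x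
    obtain ⟨g, hg, w, hw, rfl⟩ := h z hzK hzδ
    refine ⟨g, hg, ?_⟩
    change Submodule.Quotient.mk g = (Submodule.Quotient.mk (g + δ w) : M ⧸ K.map δ)
    rw [eq_comm, Submodule.Quotient.eq]
    exact ⟨w, hw, by abel⟩

variable {y : R} {D : Derivation S R R}

set_option maxHeartbeats 1000000 in
theorem IsOneVar.relFin_of_leibniz (h : IsOneVar y D) {K K' : Submodule R M} {δ : M →ₗ[R] M}
    (hKK' : K ≤ K') (hδK : ∀ u ∈ K, δ u ∈ K) (hδK' : ∀ u ∈ K', δ u ∈ K')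
    (hK : HFin R K δ) (hK' : HFin R K' δ) (hrel : RelFin S K K' δ)
    (hδδ : ∀ u, δ (δ u) = 0)
    (θ : M →ₗ[S] M) (hθK : ∀ u ∈ K, θ u ∈ K') (hθδ : ∀ u, θ (δ u) = δ (θ u))
    (hθ : ∀ (r : R) u, θ (r • u) = r • θ u - D r • u) (hinj : ∀ u ∈ K, θ u = 0 → u = 0) :
    ∃ G : Submodule S M, G.FG ∧ (∀ g ∈ G, g ∈ K') ∧ ∀ z ∈ K', (∃ k ∈ K, δ z = θ k) →
      ∃ g ∈ G, ∃ k ∈ K, ∃ w ∈ K', z = g + θ k + δ w := by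
  have := h.noethS
  have := h.noethR
  have : Module.Finite R (Hm K δ) := hK.finite
  have : Module.Finite R (Hm K' δ) := hK'.finite
  have hZ : Zc K δ ≤ Zc K' δ := inf_le_inf_right _ hKK'
  set i : Hm K δ →ₗ[R] Hm K' δ := Submodule.mapQ _ _ (Submodule.inclusion hZ) (by
    rintro ⟨x, hx⟩ ⟨w, hw, hwx⟩
    exact ⟨w, hKK' hw, hwx⟩) with hi
  obtain ⟨G, hG, hrel⟩ := hrel
  have hiC : CokFin S i := by
    set P : Submodule R M := K ⊔ K'.map δ
    set f : Hm K' δ →ₗ[R] M ⧸ P := Submodule.mapQ _ _ (Zc K' δ).subtype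
      (Submodule.comap_mono le_sup_right) with hf
    refine cokFin_of_ker_le i (f.restrictScalars S) ?_ (hG.map (P.mkQ.restrictScalars S)) ?_
    · intro x hx
      obtain ⟨⟨z, hzK, hzδ⟩, rfl⟩ := Submodule.mkQ_surjective _ x
      have hx' : (Submodule.Quotient.mk z : M ⧸ P) = 0 := hx
      rw [Submodule.Quotient.mk_eq_zero] at hx'
      obtain ⟨k, hk, _, ⟨w, hw, rfl⟩, hkz⟩ := Submodule.mem_sup.1 hx'
      have hδk : δ k = 0 := by
        have : k = z - δ w := by rw [← hkz]; abel
        rw [this, map_sub, hδδ, sub_zero]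
        exact hzδ
      refine ⟨Submodule.Quotient.mk ⟨k, hk, hδk⟩, ?_⟩
      change Submodule.Quotient.mk _ = (Submodule.Quotient.mk _ : Hm K' δ)
      rw [Submodule.Quotient.eq]
      refine ⟨-w, neg_mem hw, ?_⟩
      change δ (-w) = k - z
      rw [map_neg, ← hkz]
      abel
    · rintro _ ⟨x, rfl⟩
      obtain ⟨⟨z, hzK, hzδ⟩, rfl⟩ := Submodule.mkQ_surjective _ x
      have h0 : δ z = 0 := hzδ
      obtain ⟨g, hg, k, hk, w, hw, rfl⟩ := hrel z hzK (h0 ▸ zero_mem K)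
      refine ⟨g, hg, ?_⟩
      change Submodule.Quotient.mk g = (Submodule.Quotient.mk (g + k + δ w) : M ⧸ P)
      rw [eq_comm, Submodule.Quotient.eq]
      have h2 : g + k + δ w - g = k + δ w := by abel
      rw [h2]
      exact Submodule.add_mem_sup hk ⟨w, hw, rfl⟩
  have hik : ((LinearMap.ker i).restrictScalars S).FG := by
    set N : Submodule S M := G ⊓ (K'.restrictScalars S ⊓ (K.comap δ).restrictScalars S) with hN
    have hNfg : N.FG := fg_of_le_fg hG inf_le_left
    have hNK : ∀ x : N, δ x ∈ Zc K δ := fun x => ⟨x.2.2.2, hδδ _⟩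
    set q : N →ₗ[S] Hm K δ := (Wc K δ).mkQ.restrictScalars S ∘ₗ
      { toFun := fun x => (⟨δ x, hNK x⟩ : Zc K δ)
        map_add' := fun a b => Subtype.ext (by simp)
        map_smul' := fun a b => Subtype.ext ((δ.restrictScalars S).map_smul a (b : M)) } with hq
    have : Module.Finite S N := Module.Finite.iff_fg.2 hNfg
    have hle : (LinearMap.ker i).restrictScalars S ≤ LinearMap.range q := by
      intro x hx
      obtain ⟨⟨k, hkK, hkδ⟩, rfl⟩ := Submodule.mkQ_surjective _ x
      have hx' : (Submodule.Quotient.mk (Submodule.inclusion hZ ⟨k, hkK, hkδ⟩) : Hm K' δ) = 0 := hx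
      rw [Submodule.Quotient.mk_eq_zero] at hx'
      obtain ⟨w, hw, hwk⟩ := hx'
      have hwk' : δ w = k := hwk
      obtain ⟨g, hg, k', hk', w', hw', hsum⟩ := hrel w hw (hwk' ▸ hkK)
      have hgw : g = w - k' - δ w' := by rw [hsum]; abel
      have hδg : δ g = k - δ k' := by rw [hgw, map_sub, map_sub, hδδ, sub_zero, hwk']
      have hgN : g ∈ N := ⟨hg, by
        change g ∈ K'
        rw [hgw]
        exact sub_mem (sub_mem hw (hKK' hk')) (hδK' _ hw'), by
        change δ g ∈ K
        rw [hδg]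
        exact sub_mem hkK (hδK _ hk')⟩
      refine ⟨⟨g, hgN⟩, ?_⟩
      change Submodule.Quotient.mk _ = (Submodule.Quotient.mk _ : Hm K δ)
      rw [Submodule.Quotient.eq]
      refine ⟨-k', neg_mem hk', ?_⟩
      change δ (-k') = δ g - k
      rw [hδg, map_neg]
      abel
    exact fg_of_le_fg (by rw [LinearMap.range_eq_map]; exact Module.Finite.fg_top.map q) hle
  -- the map on homology induced by `-θ`
  have hθZ : ∀ x : Zc K δ, θ x ∈ Zc K' δ := fun x =>
    ⟨hθK _ x.2.1, by
      have : δ x = 0 := x.2.2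
      change δ (θ x) = 0
      rw [← hθδ, this, map_zero]⟩
  set d₀ : Zc K δ →ₗ[S] Hm K' δ := (Wc K' δ).mkQ.restrictScalars S ∘ₗ
      { toFun := fun x => (⟨-θ x, neg_mem (hθZ x)⟩ : Zc K' δ)
        map_add' := fun a b => Subtype.ext (by simp; abel)
        map_smul' := fun a b => Subtype.ext (by simp) } with hd₀
  set d : Hm K δ →ₗ[S] Hm K' δ :=
    (((Wc K δ).restrictScalars S).liftQ d₀ (by
      rintro x ⟨w, hw, hwx⟩
      have hwx' : δ w = x := hwx
      rw [LinearMap.mem_ker]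
      change (Submodule.Quotient.mk _ : Hm K' δ) = 0
      rw [Submodule.Quotient.mk_eq_zero]
      refine ⟨-θ w, neg_mem (hθK _ hw), ?_⟩
      change δ (-θ w) = -θ x
      rw [map_neg, ← hθδ, hwx'])) ∘ₗ
    (Submodule.Quotient.restrictScalarsEquiv S (Wc K δ)).symm.toLinearMap with hd
  have hd_mk : ∀ x : Zc K δ, d (Submodule.Quotient.mk x) =
      (Submodule.Quotient.mk ⟨-θ x, neg_mem (hθZ x)⟩ : Hm K' δ) := fun x => rfl
  have hleib : ∀ (r : R) a, d (r • a) = D r • i a + r • d a := by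
    intro r a
    obtain ⟨x, rfl⟩ := Submodule.mkQ_surjective _ a
    change d (Submodule.Quotient.mk (r • x)) = D r • (Submodule.Quotient.mk _ : Hm K' δ) +
      r • d (Submodule.Quotient.mk x)
    rw [hd_mk, hd_mk, ← Submodule.Quotient.mk_smul, ← Submodule.Quotient.mk_smul,
      ← Submodule.Quotient.mk_add]
    congr 1
    apply Subtype.ext
    change -θ (r • (x : M)) = D r • (x : M) + r • -θ (x : M)
    rw [hθ, smul_neg]
    abel
  obtain ⟨G₁, hG₁, hcok⟩ := h.cokFin_of_leibniz i hiC d hleib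
  have hker := h.fg_ker_of_leibniz i hiC hik d hleib
  -- lift generators of the cokernel
  have hsurj : Function.Surjective ((Wc K' δ).mkQ.restrictScalars S) :=
    Submodule.mkQ_surjective (Wc K' δ)
  have hG₁' : ∃ G₂ : Submodule S (Zc K' δ), G₂.FG ∧
      G₂.map ((Wc K' δ).mkQ.restrictScalars S) = G₁ := by
    obtain ⟨G₂, h1, -, h2⟩ := exists_fg_map_eq ((Wc K' δ).mkQ.restrictScalars S)
      (G₁.comap ((Wc K' δ).mkQ.restrictScalars S)) (by
        rw [Submodule.map_comap_eq_of_surjective hsurj]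
        exact hG₁)
    exact ⟨G₂, h1, h2.trans (Submodule.map_comap_eq_of_surjective hsurj _)⟩
  obtain ⟨G₂, hG₂, hG₂'⟩ := hG₁'
  -- lift generators of the kernel
  obtain ⟨t, ht⟩ := hker
  have hlift : ∀ a ∈ LinearMap.ker d, ∃ z ∈ K', ∃ k : Zc K δ,
      Submodule.Quotient.mk k = a ∧ δ z = θ k := by
    intro a ha
    obtain ⟨x, rfl⟩ := Submodule.mkQ_surjective _ a
    have h1 : (Submodule.Quotient.mk ⟨-θ x, neg_mem (hθZ x)⟩ : Hm K' δ) = 0 := ha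
    rw [Submodule.Quotient.mk_eq_zero] at h1
    obtain ⟨w, hw, hwx⟩ := h1
    have hwx' : δ w = -θ x := hwx
    exact ⟨-w, neg_mem hw, x, rfl, by rw [map_neg, hwx', neg_neg]⟩
  choose! Z hZK kk hkk hkk' using hlift
  set G₃ : Submodule S M := Submodule.span S (t.image Z : Finset M) with hG₃
  have hG₃K : ∀ g ∈ G₃, g ∈ K' := by
    have : G₃ ≤ K'.restrictScalars S := by
      rw [hG₃, Submodule.span_le]
      intro x hx
      obtain ⟨a, ha, rfl⟩ := Finset.mem_image.1 (Finset.mem_coe.1 hx)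
      exact hZK a (ht ▸ Submodule.subset_span ha)
    exact this
  have hspan : ∀ a ∈ Submodule.span S (t : Set (Hm K δ)), ∃ z ∈ G₃, ∃ k : Zc K δ,
      Submodule.Quotient.mk k = a ∧ δ z = θ k := by
    intro a ha
    induction ha using Submodule.span_induction with
    | mem a ha =>
      exact ⟨Z a, Submodule.subset_span (Finset.mem_coe.2 (Finset.mem_image_of_mem _ ha)),
        kk a, hkk a (ht ▸ Submodule.subset_span ha), hkk' a (ht ▸ Submodule.subset_span ha)⟩
    | zero => exact ⟨0, zero_mem _, 0, rfl, by simp⟩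
    | add a b _ _ iha ihb =>
      obtain ⟨z, hz, k, rfl, h1⟩ := iha
      obtain ⟨z', hz', k', rfl, h2⟩ := ihb
      exact ⟨z + z', add_mem hz hz', k + k', rfl, by
        rw [map_add, h1, h2, Submodule.coe_add, map_add]⟩
    | smul s a _ iha =>
      obtain ⟨z, hz, k, rfl, h1⟩ := iha
      refine ⟨s • z, Submodule.smul_mem _ _ hz, s • k, rfl, ?_⟩
      have h2 := (δ.restrictScalars S).map_smul s z
      change δ (s • z) = s • δ z at h2
      rw [h2, h1]
      exact (θ.map_smul s (k : M)).symm
  refine ⟨G₃ ⊔ G₂.map ((Zc K' δ).subtype.restrictScalars S),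
    Submodule.FG.sup ⟨_, rfl⟩ (hG₂.map _), ?_, ?_⟩
  · intro g hg
    obtain ⟨a, ha, _, ⟨b, -, rfl⟩, rfl⟩ := Submodule.mem_sup.1 hg
    exact add_mem (hG₃K a ha) b.2.1
  rintro z hz ⟨k, hk, hzk⟩
  have hδk : δ k = 0 := hinj _ (hδK _ hk) (by rw [hθδ, ← hzk, hδδ])
  have hka : (Submodule.Quotient.mk ⟨k, hk, hδk⟩ : Hm K δ) ∈ LinearMap.ker d := by
    rw [LinearMap.mem_ker, hd_mk, Submodule.Quotient.mk_eq_zero]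
    refine ⟨-z, neg_mem hz, ?_⟩
    change δ (-z) = -θ k
    rw [map_neg, hzk]
  obtain ⟨z₁, hz₁, k₁, hk₁, hzk₁⟩ := hspan _ (ht ▸ hka)
  rw [Submodule.Quotient.eq] at hk₁
  obtain ⟨k', hk', hkk₁⟩ := hk₁
  have hkk₂ : δ k' = k₁ - k := hkk₁
  set x := z - z₁ + θ k' with hx
  have hxK : x ∈ K' := add_mem (sub_mem hz (hG₃K _ hz₁)) (hθK _ hk')
  have hδx : δ x = 0 := by
    rw [hx, map_add, map_sub, hzk, hzk₁, ← hθδ, hkk₂, map_sub]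
    abel
  obtain ⟨g, hg, a, hga⟩ := hcok (Submodule.Quotient.mk ⟨x, hxK, hδx⟩)
  obtain ⟨a, rfl⟩ := Submodule.mkQ_surjective _ a
  rw [← hG₂'] at hg
  obtain ⟨g, hg, rfl⟩ := hg
  have hga' : (Submodule.Quotient.mk ⟨x, hxK, hδx⟩ : Hm K' δ) =
      Submodule.Quotient.mk (g + ⟨-θ a, neg_mem (hθZ a)⟩) := hga
  rw [Submodule.Quotient.eq] at hga'
  obtain ⟨w, hw, hwx⟩ := hga'
  have hwx' : δ w = x - (g + -θ a) := hwx
  refine ⟨z₁ + g, Submodule.add_mem_sup hz₁ ⟨g, hg, rfl⟩, -k' - a,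
    sub_mem (neg_mem hk') a.2.1, w, hw, ?_⟩
  rw [hwx', hx, map_sub, map_neg]
  abel

end Homology

end LagFin

namespace LagFin

/-! ### The tower of modules of differential operators -/

section Tower

variable {ι : Type*} [Fintype ι]

/-- Exponents supported in `T` of degree at most `m`. -/
def ex (T : Set ι) (m : ℕ) : Set (ι →₀ ℕ) := {α | α ∈ expOn T ∧ α.degree ≤ m}

lemma ex_finite (T : Set ι) (m : ℕ) : (ex T m).Finite :=
  (Finsupp.finite_of_degree_le m).subset fun _ h => h.2

lemma ex_mono {T T' : Set ι} (h : T ⊆ T') {m m' : ℕ} (hm : m ≤ m') : ex T m ⊆ ex T' m' :=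
  fun _ hα => ⟨expOn_mono h hα.1, hα.2.trans hm⟩

lemma mem_ex_of_le {T : Set ι} {m : ℕ} {α β : ι →₀ ℕ} (hα : α ∈ ex T m) (h : β ≤ α) :
    β ∈ ex T m := by
  obtain ⟨γ, rfl⟩ := exists_add_of_le h
  refine ⟨((add_mem_expOn).1 hα.1).1, le_trans ?_ hα.2⟩
  rw [map_add]
  exact Nat.le_add_right _ _

lemma single_add_mem_ex {T : Set ι} {m : ℕ} {a : ι} (ha : a ∈ T) {α : ι →₀ ℕ}
    (hα : α ∈ ex T m) : Finsupp.single a 1 + α ∈ ex T (m + 1) := by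
  refine ⟨add_mem_expOn.2 ⟨single_mem_expOn ha 1, hα.1⟩, ?_⟩
  · rw [map_add, Finsupp.degree_single, add_comm]
    exact Nat.add_le_add_right hα.2 1

lemma exists_Pol_split {R : Type*} [CommRing R] {T : Set ι} (j : ι) {m : ℕ}
    {p : MvPolynomial ι R} (hp : p ∈ Pol (R := R) (ex (insert j T) m)) :
    ∃ q ∈ Pol (R := R) (ex (insert j T) (m - 1)), ∃ p' ∈ Pol (R := R) (ex T m),
      p = MvPolynomial.X j * q + p' := by
  refine Pol_induction (P := fun p => ∃ q ∈ Pol (R := R) (ex (insert j T) (m - 1)),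
    ∃ p' ∈ Pol (R := R) (ex T m), p = MvPolynomial.X j * q + p') ?_ ?_ ?_ hp
  · exact ⟨0, zero_mem _, 0, zero_mem _, by simp⟩
  · rintro _ _ ⟨q, hq, p', hp', rfl⟩ ⟨r, hr, s, hs, rfl⟩
    exact ⟨q + r, add_mem hq hr, p' + s, add_mem hp' hs, by ring⟩
  · intro α hα b
    by_cases hj : α j = 0
    · have hα' : α ∈ ex T m := ⟨?_, hα.2⟩
      · exact ⟨0, zero_mem _, MvPolynomial.monomial α b, monomial_mem_Pol hα' _, by simp⟩
      rw [mem_expOn]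
      intro i hi
      rcases eq_or_ne i j with rfl | h
      · exact hj
      · exact mem_expOn.1 hα.1 i fun h' => h'.elim h hi
    · have hle : Finsupp.single j 1 ≤ α := Finsupp.single_le_iff.2 (Nat.one_le_iff_ne_zero.2 hj)
      obtain ⟨γ, rfl⟩ := exists_add_of_le hle
      have hγ : γ ∈ ex (insert j T) (m - 1) := by
        refine ⟨(add_mem_expOn.1 hα.1).2, ?_⟩
        have := hα.2
        rw [map_add, Finsupp.degree_single] at this
        omega
      · refine ⟨MvPolynomial.monomial γ b, monomial_mem_Pol hγ _, 0, zero_mem _, ?_⟩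
        rw [MvPolynomial.X, MvPolynomial.monomial_mul, one_mul, add_zero]

variable {B : Type*} [CommRing B] [Algebra ℂ B] (π : Cv ι →ₐ[ℂ] B)

/-- The restriction to `I` of the operator with symbol `p`. -/
noncomputable def op (I : Set ι) : MvPolynomial ι B →+ VV ι B :=
  (res I : VV ι B →ₗ[ℂ] VV ι B).toAddMonoidHom.comp (evV π)

lemma op_eq (I : Set ι) (p : MvPolynomial ι B) : op π I p = res I (evV π p) := rfl

lemma res_op {I I' : Set ι} (h : I ⊆ I') (p : MvPolynomial ι B) :
    res I (op π I' p) = op π I p := res_res h _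

lemma op_X_mul {I : Set ι} {a : ι} (ha : a ∈ I) (p : MvPolynomial ι B) :
    op π I (MvPolynomial.X a * p) = theta a (op π I p) := by
  rw [op_eq, evV_X_mul, op_eq, theta_res ha]

lemma op_X_mul_eq_zero {I : Set ι} {a : ι} (ha : a ∉ I) (p : MvPolynomial ι B) :
    op π I (MvPolynomial.X a * p) = 0 := by
  refine VV.ext fun f => ?_
  rw [op_eq, evV_X_mul, res_app, theta_app, dd_eq_zero ha (rho_mem I f), map_zero, VV.app_zero]

/-- Operators with symbols of degree at most `m` in the directions `T`, restricted to `I`. -/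
noncomputable def DD (T I : Set ι) (m : ℕ) : Submodule (Cv ι) (VV ι B) where
  carrier := {u | ∃ p ∈ Pol (R := B) (ex T m), op π I p = u}
  zero_mem' := ⟨0, zero_mem _, map_zero _⟩
  add_mem' := by
    rintro _ _ ⟨p, hp, rfl⟩ ⟨q, hq, rfl⟩
    exact ⟨p + q, add_mem hp hq, map_add _ _ _⟩
  smul_mem' := by
    rintro r _ ⟨p, hp, rfl⟩
    refine Pol_induction (P := fun p => ∃ q ∈ Pol (R := B) (ex T m), op π I q = r • op π I p)
      ?_ ?_ ?_ hp
    · exact ⟨0, zero_mem _, by simp⟩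
    · rintro p q ⟨p', hp', h1⟩ ⟨q', hq', h2⟩
      exact ⟨p' + q', add_mem hp' hq', by rw [map_add, map_add, smul_add, h1, h2]⟩
    · intro α hα b
      obtain ⟨q, hq, h⟩ := smul_evV_monomial π α (rho I r) b
      exact ⟨_, add_mem (monomial_mem_Pol hα _)
        (Pol_mono (fun β hβ => mem_ex_of_le hα (le_of_lt hβ)) hq), by
          rw [op_eq, op_eq, smul_res, h]⟩

lemma DD_mono {T I : Set ι} {m m' : ℕ} (h : m ≤ m') : DD π T I m ≤ DD π T I m' := by
  rintro _ ⟨p, hp, rfl⟩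
  exact ⟨p, Pol_mono (ex_mono subset_rfl h) hp, rfl⟩

lemma theta_mem_DD {T I : Set ι} {m : ℕ} {a : ι} (haT : a ∈ T) (haI : a ∈ I) {u : VV ι B}
    (hu : u ∈ DD π T I m) : theta a u ∈ DD π T I (m + 1) := by
  obtain ⟨p, hp, rfl⟩ := hu
  exact ⟨_, X_mul_mem_Pol (fun α hα => single_add_mem_ex haT hα) hp, op_X_mul π haI p⟩

lemma theta_injective {I : Set ι} {a : ι} (ha : a ∈ I) {u : VV ι B} (hu : res I u = u)
    (h : theta a u = 0) : u = 0 := by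
  refine VV.ext fun f => ?_
  obtain ⟨g, -, hg⟩ := exists_primitive a ha (rho_mem I f)
  rw [← hu, res_app, ← hg, ← theta_app, h, VV.app_zero, VV.app_zero]

lemma res_of_mem_DD {T I : Set ι} {m : ℕ} {u : VV ι B} (hu : u ∈ DD π T I m) : res I u = u := by
  obtain ⟨p, -, rfl⟩ := hu
  exact res_op π subset_rfl p

lemma exists_res_eq {T T' I I' : Set ι} (hT : T ⊆ T') (hI : I ⊆ I') {m : ℕ} {u : VV ι B}
    (hu : u ∈ DD π T I m) : ∃ v ∈ DD π T' I' m, res I v = u := by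
  obtain ⟨p, hp, rfl⟩ := hu
  exact ⟨op π I' p, ⟨p, Pol_mono (ex_mono hT le_rfl) hp, rfl⟩, res_op π hI p⟩

lemma res_mem_DD {T I : Set ι} {j : ι} (hj : j ∉ I) {m : ℕ} {u : VV ι B}
    (hu : u ∈ DD π (insert j T) (insert j I) m) : res I u ∈ DD π T I m := by
  obtain ⟨p, hp, rfl⟩ := hu
  obtain ⟨q, -, p', hp', rfl⟩ := exists_Pol_split j hp
  exact ⟨p', hp', by
    rw [res_op π (Set.subset_insert _ _), map_add, op_X_mul_eq_zero π hj, zero_add]⟩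

lemma exists_theta_eq {T I : Set ι} (hTI : T ⊆ I) {j : ι} (hj : j ∉ I) {m : ℕ} {u : VV ι B}
    (hu : u ∈ DD π (insert j T) (insert j I) (m + 1)) (h : res I u = 0) :
    ∃ v ∈ DD π (insert j T) (insert j I) m, theta j v = u := by
  obtain ⟨p, hp, rfl⟩ := hu
  obtain ⟨q, hq, p', hp', rfl⟩ := exists_Pol_split j hp
  rw [res_op π (Set.subset_insert _ _), map_add, op_X_mul_eq_zero π hj, zero_add] at h
  have : p' = 0 := eq_zero_of_res_evV π hTI (Pol_mono (fun α hα => hα.1) hp') h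
  refine ⟨op π (insert j I) q, ⟨q, hq, rfl⟩, ?_⟩
  rw [this, add_zero, op_X_mul π (Set.mem_insert _ _)]

/-- Generators of the operators over a ring over which `B` is finite. -/
lemma DD_fg {T I : Set ι} {m : ℕ} (κ : Finset B)
    (hκ : ∀ b : B, ∃ r : B → Cv ι, (∀ l, r l ∈ Rs I) ∧ b = ∑ l ∈ κ, π (r l) * l) :
    ((DD π T I m).restrictScalars (Rs I)).FG := by
  set gen : (ι →₀ ℕ) × B → VV ι B := fun x => op π I (MvPolynomial.monomial x.1 x.2) with hgen
  set Gs : Finset (VV ι B) := ((ex_finite T m).toFinset ×ˢ κ).image gen with hGs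
  refine ⟨Gs, le_antisymm ?_ ?_⟩
  · rw [Submodule.span_le]
    intro u hu
    obtain ⟨⟨α, b⟩, hx, rfl⟩ := Finset.mem_image.1 (Finset.mem_coe.1 hu)
    exact ⟨_, monomial_mem_Pol ((ex_finite T m).mem_toFinset.1 (Finset.mem_product.1 hx).1) b, rfl⟩
  · have key : ∀ α ∈ ex T m, ∀ b : B, op π I (MvPolynomial.monomial α b) ∈
        Submodule.span (Rs I) (Gs : Set (VV ι B)) := by
      intro α
      induction α using WellFoundedLT.induction with
      | _ α ih =>
        intro hα b
        obtain ⟨r, hr, hb⟩ := hκ b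
        rw [hb, map_sum, map_sum]
        refine sum_mem fun l hl => ?_
        obtain ⟨q, hq, h⟩ := smul_evV_monomial π α (r l) l
        have h1 : op π I (MvPolynomial.monomial α (π (r l) * l)) =
            (⟨r l, hr l⟩ : Rs I) • op π I (MvPolynomial.monomial α l) + op π I (-q) := by
          change _ = r l • op π I (MvPolynomial.monomial α l) + op π I (-q)
          rw [op_eq, op_eq, ← res_smul_of_mem (hr l), h, map_add, map_add, map_neg, op_eq]
          abel
        rw [h1]
        refine add_mem (Submodule.smul_mem _ _ (Submodule.subset_span ?_)) ?_
        · exact Finset.mem_coe.2 (Finset.mem_image.2 ⟨(α, l), Finset.mem_product.2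
            ⟨(ex_finite T m).mem_toFinset.2 hα, hl⟩, rfl⟩)
        · refine Pol_induction (P := fun q => op π I q ∈
            Submodule.span (Rs I) (Gs : Set (VV ι B))) ?_ ?_ ?_ (neg_mem hq)
          · rw [map_zero]
            exact zero_mem _
          · intro p q hp hq
            rw [map_add]
            exact add_mem hp hq
          · exact fun β hβ b => ih β hβ (mem_ex_of_le hα (le_of_lt hβ)) b
    rintro _ ⟨p, hp, rfl⟩
    refine Pol_induction (P := fun q => op π I q ∈
        Submodule.span (Rs I) (Gs : Set (VV ι B))) ?_ ?_ key hp
    · rw [map_zero]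
      exact zero_mem _
    · intro p q hp hq
      rw [map_add]
      exact add_mem hp hq

/-- Commuting first order operators on `B`. -/
structure Sys (n : ℕ) where
  /-- The coefficients of the symbols. -/
  c : Fin n → ι → B
  /-- The operators. -/
  X : Fin n → B →ₗ[ℂ] B
  leib : ∀ j b f, X j (b * π f) = X j b * π f + b * ∑ a, c j a * π (dd a f)
  comm : ∀ i j b, X i (X j b) = X j (X i b)

variable {π} {n : ℕ} (Y : Sys π n)

/-- The operators acting by postcomposition. -/
noncomputable def Sys.XV (j : Fin n) : VV ι B →ₗ[Cv ι] VV ι B where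
  toFun u := Y.X j ∘ₗ u.app
  map_add' u v := VV.ext fun f => map_add (Y.X j) (u.app f) (v.app f)
  map_smul' _ _ := rfl

lemma Sys.XV_app (j : Fin n) (u : VV ι B) (f : Cv ι) : (Y.XV j u).app f = Y.X j (u.app f) := rfl

lemma Sys.XV_comm (i j : Fin n) (u : VV ι B) : Y.XV i (Y.XV j u) = Y.XV j (Y.XV i u) :=
  VV.ext fun _ => Y.comm i j _

/-- The symbols. -/
noncomputable def Sys.sym (T : Set ι) (j : Fin n) : MvPolynomial ι B :=
  ∑ a ∈ Finset.univ.filter (· ∈ T), MvPolynomial.C (Y.c j a) * MvPolynomial.X a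

lemma Sys.sym_mul_mem {T : Set ι} {m : ℕ} (j : Fin n) {p : MvPolynomial ι B}
    (hp : p ∈ Pol (R := B) (ex T m)) : Y.sym T j * p ∈ Pol (R := B) (ex T (m + 1)) := by
  rw [Sys.sym, Finset.sum_mul]
  refine sum_mem fun a ha => ?_
  rw [mul_assoc]
  exact C_mul_mem_Pol _ (X_mul_mem_Pol
    (fun α hα => single_add_mem_ex (Finset.mem_filter.1 ha).2 hα) hp)

lemma Sys.XV_op {T I : Set ι} (hI : ∀ a ∈ I, a ∉ T → ∀ j, Y.c j a = 0) {m : ℕ}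
    (j : Fin n) {p : MvPolynomial ι B} (hp : p ∈ Pol (R := B) (ex T m)) :
    ∃ p' ∈ Pol (R := B) (ex T m), Y.XV j (op π I p) = op π I (p' + Y.sym T j * p) := by
  refine Pol_induction (P := fun p => ∃ p' ∈ Pol (R := B) (ex T m),
    Y.XV j (op π I p) = op π I (p' + Y.sym T j * p)) ?_ ?_ ?_ hp
  · exact ⟨0, zero_mem _, by simp⟩
  · rintro p q ⟨p', hp', h1⟩ ⟨q', hq', h2⟩
    refine ⟨p' + q', add_mem hp' hq', ?_⟩
    rw [map_add, map_add, h1, h2, ← map_add]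
    congr 1
    ring
  · intro α hα b
    refine ⟨MvPolynomial.monomial α (Y.X j b), monomial_mem_Pol hα _, VV.ext fun f => ?_⟩
    have h1 : ∀ a ∈ T, op π I (MvPolynomial.C (Y.c j a) * MvPolynomial.X a *
        MvPolynomial.monomial α b) = op π I (MvPolynomial.monomial (Finsupp.single a 1 + α)
          (Y.c j a * b)) := fun a _ => by
      rw [MvPolynomial.X, MvPolynomial.C_mul_monomial, MvPolynomial.monomial_mul, mul_one]
    have happ : ∀ (s : Finset ι) (u : ι → VV ι B),
        (∑ a ∈ s, u a).app f = ∑ a ∈ s, (u a).app f := fun s u => LinearMap.sum_apply s _ f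
    rw [Sys.XV_app, map_add, VV.app_add, op_eq, op_eq, res_app, evV_monomial_app, Y.leib, res_app,
      evV_monomial_app, Sys.sym, Finset.sum_mul, map_sum,
      Finset.sum_congr rfl fun a ha => h1 a (Finset.mem_filter.1 ha).2, happ, Finset.mul_sum]
    congr 1
    rw [Finset.sum_filter]
    refine Finset.sum_congr rfl fun a _ => ?_
    split_ifs with ha
    · rw [op_eq, res_app, evV_monomial_app, dpow_single_add]
      ring
    · by_cases haI : a ∈ I
      · rw [hI a haI ha, zero_mul, mul_zero]
      · rw [← dpow_dd, dd_eq_zero haI (rho_mem I f), map_zero, map_zero, mul_zero, mul_zero]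

lemma Sys.XV_mem {T I : Set ι} (hI : ∀ a ∈ I, a ∉ T → ∀ j, Y.c j a = 0) {m : ℕ}
    (j : Fin n) {u : VV ι B} (hu : u ∈ DD π T I m) : Y.XV j u ∈ DD π T I (m + 1) := by
  obtain ⟨p, hp, rfl⟩ := hu
  obtain ⟨p', hp', h⟩ := Y.XV_op hI j hp
  exact ⟨_, add_mem (Pol_mono (ex_mono subset_rfl (Nat.le_succ m)) hp') (Y.sym_mul_mem j hp),
    h.symm⟩

end Tower

end LagFin

namespace LagFin

/-! ### Symbols of cycles -/

/-- The Koszul differential of a family of linear operators. -/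
def kosL {R : Type*} [CommRing R] {M : Type*} [AddCommGroup M] [Module R M] {n : ℕ}
    (φ : Fin n → M →ₗ[R] M) : (Finset (Fin n) → M) →ₗ[R] (Finset (Fin n) → M) where
  toFun := kos fun j => (φ j).toAddMonoidHom
  map_add' := map_add _
  map_smul' r u := by
    funext s
    rw [kos_apply, RingHom.id_apply, Pi.smul_apply, kos_apply, Finset.smul_sum]
    refine Finset.sum_congr rfl fun i _ => ?_
    rw [Pi.smul_apply]
    change ksgn i s • φ i (r • _) = _
    rw [map_smul, smul_comm]
    rfl

section Symbols

open MvPolynomial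

variable {ι : Type*} [Fintype ι] {B : Type*} [CommRing B] {n : ℕ}

/-- Exponents supported in `T` of degree `m`. -/
def hex (T : Set ι) (m : ℕ) : Set (ι →₀ ℕ) := {α | α ∈ expOn T ∧ α.degree = m}

lemma hex_subset_ex (T : Set ι) (m : ℕ) : hex T m ⊆ ex T m := fun _ h => ⟨h.1, h.2.le⟩

/-- The projection to the polynomials in the variables from `T`. -/
noncomputable def retr (T : Set ι) : MvPolynomial ι B →ₗ[B] MvPolynomial ι B :=
  (basisMonomials ι B).constr B fun α => if α ∈ expOn T then monomial α 1 else 0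

lemma retr_monomial (T : Set ι) (α : ι →₀ ℕ) (b : B) :
    retr T (monomial α b) = if α ∈ expOn T then monomial α b else 0 := by
  have : monomial α b = b • (basisMonomials ι B) α := by
    rw [coe_basisMonomials, smul_monomial, smul_eq_mul, mul_one]
  rw [this, map_smul, retr, Module.Basis.constr_basis, coe_basisMonomials, smul_ite, smul_zero]

lemma retr_of_mem {T : Set ι} {p : MvPolynomial ι B} (hp : p ∈ Pol (R := B) (expOn T)) :
    retr T p = p := by
  refine Pol_induction (P := fun p => retr T p = p) (map_zero _) ?_ ?_ hp
  · intro p q h1 h2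
    rw [map_add, h1, h2]
  · intro α hα b
    rw [retr_monomial, if_pos hα]

lemma retr_mem {T : Set ι} {m : ℕ} {p : MvPolynomial ι B}
    (hp : p ∈ Pol (R := B) {α | α.degree = m}) : retr T p ∈ Pol (R := B) (hex T m) := by
  refine Pol_induction (P := fun p => retr T p ∈ Pol (R := B) (hex T m)) ?_ ?_ ?_ hp
  · rw [map_zero]
    exact zero_mem _
  · intro p q h1 h2
    rw [map_add]
    exact add_mem h1 h2
  · intro α hα b
    rw [retr_monomial]
    split_ifs with h
    · have hα' : α ∈ hex T m := ⟨h, hα⟩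
      exact monomial_mem_Pol hα' _
    · exact zero_mem _

lemma retr_X_mul (T : Set ι) (a : ι) (p : MvPolynomial ι B) :
    retr T (X a * p) = if a ∈ T then X a * retr T p else 0 := by
  induction p using MvPolynomial.induction_on' with
  | monomial α b =>
    rw [X, monomial_mul, one_mul, retr_monomial, retr_monomial, add_mem_expOn]
    by_cases ha : a ∈ T
    · rw [if_pos ha]
      by_cases hα : α ∈ expOn T
      · rw [if_pos ⟨single_mem_expOn ha 1, hα⟩, if_pos hα, monomial_mul, one_mul]
      · rw [if_neg (fun h => hα h.2), if_neg hα, mul_zero]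
    · rw [if_neg ha, if_neg]
      intro h
      have := mem_expOn.1 h.1 a ha
      simp at this
  | add p q hp hq =>
    rw [mul_add, map_add, hp, hq, map_add]
    split_ifs
    · rw [mul_add]
    · rw [add_zero]

lemma homogeneousComponent_succ_X_mul (a : ι) (m : ℕ) (p : MvPolynomial ι B) :
    homogeneousComponent (m + 1) (X a * p) = X a * homogeneousComponent m p := by
  refine MvPolynomial.ext _ _ fun α => ?_
  rw [coeff_homogeneousComponent, coeff_X_mul', coeff_X_mul', coeff_homogeneousComponent]
  by_cases ha : a ∈ α.support
  · have hle : Finsupp.single a 1 ≤ α :=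
      Finsupp.single_le_iff.2 (Nat.one_le_iff_ne_zero.2 (Finsupp.mem_support_iff.1 ha))
    obtain ⟨γ, rfl⟩ := exists_add_of_le hle
    rw [if_pos ha, if_pos ha, add_tsub_cancel_left, map_add, Finsupp.degree_single, add_comm 1]
    simp only [Nat.add_right_cancel_iff]
  · rw [if_neg ha, if_neg ha, ite_self]

lemma homogeneousComponent_mem (m : ℕ) (p : MvPolynomial ι B) :
    homogeneousComponent m p ∈ Pol (R := B) {α : ι →₀ ℕ | α.degree = m} := by
  intro α hα
  rw [coeff_homogeneousComponent] at hα
  by_contra h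
  exact hα (if_neg h)

lemma homogeneousComponent_of_mem_hex {T : Set ι} {m : ℕ} {p : MvPolynomial ι B}
    (hp : p ∈ Pol (R := B) (hex T m)) : homogeneousComponent m p = p := by
  refine MvPolynomial.ext _ _ fun α => ?_
  rw [coeff_homogeneousComponent]
  split_ifs with h
  · rfl
  · exact (coeff_eq_zero_of_mem_Pol hp fun hα => h hα.2).symm

lemma homogeneousComponent_mem_hex {T : Set ι} {m : ℕ} {p : MvPolynomial ι B}
    (hp : p ∈ Pol (R := B) (expOn T)) : homogeneousComponent m p ∈ Pol (R := B) (hex T m) := by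
  rw [← retr_of_mem hp]
  intro α hα
  rw [coeff_homogeneousComponent] at hα
  rw [retr_of_mem hp] at hα
  by_cases h : α.degree = m
  · rw [if_pos h] at hα
    exact ⟨hp α hα, h⟩
  · exact absurd (if_neg h) hα

lemma sub_homogeneousComponent_mem {T : Set ι} {m : ℕ} {p : MvPolynomial ι B}
    (hp : p ∈ Pol (R := B) (ex T (m + 1))) :
    p - homogeneousComponent (m + 1) p ∈ Pol (R := B) (ex T m) := by
  intro α hα
  rw [coeff_sub, coeff_homogeneousComponent] at hα
  split_ifs at hα with h
  · exact absurd (sub_self _) hα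
  · rw [sub_zero] at hα
    have := hp α hα
    exact ⟨this.1, Nat.le_of_lt_succ (lt_of_le_of_ne this.2 h)⟩

lemma eq_zero_of_mem_hex_of_mem_ex {T : Set ι} {m : ℕ} {p : MvPolynomial ι B}
    (hp : p ∈ Pol (R := B) (hex T (m + 1))) (hp' : p ∈ Pol (R := B) (ex T m)) : p = 0 := by
  refine MvPolynomial.ext _ _ fun α => ?_
  rw [coeff_zero]
  by_contra h
  have h1 := (hp α h).2
  have h2 := (hp' α h).2
  omega

lemma exists_constant_add_X_mul (g : MvPolynomial ι B) :
    ∃ (b : B) (q : ι → MvPolynomial ι B), g = C b + ∑ a, X a * q a := by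
  induction g using MvPolynomial.induction_on' with
  | monomial α b =>
    by_cases h : α = 0
    · exact ⟨b, 0, by simp [h]⟩
    · obtain ⟨a, ha⟩ := Finsupp.support_nonempty_iff.2 h
      have hle : Finsupp.single a 1 ≤ α :=
        Finsupp.single_le_iff.2 (Nat.one_le_iff_ne_zero.2 (Finsupp.mem_support_iff.1 ha))
      obtain ⟨γ, rfl⟩ := exists_add_of_le hle
      refine ⟨0, fun i => if i = a then monomial γ b else 0, ?_⟩
      simp only [mul_ite, mul_zero, Finset.sum_ite_eq', Finset.mem_univ, if_true, map_zero,
        zero_add]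
      rw [X, monomial_mul, one_mul]
  | add p q hp hq =>
    obtain ⟨b, u, h1⟩ := hp
    obtain ⟨c, v, h2⟩ := hq
    refine ⟨b + c, fun a => u a + v a, ?_⟩
    rw [h1, h2, map_add]
    simp only [mul_add, Finset.sum_add_distrib]
    ring

/-- The symbols with coefficient matrix `c` in the variables from `T`. -/
noncomputable def symb (c : Fin n → ι → B) (T : Set ι) (j : Fin n) : MvPolynomial ι B :=
  ∑ a ∈ Finset.univ.filter (· ∈ T), C (c j a) * X a

/-- The Koszul differential of the symbols. -/
noncomputable def dsig (c : Fin n → ι → B) (T : Set ι) :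
    (Finset (Fin n) → MvPolynomial ι B) →ₗ[MvPolynomial ι B]
      (Finset (Fin n) → MvPolynomial ι B) :=
  kosL fun j => LinearMap.mulLeft (MvPolynomial ι B) (symb c T j)

variable (c : Fin n → ι → B) (T : Set ι)

lemma dsig_apply (u : Finset (Fin n) → MvPolynomial ι B) (s : Finset (Fin n)) :
    dsig c T u s = ∑ i ∈ s, ksgn i s • (symb c T i * u (s.erase i)) := rfl

lemma retr_symb_mul (j : Fin n) (p : MvPolynomial ι B) :
    retr T (symb c T j * p) = symb c T j * retr T p := by
  rw [symb, Finset.sum_mul, map_sum, Finset.sum_mul]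
  refine Finset.sum_congr rfl fun a ha => ?_
  rw [mul_assoc, mul_assoc, ← smul_eq_C_mul, ← smul_eq_C_mul, map_smul, retr_X_mul,
    if_pos (Finset.mem_filter.1 ha).2]

lemma homogeneousComponent_symb_mul (j : Fin n) (m : ℕ) (p : MvPolynomial ι B) :
    homogeneousComponent (m + 1) (symb c T j * p) = symb c T j * homogeneousComponent m p := by
  rw [symb, Finset.sum_mul, map_sum, Finset.sum_mul]
  refine Finset.sum_congr rfl fun a ha => ?_
  rw [mul_assoc, mul_assoc, ← smul_eq_C_mul, ← smul_eq_C_mul, map_smul,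
    homogeneousComponent_succ_X_mul]

lemma symb_mul_mem_hex {m : ℕ} (j : Fin n) {p : MvPolynomial ι B}
    (hp : p ∈ Pol (R := B) (hex T m)) : symb c T j * p ∈ Pol (R := B) (hex T (m + 1)) := by
  rw [symb, Finset.sum_mul]
  refine sum_mem fun a ha => ?_
  rw [mul_assoc]
  have key : ∀ α ∈ hex T m, Finsupp.single a 1 + α ∈ hex T (m + 1) := fun α hα =>
    ⟨add_mem_expOn.2 ⟨single_mem_expOn (Finset.mem_filter.1 ha).2 1, hα.1⟩, by
      rw [map_add, Finsupp.degree_single, hα.2, add_comm]⟩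
  exact C_mul_mem_Pol _ (X_mul_mem_Pol key hp)

/-- Homogeneous cycles of the symbol complex. -/
noncomputable def hcyc (d : ℕ) : Submodule B (Finset (Fin n) → MvPolynomial ι B) :=
  Submodule.pi Set.univ (fun s => Pol (R := B) (hex T (d + s.card))) ⊓
    (LinearMap.ker (dsig c T)).restrictScalars B

lemma mem_hcyc {d : ℕ} {Q : Finset (Fin n) → MvPolynomial ι B} :
    Q ∈ hcyc c T d ↔ (∀ s, Q s ∈ Pol (R := B) (hex T (d + s.card))) ∧ dsig c T Q = 0 :=
  ⟨fun h => ⟨fun s => h.1 s trivial, h.2⟩, fun h => ⟨fun s _ => h.1 s, h.2⟩⟩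

lemma hcyc_fg [IsNoetherianRing B] (d : ℕ) : (hcyc c T d).FG :=
  fg_of_le_fg (Submodule.fg_pi fun s =>
    Pol_fg ((ex_finite T (d + s.card)).subset (hex_subset_ex T _))) inf_le_left

lemma dsig_homogeneousComponent {u : Finset (Fin n) → MvPolynomial ι B} (hu : dsig c T u = 0)
    (d : ℕ) : dsig c T (fun s => homogeneousComponent (d + s.card) (u s)) = 0 := by
  funext s
  have h1 : homogeneousComponent (d + s.card) (dsig c T u s) = 0 := by
    rw [hu, Pi.zero_apply, map_zero]
  refine Eq.trans ?_ h1
  rw [dsig_apply, dsig_apply, map_sum]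
  refine Finset.sum_congr rfl fun i hi => ?_
  rw [map_zsmul, ← Finset.card_erase_add_one hi, ← add_assoc, homogeneousComponent_symb_mul]

lemma dsig_retr {u : Finset (Fin n) → MvPolynomial ι B} (hu : dsig c T u = 0) :
    dsig c T (fun s => retr T (u s)) = 0 := by
  funext s
  have h1 : retr T (dsig c T u s) = 0 := by
    rw [hu, Pi.zero_apply, map_zero]
  refine Eq.trans ?_ h1
  rw [dsig_apply, dsig_apply, map_sum]
  refine Finset.sum_congr rfl fun i hi => ?_
  rw [map_zsmul, retr_symb_mul]

theorem exists_hcyc_split [IsNoetherianRing B] : ∃ e : ℕ, ∀ d, e ≤ d →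
    ∀ Q ∈ hcyc c T (d + 1), ∃ Q' : ι → Finset (Fin n) → MvPolynomial ι B,
      (∀ a, Q' a ∈ hcyc c T d) ∧
      Q = fun s => ∑ a ∈ Finset.univ.filter (· ∈ T), X a * Q' a s := by
  obtain ⟨t, ht⟩ := IsNoetherian.noetherian (LinearMap.ker (dsig c T))
  refine ⟨∑ h ∈ t, ∑ s, (h s).totalDegree, fun d hd Q hQ => ?_⟩
  obtain ⟨hQ1, hQ2⟩ := (mem_hcyc c T).1 hQ
  have hQt : Q ∈ Submodule.span (MvPolynomial ι B) (t : Set _) := ht ▸ hQ2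
  obtain ⟨g, hg⟩ := Submodule.mem_span_finset.1 hQt
  choose b q hbq using exists_constant_add_X_mul (ι := ι) (B := B)
  set V : ι → Finset (Fin n) → MvPolynomial ι B := fun a => ∑ h ∈ t, q (g h) a • h with hV
  have hVc : ∀ a, dsig c T (V a) = 0 := fun a => by
    rw [hV, map_sum]
    refine Finset.sum_eq_zero fun h hh => ?_
    have : h ∈ LinearMap.ker (dsig c T) := ht ▸ Submodule.subset_span hh
    rw [map_smul, LinearMap.mem_ker.1 this, smul_zero]
  refine ⟨fun a s => retr T (homogeneousComponent (d + s.card) (V a s)), fun a => ?_, ?_⟩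
  · exact (mem_hcyc c T).2 ⟨fun s => retr_mem (homogeneousComponent_mem _ _),
      dsig_retr c T (dsig_homogeneousComponent c T (hVc a) d)⟩
  · funext s
    have h1 : Q s = ∑ h ∈ t, C (b (g h)) * h s + ∑ a, X a * V a s := by
      rw [← hg.2, Finset.sum_apply]
      have h2 : ∀ h ∈ t, (g h • h) s = C (b (g h)) * h s + ∑ a, X a * (q (g h) a * h s) := by
        intro h _
        rw [Pi.smul_apply, smul_eq_mul]
        conv_lhs => rw [hbq (g h)]
        rw [add_mul, Finset.sum_mul]
        simp only [mul_assoc]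
      rw [Finset.sum_congr rfl h2, Finset.sum_add_distrib, Finset.sum_comm]
      congr 1
      refine Finset.sum_congr rfl fun a _ => ?_
      change _ = X a * ((∑ h ∈ t, q (g h) a • h) s)
      rw [Finset.sum_apply, Finset.mul_sum]
      rfl
    have h3 : Q s = retr T (homogeneousComponent (d + 1 + s.card) (Q s)) := by
      rw [homogeneousComponent_of_mem_hex (hQ1 s),
        retr_of_mem (Pol_mono (fun α hα => hα.1) (hQ1 s))]
    rw [h3, h1, map_add, map_sum, map_sum]
    have h4 : ∑ h ∈ t, homogeneousComponent (d + 1 + s.card) (C (b (g h)) * h s) = 0 := by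
      refine Finset.sum_eq_zero fun h hh => ?_
      rw [homogeneousComponent_C_mul, homogeneousComponent_eq_zero, mul_zero]
      have h5 : (h s).totalDegree ≤ ∑ s, (h s).totalDegree :=
        Finset.single_le_sum (f := fun s => (h s).totalDegree) (fun _ _ => Nat.zero_le _)
          (Finset.mem_univ s)
      have h6 : ∑ s, (h s).totalDegree ≤ ∑ h ∈ t, ∑ s, (h s).totalDegree :=
        Finset.single_le_sum (f := fun h => ∑ s, (h s).totalDegree)
          (fun _ _ => Nat.zero_le _) hh
      omega
    rw [h4, zero_add, map_sum, Finset.sum_filter]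
    refine Finset.sum_congr rfl fun a _ => ?_
    rw [add_right_comm, homogeneousComponent_succ_X_mul, retr_X_mul]

/-- Minors annihilate the homology of the symbol complex in large degrees. -/
theorem exists_minor_smul_eq [IsNoetherianRing B] {i : ℕ} (t : Fin i → ι)
    (ht : Function.Injective t) (hT : Set.range t = T) : ∃ e : ℕ, ∀ d, e ≤ d →
    ∀ Q ∈ hcyc c T d, ∀ μ ∈ Ideal.span (Set.range fun r : Fin i → Fin n =>
      (Matrix.of fun a b => c (r b) (t a)).det),
    ∃ w : Finset (Fin n) → MvPolynomial ι B, (∀ s, w s ∈ Pol (R := B) (hex T (d + s.card))) ∧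
      μ • Q = dsig c T w := by
  obtain ⟨e, he⟩ := exists_hcyc_split c T
  refine ⟨e + 1, fun d hd Q hQ μ hμ => ?_⟩
  obtain ⟨d, rfl⟩ : ∃ d', d = d' + 1 := ⟨d - 1, by omega⟩
  obtain ⟨Q', hQ', hQQ'⟩ := he d (by omega) Q hQ
  have hsum : ∀ f : ι → MvPolynomial ι B,
      ∑ a ∈ Finset.univ.filter (· ∈ T), f a = ∑ a, f (t a) := fun f => by
    have : Finset.univ.filter (· ∈ T) = Finset.univ.image t := by
      ext x
      simp [← hT]
    rw [this, Finset.sum_image fun x _ y _ h => ht h]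
  induction hμ using Submodule.span_induction with
  | zero => exact ⟨0, fun s => zero_mem _, by rw [zero_smul, map_zero]⟩
  | add x y _ _ hx hy =>
    obtain ⟨u, hu, h1⟩ := hx
    obtain ⟨v, hv, h2⟩ := hy
    exact ⟨u + v, fun s => add_mem (hu s) (hv s), by rw [add_smul, h1, h2, map_add]⟩
  | smul b x _ hx =>
    obtain ⟨u, hu, h1⟩ := hx
    refine ⟨b • u, fun s => Submodule.smul_mem _ _ (hu s), ?_⟩
    rw [smul_assoc, h1]
    exact (((dsig c T).restrictScalars B).map_smul b u).symm
  | mem x hx =>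
    obtain ⟨r, rfl⟩ := hx
    set Mx : Matrix (Fin i) (Fin i) B := Matrix.of fun a b => c (r b) (t a) with hMx
    set w : Finset (Fin n) → MvPolynomial ι B := fun s =>
      ∑ a, ∑ b, C (Mx.adjugate b a) * kcon (r b) (Q' (t a)) s with hw
    have hcon : ∀ (j : Fin n) (a : ι), dsig c T (kcon j (Q' a)) = fun s => symb c T j * Q' a s := by
      intro j a
      have h0 : dsig c T (Q' a) = 0 := ((mem_hcyc c T).1 (hQ' a)).2
      have h1 := kcon_kos_add (φ := fun j =>
        (LinearMap.mulLeft (MvPolynomial ι B) (symb c T j)).toAddMonoidHom) j (Q' a)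
      have h2 : kos (fun j => (LinearMap.mulLeft (MvPolynomial ι B) (symb c T j)).toAddMonoidHom)
        (Q' a) = 0 := h0
      have h3 : kcon j (0 : Finset (Fin n) → MvPolynomial ι B) = 0 := by
        funext s
        simp [kcon]
      rw [h2, h3, zero_add] at h1
      exact h1
    refine ⟨w, fun s => ?_, ?_⟩
    · refine sum_mem fun a _ => sum_mem fun b _ => C_mul_mem_Pol _ ?_
      rw [kcon]
      split_ifs with hj
      · exact zero_mem _
      · refine zsmul_mem ?_ _
        have h5 := ((mem_hcyc c T).1 (hQ' (t a))).1 (insert (r b) s)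
        rw [Finset.card_insert_of_notMem hj, ← add_assoc, add_right_comm] at h5
        exact h5
    · have hw' : w = ∑ a, ∑ b, (C (Mx.adjugate b a) : MvPolynomial ι B) •
          kcon (r b) (Q' (t a)) := by
        funext s
        simp [hw, Finset.sum_apply]
      rw [hw', map_sum]
      have hsy : ∀ b, symb c T (r b) = ∑ a, C (Mx a b) * X (t a) := fun b => by
        rw [symb, hsum]
        rfl
      funext s
      rw [Finset.sum_apply, Pi.smul_apply, hQQ', smul_eq_C_mul]
      beta_reduce
      rw [hsum, Finset.mul_sum]
      refine Finset.sum_congr rfl fun a _ => ?_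
      rw [map_sum, Finset.sum_apply]
      have h1 : ∀ b, dsig c T ((C (Mx.adjugate b a) : MvPolynomial ι B) • kcon (r b) (Q' (t a))) s =
          ∑ a', C (Mx a' b * Mx.adjugate b a) * (X (t a') * Q' (t a) s) := by
        intro b
        rw [map_smul, hcon, Pi.smul_apply, hsy, smul_eq_mul, Finset.sum_mul, Finset.mul_sum]
        refine Finset.sum_congr rfl fun a' _ => ?_
        rw [C_mul]
        ring
      rw [Finset.sum_congr rfl fun b _ => h1 b, Finset.sum_comm]
      have h2 : ∀ a', ∑ b, C (Mx a' b * Mx.adjugate b a) * (X (t a') * Q' (t a) s) =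
          C (if a' = a then Mx.det else 0) * (X (t a') * Q' (t a) s) := by
        intro a'
        rw [← Finset.sum_mul, ← map_sum, ← Matrix.mul_apply, Matrix.mul_adjugate,
          Matrix.smul_apply, Matrix.one_apply]
        simp
      rw [Finset.sum_congr rfl fun a' _ => h2 a', Finset.sum_eq_single a]
      · rw [if_pos rfl]
      · intro a' _ h
        simp [h]
      · simp

end Symbols

end LagFin

namespace LagFin

/-! ### The filtered complexes -/

section Complexes

open MvPolynomial (C X homogeneousComponent)

variable {ι : Type*} [Fintype ι] {B : Type*} [CommRing B] [Algebra ℂ B] {π : Cv ι →ₐ[ℂ] B} {n : ℕ}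

variable (π n) in
/-- Koszul cochains with values in operators of bounded order. -/
noncomputable def KK (T I : Set ι) (m : ℕ) : Submodule (Cv ι) (Finset (Fin n) → VV ι B) :=
  Submodule.pi Set.univ fun s => DD π T I (m + s.card)

lemma mem_KK {T I : Set ι} {m : ℕ} {u : Finset (Fin n) → VV ι B} :
    u ∈ KK π n T I m ↔ ∀ s, u s ∈ DD π T I (m + s.card) :=
  ⟨fun h s => h s trivial, fun h s _ => h s⟩

lemma KK_mono {T I : Set ι} {m m' : ℕ} (h : m ≤ m') : KK π n T I m ≤ KK π n T I m' :=
  fun _ hu => mem_KK.2 fun s => DD_mono π (Nat.add_le_add_right h _) (mem_KK.1 hu s)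

variable (Y : Sys π n)

/-- The Koszul differential on cochains with values in operators. -/
noncomputable def Sys.del :
    (Finset (Fin n) → VV ι B) →ₗ[Cv ι] (Finset (Fin n) → VV ι B) := kosL Y.XV

lemma Sys.del_apply (u : Finset (Fin n) → VV ι B) (s : Finset (Fin n)) :
    Y.del u s = ∑ i ∈ s, ksgn i s • Y.XV i (u (s.erase i)) := rfl

lemma Sys.del_del (u : Finset (Fin n) → VV ι B) : Y.del (Y.del u) = 0 :=
  kos_kos (fun i l x => Y.XV_comm i l x) u

lemma Sys.del_mem {T I : Set ι} (hI : ∀ a ∈ I, a ∉ T → ∀ j, Y.c j a = 0) {m : ℕ}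
    {u : Finset (Fin n) → VV ι B} (hu : u ∈ KK π n T I m) : Y.del u ∈ KK π n T I m := by
  refine mem_KK.2 fun s => ?_
  rw [Sys.del_apply]
  refine sum_mem fun i hi => zsmul_mem ?_ _
  rw [← Finset.card_erase_add_one hi, ← add_assoc]
  exact Y.XV_mem hI i (mem_KK.1 hu _)

/-- The operators of order at most `m` have homology finite over the series in `I`. -/
def Sys.HF (T I : Set ι) (m : ℕ) : Prop := HFin (Rs I) (KK π n T I m) Y.del

lemma Sys.HF_of_finite (T I : Set ι) (m : ℕ) (κ : Finset B)
    (hκ : ∀ b : B, ∃ r : B → Cv ι, (∀ l, r l ∈ Rs I) ∧ b = ∑ l ∈ κ, π (r l) * l) :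
    Y.HF T I m := by
  refine ⟨Submodule.pi Set.univ fun s => (DD π T I (m + s.card)).restrictScalars (Rs I),
    Submodule.fg_pi fun s => DD_fg π κ hκ, fun z hz _ => ⟨z, hz, 0, zero_mem _, ?_⟩⟩
  rw [map_zero, add_zero]

lemma Sys.del_op {T I : Set ι} (hI : ∀ a ∈ I, a ∉ T → ∀ j, Y.c j a = 0) {m : ℕ}
    {P : Finset (Fin n) → MvPolynomial ι B}
    (hP : ∀ s, P s ∈ Pol (R := B) (ex T (m + 1 + s.card))) :
    ∃ v : Finset (Fin n) → MvPolynomial ι B, (∀ s, v s ∈ Pol (R := B) (ex T (m + s.card))) ∧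
      Y.del (fun s => op π I (P s)) = fun s => op π I (dsig Y.c T P s + v s) := by
  choose p' hp' h using fun (j : Fin n) (s : Finset (Fin n)) => Y.XV_op hI j (hP s)
  refine ⟨fun s => ∑ i ∈ s, ksgn i s • p' i (s.erase i), fun s => ?_, ?_⟩
  · refine sum_mem fun i hi => zsmul_mem ?_ _
    have := hp' i (s.erase i)
    rwa [add_assoc, add_comm 1, Finset.card_erase_add_one hi] at this
  · funext s
    rw [Sys.del_apply, dsig_apply, ← Finset.sum_add_distrib, map_sum]
    refine Finset.sum_congr rfl fun i _ => ?_
    rw [h, ← smul_add, map_zsmul, add_comm]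
    rfl

lemma smul_op {T I : Set ι} {m : ℕ} {r : Cv ι} (hr : r ∈ Rs I) {p : MvPolynomial ι B}
    (hp : p ∈ Pol (R := B) (ex T (m + 1))) :
    ∃ q ∈ Pol (R := B) (ex T m), r • op π I p = op π I (C (π r) * p + q) := by
  refine Pol_induction (P := fun p => ∃ q ∈ Pol (R := B) (ex T m),
    r • op π I p = op π I (C (π r) * p + q)) ?_ ?_ ?_ hp
  · exact ⟨0, zero_mem _, by simp⟩
  · rintro p q ⟨p', hp', h1⟩ ⟨q', hq', h2⟩
    refine ⟨p' + q', add_mem hp' hq', ?_⟩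
    rw [map_add, smul_add, h1, h2, ← map_add]
    congr 1
    ring
  · intro α hα b
    obtain ⟨q, hq, h⟩ := smul_evV_monomial π α r b
    have hle : ({β | β < α} : Set (ι →₀ ℕ)) ⊆ ex T m := by
      intro β hβ
      have hβ' : β < α := hβ
      refine ⟨(mem_ex_of_le hα hβ'.le).1, Nat.le_of_lt_succ (lt_of_lt_of_le ?_ hα.2)⟩
      obtain ⟨γ, rfl⟩ := exists_add_of_le hβ'.le
      rw [map_add]
      refine Nat.lt_add_of_pos_right (Nat.pos_of_ne_zero fun h0 => ?_)
      rw [(Finsupp.degree_eq_zero_iff γ).1 h0, add_zero] at hβ'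
      exact lt_irrefl _ hβ'
    refine ⟨q, Pol_mono hle hq, ?_⟩
    rw [op_eq, ← res_smul_of_mem hr, h, MvPolynomial.C_mul_monomial, op_eq]

theorem Sys.exists_relFin [IsNoetherianRing B] {T I I₀ : Set ι} (hTI : T ⊆ I) (hI₀ : I₀ ⊆ I)
    (hI : ∀ a ∈ I, a ∉ T → ∀ j, Y.c j a = 0)
    {i : ℕ} (t : Fin i → ι) (ht : Function.Injective t) (hT : Set.range t = T) (κ : Finset B)
    (hκ : ∀ b : B, ∃ r : B → Cv ι, (∀ l, r l ∈ Rs I₀) ∧ b - ∑ l ∈ κ, π (r l) * l ∈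
      Ideal.span (Set.range fun r : Fin i → Fin n =>
        (Matrix.of fun a b => Y.c (r b) (t a)).det)) :
    ∃ e, ∀ m, e ≤ m → RelFin (Rs I₀) (KK π n T I m) (KK π n T I (m + 1)) Y.del := by
  obtain ⟨e, he⟩ := exists_minor_smul_eq Y.c T t ht hT
  refine ⟨e, fun m hm => ?_⟩
  obtain ⟨Qs, hQs⟩ := hcyc_fg Y.c T (m + 1)
  set gen : B × (Finset (Fin n) → MvPolynomial ι B) → Finset (Fin n) → VV ι B :=
    fun x s => op π I (C x.1 * x.2 s) with hgen
  set Gs : Finset (Finset (Fin n) → VV ι B) := (κ ×ˢ Qs).image gen with hGs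
  refine ⟨Submodule.span (Rs I₀) Gs, ⟨Gs, rfl⟩, fun z hz hδz => ?_⟩
  choose P hP hPz using fun s => mem_KK.1 hz s
  obtain rfl : (fun s => op π I (P s)) = z := funext hPz
  have hP' : ∀ s, P s ∈ Pol (R := B) (ex T (m + s.card + 1)) := fun s => by
    rw [add_right_comm]; exact hP s
  set Q : Finset (Fin n) → MvPolynomial ι B :=
    fun s => homogeneousComponent (m + s.card + 1) (P s) with hQ
  have hQhex : ∀ s, Q s ∈ Pol (R := B) (hex T (m + 1 + s.card)) := fun s => by
    rw [add_right_comm]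
    exact homogeneousComponent_mem_hex (Pol_mono (fun α hα => hα.1) (hP s))
  have hPQ : ∀ s, P s - Q s ∈ Pol (R := B) (ex T (m + s.card)) := fun s =>
    sub_homogeneousComponent_mem (hP' s)
  have hQcyc : Q ∈ hcyc Y.c T (m + 1) := by
    refine (mem_hcyc Y.c T).2 ⟨hQhex, ?_⟩
    obtain ⟨v, hv, hdel⟩ := Y.del_op hI hP
    rw [hdel] at hδz
    funext s
    obtain ⟨v', hv', h1⟩ := mem_KK.1 hδz s
    have hPex : dsig Y.c T P s ∈ Pol (R := B) (expOn T) := by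
      rw [dsig_apply]
      refine sum_mem fun i _ => zsmul_mem ?_ _
      exact Pol_mono (fun α hα => hα.1) (Y.sym_mul_mem i (hP _))
    have h2 : dsig Y.c T P s + v s - v' = 0 := by
      refine eq_zero_of_res_evV π hTI (sub_mem (add_mem hPex
        (Pol_mono (fun α hα => hα.1) (hv s))) (Pol_mono (fun α hα => hα.1) hv')) ?_
      change op π I _ = 0
      rw [map_sub, sub_eq_zero]
      exact h1.symm
    have h3 : dsig Y.c T P s ∈ Pol (R := B) (ex T (m + s.card)) := by
      have : dsig Y.c T P s = v' - v s := by linear_combination h2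
      rw [this]
      exact sub_mem hv' (hv s)
    have h4 : dsig Y.c T (P - Q) s ∈ Pol (R := B) (ex T (m + s.card)) := by
      rw [dsig_apply]
      refine sum_mem fun i hi => zsmul_mem ?_ _
      rw [← Finset.card_erase_add_one hi, ← add_assoc]
      exact Y.sym_mul_mem i (hPQ _)
    refine eq_zero_of_mem_hex_of_mem_ex (T := T) (m := m + s.card) ?_ ?_
    · rw [dsig_apply]
      refine sum_mem fun i hi => zsmul_mem ?_ _
      have := symb_mul_mem_hex Y.c T i (hQhex (s.erase i))
      rwa [add_assoc, Finset.card_erase_add_one hi, add_right_comm] at this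
    · rw [map_sub] at h4
      have := sub_mem h3 h4
      rwa [Pi.sub_apply, sub_sub_cancel] at this
  have hQt := hQcyc
  rw [← hQs] at hQt
  obtain ⟨b, -, hb⟩ := Submodule.mem_span_finset.1 hQt
  choose r hr hrb using fun b => hκ b
  have hQsmem : ∀ q ∈ Qs, q ∈ hcyc Y.c T (m + 1) := fun q hq => hQs ▸ Submodule.subset_span hq
  choose! w hw hwd using fun q hq =>
    he (m + 1) (by omega) q (hQsmem q hq) _ (hrb (b q))
  set W : Finset (Fin n) → MvPolynomial ι B := ∑ q ∈ Qs, w q with hW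
  have hWmem : ∀ s, W s ∈ Pol (R := B) (hex T (m + 1 + s.card)) := fun s => by
    rw [hW, Finset.sum_apply]
    exact sum_mem fun q hq => hw q hq s
  obtain ⟨v, hv, hdelW⟩ := Y.del_op hI (P := W) fun s => Pol_mono (hex_subset_ex T _) (hWmem s)
  have hlow : ∀ (q) (l : B) (s : Finset (Fin n)), q ∈ Qs → ∃ p ∈ Pol (R := B) (ex T (m + s.card)),
      op π I (C (π (r (b q) l)) * (C l * q s)) = r (b q) l • op π I (C l * q s) + op π I p := by
    intro q l s hq
    have h1 : C l * q s ∈ Pol (R := B) (ex T (m + s.card + 1)) := by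
      refine C_mul_mem_Pol _ (Pol_mono (hex_subset_ex T _) ?_)
      rw [add_right_comm]
      exact ((mem_hcyc Y.c T).1 (hQsmem q hq)).1 s
    obtain ⟨p, hp, h2⟩ := smul_op (π := π) (Rs_mono hI₀ (hr (b q) l)) h1
    refine ⟨-p, neg_mem hp, ?_⟩
    rw [h2, ← map_add, add_neg_cancel_right]
  choose! p hp hpeq using hlow
  refine ⟨∑ q ∈ Qs, ∑ l ∈ κ, r (b q) l • gen (l, q), ?_,
    (fun s => op π I (∑ q ∈ Qs, ∑ l ∈ κ, p q l s + -v s + (P s - Q s))), ?_,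
    (fun s => op π I (W s)), ?_, ?_⟩
  · refine sum_mem fun q hq => sum_mem fun l hl => ?_
    refine Submodule.smul_mem _ (⟨r (b q) l, hr _ _⟩ : Rs I₀) (Submodule.subset_span ?_)
    exact Finset.mem_coe.2 (Finset.mem_image_of_mem _ (Finset.mk_mem_product hl hq))
  · refine mem_KK.2 fun s => ⟨_, ?_, rfl⟩
    exact add_mem (add_mem (sum_mem fun q hq => sum_mem fun l _ => hp q l s hq)
      (neg_mem (hv s))) (hPQ s)
  · exact mem_KK.2 fun s => ⟨_, Pol_mono (hex_subset_ex T _) (hWmem s), rfl⟩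
  · rw [hdelW]
    funext s
    have hd : dsig Y.c T W s = ∑ q ∈ Qs, C (b q - ∑ l ∈ κ, π (r (b q) l) * l) * q s := by
      rw [hW, map_sum, Finset.sum_apply]
      refine Finset.sum_congr rfl fun q hq => ?_
      rw [← hwd q hq, Pi.smul_apply, MvPolynomial.smul_eq_C_mul]
    have hQd : Q s = ∑ q ∈ Qs, ∑ l ∈ κ, C (π (r (b q) l)) * (C l * q s) + dsig Y.c T W s := by
      rw [hd, ← hb, Finset.sum_apply, ← Finset.sum_add_distrib]
      refine Finset.sum_congr rfl fun q _ => ?_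
      rw [Pi.smul_apply, MvPolynomial.smul_eq_C_mul, map_sub, map_sum, sub_mul, Finset.sum_mul]
      simp only [map_mul, mul_assoc]
      ring
    have h1 : op π I (P s) = op π I (∑ q ∈ Qs, ∑ l ∈ κ, C (π (r (b q) l)) * (C l * q s)) +
        op π I (dsig Y.c T W s + (P s - Q s)) := by
      rw [← map_add]
      congr 1
      linear_combination hQd
    have h2 : op π I (∑ q ∈ Qs, ∑ l ∈ κ, C (π (r (b q) l)) * (C l * q s)) =
        ∑ q ∈ Qs, ∑ l ∈ κ, r (b q) l • op π I (C l * q s) +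
          op π I (∑ q ∈ Qs, ∑ l ∈ κ, p q l s) := by
      simp only [map_sum]
      rw [← Finset.sum_add_distrib]
      refine Finset.sum_congr rfl fun q hq => ?_
      rw [← Finset.sum_add_distrib]
      exact Finset.sum_congr rfl fun l _ => hpeq q l s hq
    rw [h1, h2]
    simp only [Pi.add_apply, Finset.sum_apply, Pi.smul_apply, hgen]
    rw [add_assoc, add_assoc, ← map_add, ← map_add]
    congr 2
    abel

end Complexes

end LagFin

namespace LagFin

section Core

variable {ι : Type*} [Fintype ι] {B : Type*} [CommRing B] [Algebra ℂ B] {π : Cv ι →ₐ[ℂ] B} {n : ℕ}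

/-- The operators `theta` acting on cochains. -/
noncomputable def thetaC (n : ℕ) {I : Set ι} {j : ι} (hj : j ∉ I) :
    (Finset (Fin n) → VV ι B) →ₗ[Rs I] (Finset (Fin n) → VV ι B) where
  toFun u s := theta j (u s)
  map_add' u v := funext fun s => map_add (theta j) (u s) (v s)
  map_smul' r u := funext fun s => by
    change theta j ((r : Cv ι) • u s) = (r : Cv ι) • theta j (u s)
    rw [smul_theta, dd_eq_zero hj r.2, zero_smul, zero_add]

/-- Restriction of cochains. -/
noncomputable def resC (n : ℕ) (I : Set ι) :
    (Finset (Fin n) → VV ι B) →ₗ[Rs I] (Finset (Fin n) → VV ι B) where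
  toFun u s := res I (u s)
  map_add' u v := funext fun s => map_add (res I) (u s) (v s)
  map_smul' r u := funext fun s => res_smul_of_mem r.2 (u s)

variable (Y : Sys π n)

lemma Sys.del_resC (I : Set ι) (u : Finset (Fin n) → VV ι B) :
    Y.del (resC n I u) = resC n I (Y.del u) := by
  funext s
  change _ = res I (Y.del u s)
  rw [Y.del_apply, Y.del_apply, map_sum]
  refine Finset.sum_congr rfl fun i _ => ?_
  rw [map_zsmul]
  rfl

lemma Sys.del_thetaC {I : Set ι} {j : ι} (hj : j ∉ I) (u : Finset (Fin n) → VV ι B) :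
    thetaC n hj (Y.del u) = Y.del (thetaC n hj u) := by
  funext s
  change theta j (Y.del u s) = _
  rw [Y.del_apply, Y.del_apply, map_sum]
  refine Finset.sum_congr rfl fun i _ => ?_
  rw [map_zsmul]
  rfl

lemma res_theta_eq_zero {I : Set ι} {j : ι} (hj : j ∉ I) (u : VV ι B) :
    res I (theta j u) = 0 := VV.ext fun f => by
  rw [res_app, theta_app, dd_eq_zero hj (rho_mem I f), map_zero, VV.app_zero]

theorem Sys.HF_of_insert {T I : Set ι} {j : ι} (hj : j ∉ I) (hTI : T ⊆ I)
    (hI : ∀ a ∈ insert j I, a ∉ insert j T → ∀ l, Y.c l a = 0) {m : ℕ}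
    (h1 : Y.HF (insert j T) (insert j I) m) (h2 : Y.HF (insert j T) (insert j I) (m + 1))
    (hrel : RelFin (Rs I) (KK π n (insert j T) (insert j I) m)
      (KK π n (insert j T) (insert j I) (m + 1)) Y.del) : Y.HF T I (m + 1) := by
  have hj' : j ∈ insert j I := Set.mem_insert _ _
  obtain ⟨G, hG, hGK, h⟩ := (isOneVar hj).relFin_of_leibniz
    (M := Finset (Fin n) → VV ι B)
    (K := (KK π n (insert j T) (insert j I) m).restrictScalars (Rs (insert j I)))
    (K' := (KK π n (insert j T) (insert j I) (m + 1)).restrictScalars (Rs (insert j I)))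
    (δ := Y.del.restrictScalars (Rs (insert j I)))
    (KK_mono (Nat.le_succ m)) (fun u hu => Y.del_mem hI hu) (fun u hu => Y.del_mem hI hu)
    h1 h2 hrel Y.del_del (thetaC n hj)
    (fun u hu => mem_KK.2 fun s => by
      rw [add_right_comm]
      exact theta_mem_DD π (Set.mem_insert _ _) hj' (mem_KK.1 hu s))
    (fun u => Y.del_thetaC hj u)
    (fun r u => funext fun s => by
      change theta j ((r : Cv ι) • u s) = (r : Cv ι) • theta j (u s) - dd j (r : Cv ι) • u s
      rw [smul_theta]
      abel)
    (fun u hu h0 => funext fun s => theta_injective hj' (res_of_mem_DD π (mem_KK.1 hu s))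
      (congrFun h0 s))
  refine ⟨G.map (resC n I), hG.map _, fun z hz hδz => ?_⟩
  choose z' hz' hzz' using fun s => exists_res_eq π (Set.subset_insert j T)
    (Set.subset_insert j I) (mem_KK.1 hz s)
  have hz'K : z' ∈ KK π n (insert j T) (insert j I) (m + 1) := mem_KK.2 hz'
  have hres : resC n I z' = z := funext hzz'
  have hδ : ∀ s, res I (Y.del z' s) = 0 := fun s => by
    have := Y.del_resC I z'
    rw [hres, hδz] at this
    exact (congrFun this s).symm
  have hth : ∀ s, ∃ v ∈ DD π (insert j T) (insert j I) (m + s.card),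
      theta j v = Y.del z' s := fun s => by
    have h3 := mem_KK.1 (Y.del_mem hI hz'K) s
    rw [add_right_comm] at h3
    exact exists_theta_eq π hTI hj h3 (hδ s)
  choose k hk hkz using hth
  obtain ⟨g, hg, k', hk', w, hw, hz''⟩ := h z' hz'K ⟨k, mem_KK.2 hk, funext fun s => (hkz s).symm⟩
  refine ⟨resC n I g, Submodule.mem_map_of_mem hg, resC n I w,
    mem_KK.2 fun s => res_mem_DD π hj (mem_KK.1 hw s), ?_⟩
  have h0 : resC n I (thetaC n hj k') = 0 := funext fun s => res_theta_eq_zero hj (k' s)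
  rw [← hres, hz'', map_add, map_add, h0, add_zero, Y.del_resC]
  rfl

lemma exists_finite_mod (hπ : Function.Surjective π) (I : Set ι) (𝔟 : Ideal B) {N : ℕ}
    (h : IsLocalRing.maximalIdeal (Cv ι) ^ N ≤ 𝔟.comap π ⊔ Ideal.span (vr '' I)) :
    ∃ κ : Finset B, ∀ b : B, ∃ r : B → Cv ι, (∀ l, r l ∈ Rs I) ∧
      b - ∑ l ∈ κ, π (r l) * l ∈ 𝔟 := by
  refine ⟨(boxOff I (N + 1)).image fun β => π (mon β), fun b => ?_⟩
  obtain ⟨f, rfl⟩ := hπ b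
  obtain ⟨r, hr, hf⟩ := finite_mod I _ N h f
  refine ⟨fun l => ∑ β ∈ (boxOff I (N + 1)).filter (fun β => π (mon β) = l), r β,
    fun l => sum_mem fun β _ => hr β, ?_⟩
  have h1 : ∑ l ∈ (boxOff I (N + 1)).image (fun β => π (mon β)),
      π (∑ β ∈ (boxOff I (N + 1)).filter (fun β => π (mon β) = l), r β) * l =
      ∑ β ∈ boxOff I (N + 1), π (r β) * π (mon β) := by
    rw [← Finset.sum_fiberwise_of_maps_to (g := fun β => π (mon β))
      (fun β hβ => Finset.mem_image_of_mem (fun β => π (mon β)) hβ)]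
    refine Finset.sum_congr rfl fun l _ => ?_
    rw [map_sum, Finset.sum_mul]
    refine Finset.sum_congr rfl fun β hβ => ?_
    rw [(Finset.mem_filter.1 hβ).2]
  rw [h1]
  have h2 := Ideal.mem_comap.1 hf
  simpa only [map_sub, map_sum, map_mul] using h2

/-- The Koszul differential on cochains with values in `B`. -/
noncomputable def Sys.dB : (Finset (Fin n) → B) →+ (Finset (Fin n) → B) :=
  kos fun j => (Y.X j).toAddMonoidHom

lemma Sys.XV_op_C {Λ₀ : Set ι} (h0 : ∀ a ∈ Λ₀, ∀ j, Y.c j a = 0) (j : Fin n) (b : B) :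
    Y.XV j (op π Λ₀ (MvPolynomial.C b)) = op π Λ₀ (MvPolynomial.C (Y.X j b)) := by
  have hop : ∀ (b : B) f, (op π Λ₀ (MvPolynomial.C b)).app f = b * π (rho Λ₀ f) := fun b f => by
    rw [op_eq, res_app, MvPolynomial.C_apply, evV_monomial_app, dpow_zero]
    rfl
  refine VV.ext fun f => ?_
  rw [Y.XV_app, hop, hop, Y.leib, Finset.sum_eq_zero, mul_zero, add_zero]
  intro a _
  by_cases ha : a ∈ Λ₀
  · rw [h0 a ha, zero_mul]
  · rw [dd_eq_zero ha (rho_mem Λ₀ f), map_zero, mul_zero]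

lemma app_eq_of_mem_DD_empty {Λ₀ : Set ι} {m : ℕ} {u : VV ι B} (hu : u ∈ DD π ∅ Λ₀ m)
    {r : Cv ι} (hr : r ∈ Rs Λ₀) : u.app r = π r * u.app 1 := by
  obtain ⟨p, hp, rfl⟩ := hu
  refine Pol_induction (P := fun p => (op π Λ₀ p).app r = π r * (op π Λ₀ p).app 1) ?_ ?_ ?_ hp
  · simp
  · intro p q h1 h2
    rw [map_add, VV.app_add, VV.app_add, h1, h2, mul_add]
  · intro α hα b
    have : α = 0 := by
      ext a
      exact mem_expOn.1 hα.1 a (Set.notMem_empty a)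
    subst this
    rw [op_eq, res_app, res_app, evV_monomial_app, evV_monomial_app, dpow_zero, LinearMap.id_apply,
      LinearMap.id_apply, map_one, map_one, rho_of_mem hr]
    ring

/-- **Finiteness for systems of commuting first order operators.** -/
theorem Sys.finite_cohomology [IsNoetherianRing B] (hπ : Function.Surjective π) (Λ₀ : Set ι)
    (h0 : ∀ a ∈ Λ₀, ∀ j, Y.c j a = 0) (y : Fin n → ι) (hy : Function.Injective y)
    (hyΛ : ∀ i, y i ∉ Λ₀)
    (hS : ∀ (i : ℕ) (hi : i < n), ∃ N, IsLocalRing.maximalIdeal (Cv ι) ^ N ≤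
      (Ideal.span (Set.range fun r : Fin (i + 1) → Fin n =>
        (Matrix.of fun a b => Y.c (r b) (y (Fin.castLE hi a))).det)).comap π ⊔
      Ideal.span (vr '' (Λ₀ ∪ y '' {b | b.val < i})))
    (hSn : ∃ N, IsLocalRing.maximalIdeal (Cv ι) ^ N ≤
      (⊥ : Ideal B).comap π ⊔ Ideal.span (vr '' (Λ₀ ∪ Set.range y))) :
    ∃ (N : ℕ) (g : Fin N → Finset (Fin n) → B), (∀ l, Y.dB (g l) = 0) ∧
      ∀ z, Y.dB z = 0 → ∃ r : Fin N → Cv ι, (∀ l, r l ∈ Rs Λ₀) ∧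
        ∃ w, z = ∑ l, π (r l) • g l + Y.dB w := by
  set T : ℕ → Set ι := fun i => y '' {b | b.val < i} with hTdef
  have hT0 : T 0 = ∅ := by simp [hTdef]
  have hTn : T n = Set.range y := by simp [hTdef]
  have hTsucc : ∀ i (hi : i < n), T (i + 1) = insert (y ⟨i, hi⟩) (T i) := by
    intro i hi
    simp only [hTdef, Nat.lt_succ_iff_lt_or_eq]
    rw [← Set.image_insert_eq]
    congr 1
    ext b
    simp only [Set.mem_insert_iff, Fin.ext_iff]
    exact or_comm
  have hc : ∀ i, ∀ a ∈ Λ₀ ∪ T i, a ∉ T i → ∀ j, Y.c j a = 0 := fun i a ha haT =>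
    h0 a (ha.resolve_right haT)
  have main : ∀ i, i ≤ n → ∃ M, ∀ m, M ≤ m → Y.HF (T i) (Λ₀ ∪ T i) m := by
    intro i hi
    induction hi using Nat.decreasingInduction with
    | self =>
      obtain ⟨N, hN⟩ := hSn
      obtain ⟨κ, hκ⟩ := exists_finite_mod hπ _ _ hN
      refine ⟨0, fun m _ => Y.HF_of_finite _ _ _ κ fun b => ?_⟩
      obtain ⟨r, hr, h⟩ := hκ b
      rw [hTn]
      exact ⟨r, hr, sub_eq_zero.1 (Ideal.mem_bot.1 h)⟩
    | of_succ i hi ih =>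
      obtain ⟨M, hM⟩ := ih
      obtain ⟨N, hN⟩ := hS i hi
      obtain ⟨κ, hκ⟩ := exists_finite_mod hπ _ _ hN
      have hyi : y ⟨i, hi⟩ ∉ Λ₀ ∪ T i := by
        rintro (h | ⟨b, hb, hbi⟩)
        · exact hyΛ _ h
        · have hb' : b.val < i := hb
          have := congrArg Fin.val (hy hbi)
          simp only at this
          omega
      have hI : Λ₀ ∪ T (i + 1) = insert (y ⟨i, hi⟩) (Λ₀ ∪ T i) := by
        rw [hTsucc i hi, Set.union_insert]
      have hrg : Set.range (fun a : Fin (i + 1) => y (Fin.castLE hi a)) = T (i + 1) := by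
        ext x
        constructor
        · rintro ⟨a, rfl⟩
          exact ⟨Fin.castLE hi a, a.2, rfl⟩
        · rintro ⟨b, hb, rfl⟩
          exact ⟨⟨b.val, hb⟩, rfl⟩
      obtain ⟨e, he⟩ := Y.exists_relFin (T := T (i + 1)) (I := Λ₀ ∪ T (i + 1)) (I₀ := Λ₀ ∪ T i)
        Set.subset_union_right (by rw [hI]; exact Set.subset_insert _ _) (hc (i + 1))
        (fun a => y (Fin.castLE hi a)) (fun a b h => Fin.castLE_injective hi (hy h)) hrg κ hκ
      refine ⟨max M e + 1, fun m hm => ?_⟩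
      obtain ⟨m, rfl⟩ : ∃ m', m = m' + 1 := ⟨m - 1, by omega⟩
      have hc' := hc (i + 1)
      have h1 := hM m (by omega)
      have h2 := hM (m + 1) (by omega)
      have h3 := he m (by omega)
      rw [hI, hTsucc i hi] at hc' h1 h2 h3
      exact Y.HF_of_insert hyi Set.subset_union_right hc' h1 h2 h3
  obtain ⟨M, hM⟩ := main 0 (Nat.zero_le n)
  have hHF := hM M le_rfl
  rw [hT0, Set.union_empty] at hHF
  obtain ⟨G, hG, hz⟩ := hHF
  set G' : Submodule (Rs Λ₀) (Finset (Fin n) → VV ι B) :=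
    G ⊓ (KK π n ∅ Λ₀ M ⊓ LinearMap.ker Y.del).restrictScalars (Rs Λ₀) with hG'
  have hle : G' ≤ G := fun x hx => hx.1
  obtain ⟨t, ht⟩ := fg_of_le_fg (S := Rs Λ₀) (N := G') (G := G) hG hle
  have htm : ∀ g ∈ t, g ∈ G' := fun g hg => ht ▸ Submodule.subset_span hg
  have hcK : ∀ a ∈ Λ₀, a ∉ (∅ : Set ι) → ∀ j, Y.c j a = 0 := fun a ha _ => h0 a ha
  have hdel1 : ∀ u s, (Y.del u s).app 1 = Y.dB (fun s => (u s).app 1) s := by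
    intro u s
    rw [Y.del_apply, Sys.dB, kos_apply]
    have happ : ∀ (u : Fin n → VV ι B),
        (∑ a ∈ s, u a).app 1 = ∑ a ∈ s, (u a).app 1 := fun u => LinearMap.sum_apply s _ 1
    rw [happ]
    rfl
  refine ⟨t.card, fun l s => ((t.equivFin.symm l : Finset (Fin n) → VV ι B) s).app 1,
    fun l => funext fun s => ?_, fun z hz0 => ?_⟩
  · rw [← hdel1]
    have : Y.del (t.equivFin.symm l : Finset (Fin n) → VV ι B) = 0 :=
      (htm _ (t.equivFin.symm l).2).2.2
    rw [this]
    rfl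
  · set u : Finset (Fin n) → VV ι B := fun s => op π Λ₀ (MvPolynomial.C (z s)) with hu
    have huK : u ∈ KK π n ∅ Λ₀ M := mem_KK.2 fun s => ⟨_, by
      rw [MvPolynomial.C_apply]
      exact monomial_mem_Pol (show (0 : ι →₀ ℕ) ∈ ex ∅ _ from
        ⟨zero_mem_expOn _, by simp⟩) _, rfl⟩
    have hu0 : Y.del u = 0 := by
      funext s
      have h1 : Y.del u s = op π Λ₀ (MvPolynomial.C (Y.dB z s)) := by
        rw [Y.del_apply, Sys.dB, kos_apply, map_sum, map_sum]
        refine Finset.sum_congr rfl fun i _ => ?_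
        rw [hu, Y.XV_op_C h0, map_zsmul, map_zsmul]
        rfl
      rw [h1, hz0, Pi.zero_apply, map_zero, map_zero]
      rfl
    obtain ⟨g, hg, w, hw, hgw⟩ := hz u huK hu0
    have hgG' : g ∈ G' := by
      refine ⟨hg, ?_, ?_⟩
      · have h1 : g = u - Y.del w := by rw [hgw, add_sub_cancel_right]
        change g ∈ KK π n ∅ Λ₀ M
        rw [h1]
        exact sub_mem huK (Y.del_mem hcK hw)
      · change Y.del g = 0
        rw [hgw, map_add, Y.del_del, add_zero] at hu0
        exact hu0
    rw [← ht] at hgG'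
    obtain ⟨r, -, hr⟩ := Submodule.mem_span_finset.1 hgG'
    refine ⟨fun l => r (t.equivFin.symm l), fun l => (r _).2, fun s => (w s).app 1, ?_⟩
    funext s
    have h1 : z s = (u s).app 1 := by
      change z s = (op π Λ₀ (MvPolynomial.C (z s))).app 1
      rw [op_eq, res_app, MvPolynomial.C_apply, evV_monomial_app, dpow_zero,
        LinearMap.id_apply, map_one, map_one, mul_one]
    rw [h1, hgw, Pi.add_apply, VV.app_add, hdel1, Pi.add_apply, ← hr]
    congr 1
    have happ : ∀ (u : (Finset (Fin n) → VV ι B) → VV ι B),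
      (∑ a ∈ t, u a).app 1 = ∑ a ∈ t, (u a).app 1 := fun u => LinearMap.sum_apply t _ 1
    rw [Finset.sum_apply, Finset.sum_apply, happ, ← Finset.sum_coe_sort t,
      ← t.equivFin.symm.sum_comp]
    refine Finset.sum_congr rfl fun l _ => ?_
    have h2 := htm _ (t.equivFin.symm l).2
    have h3 := app_eq_of_mem_DD_empty (mem_KK.1 h2.2.1 s)
      (r (t.equivFin.symm l)).2
    rw [Pi.smul_apply, Pi.smul_apply, smul_eq_mul, ← h3]
    change ((r (t.equivFin.symm l) : Cv ι) • (t.equivFin.symm l : Finset (Fin n) → VV ι B) s).app 1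
      = _
    rw [VV.smul_app]
    congr 1
    exact mul_one _

end Core

end LagFin

namespace LagFin

section LinearForms

variable {δ : Type*} [Fintype δ]

/-- The linear form with given coefficient vector. -/
noncomputable def lin (K : Type*) [CommRing K] : (δ → K) →ₗ[K] MvPolynomial δ K :=
  Fintype.linearCombination K (MvPolynomial.X : δ → MvPolynomial δ K)

lemma lin_apply {K : Type*} [CommRing K] (v : δ → K) :
    lin K v = ∑ c, v c • (MvPolynomial.X c : MvPolynomial δ K) :=
  Fintype.linearCombination_apply ..

lemma lin_single {K : Type*} [CommRing K] (c : δ) :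
    lin K (Pi.single c (1 : K)) = MvPolynomial.X c := by
  rw [lin, Fintype.linearCombination_apply_single, one_smul]

lemma coeff_lin {K : Type*} [CommRing K] (v : δ → K) (c : δ) :
    MvPolynomial.coeff (Finsupp.single c 1) (lin K v) = v c := by
  rw [lin_apply, MvPolynomial.coeff_sum, Finset.sum_eq_single c]
  · simp
  · intro b _ hb
    simp [MvPolynomial.coeff_X, Finsupp.single_left_inj, hb]
  · simp

lemma lin_injective {K : Type*} [CommRing K] : Function.Injective (lin (δ := δ) K) := by
  intro v w h
  funext c
  rw [← coeff_lin v, h, coeff_lin]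

lemma map_lin {K L : Type*} [CommRing K] [CommRing L] (f : K →+* L) (v : δ → K) :
    MvPolynomial.map f (lin K v) = lin L (fun c => f (v c)) := by
  simp [lin_apply, MvPolynomial.smul_eq_C_mul]

lemma eval_lin {K : Type*} [CommRing K] (v u : δ → K) :
    MvPolynomial.eval u (lin K v) = ∑ c, v c * u c := by
  simp [lin_apply]

/-- For every subspace `U` of coefficient vectors, the ideal generated by the corresponding
linear forms is the kernel of a substitution. -/
lemma exists_subst_ker {K : Type*} [Field K] (U : Submodule K (δ → K)) :
    ∃ φ : MvPolynomial δ K →ₐ[K] MvPolynomial δ K,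
      RingHom.ker φ = Ideal.span (lin K '' (U : Set (δ → K))) ∧
      ∀ v, φ (lin K v) = 0 ↔ v ∈ U := by
  obtain ⟨s, hs⟩ := LinearMap.exists_rightInverse_of_surjective U.mkQ U.range_mkQ
  have hs' : ∀ x, U.mkQ (s x) = x := fun x => LinearMap.congr_fun hs x
  have hsinj : Function.Injective s := Function.LeftInverse.injective hs'
  set q : (δ → K) →ₗ[K] (δ → K) := s ∘ₗ U.mkQ with hq
  have hq0 : ∀ v, q v = 0 ↔ v ∈ U := by
    intro v
    rw [hq, LinearMap.comp_apply, map_eq_zero_iff s hsinj, Submodule.mkQ_apply,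
      Submodule.Quotient.mk_eq_zero]
  have hqs : ∀ v, v - q v ∈ U := by
    intro v
    rw [← Submodule.Quotient.mk_eq_zero, Submodule.Quotient.mk_sub, sub_eq_zero]
    exact (hs' _).symm
  set φ : MvPolynomial δ K →ₐ[K] MvPolynomial δ K :=
    MvPolynomial.aeval fun c => lin K (q (Pi.single c 1)) with hφ
  have hφlin : ∀ v, φ (lin K v) = lin K (q v) := by
    intro v
    have : (φ.toLinearMap ∘ₗ lin K) = lin K ∘ₗ q := by
      refine LinearMap.pi_ext' fun c => LinearMap.ext_ring ?_
      simp only [LinearMap.comp_apply, LinearMap.single_apply, AlgHom.toLinearMap_apply]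
      rw [lin_single, hφ, MvPolynomial.aeval_X]
    exact LinearMap.congr_fun this v
  refine ⟨φ, le_antisymm ?_ ?_, fun v => ?_⟩
  · intro f hf
    have key : ∀ f, f - φ f ∈ Ideal.span (lin K '' (U : Set (δ → K))) := by
      intro f
      induction f using MvPolynomial.induction_on with
      | C a =>
        have : φ (MvPolynomial.C a) = MvPolynomial.C a := by rw [hφ, MvPolynomial.aeval_C]; rfl
        rw [this, sub_self]; exact Ideal.zero_mem _
      | add p q hp hq =>
        rw [map_add, add_sub_add_comm]; exact Ideal.add_mem _ hp hq
      | mul_X p c hp =>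
        have e : p * MvPolynomial.X c - φ (p * MvPolynomial.X c) =
            (p - φ p) * MvPolynomial.X c +
              φ p * (lin K (Pi.single c 1 - q (Pi.single c 1))) := by
          rw [map_mul, map_sub, lin_single, ← hφlin, lin_single]; ring
        rw [e]
        exact Ideal.add_mem _ (Ideal.mul_mem_right _ _ hp)
          (Ideal.mul_mem_left _ _ (Ideal.subset_span ⟨_, hqs _, rfl⟩))
    have := key f
    rwa [show φ f = 0 from hf, sub_zero] at this
  · rw [Ideal.span_le]
    rintro _ ⟨v, hv, rfl⟩
    change φ (lin K v) = 0
    rw [hφlin, (hq0 v).2 hv, map_zero]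
  · rw [hφlin, map_eq_zero_iff _ lin_injective, hq0]

end LinearForms

section Height

variable {δ : Type*} [Fintype δ] {A : Type*} [CommRing A] [IsDomain A]
  (K : Type*) [Field K] [Algebra A K] [IsFractionRing A K]

/-- Over a Noetherian local domain `A`, a prime of `A[u]` lying over `0`, contained in the
extension of the maximal ideal and containing `r` independent linear forms forces
`r + 1 ≤ dim A`, unless `A` is a field. -/
lemma add_one_le_height [IsNoetherianRing A] [IsLocalRing A]
    (hA : IsLocalRing.maximalIdeal A ≠ ⊥)
    (𝔮 : Ideal (MvPolynomial δ A)) [𝔮.IsPrime] (h0 : 𝔮.comap MvPolynomial.C = ⊥)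
    (hle : 𝔮 ≤ (IsLocalRing.maximalIdeal A).map MvPolynomial.C) {r : ℕ}
    (w : Fin r → δ → A) (hw : ∀ s, lin A (w s) ∈ 𝔮)
    (hli : LinearIndependent K fun s c => algebraMap A K (w s c)) :
    ((r + 1 : ℕ) : ℕ∞) ≤ (IsLocalRing.maximalIdeal A).height := by
  set ι : A →+* K := algebraMap A K
  have hι : Function.Injective ι := IsFractionRing.injective A K
  set m := IsLocalRing.maximalIdeal A
  set W : Fin r → δ → K := fun s c => ι (w s c) with hW
  set M : Ideal (MvPolynomial δ A) := m.map MvPolynomial.C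
  have hMker : M = RingHom.ker (MvPolynomial.map (σ := δ) (Ideal.Quotient.mk m)) := by
    rw [MvPolynomial.ker_map, Ideal.mk_ker]
  have : M.IsPrime := by rw [hMker]; exact RingHom.ker_isPrime _
  have hMc : M.comap MvPolynomial.C = m := by
    ext a
    rw [Ideal.mem_comap, MvPolynomial.mem_map_C_iff]
    constructor
    · intro h; simpa using h 0
    · intro h k
      rw [MvPolynomial.coeff_C]
      split_ifs
      · exact h
      · exact m.zero_mem
  -- upper bound
  have hup : M.height ≤ m.height := by
    obtain ⟨s, hs, hc⟩ := Ideal.exists_finset_card_eq_height_of_isNoetherianRing m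
    rw [← hc]
    have hcard : ((s.image (MvPolynomial.C (σ := δ))).card : ℕ∞) ≤ s.card := by
      exact_mod_cast Finset.card_image_le
    refine le_trans (Ideal.height_le_card_of_mem_minimalPrimes_span_finset ?_) hcard
    rw [Finset.coe_image, ← Ideal.map_span]
    refine ⟨⟨inferInstance, Ideal.map_mono hs.1.2⟩, ?_⟩
    rintro Q ⟨hQ, hQs⟩ hQM
    have h1 : m ≤ Q.comap MvPolynomial.C :=
      hs.2 ⟨Ideal.comap_isPrime _ _, Ideal.map_le_iff_le_comap.1 hQs⟩
        ((Ideal.comap_mono hQM).trans hMc.le)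
    exact Ideal.map_le_iff_le_comap.2 h1
  -- lower bound
  have hU : ∀ t : ℕ, t ≤ r → ∃ P : Ideal (MvPolynomial δ A), P.IsPrime ∧ (t : ℕ∞) ≤ P.height ∧
      ∃ φ : MvPolynomial δ K →ₐ[K] MvPolynomial δ K,
      RingHom.ker φ = Ideal.span (lin K '' (Submodule.span K (W '' {s | s.val < t}) : Set (δ → K))) ∧
      (∀ v, φ (lin K v) = 0 ↔ v ∈ Submodule.span K (W '' {s | s.val < t})) ∧
      P = RingHom.ker ((φ : MvPolynomial δ K →+* MvPolynomial δ K).comp (MvPolynomial.map ι)) := by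
    intro t
    induction t with
    | zero =>
      intro _
      obtain ⟨φ, h1, h2⟩ := exists_subst_ker (Submodule.span K (W '' {s | s.val < 0}))
      exact ⟨_, RingHom.ker_isPrime _, by simp, φ, h1, h2, rfl⟩
    | succ t ih =>
      intro ht
      obtain ⟨P, hP, hPh, φ, h1, h2, h3⟩ := ih (by omega)
      obtain ⟨ψ, k1, k2⟩ := exists_subst_ker (Submodule.span K (W '' {s | s.val < t + 1}))
      refine ⟨_, RingHom.ker_isPrime
        ((ψ : MvPolynomial δ K →+* MvPolynomial δ K).comp (MvPolynomial.map ι)), ?_, ψ, k1, k2, rfl⟩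
      set P' := RingHom.ker ((ψ : MvPolynomial δ K →+* MvPolynomial δ K).comp (MvPolynomial.map ι))
      have : P'.IsPrime := RingHom.ker_isPrime _
      have hlt : P < P' := by
        refine lt_of_le_of_ne ?_ ?_
        · intro f hf
          rw [h3, RingHom.mem_ker] at hf
          have hf' : MvPolynomial.map ι f ∈ RingHom.ker φ := hf
          rw [h1] at hf'
          have : MvPolynomial.map ι f ∈ RingHom.ker ψ := by
            rw [k1]
            refine Ideal.span_mono (Set.image_mono ?_) hf'
            exact Submodule.span_mono (Set.image_mono fun s (hs : s.val < t) => Nat.lt_succ_of_lt hs)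
          exact this
        · intro heq
          have hmem : lin A (w ⟨t, ht⟩) ∈ P' := by
            change ψ (MvPolynomial.map ι (lin A (w ⟨t, ht⟩))) = 0
            rw [map_lin]
            exact (k2 (W ⟨t, ht⟩)).2 (Submodule.subset_span ⟨⟨t, ht⟩, Nat.lt_succ_self t, rfl⟩)
          rw [← heq, h3] at hmem
          have hmem' : φ (MvPolynomial.map ι (lin A (w ⟨t, ht⟩))) = 0 := hmem
          rw [map_lin] at hmem'
          have := (h2 (W ⟨t, ht⟩)).1 hmem'
          exact hli.notMem_span_image (s := {s | s.val < t}) (x := ⟨t, ht⟩) (by simp) this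
      have := Ideal.height_add_one_le_of_lt_of_isPrime hlt
      refine le_trans ?_ this
      push_cast
      gcongr
  obtain ⟨P, hP, hPh, φ, h1, h2, h3⟩ := hU r le_rfl
  have hspan : Ideal.span (lin K '' (Submodule.span K (W '' {s | s.val < r}) : Set (δ → K))) =
      (Ideal.span (Set.range fun s => lin A (w s))).map (MvPolynomial.map ι) := by
    have hset : {s : Fin r | s.val < r} = Set.univ := by ext s; simp
    rw [hset, Set.image_univ, Ideal.map_span]
    refine le_antisymm (Ideal.span_le.2 ?_) (Ideal.span_le.2 ?_)
    · rintro _ ⟨v, hv, rfl⟩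
      refine Submodule.span_induction (p := fun v _ => lin K v ∈ Ideal.span _) ?_ ?_ ?_ ?_ hv
      · rintro _ ⟨s, rfl⟩
        refine Ideal.subset_span ⟨_, ⟨s, rfl⟩, ?_⟩
        exact map_lin ι (w s)
      · rw [map_zero]; exact Ideal.zero_mem _
      · intro a b _ _ ha hb; rw [map_add]; exact Ideal.add_mem _ ha hb
      · intro a b _ hb
        rw [map_smul, MvPolynomial.smul_eq_C_mul]; exact Ideal.mul_mem_left _ _ hb
    · rintro _ ⟨_, ⟨s, rfl⟩, rfl⟩
      refine Ideal.subset_span ⟨W s, Submodule.subset_span ⟨s, rfl⟩, (map_lin ι (w s)).symm⟩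
  have hPq : P ≤ 𝔮 := by
    intro f hf
    rw [h3, RingHom.mem_ker] at hf
    have hf' : MvPolynomial.map ι f ∈ RingHom.ker φ := hf
    rw [h1, hspan] at hf'
    let _ := MvPolynomial.algebraMvPolynomial (R := A) (S := K) (σ := δ)
    have hloc : IsLocalization ((nonZeroDivisors A).map (MvPolynomial.C (σ := δ)))
        (MvPolynomial δ K) := inferInstance
    obtain ⟨⟨⟨a, ha⟩, ⟨_, ⟨d, hd, rfl⟩⟩⟩, hx⟩ :=
      (IsLocalization.mem_map_algebraMap_iff ((nonZeroDivisors A).map (MvPolynomial.C (σ := δ)))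
        (MvPolynomial δ K)).1 hf'
    have hx' : MvPolynomial.map ι (f * MvPolynomial.C d) = MvPolynomial.map ι a := by
      rw [map_mul]; exact hx
    have hx2 := MvPolynomial.map_injective ι hι hx'
    have hin : f * MvPolynomial.C d ∈ 𝔮 := by
      rw [hx2]
      refine (Ideal.span_le.2 ?_) ha
      rintro _ ⟨s, rfl⟩
      exact hw s
    rcases Ideal.IsPrime.mem_or_mem inferInstance hin with h | h
    · exact h
    · exfalso
      have : d ∈ 𝔮.comap MvPolynomial.C := h
      rw [h0] at this
      exact nonZeroDivisors.ne_zero hd this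
  have hlt : P < M := by
    refine lt_of_le_of_ne (hPq.trans hle) ?_
    intro heq
    apply hA
    rw [eq_bot_iff, ← hMc, ← heq, ← h0]
    exact Ideal.comap_mono hPq
  have := Ideal.height_add_one_le_of_lt_of_isPrime hlt
  push_cast
  exact (add_le_add hPh le_rfl).trans (this.trans hup)

end Height

end LagFin

namespace LagFin

section Minors

variable {n : ℕ}

/-- The `(i+1)`-minor, with rows `ρ`, of the columns `v` followed by a variable last column. -/
noncomputable def minorL {R : Type*} [CommRing R] {i : ℕ} (v : Fin i → Fin n → R)
    (ρ : Fin (i + 1) → Fin n) : (Fin n → R) →ₗ[R] R :=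
  (Matrix.detRowAlternating.toMultilinearMap.toLinearMap
    (Fin.snoc (α := fun _ => Fin (i + 1) → R) (fun b a => v b (ρ a)) 0) (Fin.last i)) ∘ₗ
    LinearMap.funLeft R R ρ

lemma minorL_apply {R : Type*} [CommRing R] {i : ℕ} (v : Fin i → Fin n → R)
    (ρ : Fin (i + 1) → Fin n) (x : Fin n → R) :
    minorL v ρ x = (Matrix.of fun a b : Fin (i + 1) =>
      (Fin.snoc (α := fun _ => Fin n → R) v x : Fin (i + 1) → Fin n → R) b (ρ a)).det := by
  rw [← Matrix.det_transpose]
  change Matrix.det (Function.update _ _ _) = _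
  rw [Fin.update_snoc_last]
  congr 1
  funext b a
  refine Fin.lastCases ?_ (fun b => ?_) b
  · simp [LinearMap.funLeft, Matrix.transpose]
  · simp [Matrix.transpose]

lemma minorL_eq {R : Type*} [CommRing R] (i : ℕ) (v : ℕ → Fin n → R)
    (ρ : Fin (i + 1) → Fin n) :
    minorL (fun b : Fin i => v b) ρ (v i) =
      (Matrix.of fun a b : Fin (i + 1) => v b (ρ a)).det := by
  rw [minorL_apply]
  congr 1
  ext a b
  refine Fin.lastCases ?_ (fun b => ?_) b
  · simp
  · simp

lemma map_minorL {R S : Type*} [CommRing R] [CommRing S] (f : R →+* S) {i : ℕ}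
    (v : Fin i → Fin n → R) (ρ : Fin (i + 1) → Fin n) (x : Fin n → R) :
    f (minorL v ρ x) = minorL (fun b j => f (v b j)) ρ (fun j => f (x j)) := by
  rw [minorL_apply, minorL_apply, RingHom.map_det]
  congr 1
  ext a b
  refine Fin.lastCases ?_ (fun b => ?_) b
  · simp
  · simp

variable {K : Type*} [Field K]

lemma exists_minor_ne_zero {m : ℕ} (v : Fin m → Fin n → K) (h : LinearIndependent K v) :
    ∃ ρ : Fin m → Fin n, (Matrix.of fun a b : Fin m => v b (ρ a)).det ≠ 0 := by
  have hM : (Matrix.of v).rank = m := by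
    have := LinearIndependent.rank_matrix (M := Matrix.of v) h
    simpa using this
  have hT : Module.finrank K (Submodule.span K (Set.range (Matrix.of v).transpose.row)) = m := by
    rw [← Matrix.rank_eq_finrank_span_row, Matrix.rank_transpose, hM]
  obtain ⟨f, hf, -, hli⟩ :=
    Submodule.exists_fun_fin_finrank_span_eq K (Set.range (Matrix.of v).transpose.row)
  choose ρ hρ using fun a : Fin m => hf (Fin.cast hT.symm a)
  refine ⟨ρ, ?_⟩
  have hli' : LinearIndependent K (Matrix.of fun a b : Fin m => v b (ρ a)).row := by
    have e : (Matrix.of fun a b : Fin m => v b (ρ a)).row = f ∘ Fin.cast hT.symm := by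
      funext a
      rw [Function.comp_apply, ← hρ a]
      rfl
    rw [e]
    exact hli.comp _ (Fin.cast_injective _)
  have := Matrix.linearIndependent_rows_iff_isUnit.1 hli'
  exact ((Matrix.isUnit_iff_isUnit_det _).1 this).ne_zero

lemma linearIndependent_of_minor_ne_zero {m : ℕ} (v : Fin m → Fin n → K) (ρ : Fin m → Fin n)
    (h : (Matrix.of fun a b : Fin m => v b (ρ a)).det ≠ 0) : LinearIndependent K v := by
  have h1 : IsUnit (Matrix.of fun b a : Fin m => v b (ρ a)) := by
    rw [Matrix.isUnit_iff_isUnit_det, ← Matrix.det_transpose]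
    exact isUnit_iff_ne_zero.2 h
  have h2 := Matrix.linearIndependent_rows_iff_isUnit.2 h1
  exact LinearIndependent.of_comp (LinearMap.funLeft K K ρ) h2

lemma mem_span_of_minorL_eq_zero {i : ℕ} (v : Fin i → Fin n → K) (hv : LinearIndependent K v)
    (x : Fin n → K) (hx : ∀ ρ, minorL v ρ x = 0) : x ∈ Submodule.span K (Set.range v) := by
  by_contra hcon
  have hli : LinearIndependent K (Fin.snoc (α := fun _ => Fin n → K) v x) :=
    linearIndependent_finSnoc.2 ⟨hv, hcon⟩
  obtain ⟨ρ, hρ⟩ := exists_minor_ne_zero _ hli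
  exact hρ ((minorL_apply v ρ x).symm.trans (hx ρ))

lemma rank_le_finrank_minorL {δ : Type*} [Fintype δ] (D : Matrix (Fin n) δ K) {i : ℕ}
    (v : Fin i → Fin n → K) (hv : LinearIndependent K v) :
    D.rank ≤ Module.finrank K (Submodule.span K
      (Set.range fun (ρ : Fin (i + 1) → Fin n) (c : δ) => minorL v ρ fun j => D j c)) + i := by
  set L : Matrix (Fin (i + 1) → Fin n) δ K :=
    Matrix.of fun ρ c => minorL v ρ fun j => D j c with hL
  have h1 : Module.finrank K (Submodule.span K
      (Set.range fun (ρ : Fin (i + 1) → Fin n) (c : δ) => minorL v ρ fun j => D j c)) = L.rank := by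
    rw [Matrix.rank_eq_finrank_span_row]; rfl
  rw [h1]
  set T : (Fin n → K) →ₗ[K] ((Fin (i + 1) → Fin n) → K) := LinearMap.pi fun ρ => minorL v ρ
  have h2 : L.mulVecLin = T ∘ₗ D.mulVecLin := by
    refine LinearMap.pi_ext' fun c => LinearMap.ext_ring ?_
    funext ρ
    simp only [LinearMap.comp_apply, LinearMap.single_apply, Matrix.mulVecLin_apply,
      Matrix.mulVec_single_one]
    rfl
  have h3 : L.rank = Module.finrank K (D.mulVecLin.range.map T) := by
    rw [Matrix.rank, h2, LinearMap.range_comp]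
  have h4 := LinearMap.finrank_range_add_finrank_ker (T.domRestrict D.mulVecLin.range)
  rw [LinearMap.range_domRestrict] at h4
  have h5 : Module.finrank K (T.domRestrict D.mulVecLin.range).ker ≤ i := by
    rw [← Submodule.finrank_map_subtype_eq]
    have hle : (T.domRestrict D.mulVecLin.range).ker.map D.mulVecLin.range.subtype ≤
        Submodule.span K (Set.range v) := by
      rintro _ ⟨x, hx, rfl⟩
      refine mem_span_of_minorL_eq_zero v hv _ fun ρ => ?_
      exact congrFun (show T x.1 = 0 from hx) ρ
    refine (Submodule.finrank_mono hle).trans ((finrank_range_le_card v).trans ?_)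
    simp
  rw [h3]
  change Module.finrank K D.mulVecLin.range ≤ _
  omega

lemma minor_eq_zero_of_rank_lt {δ : Type*} [Fintype δ] (D : Matrix (Fin n) δ K) {m : ℕ}
    (h : D.rank < m) (r : Fin m → Fin n) (c : Fin m → δ) :
    (Matrix.of fun a b => D (r a) (c b)).det = 0 := by
  by_contra hne
  have h1 : IsUnit (D.submatrix r c) :=
    (Matrix.isUnit_iff_isUnit_det _).2 (isUnit_iff_ne_zero.2 hne)
  have h2 := Matrix.rank_of_isUnit _ h1
  have h3 := Matrix.rank_submatrix_le D r c
  rw [h2, Fintype.card_fin] at h3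
  omega

end Minors

end LagFin

namespace LagFin

section Generic

variable {n : ℕ} {δ : Type*} [Fintype δ] {A : Type*} [CommRing A] [IsNoetherianRing A]
  [IsLocalRing A]
  {B : Type*} [CommRing B] [IsDomain B] [IsNoetherianRing B] [IsLocalRing B]

open IsLocalRing in
lemma not_le_map_maximalIdeal (K : Type*) [Field K] [Algebra B K] [IsFractionRing B K]
    (π : A →+* B) (hπ : Function.Surjective π) (D : Matrix (Fin n) δ A) {i : ℕ} (v : Fin i → Fin n → A)
    (𝔮 : Ideal (MvPolynomial δ A)) [𝔮.IsPrime]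
    (hker : RingHom.ker π = 𝔮.comap MvPolynomial.C)
    (hp : 𝔮.comap MvPolynomial.C ≠ maximalIdeal A)
    (hv : ∃ ρ : Fin i → Fin n,
      (Matrix.of fun a b => v b (ρ a)).det ∉ 𝔮.comap MvPolynomial.C)
    (hdim : ∀ k ≤ n, (∀ (r : Fin (k + 1) → Fin n) (c : Fin (k + 1) → δ),
      (Matrix.of fun a b => D (r a) (c b)).det ∈ 𝔮.comap MvPolynomial.C) →
      ringKrullDim B + i ≤ k)
    (hl : ∀ ρ, lin A (fun c => minorL v ρ fun j => D j c) ∈ 𝔮) :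
    ¬ 𝔮 ≤ (maximalIdeal A).map MvPolynomial.C := by
  intro hle
  set p := 𝔮.comap (MvPolynomial.C (σ := δ)) with hpdef
  have hpp : p.IsPrime := Ideal.comap_isPrime _ _
  have hpm : p ≤ maximalIdeal A := le_maximalIdeal hpp.ne_top
  have hπ0 : ∀ a, π a = 0 ↔ a ∈ p := fun a => by rw [← hker]; rfl
  set ι : B →+* K := algebraMap B K
  have hι : Function.Injective ι := IsFractionRing.injective B K
  set κ : A →+* K := ι.comp π
  have hκ : ∀ a, κ a = 0 ↔ a ∈ p := by
    intro a
    rw [RingHom.comp_apply, map_eq_zero_iff ι hι]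
    exact hπ0 a
  have hmB : (maximalIdeal A).map π = maximalIdeal B := by
    refine IsLocalRing.eq_maximalIdeal ?_
    refine Ideal.IsMaximal.map_of_surjective_of_ker_le hπ ?_
    rw [hker]; exact hpm
  have hmB0 : maximalIdeal B ≠ ⊥ := by
    rw [← hmB]
    intro h0
    apply hp
    refine le_antisymm hpm fun a ha => ?_
    have : π a ∈ (maximalIdeal A).map π := Ideal.mem_map_of_mem _ ha
    rw [h0] at this
    exact (hπ0 a).1 this
  -- the matrix over the residue field of `p`
  set DK : Matrix (Fin n) δ K := D.map κ with hDK
  set vK : Fin i → Fin n → K := fun b j => κ (v b j)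
  have hvK : LinearIndependent K vK := by
    obtain ⟨ρ, hρ⟩ := hv
    refine linearIndependent_of_minor_ne_zero vK ρ ?_
    rw [← hκ, RingHom.map_det] at hρ
    exact hρ
  have hk : DK.rank ≤ n := by
    simpa using DK.rank_le_card_height
  have hd := hdim DK.rank hk fun r c => by
    rw [← hκ, RingHom.map_det]
    exact minor_eq_zero_of_rank_lt DK (Nat.lt_succ_self _) r c
  have hr := rank_le_finrank_minorL DK vK hvK
  obtain ⟨f, hf, -, hfli⟩ := Submodule.exists_fun_fin_finrank_span_eq K
    (Set.range fun (ρ : Fin (i + 1) → Fin n) (c : δ) => minorL vK ρ fun j => DK j c)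
  let r := Module.finrank K (Submodule.span K
    (Set.range fun (ρ : Fin (i + 1) → Fin n) (c : δ) => minorL vK ρ fun j => DK j c))
  choose ρ hρ using hf
  set φ : MvPolynomial δ A →+* MvPolynomial δ B := MvPolynomial.map π
  have hφ : Function.Surjective φ := MvPolynomial.map_surjective π hπ
  have hkφ : RingHom.ker φ ≤ 𝔮 := by
    rw [MvPolynomial.ker_map, hker]
    exact Ideal.map_le_iff_le_comap.2 le_rfl
  have : (𝔮.map φ).IsPrime := Ideal.map_isPrime_of_surjective hφ hkφ
  have hcm : (𝔮.map φ).comap φ = 𝔮 := by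
    rw [Ideal.comap_map_of_surjective' φ hφ, sup_eq_left]
    exact hkφ
  have hmem : ∀ x, φ x ∈ 𝔮.map φ → x ∈ 𝔮 := fun x hx => by
    rw [← hcm]; exact hx
  have key := add_one_le_height K hmB0 (𝔮.map φ) ?_ ?_
    (fun s c => π (minorL v (ρ s) fun j => D j c)) ?_ ?_ (r := r)
  · have h1 : ((r + 1 : ℕ) : WithBot ℕ∞) ≤ ringKrullDim B := by
      rw [← IsLocalRing.maximalIdeal_height_eq_ringKrullDim]
      exact_mod_cast key
    have h2 : ((r + 1 + i : ℕ) : WithBot ℕ∞) ≤ ((DK.rank : ℕ) : WithBot ℕ∞) := by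
      refine le_trans ?_ hd
      push_cast at h1 ⊢
      gcongr
    have h3 : r + 1 + i ≤ DK.rank := by exact_mod_cast h2
    omega
  · rw [eq_bot_iff]
    intro b hb
    obtain ⟨a, rfl⟩ := hπ b
    have : φ (MvPolynomial.C a) ∈ 𝔮.map φ := by
      rw [MvPolynomial.map_C]; exact hb
    exact (hπ0 a).2 (hmem _ this)
  · refine (Ideal.map_mono hle).trans ?_
    rw [Ideal.map_map, ← hmB, Ideal.map_map]
    refine le_of_eq ?_
    congr 1
    ext a
    simp [φ]
  · intro s
    rw [← map_lin]
    exact Ideal.mem_map_of_mem _ (hl _)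
  · have e : (fun (s : Fin r) (c : δ) => algebraMap B K (π (minorL v (ρ s) fun j => D j c))) = f := by
      funext s
      rw [← hρ]
      funext c
      exact map_minorL κ v (ρ s) _
    rw [e]
    exact hfli

end Generic

end LagFin

namespace LagFin

section GenericChoice

variable {n : ℕ} {δ : Type*} [Fintype δ]

lemma exists_avoid (S : Finset (Submodule ℂ (δ → ℂ))) (hS : ∀ U ∈ S, U < ⊤)
    (T : Finset (MvPolynomial δ ℂ)) (hT : ∀ g ∈ T, g ≠ 0) :
    ∃ u : δ → ℂ, (∀ U ∈ S, u ∉ U) ∧ ∀ g ∈ T, MvPolynomial.eval u g ≠ 0 := by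
  have h1 : ∀ U ∈ S, ∃ g : MvPolynomial δ ℂ, g ≠ 0 ∧ ∀ u ∈ U, MvPolynomial.eval u g = 0 := by
    intro U hU
    obtain ⟨f, hf, hle⟩ := Submodule.exists_le_ker_of_lt_top U (hS U hU)
    have hfe : ∀ u, f u = ∑ c, f (Pi.single c 1) * u c := by
      intro u
      conv_lhs => rw [← Finset.univ_sum_single u]
      rw [map_sum]
      refine Finset.sum_congr rfl fun c _ => ?_
      have : (Pi.single c (u c) : δ → ℂ) = u c • Pi.single c 1 := by
        rw [← Pi.single_smul, smul_eq_mul, mul_one]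
      rw [this, map_smul, smul_eq_mul, mul_comm]
    refine ⟨lin ℂ fun c => f (Pi.single c 1), ?_, ?_⟩
    · intro h0
      apply hf
      rw [map_eq_zero_iff _ lin_injective] at h0
      ext u
      change f (Pi.single u 1) = 0
      exact congrFun h0 u
    · intro u hu
      rw [eval_lin, ← hfe]
      exact hle hu
  choose! g hg0 hg using h1
  have hprod : (∏ U ∈ S, g U) * ∏ p ∈ T, p ≠ 0 :=
    mul_ne_zero (Finset.prod_ne_zero_iff.2 hg0) (Finset.prod_ne_zero_iff.2 hT)
  by_contra! hcon
  apply hprod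
  apply MvPolynomial.funext
  intro u
  rw [map_mul, map_prod, map_prod, map_zero]
  by_cases hu : ∀ U ∈ S, u ∉ U
  · obtain ⟨p, hp, h0⟩ := hcon u hu
    rw [Finset.prod_eq_zero hp h0, mul_zero]
  · push Not at hu
    obtain ⟨U, hU, huU⟩ := hu
    rw [Finset.prod_eq_zero hU (hg U hU u huU), zero_mul]

variable {A : Type*} [CommRing A] [IsNoetherianRing A] [IsLocalRing A] [Algebra ℂ A]

open IsLocalRing in
lemma exists_polys_forcing_maximal (ε : A →ₐ[ℂ] ℂ) (hε : ∀ a, ε a = 0 ↔ a ∈ maximalIdeal A)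
    {κ : Type*} (l : κ → δ → A) (I : Ideal A)
    (h : ∀ 𝔮 : Ideal (MvPolynomial δ A), 𝔮.IsPrime → I ≤ 𝔮.comap MvPolynomial.C →
      (∀ ρ, lin A (l ρ) ∈ 𝔮) → 𝔮.comap MvPolynomial.C ≠ maximalIdeal A →
      ¬ 𝔮 ≤ (maximalIdeal A).map MvPolynomial.C) :
    ∃ T : Finset (MvPolynomial δ ℂ), (∀ g ∈ T, g ≠ 0) ∧
      ∀ w : δ → ℂ, (∀ g ∈ T, MvPolynomial.eval w g ≠ 0) →
      ∀ p : Ideal A, p.IsPrime → I ≤ p → (∀ ρ, ∑ c, w c • l ρ c ∈ p) → p = maximalIdeal A := by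
  set J : Ideal (MvPolynomial δ A) :=
    I.map MvPolynomial.C ⊔ Ideal.span (Set.range fun ρ => lin A (l ρ)) with hJ
  have hker : RingHom.ker (MvPolynomial.map (σ := δ) (ε : A →+* ℂ)) =
      (maximalIdeal A).map MvPolynomial.C := by
    rw [MvPolynomial.ker_map]
    congr 1
    ext a
    exact hε a
  have hfin := J.finite_minimalPrimes_of_isNoetherianRing
  have hg : ∀ 𝔮 ∈ J.minimalPrimes, ¬ (maximalIdeal A).map MvPolynomial.C ≤ 𝔮 →
      ∃ g ∈ 𝔮, MvPolynomial.map (ε : A →+* ℂ) g ≠ 0 := by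
    intro 𝔮 h𝔮 hm
    have := h 𝔮 h𝔮.1.1 (Ideal.map_le_iff_le_comap.1 (le_sup_left.trans h𝔮.1.2))
      (fun ρ => h𝔮.1.2 (Ideal.mem_sup_right (Ideal.subset_span ⟨ρ, rfl⟩)))
      (fun heq => hm (Ideal.map_le_iff_le_comap.2 heq.ge))
    obtain ⟨g, hg, hg'⟩ := SetLike.not_le_iff_exists.1 this
    refine ⟨g, hg, fun h0 => hg' ?_⟩
    rw [← hker]
    exact h0
  choose! g hg1 hg2 using hg
  refine ⟨(hfin.toFinset.filter fun 𝔮 => ¬ (maximalIdeal A).map MvPolynomial.C ≤ 𝔮).image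
    fun 𝔮 => MvPolynomial.map (ε : A →+* ℂ) (g 𝔮), ?_, ?_⟩
  · intro p hp
    obtain ⟨𝔮, h𝔮, rfl⟩ := Finset.mem_image.1 hp
    rw [Finset.mem_filter, Set.Finite.mem_toFinset] at h𝔮
    exact hg2 𝔮 h𝔮.1 h𝔮.2
  · intro w hw p hp hIp hl
    have hpm : p ≤ maximalIdeal A := le_maximalIdeal hp.ne_top
    set ev : MvPolynomial δ A →+* A := MvPolynomial.eval fun c => algebraMap ℂ A (w c)
    have : (p.comap ev).IsPrime := Ideal.comap_isPrime _ _
    have hle : J ≤ p.comap ev := by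
      refine sup_le (Ideal.map_le_iff_le_comap.2 fun a ha => ?_) (Ideal.span_le.2 ?_)
      · change ev (MvPolynomial.C a) ∈ p
        rw [MvPolynomial.eval_C]
        exact hIp ha
      · rintro _ ⟨ρ, rfl⟩
        change ev (lin A (l ρ)) ∈ p
        rw [eval_lin]
        convert hl ρ using 2 with c
        rw [Algebra.smul_def, mul_comm]
    obtain ⟨𝔮, h𝔮, h𝔮p⟩ := Ideal.exists_minimalPrimes_le hle
    by_cases hm : (maximalIdeal A).map MvPolynomial.C ≤ 𝔮
    · refine le_antisymm hpm fun a ha => ?_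
      have : ev (MvPolynomial.C a) ∈ p := h𝔮p (hm (Ideal.mem_map_of_mem _ ha))
      rwa [MvPolynomial.eval_C] at this
    · exfalso
      refine hw _ (Finset.mem_image.2 ⟨𝔮, Finset.mem_filter.2
        ⟨(Set.Finite.mem_toFinset _).2 h𝔮, hm⟩, rfl⟩) ?_
      have h1 : ε (ev (g 𝔮)) = 0 := (hε _).2 (hpm (h𝔮p (hg1 𝔮 h𝔮 hm)))
      rw [← h1, MvPolynomial.eval_map]
      change MvPolynomial.eval₂ (ε : A →+* ℂ) w (g 𝔮) = (ε : A →+* ℂ) (ev (g 𝔮))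
      rw [← MvPolynomial.eval₂_id, MvPolynomial.hom_eval₂]
      congr 1
      funext c
      simp

/-- The ideal of minors of a matrix. -/
def minIdeal (D : Matrix (Fin n) δ A) (m : ℕ) : Ideal A :=
  Ideal.span {x | ∃ (r : Fin m → Fin n) (c : Fin m → δ),
    x = (Matrix.of fun a b => D (r a) (c b)).det}

lemma minIdeal_le_iff (D : Matrix (Fin n) δ A) (m : ℕ) (p : Ideal A) :
    minIdeal D m ≤ p ↔ ∀ (r : Fin m → Fin n) (c : Fin m → δ),
      (Matrix.of fun a b => D (r a) (c b)).det ∈ p := by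
  rw [minIdeal, Ideal.span_le]
  constructor
  · intro h r c; exact h ⟨r, c, rfl⟩
  · rintro h _ ⟨r, c, rfl⟩; exact h r c

/-- The linear combination of the entries of `z` with complex coefficients. -/
noncomputable def comb (z : δ → A) : (δ → ℂ) →ₗ[ℂ] A := Fintype.linearCombination ℂ z

lemma comb_apply (z : δ → A) (u : δ → ℂ) : comb z u = ∑ c, u c • z c :=
  Fintype.linearCombination_apply ..

lemma comb_single (z : δ → A) (c : δ) : comb z (Pi.single c 1) = z c := by
  rw [comb, Fintype.linearCombination_apply_single, one_smul]

open IsLocalRing in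
lemma exists_subspaces_forcing_notMem (z : δ → A) (hz : Ideal.span (Set.range z) = maximalIdeal A)
    (J : ℕ → Ideal A) :
    ∃ S : Finset (Submodule ℂ (δ → ℂ)), (∀ U ∈ S, U < ⊤) ∧
      ∀ w, (∀ U ∈ S, w ∉ U) → ∀ k ≤ n, ∀ p ∈ (J k).minimalPrimes, p ≠ maximalIdeal A →
        comb z w ∉ p := by
  have hfin := fun k => (J k).finite_minimalPrimes_of_isNoetherianRing
  refine ⟨(Finset.range (n + 1)).biUnion fun k =>
    ((hfin k).toFinset.filter fun p => p ≠ maximalIdeal A).image fun p =>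
      (p.restrictScalars ℂ).comap (comb z), ?_, ?_⟩
  · intro U hU
    obtain ⟨k, -, hU⟩ := Finset.mem_biUnion.1 hU
    obtain ⟨p, hp, rfl⟩ := Finset.mem_image.1 hU
    rw [Finset.mem_filter, Set.Finite.mem_toFinset] at hp
    rw [lt_top_iff_ne_top]
    intro htop
    apply hp.2
    refine le_antisymm (le_maximalIdeal hp.1.1.1.ne_top) ?_
    rw [← hz, Ideal.span_le]
    rintro _ ⟨c, rfl⟩
    have : (Pi.single c 1 : δ → ℂ) ∈ (p.restrictScalars ℂ).comap (comb z) := by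
      rw [htop]; trivial
    have h2 : comb z (Pi.single c 1) ∈ p := this
    rwa [comb_single] at h2
  · intro w hw k hk p hp hpm hmem
    refine hw ((p.restrictScalars ℂ).comap (comb z)) ?_ hmem
    refine Finset.mem_biUnion.2 ⟨k, Finset.mem_range.2 (by omega), Finset.mem_image.2
      ⟨p, Finset.mem_filter.2 ⟨(Set.Finite.mem_toFinset _).2 hp, hpm⟩, rfl⟩⟩

end GenericChoice

end LagFin

namespace LagFin

section GenericCoordinates

variable {n : ℕ} {δ : Type*} [Fintype δ] {A : Type*} [CommRing A] [IsNoetherianRing A]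
  [IsLocalRing A] [Algebra ℂ A]

/-- The column `∑ u_c D_c` of a matrix. -/
noncomputable def colv (D : Matrix (Fin n) δ A) (u : δ → ℂ) : Fin n → A := fun j => comb (D j) u

/-- Ideal of the `m`-minors using the first `m` of a sequence of columns. -/
def colMinors (v : ℕ → Fin n → A) (m : ℕ) : Ideal A :=
  Ideal.span (Set.range fun r : Fin m → Fin n => (Matrix.of fun a b : Fin m => v b (r a)).det)

lemma colMinors_le_iff (v : ℕ → Fin n → A) (m : ℕ) (p : Ideal A) :
    colMinors v m ≤ p ↔
      ∀ r : Fin m → Fin n, (Matrix.of fun a b : Fin m => v b (r a)).det ∈ p := by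
  rw [colMinors, Ideal.span_le]
  exact Set.range_subset_iff

lemma colMinors_congr {v v' : ℕ → Fin n → A} {m : ℕ} (h : ∀ b < m, v b = v' b) :
    colMinors v m = colMinors v' m := by
  unfold colMinors
  congr 2
  funext r
  congr 1
  ext a b
  simp [h b b.2]

lemma minorL_colv (D : Matrix (Fin n) δ A) {i : ℕ} (v : Fin i → Fin n → A)
    (ρ : Fin (i + 1) → Fin n) (w : δ → ℂ) :
    minorL v ρ (colv D w) = ∑ c, w c • minorL v ρ fun j => D j c := by
  have : colv D w = ∑ c, algebraMap ℂ A (w c) • fun j => D j c := by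
    funext j
    rw [colv, comb_apply, Finset.sum_apply]
    refine Finset.sum_congr rfl fun c _ => ?_
    simp [Algebra.smul_def]
  rw [this, map_sum]
  refine Finset.sum_congr rfl fun c _ => ?_
  rw [map_smul, algebraMap_smul]

open IsLocalRing

lemma exists_pow_le_of_forall_prime (J : Ideal A)
    (h : ∀ p : Ideal A, p.IsPrime → J ≤ p → p = maximalIdeal A) :
    ∃ N, maximalIdeal A ^ N ≤ J := by
  obtain ⟨N, hN⟩ := J.exists_radical_pow_le_of_fg (IsNoetherian.noetherian _)
  refine ⟨N, (Ideal.pow_right_mono ?_ N).trans hN⟩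
  rw [Ideal.radical_eq_sInf]
  refine le_sInf fun p hp => ?_
  rw [h p hp.2 hp.1]

lemma exists_generic_step (ε : A →ₐ[ℂ] ℂ) (hε : ∀ a, ε a = 0 ↔ a ∈ maximalIdeal A)
    (z : δ → A) (hz : Ideal.span (Set.range z) = maximalIdeal A)
    (D : Matrix (Fin n) δ A) (I : Ideal A) {i : ℕ} (hi : i < Fintype.card δ)
    (u : Fin i → δ → ℂ)
    (hv : ∀ p : Ideal A, p.IsPrime → I ≤ p → p ≠ maximalIdeal A →
      ∃ ρ : Fin i → Fin n, (Matrix.of fun a b => colv D (u b) (ρ a)).det ∉ p)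
    (hdim : ∀ k ≤ n, ∀ p : Ideal A, p.IsPrime → p ≠ maximalIdeal A → I ≤ p →
      minIdeal D (k + 1) ≤ p → ringKrullDim (A ⧸ p) + i ≤ k) :
    ∃ w : δ → ℂ, w ∉ Submodule.span ℂ (Set.range u) ∧
      (∀ p : Ideal A, p.IsPrime → I ≤ p →
        (∀ ρ, minorL (fun b => colv D (u b)) ρ (colv D w) ∈ p) → p = maximalIdeal A) ∧
      ∀ k ≤ n, ∀ p : Ideal A, p.IsPrime → p ≠ maximalIdeal A → I ≤ p → comb z w ∈ p →
        minIdeal D (k + 1) ≤ p → ringKrullDim (A ⧸ p) + (i + 1 : ℕ) ≤ k := by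
  obtain ⟨S, hS, hS'⟩ := exists_subspaces_forcing_notMem (n := n) z hz
    fun k => I ⊔ minIdeal D (k + 1)
  obtain ⟨T, hT, hT'⟩ := exists_polys_forcing_maximal ε hε
    (fun (ρ : Fin (i + 1) → Fin n) (c : δ) =>
      minorL (fun b => colv D (u b)) ρ fun j => D j c) I (by
    intro 𝔮 h𝔮 hI hl hne
    have hp : (𝔮.comap (MvPolynomial.C (σ := δ))).IsPrime := Ideal.comap_isPrime _ _
    have : IsLocalRing (A ⧸ 𝔮.comap (MvPolynomial.C (σ := δ))) :=
      IsLocalRing.of_surjective' _ Ideal.Quotient.mk_surjective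
    refine not_le_map_maximalIdeal (FractionRing (A ⧸ 𝔮.comap (MvPolynomial.C (σ := δ))))
      (Ideal.Quotient.mk _) Ideal.Quotient.mk_surjective D (fun b => colv D (u b)) 𝔮
      (Ideal.mk_ker ..) hne (hv _ hp hI hne) ?_ hl
    intro k hk hm
    exact hdim k hk _ hp hne hI ((minIdeal_le_iff ..).2 hm))
  have hspan : Submodule.span ℂ (Set.range u) < ⊤ := by
    refine Submodule.lt_top_of_finrank_lt_finrank ?_
    rw [Module.finrank_fintype_fun_eq_card]
    refine lt_of_le_of_lt (finrank_range_le_card u) ?_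
    simpa using hi
  obtain ⟨w, hw1, hw2⟩ := exists_avoid (insert (Submodule.span ℂ (Set.range u)) S)
    (by
      intro U hU
      rcases Finset.mem_insert.1 hU with rfl | hU
      · exact hspan
      · exact hS U hU) T hT
  refine ⟨w, hw1 _ (Finset.mem_insert_self _ _), ?_, ?_⟩
  · intro p hp hI hm
    refine hT' w hw2 p hp hI fun ρ => ?_
    rw [← minorL_colv]
    exact hm ρ
  · intro k hk p hp hpm hI hwp hmin
    obtain ⟨p0, hp0, hle⟩ := Ideal.exists_minimalPrimes_le (sup_le hI hmin)
    have hp0' : p0.IsPrime := hp0.1.1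
    have hp0m : p0 ≠ maximalIdeal A := by
      rintro rfl
      exact hpm (le_antisymm (le_maximalIdeal hp.ne_top) hle)
    have hnot := hS' w (fun U hU => hw1 U (Finset.mem_insert_of_mem hU)) k hk p0 hp0 hp0m
    have h1 := hdim k hk p0 hp0' hp0m (le_sup_left.trans hp0.1.2) (le_sup_right.trans hp0.1.2)
    have h2 := ringKrullDim_succ_le_of_surjective (Ideal.Quotient.factor hle)
      (Ideal.Quotient.factor_surjective hle) (r := Ideal.Quotient.mk p0 (comb z w))
      (by
        rw [mem_nonZeroDivisors_iff_ne_zero]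
        intro h0
        exact hnot (Ideal.Quotient.eq_zero_iff_mem.1 h0))
      (by
        rw [Ideal.Quotient.factor_mk]
        exact Ideal.Quotient.eq_zero_iff_mem.2 hwp)
    refine le_trans ?_ h1
    refine le_trans (le_of_eq ?_) (add_le_add h2 le_rfl)
    push_cast
    rw [add_assoc, add_comm (1 : WithBot ℕ∞)]

theorem exists_generic_coordinates (ε : A →ₐ[ℂ] ℂ) (hε : ∀ a, ε a = 0 ↔ a ∈ maximalIdeal A)
    (z : δ → A) (hz : Ideal.span (Set.range z) = maximalIdeal A)
    (D : Matrix (Fin n) δ A) (I : Ideal A) (hn : n ≤ Fintype.card δ)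
    (hdim : ∀ k ≤ n, ringKrullDim (A ⧸ (I ⊔ minIdeal D (k + 1))) ≤ k) :
    ∃ u : ℕ → δ → ℂ, LinearIndependent ℂ (fun b : Fin n => u b) ∧
      (∀ i < n, ∃ N, maximalIdeal A ^ N ≤
        I ⊔ Ideal.span ((fun b => comb z (u b)) '' {b | b < i}) ⊔
          colMinors (fun b => colv D (u b)) (i + 1)) ∧
      ∃ N, maximalIdeal A ^ N ≤ I ⊔ Ideal.span ((fun b => comb z (u b)) '' {b | b < n}) := by
  set Y : (ℕ → δ → ℂ) → ℕ → Ideal A := fun u i =>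
    I ⊔ Ideal.span ((fun b => comb z (u b)) '' {b | b < i}) with hY
  have hYc : ∀ (u u' : ℕ → δ → ℂ) i, (∀ b < i, u b = u' b) → Y u i = Y u' i := by
    intro u u' i h
    rw [hY]
    change I ⊔ _ = I ⊔ _
    congr 2
    exact Set.image_congr fun b (hb : b < i) => by rw [h b hb]
  have main : ∀ i ≤ n, ∃ u : ℕ → δ → ℂ, LinearIndependent ℂ (fun b : Fin i => u b) ∧
      (∀ b < i, ∀ p : Ideal A, p.IsPrime → Y u b ≤ p →
        colMinors (fun b => colv D (u b)) (b + 1) ≤ p → p = maximalIdeal A) ∧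
      (∀ k ≤ n, ∀ p : Ideal A, p.IsPrime → p ≠ maximalIdeal A → Y u i ≤ p →
        minIdeal D (k + 1) ≤ p → ringKrullDim (A ⧸ p) + i ≤ k) := by
    intro i
    induction i with
    | zero =>
      intro _
      refine ⟨fun _ => 0, linearIndependent_empty_type, by simp, ?_⟩
      intro k hk p hp _ hI hm
      have hle : I ⊔ minIdeal D (k + 1) ≤ p := sup_le (le_sup_left.trans hI) hm
      have := ringKrullDim_le_of_surjective (Ideal.Quotient.factor hle)
        (Ideal.Quotient.factor_surjective hle)
      simpa using this.trans (hdim k hk)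
    | succ i ih =>
      intro hi
      obtain ⟨u, hu1, hu2, hu3⟩ := ih (by omega)
      obtain ⟨w, hw1, hw2, hw3⟩ := exists_generic_step ε hε z hz D (Y u i)
        (i := i) (by omega) (fun b => u b) (by
          intro p hp hI hpm
          by_contra! hcon
          rcases Nat.eq_zero_or_pos i with rfl | hpos
          · have := hcon Fin.elim0
            rw [Matrix.det_fin_zero] at this
            exact hp.ne_top ((Ideal.eq_top_iff_one _).2 this)
          · obtain ⟨j, rfl⟩ : ∃ j, i = j + 1 := ⟨i - 1, by omega⟩
            refine hpm (hu2 j (by omega) p hp (le_trans ?_ hI) ((colMinors_le_iff ..).2 hcon))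
            refine sup_le_sup_left (Ideal.span_mono (Set.image_mono ?_)) _
            intro b (hb : b < j)
            exact Nat.lt_succ_of_lt hb) hu3
      set u' : ℕ → δ → ℂ := Function.update u i w with hu'
      have hlt : ∀ b < i, u' b = u b := fun b hb => by
        rw [hu', Function.update_of_ne (by omega)]
      have hii : u' i = w := by rw [hu', Function.update_self]
      have hYe : ∀ b ≤ i, Y u' b = Y u b := fun b hb =>
        hYc _ _ _ fun c hc => hlt c (by omega)
      refine ⟨u', ?_, ?_, ?_⟩
      · have e : (fun b : Fin (i + 1) => u' b) =
            Fin.snoc (α := fun _ => δ → ℂ) (fun b : Fin i => u b) w := by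
          funext b
          refine Fin.lastCases ?_ (fun b => ?_) b
          · simp [hii]
          · simp [hlt]
        rw [e]
        exact linearIndependent_finSnoc.2 ⟨hu1, hw1⟩
      · intro b hb p hp hYp hm
        rcases Nat.lt_succ_iff_lt_or_eq.1 hb with h | rfl
        · refine hu2 b h p hp (by rwa [← hYe b h.le]) ?_
          rw [colMinors_congr (v' := fun b => colv D (u' b))]
          · exact hm
          · intro c hc
            rw [hlt c (by omega)]
        · refine hw2 p hp (by rwa [← hYe b le_rfl]) fun ρ => ?_
          have := (colMinors_le_iff ..).1 hm ρ
          rw [← minorL_eq b (fun b => colv D (u' b)) ρ] at this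
          simpa [hii, hlt] using this
      · intro k hk p hp hpm hYp hm
        refine hw3 k hk p hp hpm ?_ ?_ hm
        · rw [← hYe i le_rfl]
          refine le_trans ?_ hYp
          refine sup_le_sup_left (Ideal.span_mono (Set.image_mono ?_)) _
          intro b (hb : b < i)
          exact Nat.lt_succ_of_lt hb
        · refine hYp (Ideal.mem_sup_right (Ideal.subset_span ⟨i, Nat.lt_succ_self i, ?_⟩))
          change comb z (u' i) = _
          rw [hii]
  obtain ⟨u, hu1, hu2, hu3⟩ := main n le_rfl
  refine ⟨u, hu1, fun i hi => exists_pow_le_of_forall_prime _ fun p hp hle =>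
    hu2 i hi p hp (le_sup_left.trans hle) (le_sup_right.trans hle),
    exists_pow_le_of_forall_prime _ fun p hp hle => ?_⟩
  by_contra hpm
  have hmin : minIdeal D (n + 1) ≤ p := by
    rw [minIdeal_le_iff]
    intro r c
    obtain ⟨a, b, hab, hr⟩ := Fintype.exists_ne_map_eq_of_card_lt r (by simp)
    rw [Matrix.det_zero_of_row_eq hab]
    · exact p.zero_mem
    · funext e
      simp [hr]
  have h1 := hu3 n le_rfl p hp hpm hle hmin
  have hlm : p ≤ maximalIdeal A := le_maximalIdeal hp.ne_top
  obtain ⟨x, hx, hxp⟩ := SetLike.exists_of_lt (lt_of_le_of_ne hlm hpm)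
  have h2 := ringKrullDim_succ_le_of_surjective (Ideal.Quotient.factor hlm)
    (Ideal.Quotient.factor_surjective hlm) (r := Ideal.Quotient.mk p x)
    (by
      rw [mem_nonZeroDivisors_iff_ne_zero]
      exact fun h0 => hxp (Ideal.Quotient.eq_zero_iff_mem.1 h0))
    (by
      rw [Ideal.Quotient.factor_mk]
      exact Ideal.Quotient.eq_zero_iff_mem.2 hx)
  have h3 : (0 : WithBot ℕ∞) ≤ ringKrullDim (A ⧸ maximalIdeal A) := by
    have := Ideal.Quotient.nontrivial_iff.2 (maximalIdeal.isMaximal A).ne_top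
    exact ringKrullDim_nonneg_of_nontrivial
  have h4 : ((0 + 1 + n : ℕ) : WithBot ℕ∞) ≤ ((n : ℕ) : WithBot ℕ∞) := by
    refine le_trans ?_ h1
    push_cast
    gcongr
    exact (add_le_add h3 le_rfl).trans h2
  have : 0 + 1 + n ≤ n := by exact_mod_cast h4
  omega

end GenericCoordinates

end LagFin

namespace LagFin

open scoped ENNReal NNReal

section Evaluation

variable {ι : Type*} [Fintype ι]

/-- Total degree of an exponent. -/
def tdeg (α : ι →₀ ℕ) : ℕ := ∑ i, α i

/-- Exponents of total degree `n`. -/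
noncomputable def degSet (n : ℕ) : Finset (ι →₀ ℕ) := Finset.univ.finsuppAntidiag n

lemma mem_degSet {n : ℕ} {α : ι →₀ ℕ} : α ∈ degSet n ↔ tdeg α = n := by
  simp [degSet, Finset.mem_finsuppAntidiag, tdeg]

/-- The value of a monomial. -/
def mval {R : Type*} [CommMonoid R] (x : ι → R) (α : ι →₀ ℕ) : R := ∏ i, x i ^ α i

lemma mval_add {R : Type*} [CommMonoid R] (x : ι → R) (α β : ι →₀ ℕ) :
    mval x (α + β) = mval x α * mval x β := by
  simp [mval, pow_add, Finset.prod_mul_distrib]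

lemma mval_zero {R : Type*} [CommMonoid R] (x : ι → R) : mval x 0 = 1 := by simp [mval]

lemma mval_single {R : Type*} [CommMonoid R] (x : ι → R) (i : ι) :
    mval x (Finsupp.single i 1) = x i := by
  rw [mval, Finset.prod_eq_single i]
  · simp
  · intro b _ hb; simp [Ne.symm hb]
  · simp

lemma norm_mval_le {x : ι → ℂ} {r : ℝ} (hx : ‖x‖ ≤ r) (α : ι →₀ ℕ) :
    ‖mval x α‖ ≤ r ^ tdeg α := by
  rw [mval, norm_prod, tdeg, ← Finset.prod_pow_eq_pow_sum]
  refine Finset.prod_le_prod (fun _ _ => norm_nonneg _) fun i _ => ?_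
  rw [norm_pow]
  exact pow_le_pow_left₀ (norm_nonneg _) ((norm_le_pi_norm x i).trans hx) _

lemma hasSum_degSet {M : Type*} [AddCommMonoid M] [TopologicalSpace M] [ContinuousAdd M]
    [RegularSpace M] {g : (ι →₀ ℕ) → M} {a : M} (h : HasSum g a) :
    HasSum (fun n => ∑ α ∈ degSet n, g α) a := by
  have h1 : HasSum (g ∘ Equiv.sigmaFiberEquiv (tdeg (ι := ι))) a :=
    (Equiv.hasSum_iff _).2 h
  refine HasSum.sigma h1 fun n => ?_
  have h2 := (degSet (ι := ι) n).hasSum g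
  let e : {α : ι →₀ ℕ // tdeg α = n} ≃ {α // α ∈ degSet (ι := ι) n} :=
    Equiv.subtypeEquivRight fun α => mem_degSet.symm
  exact (Equiv.hasSum_iff e).2 h2

lemma exists_summable_cf (f : Cv ι) :
    ∃ r : ℝ≥0, 0 < r ∧ Summable fun α => ‖cf α f‖ * (r : ℝ) ^ tdeg α := by
  obtain ⟨w, hw, hf⟩ := f.2
  obtain ⟨r, hr, hrw⟩ : ∃ r : ℝ≥0, 0 < r ∧ ∀ i, r ≤ w i := by
    rcases isEmpty_or_nonempty ι with h | h
    · exact ⟨1, one_pos, fun i => (h.false i).elim⟩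
    · obtain ⟨i, hi⟩ := Finite.exists_min w
      exact ⟨w i, hw i, hi⟩
  refine ⟨r, hr, ?_⟩
  have h1 : pnorm (fun _ => r) f.1 ≠ ⊤ := ne_top_of_le_ne_top hf (pnorm_mono hrw _)
  have h2 : ∑' α, ((‖cf α f‖₊ * r ^ tdeg α : ℝ≥0) : ℝ≥0∞) ≠ ⊤ := by
    refine ne_of_eq_of_ne (tsum_congr fun α => ?_) h1
    rw [ENNReal.coe_mul, wt, Finset.prod_pow_eq_pow_sum]
    rfl
  have h3 := ENNReal.tsum_coe_ne_top_iff_summable.1 h2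
  have h4 := NNReal.summable_coe.2 h3
  refine h4.congr fun α => ?_
  simp

lemma exists_cf_of_summable {c : (ι →₀ ℕ) → ℂ} {r : ℝ≥0} (hr : 0 < r)
    (h : Summable fun α => ‖c α‖ * (r : ℝ) ^ tdeg α) : ∃ f : Cv ι, ∀ α, cf α f = c α := by
  refine ⟨⟨fun α => c α, fun _ => r, fun _ => hr, ?_⟩, fun _ => rfl⟩
  have h3 : Summable fun α : ι →₀ ℕ => (‖c α‖₊ * r ^ tdeg α : ℝ≥0) := by
    refine NNReal.summable_coe.1 (h.congr fun α => ?_)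
    simp
  have h2 := ENNReal.tsum_coe_ne_top_iff_summable.2 h3
  refine ne_of_eq_of_ne (tsum_congr fun α => ?_) h2
  rw [ENNReal.coe_mul, wt, Finset.prod_pow_eq_pow_sum]
  rfl

lemma summable_mval {c : (ι →₀ ℕ) → ℂ} {r : ℝ}
    (h : Summable fun α => ‖c α‖ * r ^ tdeg α) {x : ι → ℂ} (hx : ‖x‖ ≤ r) :
    Summable fun α => ‖c α * mval x α‖ := by
  refine Summable.of_nonneg_of_le (fun _ => norm_nonneg _) (fun α => ?_) h
  rw [norm_mul]
  gcongr
  exact norm_mval_le hx α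

/-- A multilinear map whose diagonal is a given monomial. -/
lemma exists_multilinear (α : ι →₀ ℕ) {n : ℕ} (hn : tdeg α = n) :
    ∃ M : ContinuousMultilinearMap ℂ (fun _ : Fin n => ι → ℂ) ℂ, ‖M‖ ≤ 1 ∧
      ∀ x, M (fun _ => x) = mval x α := by
  have hl : (Finsupp.toMultiset α).toList.length = n := by
    rw [Multiset.length_toList, Finsupp.card_toMultiset, ← hn, tdeg, Finsupp.sum_fintype _ _ (by simp)]
    rfl
  have hprod : ∀ x : ι → ℂ, ((Finsupp.toMultiset α).toList.map x).prod = mval x α := by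
    intro x
    rw [← Multiset.prod_coe, ← Multiset.map_coe, Multiset.coe_toList, Finsupp.toMultiset_map,
      Finsupp.prod_toMultiset, Finsupp.prod_mapDomain_index (by simp) (by simp [pow_add]),
      Finsupp.prod_fintype _ _ (by simp), mval]
  generalize (Finsupp.toMultiset α).toList = l at hl hprod
  subst hl
  refine ⟨(ContinuousMultilinearMap.mkPiAlgebra ℂ (Fin l.length) ℂ).compContinuousLinearMap
    fun j => ContinuousLinearMap.proj (l.get j), ?_, ?_⟩
  · refine ContinuousMultilinearMap.opNorm_le_bound zero_le_one fun m => ?_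
    rw [one_mul, ContinuousMultilinearMap.compContinuousLinearMap_apply,
      ContinuousMultilinearMap.mkPiAlgebra_apply, norm_prod]
    exact Finset.prod_le_prod (fun _ _ => norm_nonneg _) fun j _ => norm_le_pi_norm (m j) _
  · intro x
    rw [ContinuousMultilinearMap.compContinuousLinearMap_apply,
      ContinuousMultilinearMap.mkPiAlgebra_apply, ← hprod]
    exact Fin.prod_univ_fun_getElem l x

/-- A convergent power series defines an analytic function. -/
lemma exists_hasFPowerSeriesOnBall {c : (ι →₀ ℕ) → ℂ} {r : ℝ≥0} (hr : 0 < r)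
    (h : Summable fun α => ‖c α‖ * (r : ℝ) ^ tdeg α) :
    ∃ p : FormalMultilinearSeries ℂ (ι → ℂ) ℂ,
      (∀ n x, p n (fun _ => x) = ∑ α ∈ degSet n, c α * mval x α) ∧
      HasFPowerSeriesOnBall (fun x => ∑' α, c α * mval x α) p 0 r := by
  choose! M hM1 hM2 using fun (n : ℕ) (α : ι →₀ ℕ) (hα : α ∈ degSet n) =>
    exists_multilinear α (mem_degSet.1 hα)
  let p : FormalMultilinearSeries ℂ (ι → ℂ) ℂ := fun n => ∑ α ∈ degSet n, c α • M n α
  have hp : ∀ n x, p n (fun _ => x) = ∑ α ∈ degSet n, c α * mval x α := by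
    intro n x
    change (∑ α ∈ degSet n, c α • M n α) _ = _
    rw [sum_apply]
    refine Finset.sum_congr rfl fun α hα => ?_
    rw [smul_apply, hM2 n α hα, smul_eq_mul]
  refine ⟨p, hp, ⟨?_, by exact_mod_cast hr, ?_⟩⟩
  · refine p.le_radius_of_summable_norm ?_
    refine Summable.of_nonneg_of_le (fun n => by positivity) (fun n => ?_)
      (hasSum_degSet h.hasSum).summable
    have : ‖p n‖ ≤ ∑ α ∈ degSet n, ‖c α‖ := by
      refine (norm_sum_le _ _).trans (Finset.sum_le_sum fun α hα => ?_)
      rw [norm_smul]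
      exact mul_le_of_le_one_right (norm_nonneg _) (hM1 n α hα)
    calc ‖p n‖ * (r : ℝ) ^ n ≤ (∑ α ∈ degSet n, ‖c α‖) * (r : ℝ) ^ n := by gcongr
      _ = ∑ α ∈ degSet n, ‖c α‖ * (r : ℝ) ^ tdeg α := by
        rw [Finset.sum_mul]
        exact Finset.sum_congr rfl fun α hα => by rw [mem_degSet.1 hα]
  · intro y hy
    have hy' : ‖y‖ ≤ r := by
      have : ‖y‖ < (r : ℝ) := by simpa [Metric.mem_eball, edist_zero_right] using hy
      exact this.le
    have h1 := (summable_mval h hy').of_norm.hasSum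
    simp only [hp, zero_add]
    exact hasSum_degSet h1

end Evaluation

end LagFin

namespace LagFin

open scoped ENNReal NNReal

section Evaluation

variable {ι : Type*} [Fintype ι]

/-- The sum of a convergent power series. -/
noncomputable def evf (f : Cv ι) (x : ι → ℂ) : ℂ := ∑' α, cf α f * mval x α

lemma eventually_summable_evf (f : Cv ι) :
    ∀ᶠ x in 𝓝 (0 : ι → ℂ), Summable fun α => ‖cf α f * mval x α‖ := by
  obtain ⟨r, hr, h⟩ := exists_summable_cf f
  filter_upwards [Metric.closedBall_mem_nhds (0 : ι → ℂ) (by exact_mod_cast hr : (0 : ℝ) < r)]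
    with x hx
  exact summable_mval h (by simpa using hx)

lemma analyticAt_evf (f : Cv ι) : AnalyticAt ℂ (evf f) 0 := by
  obtain ⟨r, hr, h⟩ := exists_summable_cf f
  obtain ⟨p, -, hp⟩ := exists_hasFPowerSeriesOnBall hr h
  exact hp.analyticAt

lemma evf_add (f g : Cv ι) : evf (f + g) =ᶠ[𝓝 0] evf f + evf g := by
  filter_upwards [eventually_summable_evf f, eventually_summable_evf g] with x hf hg
  simp only [evf, map_add, add_mul, Pi.add_apply]
  exact hf.of_norm.tsum_add hg.of_norm

lemma tsum_mval_mul {a b : (ι →₀ ℕ) → ℂ} {x : ι → ℂ} 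
    (hf : Summable fun α => ‖a α * mval x α‖) (hg : Summable fun α => ‖b α * mval x α‖) :
    (∑' α, a α * mval x α) * (∑' α, b α * mval x α) =
      ∑' α, (∑ q ∈ Finset.HasAntidiagonal.antidiagonal α, a q.1 * b q.2) * mval x α := by
  have h1 : Summable fun q : (ι →₀ ℕ) × (ι →₀ ℕ) => a q.1 * mval x q.1 * (b q.2 * mval x q.2) :=
    summable_mul_of_summable_norm (f := fun α => a α * mval x α)
      (g := fun α => b α * mval x α) hf hg
  have h2 := Summable.tsum_mul_tsum_eq_tsum_sum_antidiagonal
    (f := fun α => a α * mval x α) (g := fun α => b α * mval x α) hf.of_norm hg.of_norm h1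
  refine h2.trans ?_
  refine tsum_congr fun α => ?_
  rw [Finset.sum_mul]
  refine Finset.sum_congr rfl fun q hq => ?_
  rw [← Finset.HasAntidiagonal.mem_antidiagonal.1 hq, mval_add]
  ring
lemma evf_mul (f g : Cv ι) : evf (f * g) =ᶠ[𝓝 0] evf f * evf g := by
  filter_upwards [eventually_summable_evf f, eventually_summable_evf g] with x hf hg
  rw [Pi.mul_apply, evf, evf, evf, tsum_mval_mul hf hg]
  exact tsum_congr fun α => by rw [cf_mul]

lemma evf_mon (α : ι →₀ ℕ) (x : ι → ℂ) : evf (mon α) x = mval x α := by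
  rw [evf, tsum_eq_single α]
  · simp [cf_mon]
  · intro β hβ
    simp [cf_mon, hβ]

lemma evf_algebraMap (c : ℂ) (x : ι → ℂ) : evf (algebraMap ℂ (Cv ι) c) x = c := by
  rw [evf, tsum_eq_single 0, mval_zero]
  · rw [Algebra.algebraMap_eq_smul_one, map_smul, ← mon_zero, cf_mon]; simp
  · intro β hβ
    rw [Algebra.algebraMap_eq_smul_one, map_smul, ← mon_zero, cf_mon]; simp [hβ]

lemma eq_zero_of_evf (f : Cv ι) (h : evf f =ᶠ[𝓝 0] 0) : f = 0 := by
  obtain ⟨r, hr, hs⟩ := exists_summable_cf f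
  obtain ⟨p, hp1, hp⟩ := exists_hasFPowerSeriesOnBall hr hs
  have h0 : HasFPowerSeriesAt (0 : (ι → ℂ) → ℂ) p 0 := hp.hasFPowerSeriesAt.congr h
  refine Cv_ext fun α => ?_
  let P : MvPolynomial ι ℂ := ∑ β ∈ degSet (tdeg α), MvPolynomial.monomial β (cf β f)
  have hP : P = 0 := by
    refine MvPolynomial.funext fun x => ?_
    have h1 := h0.apply_eq_zero (tdeg α) x
    rw [hp1] at h1
    rw [map_sum, map_zero, ← h1]
    refine Finset.sum_congr rfl fun β _ => ?_
    rw [MvPolynomial.eval_monomial, Finsupp.prod_fintype _ _ (by simp), mval]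
  have h2 : P.coeff α = cf α f := by
    rw [MvPolynomial.coeff_sum, Finset.sum_eq_single α]
    · simp
    · intro β _ hβ; simp [MvPolynomial.coeff_monomial, hβ]
    · intro h; exact absurd (mem_degSet.2 rfl) h
  rw [← h2, hP]
  simp

/-- The exponent counting the values of a tuple. -/
noncomputable def cnt {n : ℕ} (s : Fin n → ι) : ι →₀ ℕ := ∑ j, Finsupp.single (s j) 1

lemma tdeg_cnt {n : ℕ} (s : Fin n → ι) : tdeg (cnt s) = n := by
  have h : ∀ α : ι →₀ ℕ, tdeg α = Finsupp.degree α := fun α => by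
    rw [Finsupp.degree_eq_sum, tdeg]
  rw [h, cnt, map_sum]
  simp

lemma mval_cnt {n : ℕ} (s : Fin n → ι) (x : ι → ℂ) : mval x (cnt s) = ∏ j, x (s j) := by
  have h : ∀ t : Finset (Fin n), mval x (∑ j ∈ t, Finsupp.single (s j) 1) = ∏ j ∈ t, x (s j) := by
    intro t
    induction t using Finset.induction_on with
    | empty => simp [mval_zero]
    | insert a t ha ih => rw [Finset.sum_insert ha, Finset.prod_insert ha, mval_add, mval_single, ih]
  exact h _

/-- The coefficients of the homogeneous polynomial of a multilinear map. -/
noncomputable def mcoef {n : ℕ} (M : ContinuousMultilinearMap ℂ (fun _ : Fin n => ι → ℂ) ℂ)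
    (α : ι →₀ ℕ) : ℂ :=
  ∑ s : Fin n → ι with cnt s = α, M fun j => Pi.single (s j) 1

lemma sum_mcoef {n : ℕ} (M : ContinuousMultilinearMap ℂ (fun _ : Fin n => ι → ℂ) ℂ)
    (x : ι → ℂ) : ∑ α ∈ degSet n, mcoef M α * mval x α = M fun _ => x := by
  have hx : (fun _ : Fin n => x) = fun _ => ∑ i, x i • (Pi.single i 1 : ι → ℂ) := by
    funext _
    funext i
    simp [Finset.sum_apply, Pi.single_apply]
  rw [hx, ContinuousMultilinearMap.map_sum,
    ← Finset.sum_fiberwise_of_maps_to (t := degSet n) (g := cnt)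
      (fun s _ => mem_degSet.2 (tdeg_cnt s))]
  refine Finset.sum_congr rfl fun α _ => ?_
  rw [mcoef, Finset.sum_mul]
  refine Finset.sum_congr rfl fun s hs => ?_
  rw [ContinuousMultilinearMap.map_smul_univ, ← (Finset.mem_filter.1 hs).2, mval_cnt,
    smul_eq_mul, mul_comm]

lemma sum_norm_mcoef {n : ℕ} (M : ContinuousMultilinearMap ℂ (fun _ : Fin n => ι → ℂ) ℂ) :
    ∑ α ∈ degSet n, ‖mcoef M α‖ ≤ ‖M‖ * (Fintype.card ι : ℝ) ^ n := by
  calc ∑ α ∈ degSet n, ‖mcoef M α‖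
      ≤ ∑ α ∈ degSet n, ∑ s : Fin n → ι with cnt s = α, ‖M‖ := by
        refine Finset.sum_le_sum fun α _ => (norm_sum_le _ _).trans
          (Finset.sum_le_sum fun s _ => (M.le_opNorm _).trans ?_)
        refine mul_le_of_le_one_right (norm_nonneg _) (Finset.prod_le_one (fun _ _ => norm_nonneg _)
          fun j _ => ?_)
        rw [Pi.norm_single]; simp
    _ = ∑ s : Fin n → ι, ‖M‖ :=
        Finset.sum_fiberwise_of_maps_to (fun s _ => mem_degSet.2 (tdeg_cnt s)) _
    _ = ‖M‖ * (Fintype.card ι : ℝ) ^ n := by simp [mul_comm]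

lemma summable_of_degSet {g : (ι →₀ ℕ) → ℝ} (hg : ∀ α, 0 ≤ g α)
    (h : Summable fun n => ∑ α ∈ degSet n, g α) : Summable g := by
  rw [← (Equiv.sigmaFiberEquiv (tdeg (ι := ι))).summable_iff]
  have key : ∀ n, HasSum (fun y : {α : ι →₀ ℕ // tdeg α = n} => g y) (∑ α ∈ degSet n, g α) := by
    intro n
    have h2 := (degSet (ι := ι) n).hasSum g
    let e : {α : ι →₀ ℕ // tdeg α = n} ≃ {α // α ∈ degSet (ι := ι) n} :=
      Equiv.subtypeEquivRight fun α => mem_degSet.symm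
    exact (Equiv.hasSum_iff e).2 h2
  refine (summable_sigma_of_nonneg fun _ => hg _).2 ⟨fun n => (key n).summable, ?_⟩
  exact h.congr fun n => ((key n).tsum_eq).symm

/-- Every analytic function is the sum of a convergent power series. -/
lemma exists_evf_eq {f : (ι → ℂ) → ℂ} (hf : AnalyticAt ℂ f 0) : ∃ g : Cv ι, evf g =ᶠ[𝓝 0] f := by
  obtain ⟨p, R, hp⟩ := hf
  obtain ⟨r, hr0, hr⟩ := ENNReal.lt_iff_exists_nnreal_btwn.1 (hp.r_pos.trans_le hp.r_le)
  have hr0' : 0 < r := by exact_mod_cast hr0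
  set ρ : ℝ≥0 := r / (Fintype.card ι + 1) with hρ
  have hρ0 : 0 < ρ := by positivity
  have hρ' : (Fintype.card ι : ℝ) * ρ ≤ r := by
    rw [hρ, NNReal.coe_div]
    push_cast
    rw [mul_div_assoc', div_le_iff₀ (by positivity)]
    nlinarith [r.coe_nonneg]
  let c : (ι →₀ ℕ) → ℂ := fun α => mcoef (p (tdeg α)) α
  have hc : ∀ n, ∀ α ∈ degSet n, c α = mcoef (p n) α := by
    intro n α hα
    obtain rfl := mem_degSet.1 hα
    rfl
  have hs : Summable fun α => ‖c α‖ * (ρ : ℝ) ^ tdeg α := by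
    refine summable_of_degSet (fun α => by positivity) ?_
    refine Summable.of_nonneg_of_le (fun n => Finset.sum_nonneg fun _ _ => by positivity)
      (fun n => ?_) (p.summable_norm_mul_pow hr)
    calc ∑ α ∈ degSet n, ‖c α‖ * (ρ : ℝ) ^ tdeg α
        = (∑ α ∈ degSet n, ‖mcoef (p n) α‖) * (ρ : ℝ) ^ n := by
          rw [Finset.sum_mul]
          exact Finset.sum_congr rfl fun α hα => by rw [hc n α hα, mem_degSet.1 hα]
      _ ≤ (‖p n‖ * (Fintype.card ι : ℝ) ^ n) * (ρ : ℝ) ^ n := by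
          gcongr
          exact sum_norm_mcoef _
      _ = ‖p n‖ * ((Fintype.card ι : ℝ) * ρ) ^ n := by rw [mul_pow, mul_assoc]
      _ ≤ ‖p n‖ * (r : ℝ) ^ n := by gcongr
  obtain ⟨g, hg⟩ := exists_cf_of_summable hρ0 hs
  refine ⟨g, ?_⟩
  filter_upwards [eventually_summable_evf g, hp.eventually_hasSum] with x hx hx'
  have h1 := hasSum_degSet hx.of_norm.hasSum
  have h2 : (fun n => ∑ α ∈ degSet n, cf α g * mval x α) = fun n => p n fun _ => x := by
    funext n
    rw [← sum_mcoef]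
    exact Finset.sum_congr rfl fun α hα => by rw [hg, hc n α hα]
  rw [h2] at h1
  rw [zero_add] at hx'
  exact h1.unique hx'

end Evaluation

end LagFin

namespace LagFin

section Germs

variable {V W : Type*} [NormedAddCommGroup V] [NormedSpace ℂ V]
  [NormedAddCommGroup W] [NormedSpace ℂ W]

/-- The germ of an analytic function. -/
noncomputable def germ (g : V → ℂ) (h : AnalyticAt ℂ g 0) : Og V := ⟨↑g, g, h, rfl⟩

lemma germ_eq_iff {f g : V → ℂ} {hf : AnalyticAt ℂ f 0} {hg : AnalyticAt ℂ g 0} :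
    germ f hf = germ g hg ↔ f =ᶠ[𝓝 0] g :=
  Subtype.ext_iff.trans Germ.coe_eq

lemma germ_rep (f : Og V) : germ (Og.rep f) (Og.rep_spec f).1 = f :=
  Subtype.ext (Og.rep_spec f).2.symm

lemma rep_germ {f : V → ℂ} (hf : AnalyticAt ℂ f 0) : Og.rep (germ f hf) =ᶠ[𝓝 0] f :=
  germ_eq_iff.1 (germ_rep (germ f hf))

lemma exists_germ (f : Og V) : ∃ g hg, f = germ g hg := ⟨_, _, (germ_rep f).symm⟩

lemma germ_add {f g : V → ℂ} (hf : AnalyticAt ℂ f 0) (hg : AnalyticAt ℂ g 0) :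
    germ f hf + germ g hg = germ (f + g) (hf.add hg) := rfl

lemma germ_mul {f g : V → ℂ} (hf : AnalyticAt ℂ f 0) (hg : AnalyticAt ℂ g 0) :
    germ f hf * germ g hg = germ (f * g) (hf.mul hg) := rfl

/-- The inclusion of constants. -/
noncomputable def constHom : ℂ →+* Og V where
  toFun c := germ (fun _ => c) analyticAt_const
  map_one' := rfl
  map_zero' := rfl
  map_mul' _ _ := rfl
  map_add' _ _ := rfl

noncomputable instance : Algebra ℂ (Og V) := constHom.toAlgebra

lemma algebraMap_Og (c : ℂ) :
    algebraMap ℂ (Og V) c = germ (fun _ => c) analyticAt_const := rfl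

lemma analyticAt_fderiv_apply {f : V → ℂ} (hf : AnalyticAt ℂ f 0) (v : V) :
    AnalyticAt ℂ (fun z => fderiv ℂ f z v) 0 :=
  AnalyticAt.comp (g := fun l : V →L[ℂ] ℂ => l v)
    ((ContinuousLinearMap.apply ℂ ℂ v).analyticAt _) hf.fderiv

lemma pd_germ (v : V) {f : V → ℂ} (hf : AnalyticAt ℂ f 0) :
    Og.pd v (germ f hf) = germ (fun z => fderiv ℂ f z v) (analyticAt_fderiv_apply hf v) := by
  refine Subtype.ext (Germ.coe_eq.2 ?_)
  filter_upwards [(rep_germ hf).fderiv (𝕜 := ℂ)] with z hz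
  rw [hz]

lemma eventually_differentiableAt {f : V → ℂ} (hf : AnalyticAt ℂ f 0) :
    ∀ᶠ z in 𝓝 0, DifferentiableAt ℂ f z :=
  hf.eventually_analyticAt.mono fun _ h => h.differentiableAt

/-- The directional derivative as a derivation. -/
noncomputable def pdD (v : V) : Derivation ℂ (Og V) (Og V) :=
  Derivation.mk'
    { toFun := Og.pd v
      map_add' := fun f g => by
        obtain ⟨f, hf, rfl⟩ := exists_germ f
        obtain ⟨g, hg, rfl⟩ := exists_germ g
        rw [germ_add, pd_germ, pd_germ, pd_germ, germ_add, germ_eq_iff]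
        filter_upwards [eventually_differentiableAt hf, eventually_differentiableAt hg]
          with z h1 h2
        simp only [fderiv_add h1 h2, Pi.add_apply, add_apply]
      map_smul' := fun c f => by
        obtain ⟨f, hf, rfl⟩ := exists_germ f
        rw [Algebra.smul_def, RingHom.id_apply, Algebra.smul_def, algebraMap_Og, germ_mul,
          pd_germ, pd_germ, germ_mul, germ_eq_iff]
        filter_upwards [eventually_differentiableAt hf] with z h1
        have : (fun _ : V => c) * f = fun z => c * f z := rfl
        rw [this, fderiv_const_mul h1]
        rfl }
    (fun f g => by
      obtain ⟨f, hf, rfl⟩ := exists_germ f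
      obtain ⟨g, hg, rfl⟩ := exists_germ g
      simp only [LinearMap.coe_mk, AddHom.coe_mk, smul_eq_mul]
      rw [germ_mul, pd_germ, pd_germ, pd_germ, germ_mul, germ_mul, germ_add, germ_eq_iff]
      filter_upwards [eventually_differentiableAt hf, eventually_differentiableAt hg]
        with z h1 h2
      rw [fderiv_mul h1 h2]
      rfl)

@[simp] lemma pdD_apply (v : V) (f : Og V) : pdD v f = Og.pd v f := rfl

lemma pdD_comm (v w : V) (f : Og V) : pdD v (pdD w f) = pdD w (pdD v f) := by
  obtain ⟨f, hf, rfl⟩ := exists_germ f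
  rw [pdD_apply, pdD_apply, pdD_apply, pdD_apply, pd_germ, pd_germ, pd_germ, pd_germ, germ_eq_iff]
  filter_upwards [hf.eventually_analyticAt] with z hz
  have h1 : ∀ u : V, fderiv ℂ (fun y => fderiv ℂ f y u) z =
      (ContinuousLinearMap.apply ℂ ℂ u).comp (fderiv ℂ (fderiv ℂ f) z) := fun u =>
    ((ContinuousLinearMap.apply ℂ ℂ u).hasFDerivAt.comp z
      hz.fderiv.differentiableAt.hasFDerivAt).fderiv
  rw [h1, h1]
  have h2 : IsSymmSndFDerivAt ℂ f z :=
    (hz.contDiffAt (n := 2)).isSymmSndFDerivAt (by simp)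
  exact h2 v w

lemma pull_germ {u : V → W} (hu : AnalyticAt ℂ u 0) (h0 : u 0 = 0) {f : W → ℂ}
    (hf : AnalyticAt ℂ f 0) :
    Og.pull u (germ f hf) = germ (fun z => f (u z)) ((h0.symm ▸ hf : AnalyticAt ℂ f (u 0)).comp hu) := by
  rw [Og.pull, dif_pos ⟨hu, h0⟩]
  refine Subtype.ext (Germ.coe_eq.2 ?_)
  have h1 : Tendsto u (𝓝 0) (𝓝 0) := by
    have := hu.continuousAt.tendsto
    rwa [h0] at this
  exact h1.eventually (rep_germ hf)

/-- Pull-back of germs as an algebra homomorphism. -/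
noncomputable def pullA (u : V → W) (hu : AnalyticAt ℂ u 0) (h0 : u 0 = 0) : Og W →ₐ[ℂ] Og V where
  toFun := Og.pull u
  map_one' := pull_germ hu h0 (f := fun _ => 1) analyticAt_const
  map_zero' := pull_germ hu h0 (f := fun _ => 0) analyticAt_const
  map_mul' f g := by
    obtain ⟨f, hf, rfl⟩ := exists_germ f
    obtain ⟨g, hg, rfl⟩ := exists_germ g
    rw [germ_mul, pull_germ hu h0, pull_germ hu h0, pull_germ hu h0, germ_mul]
    rfl
  map_add' f g := by
    obtain ⟨f, hf, rfl⟩ := exists_germ f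
    obtain ⟨g, hg, rfl⟩ := exists_germ g
    rw [germ_add, pull_germ hu h0, pull_germ hu h0, pull_germ hu h0, germ_add]
    rfl
  commutes' c := pull_germ hu h0 (f := fun _ => c) analyticAt_const

@[simp] lemma pullA_apply (u : V → W) (hu : AnalyticAt ℂ u 0) (h0 : u 0 = 0) (f : Og W) :
    pullA u hu h0 f = Og.pull u f := rfl

/-- Pull-back along a continuous linear map. -/
noncomputable def pullL (u : V →L[ℂ] W) : Og W →ₐ[ℂ] Og V := pullA u (u.analyticAt 0) (map_zero u)

lemma pullL_germ (u : V →L[ℂ] W) {f : W → ℂ} (hf : AnalyticAt ℂ f 0) :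
    ∃ h, pullL u (germ f hf) = germ (fun z => f (u z)) h :=
  ⟨_, pull_germ (u.analyticAt 0) (map_zero u) hf⟩

lemma pullL_pullL {X : Type*} [NormedAddCommGroup X] [NormedSpace ℂ X] (u : V →L[ℂ] W)
    (v : W →L[ℂ] X) (f : Og X) : pullL u (pullL v f) = pullL (v.comp u) f := by
  obtain ⟨f, hf, rfl⟩ := exists_germ f
  obtain ⟨h1, e1⟩ := pullL_germ v hf
  obtain ⟨h2, e2⟩ := pullL_germ u h1
  obtain ⟨h3, e3⟩ := pullL_germ (v.comp u) hf
  rw [e1, e2, e3]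
  rfl

lemma pullL_id (f : Og V) : pullL (ContinuousLinearMap.id ℂ V) f = f := by
  obtain ⟨f, hf, rfl⟩ := exists_germ f
  obtain ⟨h1, e1⟩ := pullL_germ (ContinuousLinearMap.id ℂ V) hf
  rw [e1]
  rfl

/-- Differentiation commutes with linear pull-back. -/
lemma pdD_pullL (u : V →L[ℂ] W) (v : V) (f : Og W) :
    pdD v (pullL u f) = pullL u (pdD (u v) f) := by
  obtain ⟨f, hf, rfl⟩ := exists_germ f
  obtain ⟨h1, e1⟩ := pullL_germ u hf
  rw [e1, pdD_apply, pdD_apply, pd_germ, pd_germ]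
  obtain ⟨h2, e2⟩ := pullL_germ u (analyticAt_fderiv_apply hf (u v))
  refine Eq.trans ?_ e2.symm
  rw [germ_eq_iff]
  have h3 : Tendsto u (𝓝 0) (𝓝 0) := by
    have := u.continuous.tendsto 0
    rwa [map_zero] at this
  filter_upwards [h3.eventually (eventually_differentiableAt hf)] with z hz
  have := (hz.hasFDerivAt.comp z u.hasFDerivAt).fderiv
  change fderiv ℂ (f ∘ u) z v = _
  rw [this]
  rfl

/-- The germ of a linear form. -/
noncomputable def lform (l : V →L[ℂ] ℂ) : Og V := germ l (l.analyticAt 0)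

lemma pdD_lform (v : V) (l : V →L[ℂ] ℂ) : pdD v (lform l) = algebraMap ℂ _ (l v) := by
  rw [lform, pdD_apply, pd_germ, algebraMap_Og, germ_eq_iff]
  exact Eventually.of_forall fun z => by simp

lemma pullL_lform (u : V →L[ℂ] W) (l : W →L[ℂ] ℂ) : pullL u (lform l) = lform (l.comp u) := by
  obtain ⟨h1, e1⟩ := pullL_germ u (l.analyticAt 0)
  exact e1

lemma lform_add (l l' : V →L[ℂ] ℂ) : lform (l + l') = lform l + lform l' := rfl

lemma lform_zero : lform (0 : V →L[ℂ] ℂ) = 0 := rfl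

lemma lform_smul (c : ℂ) (l : V →L[ℂ] ℂ) : lform (c • l) = c • lform l := by
  rw [Algebra.smul_def]; rfl

lemma lform_sum {κ : Type*} (s : Finset κ) (l : κ → V →L[ℂ] ℂ) :
    lform (∑ i ∈ s, l i) = ∑ i ∈ s, lform (l i) := by
  induction s using Finset.induction_on with
  | empty => simp [lform_zero]
  | insert a s ha ih => rw [Finset.sum_insert ha, Finset.sum_insert ha, lform_add, ih]

variable {ι : Type*} [Fintype ι]

/-- Convergent power series as germs on `ℂ^ι`. -/
noncomputable def serHom : Cv ι →ₐ[ℂ] Og (ι → ℂ) where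
  toFun f := germ (evf f) (analyticAt_evf f)
  map_one' := Subtype.ext <| Germ.coe_eq.2 (Eventually.of_forall fun x => by
    simpa using evf_algebraMap (ι := ι) 1 x)
  map_zero' := Subtype.ext <| Germ.coe_eq.2 (Eventually.of_forall fun x => by
    simpa using evf_algebraMap (ι := ι) 0 x)
  map_mul' f g := Subtype.ext <| Germ.coe_eq.2 (evf_mul f g)
  map_add' f g := Subtype.ext <| Germ.coe_eq.2 (evf_add f g)
  commutes' c := Subtype.ext <| Germ.coe_eq.2 (Eventually.of_forall fun x => evf_algebraMap c x)

lemma serHom_bijective : Function.Bijective (serHom (ι := ι)) := by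
  constructor
  · rw [injective_iff_map_eq_zero]
    intro f hf
    refine eq_zero_of_evf f ?_
    have h1 : germ (evf f) (analyticAt_evf f) = germ (fun _ => 0) analyticAt_const := hf
    exact germ_eq_iff.1 h1
  · intro f
    obtain ⟨f, hf, rfl⟩ := exists_germ f
    obtain ⟨g, hg⟩ := exists_evf_eq hf
    exact ⟨g, Subtype.ext (Germ.coe_eq.2 hg)⟩

lemma serHom_vr (i : ι) : serHom (vr i) = lform (ContinuousLinearMap.proj i) := by
  refine Subtype.ext (Germ.coe_eq.2 (Eventually.of_forall fun x => ?_))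
  exact (evf_mon _ x).trans (mval_single x i)

/-- Linear coordinates identify germs with convergent power series. -/
noncomputable def coordEquiv (e : V ≃L[ℂ] (ι → ℂ)) : Cv ι ≃ₐ[ℂ] Og V :=
  (AlgEquiv.ofBijective serHom serHom_bijective).trans
    (AlgEquiv.ofAlgHom (pullL (e : V →L[ℂ] (ι → ℂ))) (pullL (e.symm : (ι → ℂ) →L[ℂ] V))
      (by
        ext1 f
        rw [AlgHom.comp_apply, pullL_pullL, AlgHom.id_apply,
          show (e.symm : (ι → ℂ) →L[ℂ] V).comp (e : V →L[ℂ] (ι → ℂ)) = .id ℂ V by ext; simp, pullL_id])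
      (by
        ext1 f
        rw [AlgHom.comp_apply, pullL_pullL, AlgHom.id_apply,
          show (e : V →L[ℂ] (ι → ℂ)).comp (e.symm : (ι → ℂ) →L[ℂ] V) = .id ℂ _ by ext; simp,
          pullL_id]))

lemma coordEquiv_apply (e : V ≃L[ℂ] (ι → ℂ)) (f : Cv ι) :
    coordEquiv e f = pullL (e : V →L[ℂ] (ι → ℂ)) (serHom f) := rfl

lemma coordEquiv_vr (e : V ≃L[ℂ] (ι → ℂ)) (i : ι) :
    coordEquiv e (vr i) = lform ((ContinuousLinearMap.proj i).comp (e : V →L[ℂ] (ι → ℂ))) := by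
  rw [coordEquiv_apply, serHom_vr, pullL_lform]

end Germs

end LagFin

namespace LagFin

section Rigidity

variable {ι : Type*} [Fintype ι] {κ : Type*} [Fintype κ]

lemma vr_mem_maximalIdeal (a : ι) : vr a ∈ IsLocalRing.maximalIdeal (Cv ι) := by
  rw [maximalIdeal_eq_span]
  exact Ideal.subset_span ⟨a, rfl⟩

lemma eq_zero_of_mem_pow {f : Cv ι} (h : ∀ N, f ∈ IsLocalRing.maximalIdeal (Cv ι) ^ N) : f = 0 := by
  have h1 : f ∈ ⨅ N, IsLocalRing.maximalIdeal (Cv ι) ^ N := Ideal.mem_iInf.2 h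
  rw [Ideal.iInf_pow_eq_bot_of_isLocalRing _ (Ideal.IsPrime.ne_top inferInstance)] at h1
  exact h1

lemma exists_eq_cst_add (f : Cv ι) :
    ∃ g : ι → Cv ι, f = algebraMap ℂ _ (cst f) + ∑ a, g a * vr a := by
  have h1 : f - algebraMap ℂ _ (cst f) ∈ Ideal.span (Set.range (vr (ι := ι))) := by
    rw [← maximalIdeal_eq_span, mem_maximalIdeal_iff, map_sub, AlgHom.commutes]
    exact sub_self _
  obtain ⟨g, hg⟩ := (Ideal.mem_span_range_iff_exists_fun).1 h1
  exact ⟨g, by rw [hg]; ring⟩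

lemma derivation_eq_zero {X : Derivation ℂ (Cv ι) (Cv ι)} (h : ∀ a, X (vr a) = 0) (f : Cv ι) :
    X f = 0 := by
  refine eq_zero_of_mem_pow fun N => ?_
  induction N generalizing f with
  | zero => simp
  | succ N ih =>
    obtain ⟨g, hg⟩ := exists_eq_cst_add f
    rw [hg, map_add, X.map_algebraMap, zero_add, map_sum]
    refine Ideal.sum_mem _ fun a _ => ?_
    rw [X.leibniz, h, smul_zero, zero_add, smul_eq_mul, pow_succ']
    exact Ideal.mul_mem_mul (vr_mem_maximalIdeal a) (ih _)

/-- A derivation is determined by its values on the coordinates. -/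
lemma derivation_apply (X : Derivation ℂ (Cv ι) (Cv ι)) (f : Cv ι) :
    X f = ∑ a, X (vr a) * dd a f := by
  have h : ∀ f, (X - ∑ a, X (vr a) • dd a) f = X f - ∑ a, X (vr a) * dd a f := by
    intro f
    rw [Derivation.sub_apply]
    congr 1
    rw [← Derivation.coeFnAddMonoidHom_apply, map_sum, Finset.sum_apply]
    rfl
  have h0 := derivation_eq_zero (X := X - ∑ a, X (vr a) • dd a) (fun b => by
    rw [h, Finset.sum_eq_single b]
    · rw [dd_vr]; simp
    · intro a _ hab; rw [dd_vr]; simp [hab]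
    · simp) f
  rw [h] at h0
  exact sub_eq_zero.1 h0

lemma cst_algHom (σ : Cv ι →ₐ[ℂ] Cv κ) (f : Cv ι) : cst (σ f) = cst f := by
  by_contra hne
  have h1 : IsUnit (f - algebraMap ℂ _ (cst (σ f))) := by
    rw [isUnit_iff_cst, map_sub, AlgHom.commutes]
    exact fun h => hne (sub_eq_zero.1 h).symm
  have h2 := h1.map σ
  rw [isUnit_iff_cst, map_sub, map_sub, AlgHom.commutes, AlgHom.commutes] at h2
  exact h2 (sub_self _)

/-- An algebra homomorphism is determined by its values on the coordinates. -/
lemma algHom_eq {σ τ : Cv ι →ₐ[ℂ] Cv κ} (h : ∀ a, σ (vr a) = τ (vr a)) : σ = τ := by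
  ext1 f
  rw [← sub_eq_zero]
  refine eq_zero_of_mem_pow fun N => ?_
  induction N generalizing f with
  | zero => simp
  | succ N ih =>
    obtain ⟨g, hg⟩ := exists_eq_cst_add f
    have h1 : σ f - τ f = ∑ a, (σ (g a) - τ (g a)) * σ (vr a) := by
      rw [hg]
      simp only [map_add, map_sum, map_mul, AlgHom.commutes, ← h, sub_mul, Finset.sum_sub_distrib]
      ring
    rw [h1, pow_succ]
    refine Ideal.sum_mem _ fun a _ => Ideal.mul_mem_mul (ih _) ?_
    rw [mem_maximalIdeal_iff, cst_algHom, ← mem_maximalIdeal_iff]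
    exact vr_mem_maximalIdeal a

end Rigidity

section Derivations

variable {ι : Type*} [Fintype ι] {n : ℕ}

/-- Commuting derivations preserving the kernel of `π` form a system. -/
noncomputable def sysOfDerivations {B : Type*} [CommRing B] [Algebra ℂ B] (π : Cv ι →ₐ[ℂ] B)
    (hπ : Function.Surjective π) (X : Fin n → Derivation ℂ (Cv ι) (Cv ι))
    (hcomm : ∀ i j f, X i (X j f) = X j (X i f)) (hJ : ∀ j f, π f = 0 → π (X j f) = 0) :
    Sys π n :=
  have key : ∀ j f, π (X j (Function.surjInv hπ (π f))) = π (X j f) := fun j f => by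
    rw [← sub_eq_zero, ← map_sub, ← map_sub]
    exact hJ _ _ (by rw [map_sub, Function.surjInv_eq hπ, sub_self])
  have hadd : ∀ j b b', π (X j (Function.surjInv hπ (b + b'))) =
      π (X j (Function.surjInv hπ b)) + π (X j (Function.surjInv hπ b')) := fun j b b' => by
    obtain ⟨f, rfl⟩ := hπ b
    obtain ⟨f', rfl⟩ := hπ b'
    rw [← map_add, key, key, key, map_add, map_add]
  have hsmul : ∀ j (c : ℂ) b, π (X j (Function.surjInv hπ (c • b))) =
      c • π (X j (Function.surjInv hπ b)) := fun j c b => by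
    obtain ⟨f, rfl⟩ := hπ b
    rw [← map_smul, key, key, (X j).map_smul, map_smul]
  { c := fun j a => π (X j (vr a))
    X := fun j =>
      { toFun := fun b => π (X j (Function.surjInv hπ b))
        map_add' := hadd j
        map_smul' := hsmul j }
    leib := fun j b f => by
      obtain ⟨g, rfl⟩ := hπ b
      simp only [LinearMap.coe_mk, AddHom.coe_mk]
      rw [← map_mul, key, key, (X j).leibniz, smul_eq_mul, smul_eq_mul, map_add, map_mul, map_mul,
        derivation_apply (X j) f, map_sum]
      simp only [map_mul]
      ring
    comm := fun i j b => by
      obtain ⟨g, rfl⟩ := hπ b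
      simp only [LinearMap.coe_mk, AddHom.coe_mk]
      rw [key j g, key i g, key, key, hcomm] }

lemma sysOfDerivations_X {B : Type*} [CommRing B] [Algebra ℂ B] (π : Cv ι →ₐ[ℂ] B)
    (hπ : Function.Surjective π) (X : Fin n → Derivation ℂ (Cv ι) (Cv ι))
    (hcomm : ∀ i j f, X i (X j f) = X j (X i f)) (hJ : ∀ j f, π f = 0 → π (X j f) = 0)
    (j : Fin n) (f : Cv ι) : (sysOfDerivations π hπ X hcomm hJ).X j (π f) = π (X j f) := by
  change π (X j (Function.surjInv hπ (π f))) = π (X j f)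
  rw [← sub_eq_zero, ← map_sub, ← map_sub]
  exact hJ _ _ (by rw [map_sub, Function.surjInv_eq hπ, sub_self])

/-- The Koszul differential of a family of derivations. -/
noncomputable def dkos {A : Type*} [CommRing A] [Algebra ℂ A] (X : Fin n → Derivation ℂ A A) :
    (Finset (Fin n) → A) →+ Finset (Fin n) → A :=
  kos fun j => ((X j : A →ₗ[ℂ] A)).toAddMonoidHom

lemma finite_cohomology_of_surjective {B : Type*} [CommRing B] [Algebra ℂ B] [IsNoetherianRing B]
    (π : Cv ι →ₐ[ℂ] B) (hπ : Function.Surjective π) (X : Fin n → Derivation ℂ (Cv ι) (Cv ι))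
    (hcomm : ∀ i j f, X i (X j f) = X j (X i f)) (J : Ideal (Cv ι)) (hπJ : ∀ f, π f = 0 ↔ f ∈ J)
    (hJ : ∀ j, ∀ f ∈ J, X j f ∈ J)
    (Λ₀ : Set ι) (h0 : ∀ a ∈ Λ₀, ∀ j, X j (vr a) = 0) (y : Fin n → ι)
    (hy : Function.Injective y) (hyΛ : ∀ i, y i ∉ Λ₀)
    (hS : ∀ (i : ℕ) (hi : i < n), ∃ N, IsLocalRing.maximalIdeal (Cv ι) ^ N ≤
      J ⊔ (Ideal.span (Set.range fun r : Fin (i + 1) → Fin n =>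
        (Matrix.of fun a b => X (r b) (vr (y (Fin.castLE hi a)))).det)) ⊔
      Ideal.span (vr '' (Λ₀ ∪ y '' {b | b.val < i})))
    (hSn : ∃ N, IsLocalRing.maximalIdeal (Cv ι) ^ N ≤
      J ⊔ Ideal.span (vr '' (Λ₀ ∪ Set.range y))) :
    ∃ (N : ℕ) (g : Fin N → Finset (Fin n) → Cv ι), (∀ l s, dkos X (g l) s ∈ J) ∧
      ∀ z, (∀ s, dkos X z s ∈ J) → ∃ r : Fin N → Cv ι, (∀ l, r l ∈ Rs Λ₀) ∧
        ∃ w, ∀ s, z s - ∑ l, r l * g l s - dkos X w s ∈ J := by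
  simp only [← hπJ]
  have hJ' : ∀ j f, π f = 0 → π (X j f) = 0 := fun j f hf => (hπJ _).2 (hJ j f ((hπJ f).1 hf))
  let Y := sysOfDerivations π hπ X hcomm hJ'
  have hYX : ∀ j f, Y.X j (π f) = π (X j f) := sysOfDerivations_X π hπ X hcomm hJ'
  have hdB : ∀ z : Finset (Fin n) → Cv ι, (Y.dB fun s => π (z s)) = fun s => π (dkos X z s) := by
    intro z
    exact kos_map (φ' := fun j => (Y.X j).toAddMonoidHom) (π : Cv ι →+ B)
      (fun i x => (hYX i x).symm) z
  obtain ⟨N, g, hg1, hg2⟩ := Sys.finite_cohomology Y hπ Λ₀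
    (fun a ha j => by
      change π (X j (vr a)) = 0
      rw [h0 a ha, map_zero]) y hy hyΛ
    (fun i hi => by
      obtain ⟨N, hN⟩ := hS i hi
      refine ⟨N, hN.trans (sup_le_sup_right (sup_le ?_ ?_) _)⟩
      · intro f hf
        have h1 : π f = 0 := (hπJ f).2 hf
        rw [Ideal.mem_comap, h1]
        exact zero_mem _
      · rw [Ideal.span_le]
        rintro _ ⟨r, rfl⟩
        refine Ideal.mem_comap.2 (Ideal.subset_span ⟨r, ?_⟩)
        change _ = (π : Cv ι →+* B) _
        rw [RingHom.map_det]
        rfl)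
    (by
      obtain ⟨N, hN⟩ := hSn
      refine ⟨N, hN.trans (sup_le_sup_right (fun f hf => ?_) _)⟩
      have h1 : π f = 0 := (hπJ f).2 hf
      rw [Ideal.mem_comap, h1]
      exact zero_mem _)
  choose g' hg' using fun l s => hπ (g l s)
  have hgg : ∀ l, g l = fun s => π (g' l s) := fun l => funext fun s => (hg' l s).symm
  refine ⟨N, g', fun l s => ?_, fun z hz => ?_⟩
  · have h1 := hg1 l
    rw [hgg l, hdB] at h1
    exact congrFun h1 s
  · obtain ⟨r, hr, w, hw⟩ := hg2 (fun s => π (z s)) (by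
      rw [hdB]
      funext s
      exact hz s)
    choose w' hw' using fun s => hπ (w s)
    refine ⟨r, hr, w', fun s => ?_⟩
    have h1 := congrFun hw s
    have h2 : w = fun s => π (w' s) := funext fun s => (hw' s).symm
    rw [h2, hdB] at h1
    rw [map_sub, map_sub, h1, map_sum]
    simp only [Pi.add_apply, Finset.sum_apply, Pi.smul_apply, smul_eq_mul, map_mul, hg']
    ring

lemma exists_quotient_algHom.{u} {A : Type u} [CommRing A] [Algebra ℂ A] [IsNoetherianRing A]
    (J : Ideal A) : ∃ (B : Type u) (_ : CommRing B) (_ : Algebra ℂ B) (_ : IsNoetherianRing B)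
      (π : A →ₐ[ℂ] B), Function.Surjective π ∧ ∀ f, π f = 0 ↔ f ∈ J :=
  ⟨A ⧸ J, inferInstance, inferInstance, inferInstance, Ideal.Quotient.mkₐ ℂ J,
    Ideal.Quotient.mkₐ_surjective ℂ J, fun _ => Ideal.Quotient.eq_zero_iff_mem⟩

theorem finite_cohomology_of_derivations (J : Ideal (Cv ι))
    (X : Fin n → Derivation ℂ (Cv ι) (Cv ι))
    (hcomm : ∀ i j f, X i (X j f) = X j (X i f)) (hJ : ∀ j, ∀ f ∈ J, X j f ∈ J)
    (Λ₀ : Set ι) (h0 : ∀ a ∈ Λ₀, ∀ j, X j (vr a) = 0) (y : Fin n → ι)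
    (hy : Function.Injective y) (hyΛ : ∀ i, y i ∉ Λ₀)
    (hS : ∀ (i : ℕ) (hi : i < n), ∃ N, IsLocalRing.maximalIdeal (Cv ι) ^ N ≤
      J ⊔ (Ideal.span (Set.range fun r : Fin (i + 1) → Fin n =>
        (Matrix.of fun a b => X (r b) (vr (y (Fin.castLE hi a)))).det)) ⊔
      Ideal.span (vr '' (Λ₀ ∪ y '' {b | b.val < i})))
    (hSn : ∃ N, IsLocalRing.maximalIdeal (Cv ι) ^ N ≤
      J ⊔ Ideal.span (vr '' (Λ₀ ∪ Set.range y))) :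
    ∃ (N : ℕ) (g : Fin N → Finset (Fin n) → Cv ι), (∀ l s, dkos X (g l) s ∈ J) ∧
      ∀ z, (∀ s, dkos X z s ∈ J) → ∃ r : Fin N → Cv ι, (∀ l, r l ∈ Rs Λ₀) ∧
        ∃ w, ∀ s, z s - ∑ l, r l * g l s - dkos X w s ∈ J := by
  obtain ⟨B, _, _, _, π, hπ, hπJ⟩ := exists_quotient_algHom J
  exact finite_cohomology_of_surjective π hπ X hcomm J hπJ hJ Λ₀ h0 y hy hyΛ hS hSn

end Derivations

end LagFin

namespace LagFin

section Hamiltonian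

variable {A : Type*} [CommRing A] [Algebra ℂ A] {κ : Type*} [Fintype κ]

/-- The Hamiltonian derivation of `h` for conjugate families of derivations. -/
noncomputable def ham (Q P : κ → Derivation ℂ A A) (h : A) : Derivation ℂ A A :=
  ∑ i, (P i h • Q i - Q i h • P i)

lemma ham_apply (Q P : κ → Derivation ℂ A A) (h g : A) :
    ham Q P h g = ∑ i, (Q i g * P i h - P i g * Q i h) := by
  have h1 : ∀ (s : Finset κ) (D : κ → Derivation ℂ A A), (∑ i ∈ s, D i) g = ∑ i ∈ s, D i g := by
    intro s D
    induction s using Finset.induction_on with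
    | empty => simp
    | insert a s ha ih => rw [Finset.sum_insert ha, Finset.sum_insert ha, Derivation.add_apply, ih]
  rw [ham, h1]
  refine Finset.sum_congr rfl fun i _ => ?_
  rw [Derivation.sub_apply, Derivation.smul_apply, Derivation.smul_apply, smul_eq_mul,
    smul_eq_mul]
  ring

lemma sum_sum_eq_zero (T : κ → κ → A) (h : ∀ i j, T i j + T j i = 0) :
    ∑ i, ∑ j, T i j = 0 := by
  have h1 : ∑ i, ∑ j, T i j + ∑ i, ∑ j, T i j = 0 := by
    nth_rewrite 2 [Finset.sum_comm]
    rw [← Finset.sum_add_distrib]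
    refine Finset.sum_eq_zero fun i _ => ?_
    rw [← Finset.sum_add_distrib]
    exact Finset.sum_eq_zero fun j _ => h i j
  rw [← two_smul ℂ] at h1
  exact (smul_eq_zero_iff_right (two_ne_zero : (2 : ℂ) ≠ 0)).1 h1

/-- The Jacobi identity. -/
lemma ham_ham (Q P : κ → Derivation ℂ A A) (hQ : ∀ i j f, Q i (Q j f) = Q j (Q i f))
    (hP : ∀ i j f, P i (P j f) = P j (P i f)) (hQP : ∀ i j f, Q i (P j f) = P j (Q i f))
    (a b f : A) :
    ham Q P a (ham Q P b f) - ham Q P b (ham Q P a f) = ham Q P (ham Q P a b) f := by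
  rw [← sub_eq_zero]
  simp only [ham_apply, map_sum, Derivation.map_sub, Derivation.leibniz, smul_eq_mul,
    Finset.mul_sum, ← Finset.sum_sub_distrib, ← Finset.sum_add_distrib]
  refine sum_sum_eq_zero _ fun i j => ?_
  simp only [hQ j i, hP j i, hQP]
  ring

lemma ham_comm (Q P : κ → Derivation ℂ A A) (hQ : ∀ i j f, Q i (Q j f) = Q j (Q i f))
    (hP : ∀ i j f, P i (P j f) = P j (P i f)) (hQP : ∀ i j f, Q i (P j f) = P j (Q i f))
    {a b : A} (hab : ham Q P a b = 0) (f : A) :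
    ham Q P a (ham Q P b f) = ham Q P b (ham Q P a f) := by
  rw [← sub_eq_zero, ham_ham Q P hQ hP hQP, hab, ham_apply]
  simp

/-- A derivation killing generators of an ideal preserves the ideal. -/
lemma derivation_mem_span (X : Derivation ℂ A A) {S : Set A} (hS : ∀ a ∈ S, X a = 0) {f : A}
    (hf : f ∈ Ideal.span S) : X f ∈ Ideal.span S := by
  induction hf using Submodule.span_induction with
  | mem x hx => rw [hS x hx]; exact zero_mem _
  | zero => rw [map_zero]; exact zero_mem _
  | add x y _ _ hx hy => rw [map_add]; exact add_mem hx hy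
  | smul a x hx ih =>
    rw [smul_eq_mul, X.leibniz, smul_eq_mul, smul_eq_mul]
    exact add_mem (Ideal.mul_mem_left _ _ ih) (Ideal.mul_mem_right _ _ hx)

end Hamiltonian

section Phase

variable {Λ : Type*} [NormedAddCommGroup Λ] [NormedSpace ℂ Λ] {n : ℕ}

/-- The Hamiltonian derivation of a germ on phase space. -/
noncomputable def hamG (h : Og (PhaseC n)) : Derivation ℂ (Og (PhaseC n)) (Og (PhaseC n)) :=
  ham (fun i => pdD (qdir i)) (fun i => pdD (pdir i)) h

/-- The relative Hamiltonian derivation of a germ on `Λ × ℂ^{2n}`. -/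
noncomputable def hamP (h : Og (Λ × PhaseC n)) :
    Derivation ℂ (Og (Λ × PhaseC n)) (Og (Λ × PhaseC n)) :=
  ham (fun i => pdD (0, qdir i)) (fun i => pdD (0, pdir i)) h

lemma hamP_apply (h g : Og (Λ × PhaseC n)) : hamP h g = poisP g h := ham_apply _ _ _ _

lemma hamP_comm {a b : Og (Λ × PhaseC n)} (hab : poisP b a = 0) (f : Og (Λ × PhaseC n)) :
    hamP a (hamP b f) = hamP b (hamP a f) :=
  ham_comm _ _ (fun _ _ _ => pdD_comm _ _ _) (fun _ _ _ => pdD_comm _ _ _)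
    (fun _ _ _ => pdD_comm _ _ _) ((hamP_apply a b).trans hab) f

/-- Restriction to the zero fibre as an algebra homomorphism. -/
noncomputable def sliceA (Λ : Type*) [NormedAddCommGroup Λ] [NormedSpace ℂ Λ] (n : ℕ) :
    Og (Λ × PhaseC n) →ₐ[ℂ] Og (PhaseC n) :=
  pullL (ContinuousLinearMap.inr ℂ Λ (PhaseC n))

lemma sliceA_apply (f : Og (Λ × PhaseC n)) : sliceA Λ n f = slice0 f := rfl

lemma sliceA_hamP (h f : Og (Λ × PhaseC n)) :
    sliceA Λ n (hamP h f) = hamG (sliceA Λ n h) (sliceA Λ n f) := by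
  have h1 : ∀ (v : PhaseC n) (g : Og (Λ × PhaseC n)),
      sliceA Λ n (pdD (0, v) g) = pdD v (sliceA Λ n g) := fun v g =>
    (pdD_pullL (ContinuousLinearMap.inr ℂ Λ (PhaseC n)) v g).symm
  rw [hamP, hamG, ham_apply, ham_apply, map_sum]
  simp only [map_sub, map_mul, h1]

lemma hamP_lform_comp_fst (h : Og (Λ × PhaseC n)) (l : Λ →L[ℂ] ℂ) :
    hamP h (lform (l.comp (ContinuousLinearMap.fst ℂ Λ (PhaseC n)))) = 0 := by
  rw [hamP, ham_apply]
  simp [pdD_lform, -pdD_apply]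

end Phase

end LagFin

namespace LagFin

lemma ringKrullDim_quotient_le {A : Type*} [CommRing A] {I J : Ideal A} (h : I ≤ J)
    {d : WithBot ℕ∞} (hd : ringKrullDim (A ⧸ I) ≤ d) : ringKrullDim (A ⧸ J) ≤ d :=
  (ringKrullDim_le_of_surjective (Ideal.Quotient.factor h)
    (Ideal.Quotient.factor_surjective h)).trans hd

/-- A linearly independent family in the first half of the dual coordinates extends to a linear
change of coordinates. -/
lemma exists_coordinates_extending {m : ℕ} {V : Type*} [NormedAddCommGroup V] [NormedSpace ℂ V]
    (e₀ : V ≃L[ℂ] (Fin m ⊕ Fin m → ℂ)) (u : Fin m → Fin m ⊕ Fin m → ℂ)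
    (hu : LinearIndependent ℂ u) :
    ∃ e : V ≃L[ℂ] (Fin m ⊕ Fin m → ℂ), ∀ b x, e x (Sum.inl b) = ∑ c, u b c * e₀ x c := by
  let B := Module.Basis.sumExtend hu
  have hB : ∀ i, B (Sum.inl i) = u i := fun i => by
    simp only [B, Module.Basis.sumExtend, Trans.trans, Module.Basis.coe_reindex,
      Module.Basis.coe_extend, Function.comp_apply]
    rfl
  have hfin : Finite (Fin m ⊕ Module.Basis.sumExtendIndex hu) := Module.Finite.finite_basis B
  have : Finite (Module.Basis.sumExtendIndex hu) :=
    Finite.of_injective (β := Fin m ⊕ Module.Basis.sumExtendIndex hu) Sum.inr Sum.inr_injective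
  have := Fintype.ofFinite (Module.Basis.sumExtendIndex hu)
  have hcard : Fintype.card (Module.Basis.sumExtendIndex hu) = m := by
    have h1 := Module.finrank_eq_card_basis B
    rw [Module.finrank_fintype_fun_eq_card, Fintype.card_sum, Fintype.card_sum, Fintype.card_fin] at h1
    omega
  let w : Fin m ⊕ Fin m → Fin m ⊕ Fin m → ℂ :=
    Sum.elim u fun b => B (Sum.inr ((Fintype.equivFinOfCardEq hcard).symm b))
  have hw : ⊤ ≤ Submodule.span ℂ (Set.range w) := by
    rw [← B.span_eq, Submodule.span_le]
    rintro _ ⟨i | i, rfl⟩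
    · refine Submodule.subset_span ⟨Sum.inl i, ?_⟩
      exact (hB i).symm
    · refine Submodule.subset_span ⟨Sum.inr (Fintype.equivFinOfCardEq hcard i), ?_⟩
      simp [w]
  let M : (Fin m ⊕ Fin m → ℂ) →ₗ[ℂ] (Fin m ⊕ Fin m → ℂ) := Matrix.mulVecLin (Matrix.of w)
  have hM : Function.Injective M := by
    rw [injective_iff_map_eq_zero]
    intro x hx
    have h1 : ∀ y : Fin m ⊕ Fin m → ℂ, y ⬝ᵥ x = 0 := by
      intro y
      have hy : y ∈ Submodule.span ℂ (Set.range w) := hw trivial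
      induction hy using Submodule.span_induction with
      | mem y hy =>
        obtain ⟨c, rfl⟩ := hy
        exact congrFun hx c
      | zero => exact zero_dotProduct x
      | add y z _ _ h h' => rw [add_dotProduct, h, h', add_zero]
      | smul a y _ h => rw [smul_dotProduct, h, smul_zero]
    exact dotProduct_eq_zero x fun y => by rw [dotProduct_comm, h1]
  refine ⟨e₀.trans (LinearEquiv.ofInjectiveEndo M hM).toContinuousLinearEquiv, fun b x => ?_⟩
  rfl

end LagFin

namespace LagFin

section Local

variable {V : Type*} [NormedAddCommGroup V] [NormedSpace ℂ V] {ι : Type*} [Fintype ι]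

lemma isLocalRing_Og (e : V ≃L[ℂ] (ι → ℂ)) : IsLocalRing (Og V) :=
  RingEquiv.isLocalRing (coordEquiv e).toRingEquiv

lemma isNoetherianRing_Og (e : V ≃L[ℂ] (ι → ℂ)) : IsNoetherianRing (Og V) :=
  isNoetherianRing_of_ringEquiv _ (coordEquiv e).toRingEquiv

lemma mem_maximalIdeal_Og_iff [IsLocalRing (Og V)] (e : V ≃L[ℂ] (ι → ℂ)) (f : Og V) :
    cst ((coordEquiv e).symm f) = 0 ↔ f ∈ IsLocalRing.maximalIdeal (Og V) := by
  rw [← mem_maximalIdeal_iff, IsLocalRing.mem_maximalIdeal, IsLocalRing.mem_maximalIdeal,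
    mem_nonunits_iff, mem_nonunits_iff, MulEquiv.isUnit_map]

lemma span_coordinates_eq_maximalIdeal [IsLocalRing (Og V)] (e : V ≃L[ℂ] (ι → ℂ)) :
    Ideal.span (Set.range fun c =>
      (lform ((ContinuousLinearMap.proj c).comp (e : V →L[ℂ] (ι → ℂ))) : Og V)) =
      IsLocalRing.maximalIdeal (Og V) := by
  have h1 : (Set.range fun c =>
      (lform ((ContinuousLinearMap.proj c).comp (e : V →L[ℂ] (ι → ℂ))) : Og V)) =
      (coordEquiv e : Cv ι →+* Og V) '' Set.range vr := by
    rw [← Set.range_comp]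
    congr 1
    funext c
    exact (coordEquiv_vr e c).symm
  rw [h1, ← Ideal.map_span, ← maximalIdeal_eq_span]
  ext f
  rw [← mem_maximalIdeal_Og_iff e, ← mem_maximalIdeal_iff]
  constructor
  · intro hf
    obtain ⟨g, hg, rfl⟩ := (Ideal.mem_map_iff_of_surjective _ (coordEquiv e).surjective).1 hf
    exact ((coordEquiv e).symm_apply_apply g).symm ▸ hg
  · intro hf
    rw [← (coordEquiv e).apply_symm_apply f]
    exact Ideal.mem_map_of_mem _ hf

end Local

section Phase

variable {n : ℕ}

/-- The standard coordinates of phase space. -/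
noncomputable def phaseEquiv (n : ℕ) : PhaseC n ≃L[ℂ] (Fin n ⊕ Fin n → ℂ) :=
  (LinearEquiv.sumArrowLequivProdArrow (Fin n) (Fin n) ℂ ℂ).symm.toContinuousLinearEquiv

/-- The coordinate functions of phase space. -/
noncomputable def phaseCoord (c : Fin n ⊕ Fin n) : Og (PhaseC n) :=
  lform ((ContinuousLinearMap.proj c).comp
    (phaseEquiv n : PhaseC n →L[ℂ] (Fin n ⊕ Fin n → ℂ)))

lemma pd_eq_hamG (h : Og (PhaseC n)) (c : Fin n ⊕ Fin n) :
    Og.pd (phaseDir c) h =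
      Sum.elim (fun _ => -1) (fun _ => 1) c * hamG h (phaseCoord c.swap) := by
  have h1 : ∀ a b : Fin n, (phaseEquiv n) (qdir a) (Sum.inl b) = if b = a then 1 else 0 :=
    fun a b => Pi.single_apply a 1 b
  have h2 : ∀ a b : Fin n, (phaseEquiv n) (qdir a) (Sum.inr b) = 0 := fun a b => rfl
  have h3 : ∀ a b : Fin n, (phaseEquiv n) (pdir a) (Sum.inl b) = 0 := fun a b => rfl
  have h4 : ∀ a b : Fin n, (phaseEquiv n) (pdir a) (Sum.inr b) = if b = a then 1 else 0 :=
    fun a b => Pi.single_apply a 1 b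
  rw [hamG, ham_apply]
  simp only [phaseCoord, pdD_lform, ContinuousLinearMap.comp_apply,
    ContinuousLinearMap.proj_apply, ContinuousLinearEquiv.coe_coe]
  rcases c with a | a
  · simp only [Sum.swap_inl, Sum.elim_inl, h2, h4]
    simp [phaseDir, -pdD_apply, apply_ite]
    rfl
  · simp only [Sum.swap_inr, Sum.elim_inr, h1, h3]
    simp [phaseDir, -pdD_apply, apply_ite]
    rfl

lemma minorsIdeal_le_minIdeal (H : Fin n → Og (PhaseC n)) (m : ℕ) :
    minorsIdeal H m ≤ minIdeal (fun j c => hamG (H j) (phaseCoord c)) m := by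
  rw [minorsIdeal, Ideal.span_le]
  rintro _ ⟨r, c, rfl⟩
  have h1 := Matrix.det_mul_row (fun b => (Sum.elim (fun _ => -1) (fun _ => 1) (c b) : Og (PhaseC n)))
    (Matrix.of fun a b => hamG (H (r a)) (phaseCoord (c b).swap))
  simp only [pd_eq_hamG]
  refine (congrArg (· ∈ minIdeal (fun j c => hamG (H j) (phaseCoord c)) m) h1).mpr ?_
  exact Ideal.mul_mem_left _ _ (Ideal.subset_span ⟨r, fun b => (c b).swap, rfl⟩)

lemma exists_generic_linear_coordinates [IsLocalRing (Og (PhaseC n))] (H : Fin n → Og (PhaseC n))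
    (hred : IsReducedLagrangianCI H) (hpyr : IsPyramidal H) :
    ∃ e : PhaseC n ≃L[ℂ] (Fin n ⊕ Fin n → ℂ), ∃ y : Fin n → Og (PhaseC n),
      (∀ b, y b = lform ((ContinuousLinearMap.proj (Sum.inl b)).comp
        (e : PhaseC n →L[ℂ] (Fin n ⊕ Fin n → ℂ)))) ∧
      (∀ (i : ℕ) (hi : i < n), ∃ N, IsLocalRing.maximalIdeal (Og (PhaseC n)) ^ N ≤
        momentIdeal H ⊔ (Ideal.span (Set.range fun r : Fin (i + 1) → Fin n =>
          (Matrix.of fun a b => hamG (H (r b)) (y (Fin.castLE hi a))).det)) ⊔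
        Ideal.span (y '' {b | b.val < i})) ∧
      ∃ N, IsLocalRing.maximalIdeal (Og (PhaseC n)) ^ N ≤
        momentIdeal H ⊔ Ideal.span (Set.range y) := by
  have := isNoetherianRing_Og (phaseEquiv n)
  obtain ⟨u, hu, hS, hSn⟩ := exists_generic_coordinates
    (cst.comp ((coordEquiv (phaseEquiv n)).symm : Og (PhaseC n) →ₐ[ℂ] Cv (Fin n ⊕ Fin n)))
    (fun a => mem_maximalIdeal_Og_iff (phaseEquiv n) a) phaseCoord
    (span_coordinates_eq_maximalIdeal (phaseEquiv n))
    (fun j c => hamG (H j) (phaseCoord c)) (momentIdeal H) (by simp) (fun m hm => by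
      rcases hm.lt_or_eq with hm | rfl
      · exact ringKrullDim_quotient_le (sup_le_sup_left (minorsIdeal_le_minIdeal H _) _) (hpyr m hm)
      · exact ringKrullDim_quotient_le le_sup_left hred.2.le)
  obtain ⟨e, he⟩ := exists_coordinates_extending (phaseEquiv n) (fun b : Fin n => u b) hu
  have hy : ∀ b : Fin n, comb phaseCoord (u b) =
      lform ((ContinuousLinearMap.proj (Sum.inl b)).comp
        (e : PhaseC n →L[ℂ] (Fin n ⊕ Fin n → ℂ))) := by
    intro b
    rw [comb_apply]
    simp only [phaseCoord]
    rw [show ((ContinuousLinearMap.proj (Sum.inl b)).comp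
        (e : PhaseC n →L[ℂ] (Fin n ⊕ Fin n → ℂ))) = ∑ c, u b c • ((ContinuousLinearMap.proj c).comp
        (phaseEquiv n : PhaseC n →L[ℂ] (Fin n ⊕ Fin n → ℂ))) from ?_]
    · rw [lform_sum]
      exact Finset.sum_congr rfl fun c _ => (lform_smul _ _).symm
    · refine ContinuousLinearMap.ext fun x => ?_
      rw [_root_.sum_apply]
      exact he b x
  have hcol : ∀ (j b : Fin n), colv (fun j c => hamG (H j) (phaseCoord c)) (u b) j =
      hamG (H j) (comb phaseCoord (u b)) := by
    intro j b
    change comb (fun c => hamG (H j) (phaseCoord c)) (u b) = _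
    rw [comb_apply, comb_apply, map_sum]
    exact Finset.sum_congr rfl fun c _ => ((hamG (H j)).map_smul _ _).symm
  have himage : ∀ i ≤ n, (fun b => comb (phaseCoord (n := n)) (u b)) '' {b | b < i} =
      (fun b : Fin n => comb phaseCoord (u b)) '' {b | b.val < i} := by
    intro i hi
    ext f
    constructor
    · rintro ⟨b, hb, rfl⟩
      exact ⟨⟨b, lt_of_lt_of_le hb hi⟩, hb, rfl⟩
    · rintro ⟨b, hb, rfl⟩
      exact ⟨b, hb, rfl⟩
  refine ⟨e, fun b => comb phaseCoord (u b), hy, fun i hi => ?_, ?_⟩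
  · obtain ⟨N, hN⟩ := hS i hi
    refine ⟨N, hN.trans ?_⟩
    rw [himage i hi.le, sup_assoc, sup_assoc]
    refine sup_le_sup_left (sup_le le_sup_right (le_trans ?_ le_sup_left)) _
    rw [colMinors_le_iff]
    intro r
    rw [← Matrix.det_transpose]
    refine Ideal.subset_span ⟨r, congrArg Matrix.det (Matrix.ext fun a b => ?_)⟩
    exact (hcol (r b) (Fin.castLE hi a)).symm
  · obtain ⟨N, hN⟩ := hSn
    refine ⟨N, hN.trans ?_⟩
    rw [himage n le_rfl]
    exact sup_le_sup_left (Ideal.span_mono (Set.image_subset_range _ _)) _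

end Phase

end LagFin

namespace LagFin

section Family

variable {k n : ℕ}

/-- Linear coordinates on `ℂ^k × ℂ^{2n}` extending linear coordinates on `ℂ^{2n}`. -/
noncomputable def famEquiv (k : ℕ) (e : PhaseC n ≃L[ℂ] (Fin n ⊕ Fin n → ℂ)) :
    ((Fin k → ℂ) × PhaseC n) ≃L[ℂ] (Fin k ⊕ (Fin n ⊕ Fin n) → ℂ) :=
  ((ContinuousLinearEquiv.refl ℂ (Fin k → ℂ)).prodCongr e).trans
    (LinearEquiv.sumArrowLequivProdArrow (Fin k) (Fin n ⊕ Fin n) ℂ ℂ).symm.toContinuousLinearEquiv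

variable (e : PhaseC n ≃L[ℂ] (Fin n ⊕ Fin n → ℂ))

lemma coordEquiv_famEquiv_inl (a : Fin k) :
    coordEquiv (famEquiv k e) (vr (Sum.inl a)) =
      lform ((ContinuousLinearMap.proj (R := ℂ) (φ := fun _ : Fin k => ℂ) a).comp
        (ContinuousLinearMap.fst ℂ (Fin k → ℂ) (PhaseC n))) :=
  coordEquiv_vr _ _

lemma coordEquiv_famEquiv_inr (c : Fin n ⊕ Fin n) :
    coordEquiv (famEquiv k e) (vr (Sum.inr c)) =
      lform (((ContinuousLinearMap.proj c).comp (e : PhaseC n →L[ℂ] (Fin n ⊕ Fin n → ℂ))).comp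
        (ContinuousLinearMap.snd ℂ (Fin k → ℂ) (PhaseC n))) :=
  coordEquiv_vr _ _

lemma slice_inl (a : Fin k) :
    sliceA (Fin k → ℂ) n (coordEquiv (famEquiv k e) (vr (Sum.inl a))) = 0 := by
  rw [coordEquiv_famEquiv_inl, sliceA, pullL_lform, ← lform_zero]
  rfl

lemma slice_inr (c : Fin n ⊕ Fin n) :
    sliceA (Fin k → ℂ) n (coordEquiv (famEquiv k e) (vr (Sum.inr c))) =
      lform ((ContinuousLinearMap.proj c).comp (e : PhaseC n →L[ℂ] (Fin n ⊕ Fin n → ℂ))) := by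
  rw [coordEquiv_famEquiv_inr, sliceA, pullL_lform]
  rfl

lemma rho_vr_of_mem {ι : Type*} [Fintype ι] {I : Set ι} {i : ι} (hi : i ∈ I) :
    rho I (vr i) = vr i := rho_of_mem (vr_mem_Rs hi)

lemma rho_vr_of_notMem {ι : Type*} [Fintype ι] {I : Set ι} {i : ι} (hi : i ∉ I) :
    rho I (vr i) = 0 := by
  rw [← compl_compl I]
  exact mem_span_vr_iff.1 (Ideal.subset_span ⟨i, hi, rfl⟩)

/-- The kernel of the restriction to the zero fibre is generated by the parameters. -/
lemma mem_span_of_slice_eq_zero {f : Cv (Fin k ⊕ (Fin n ⊕ Fin n))}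
    (hf : sliceA (Fin k → ℂ) n (coordEquiv (famEquiv k e) f) = 0) :
    f ∈ Ideal.span (vr '' Set.range (Sum.inl : Fin k → Fin k ⊕ (Fin n ⊕ Fin n))) := by
  rw [mem_span_vr_iff]
  let Ψ := coordEquiv (famEquiv k e)
  let τ : Og (PhaseC n) →ₐ[ℂ] Og ((Fin k → ℂ) × PhaseC n) :=
    pullL (ContinuousLinearMap.snd ℂ (Fin k → ℂ) (PhaseC n))
  have key : rho (Set.range (Sum.inl : Fin k → Fin k ⊕ (Fin n ⊕ Fin n)))ᶜ =
      ((Ψ.symm : _ →ₐ[ℂ] _).comp τ).comp ((sliceA (Fin k → ℂ) n).comp (Ψ : _ →ₐ[ℂ] _)) := by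
    refine algHom_eq fun a => ?_
    rw [AlgHom.comp_apply, AlgHom.comp_apply, AlgHom.comp_apply]
    change _ = Ψ.symm (τ (sliceA _ _ (Ψ (vr a))))
    rcases a with a | c
    · rw [slice_inl, map_zero, map_zero, rho_vr_of_notMem (by simp)]
    · rw [slice_inr, rho_vr_of_mem (by simp), AlgEquiv.eq_symm_apply, coordEquiv_famEquiv_inr,
        pullL_lform]
  rw [key]
  change Ψ.symm (τ (sliceA _ _ (Ψ f))) = 0
  rw [hf, map_zero, map_zero]

/-- Series in the parameters only are pulled back from the parameter space. -/
lemma exists_lift1_eq {f : Cv (Fin k ⊕ (Fin n ⊕ Fin n))}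
    (hf : f ∈ Rs (Set.range (Sum.inl : Fin k → Fin k ⊕ (Fin n ⊕ Fin n)))) :
    ∃ c : Og (Fin k → ℂ), lift1 c = coordEquiv (famEquiv k e) f := by
  let Ψ := coordEquiv (famEquiv k e)
  let τ : Og (Fin k → ℂ) →ₐ[ℂ] Og ((Fin k → ℂ) × PhaseC n) :=
    pullL (ContinuousLinearMap.fst ℂ (Fin k → ℂ) (PhaseC n))
  let σ : Og ((Fin k → ℂ) × PhaseC n) →ₐ[ℂ] Og (Fin k → ℂ) :=
    pullL (ContinuousLinearMap.inl ℂ (Fin k → ℂ) (PhaseC n))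
  have key : rho (Set.range (Sum.inl : Fin k → Fin k ⊕ (Fin n ⊕ Fin n))) =
      ((Ψ.symm : _ →ₐ[ℂ] _).comp τ).comp (σ.comp (Ψ : _ →ₐ[ℂ] _)) := by
    refine algHom_eq fun a => ?_
    rw [AlgHom.comp_apply, AlgHom.comp_apply, AlgHom.comp_apply]
    change _ = Ψ.symm (τ (σ (Ψ (vr a))))
    rcases a with a | c
    · rw [rho_vr_of_mem (by simp), AlgEquiv.eq_symm_apply, coordEquiv_famEquiv_inl,
        pullL_lform, pullL_lform]
      rfl
    · rw [rho_vr_of_notMem (by simp), coordEquiv_famEquiv_inr, pullL_lform, eq_comm]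
      have h0 : (((ContinuousLinearMap.proj c).comp (e : PhaseC n →L[ℂ] (Fin n ⊕ Fin n → ℂ))).comp
        (ContinuousLinearMap.snd ℂ (Fin k → ℂ) (PhaseC n))).comp
          (ContinuousLinearMap.inl ℂ (Fin k → ℂ) (PhaseC n)) = 0 := by
        refine ContinuousLinearMap.ext fun x => ?_
        change (e 0) c = 0
        rw [map_zero]
        rfl
      rw [h0, lform_zero, map_zero, map_zero]
  refine ⟨σ (Ψ f), ?_⟩
  change τ (σ (Ψ f)) = Ψ f
  rw [← AlgEquiv.symm_apply_eq]
  exact (DFunLike.congr_fun key f).symm.trans (rho_of_mem hf)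

lemma sliceA_surjective : Function.Surjective (sliceA (Fin k → ℂ) n) := fun f =>
  ⟨pullL (ContinuousLinearMap.snd ℂ (Fin k → ℂ) (PhaseC n)) f, by
    rw [sliceA, pullL_pullL]
    exact pullL_id f⟩

/-- Membership in an ideal containing the parameters can be tested on the zero fibre. -/
lemma pow_le_of_slice [IsLocalRing (Og (PhaseC n))] (K : Ideal (Cv (Fin k ⊕ (Fin n ⊕ Fin n))))
    (hK : Ideal.span (vr '' Set.range (Sum.inl : Fin k → Fin k ⊕ (Fin n ⊕ Fin n))) ≤ K)
    (K₀ : Ideal (Og (PhaseC n)))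
    (hK₀ : K₀ ≤ K.map ((sliceA (Fin k → ℂ) n).comp
      (coordEquiv (famEquiv k e) : Cv (Fin k ⊕ (Fin n ⊕ Fin n)) →ₐ[ℂ] _)))
    {N : ℕ} (hN : IsLocalRing.maximalIdeal (Og (PhaseC n)) ^ N ≤ K₀) :
    IsLocalRing.maximalIdeal (Cv (Fin k ⊕ (Fin n ⊕ Fin n))) ^ N ≤ K := by
  set σ := (sliceA (Fin k → ℂ) n).comp
      (coordEquiv (famEquiv k e) : Cv (Fin k ⊕ (Fin n ⊕ Fin n)) →ₐ[ℂ] _) with hσ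
  have hsurj : Function.Surjective σ := sliceA_surjective.comp (coordEquiv (famEquiv k e)).surjective
  have h1 : (IsLocalRing.maximalIdeal (Cv (Fin k ⊕ (Fin n ⊕ Fin n)))).map σ ≤
      IsLocalRing.maximalIdeal (Og (PhaseC n)) := by
    rw [Ideal.map_le_iff_le_comap]
    intro f hf
    rw [Ideal.mem_comap, ← mem_maximalIdeal_Og_iff (phaseEquiv n)]
    exact (cst_algHom (((coordEquiv (phaseEquiv n)).symm :
      Og (PhaseC n) →ₐ[ℂ] Cv (Fin n ⊕ Fin n)).comp σ) f).trans (mem_maximalIdeal_iff.1 hf)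
  intro f hf
  have h2 : σ f ∈ K.map σ := by
    refine hK₀ (hN (Ideal.pow_right_mono h1 N ?_))
    rw [← Ideal.map_pow]
    exact Ideal.mem_map_of_mem σ hf
  obtain ⟨g, hg, hgf⟩ := (Ideal.mem_map_iff_of_surjective σ hsurj).1 h2
  rw [← sub_add_cancel f g]
  refine add_mem (hK (mem_span_of_slice_eq_zero e ?_)) hg
  change σ (f - g) = 0
  rw [map_sub, hgf, sub_self]

end Family

end LagFin

namespace LagFin

section Transport

variable {A B : Type*} [CommRing A] [Algebra ℂ A] [CommRing B] [Algebra ℂ B]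

/-- Transport of a derivation along an isomorphism. -/
noncomputable def conjDer (Ψ : B ≃ₐ[ℂ] A) (X : Derivation ℂ A A) : Derivation ℂ B B :=
  Derivation.mk' ((Ψ.symm.toLinearMap ∘ₗ (X : A →ₗ[ℂ] A)) ∘ₗ Ψ.toLinearMap) fun a b => by
    change Ψ.symm (X (Ψ (a * b))) = a • Ψ.symm (X (Ψ b)) + b • Ψ.symm (X (Ψ a))
    rw [map_mul, X.leibniz, map_add, smul_eq_mul, smul_eq_mul, map_mul, map_mul,
      Ψ.symm_apply_apply, Ψ.symm_apply_apply, smul_eq_mul, smul_eq_mul]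

lemma conjDer_apply (Ψ : B ≃ₐ[ℂ] A) (X : Derivation ℂ A A) (b : B) :
    conjDer Ψ X b = Ψ.symm (X (Ψ b)) := rfl

lemma apply_conjDer (Ψ : B ≃ₐ[ℂ] A) (X : Derivation ℂ A A) (b : B) :
    Ψ (conjDer Ψ X b) = X (Ψ b) := by
  rw [conjDer_apply, Ψ.apply_symm_apply]

lemma apply_dkos_conjDer {n : ℕ} (Ψ : B ≃ₐ[ℂ] A) (X : Fin n → Derivation ℂ A A)
    (z : Finset (Fin n) → B) (s : Finset (Fin n)) :
    Ψ (dkos (fun j => conjDer Ψ (X j)) z s) = dkos X (fun s => Ψ (z s)) s :=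
  (congrFun (kos_map (φ' := fun j => ((X j : A →ₗ[ℂ] A)).toAddMonoidHom) (Ψ : B →+ A)
    (fun i x => apply_conjDer Ψ (X i) x) z) s).symm

end Transport

section Family

variable {k n : ℕ}

theorem exists_generators (H : Fin n → Og (PhaseC n))
    (hred : IsReducedLagrangianCI H) (hpyr : IsPyramidal H)
    (F : Fin n → Og ((Fin k → ℂ) × PhaseC n)) (hF : IsIntegrableDef H F) :
    ∃ (N : ℕ) (g : Fin N → Finset (Fin n) → Og ((Fin k → ℂ) × PhaseC n)),
      (∀ l s, dkos (fun j => hamP (F j)) (g l) s ∈ defIdeal F) ∧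
      ∀ z, (∀ s, dkos (fun j => hamP (F j)) z s ∈ defIdeal F) →
        ∃ (c : Fin N → Og (Fin k → ℂ)) (w : Finset (Fin n) → Og ((Fin k → ℂ) × PhaseC n)),
          ∀ s, z s - ∑ l, lift1 (c l) * g l s - dkos (fun j => hamP (F j)) w s ∈ defIdeal F := by
  have := isLocalRing_Og (phaseEquiv n)
  obtain ⟨e, y, hy, hS, hSn⟩ := exists_generic_linear_coordinates H hred hpyr
  let Ψ := coordEquiv (famEquiv k e)
  let σ : Cv (Fin k ⊕ (Fin n ⊕ Fin n)) →ₐ[ℂ] Og (PhaseC n) :=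
    (sliceA (Fin k → ℂ) n).comp (Ψ : Cv (Fin k ⊕ (Fin n ⊕ Fin n)) →ₐ[ℂ] _)
  let X : Fin n → Derivation ℂ (Cv (Fin k ⊕ (Fin n ⊕ Fin n))) (Cv (Fin k ⊕ (Fin n ⊕ Fin n))) :=
    fun j => conjDer Ψ (hamP (F j))
  let J : Ideal (Cv (Fin k ⊕ (Fin n ⊕ Fin n))) := (defIdeal F).comap Ψ
  let Λ₀ : Set (Fin k ⊕ (Fin n ⊕ Fin n)) := Set.range Sum.inl
  let y' : Fin n → Fin k ⊕ (Fin n ⊕ Fin n) := fun b => Sum.inr (Sum.inl b)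
  have hX : ∀ j f, Ψ (X j f) = hamP (F j) (Ψ f) := fun j f => apply_conjDer Ψ _ f
  have hσX : ∀ j f, σ (X j f) = hamG (H j) (σ f) := by
    intro j f
    change sliceA _ _ (Ψ (X j f)) = hamG (H j) (sliceA _ _ (Ψ f))
    rw [hX, sliceA_hamP, sliceA_apply (F j), hF.1 j]
  have hσy : ∀ b, σ (vr (y' b)) = y b := fun b => (slice_inr e _).trans (hy b).symm
  have hmoment : momentIdeal H ≤ J.map σ := by
    rw [momentIdeal, Ideal.span_le]
    rintro _ ⟨j, rfl⟩
    have h1 : σ (Ψ.symm (F j)) = H j := by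
      change sliceA _ _ (Ψ (Ψ.symm (F j))) = _
      rw [Ψ.apply_symm_apply]
      exact hF.1 j
    rw [← h1]
    refine Ideal.mem_map_of_mem σ (Ideal.mem_comap.2 ?_)
    rw [Ψ.apply_symm_apply]
    exact Ideal.subset_span ⟨j, rfl⟩
  obtain ⟨N, g, hg1, hg2⟩ := finite_cohomology_of_derivations J X
    (fun i j f => Ψ.injective (by
      rw [hX, hX, hX, hX]
      exact hamP_comm (hF.2 j i) _))
    (fun j f hf => by
      rw [Ideal.mem_comap, hX]
      refine derivation_mem_span _ ?_ (Ideal.mem_comap.1 hf)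
      rintro _ ⟨i, rfl⟩
      rw [hamP_apply]
      exact hF.2 i j)
    Λ₀
    (by
      rintro _ ⟨a, rfl⟩ j
      refine Ψ.injective ?_
      rw [hX, map_zero, coordEquiv_famEquiv_inl]
      exact hamP_lform_comp_fst _ _)
    y' (Sum.inr_injective.comp Sum.inl_injective) (by rintro i ⟨a, ha⟩; cases ha)
    (fun i hi => by
      obtain ⟨N, hN⟩ := hS i hi
      refine ⟨N, pow_le_of_slice e _ ?_ _ ?_ hN⟩
      · exact le_trans (Ideal.span_mono (Set.image_mono Set.subset_union_left)) le_sup_right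
      · change _ ≤ Ideal.map σ _
        refine sup_le (sup_le ?_ ?_) ?_
        · exact hmoment.trans (Ideal.map_mono (le_sup_left.trans le_sup_left))
        · rw [Ideal.span_le]
          rintro _ ⟨r, rfl⟩
          have h1 : σ (Matrix.of fun a b => X (r b) (vr (y' (Fin.castLE hi a)))).det =
              (Matrix.of fun a b => hamG (H (r b)) (y (Fin.castLE hi a))).det := by
            rw [AlgHom.map_det]
            refine congrArg Matrix.det (Matrix.ext fun a b => ?_)
            exact (hσX _ _).trans (congrArg _ (hσy _))
          change (Matrix.of fun a b => hamG (H (r b)) (y (Fin.castLE hi a))).det ∈ Ideal.map σ _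
          rw [← h1]
          exact Ideal.mem_map_of_mem σ (Ideal.mem_sup_left
            (Ideal.mem_sup_right (Ideal.subset_span ⟨r, rfl⟩)))
        · rw [Ideal.span_le]
          rintro _ ⟨b, hb, rfl⟩
          rw [← hσy]
          exact Ideal.mem_map_of_mem σ (Ideal.mem_sup_right
            (Ideal.subset_span ⟨y' b, Or.inr ⟨b, hb, rfl⟩, rfl⟩)))
    (by
      obtain ⟨N, hN⟩ := hSn
      refine ⟨N, pow_le_of_slice e _ ?_ _ ?_ hN⟩
      · exact le_trans (Ideal.span_mono (Set.image_mono Set.subset_union_left)) le_sup_right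
      · change _ ≤ Ideal.map σ _
        refine sup_le (hmoment.trans (Ideal.map_mono le_sup_left)) ?_
        rw [Ideal.span_le]
        rintro _ ⟨b, rfl⟩
        rw [← hσy]
        exact Ideal.mem_map_of_mem σ (Ideal.mem_sup_right
          (Ideal.subset_span ⟨y' b, Or.inr ⟨b, rfl⟩, rfl⟩)))
  refine ⟨N, fun l s => Ψ (g l s), fun l s => ?_, fun z hz => ?_⟩
  · rw [← apply_dkos_conjDer]
    exact hg1 l s
  · have hzz : ∀ s, dkos X (fun s => Ψ.symm (z s)) s ∈ J := by
      intro s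
      rw [Ideal.mem_comap]
      refine (apply_dkos_conjDer Ψ (fun j => hamP (F j)) _ s).symm ▸ ?_
      simp only [Ψ.apply_symm_apply]
      exact hz s
    obtain ⟨r, hr, w, hw⟩ := hg2 _ hzz
    choose c hc using fun l => exists_lift1_eq e (hr l)
    refine ⟨c, fun s => Ψ (w s), fun s => ?_⟩
    have h1 := Ideal.mem_comap.1 (hw s)
    rw [map_sub, map_sub, map_sum, Ψ.apply_symm_apply, apply_dkos_conjDer] at h1
    simp only [map_mul] at h1
    simp only [hc]
    exact h1

end Family

end LagFin

namespace LagFin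

section Degrees

variable {Λ : Type*} [NormedAddCommGroup Λ] [NormedSpace ℂ Λ] {n : ℕ}

/-- Extension by zero of a homogeneous cochain. -/
noncomputable def extC {j : ℕ} (m : LagC Λ n j) (s : Finset (Fin n)) : Og (Λ × PhaseC n) :=
  if h : s.card = j then m ⟨s, h⟩ else 0

lemma dkos_hamP_apply (F : Fin n → Og (Λ × PhaseC n)) (z : Finset (Fin n) → Og (Λ × PhaseC n))
    (s : Finset (Fin n)) :
    dkos (fun j => hamP (F j)) z s = ∑ i ∈ s, ksgn i s • poisP (z (s.erase i)) (F i) := by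
  rw [dkos, kos_apply]
  exact Finset.sum_congr rfl fun i _ => congrArg _ (hamP_apply _ _)

lemma lagDiff_restrict (F : Fin n → Og (Λ × PhaseC n)) {j : ℕ}
    (z : Finset (Fin n) → Og (Λ × PhaseC n)) (s : {s : Finset (Fin n) // s.card = j + 1}) :
    lagDiff F (fun t : {s : Finset (Fin n) // s.card = j} => z t.1) s =
      dkos (fun j => hamP (F j)) z s.1 := by
  rw [dkos_hamP_apply, ← Finset.sum_attach]
  rfl

lemma extC_coe {j : ℕ} (m : LagC Λ n j) (s : {s : Finset (Fin n) // s.card = j}) :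
    extC m s.1 = m s := dif_pos s.2

lemma dkos_extC_mem (F : Fin n → Og (Λ × PhaseC n)) {j : ℕ} {m : LagC Λ n j}
    (hm : m ∈ lagCocycle F j) (s : Finset (Fin n)) :
    dkos (fun j => hamP (F j)) (extC m) s ∈ defIdeal F := by
  by_cases hs : s.card = j + 1
  · have h1 := hm ⟨s, hs⟩
    rwa [show m = fun t => extC m t.1 from funext fun t => (extC_coe m t).symm,
      lagDiff_restrict] at h1
  · rw [dkos_hamP_apply]
    refine sum_mem fun i hi => ?_
    rw [extC, dif_neg, ← hamP_apply, map_zero, smul_zero]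
    · exact zero_mem _
    · rw [Finset.card_erase_of_mem hi]
      have := Finset.card_pos.2 ⟨i, hi⟩
      omega

end Degrees

end LagFin

/-- **Finiteness of Lagrangian cohomology.**  Let `H` be a moment map germ defining a
pyramidal reduced Lagrangian complete intersection and let `F` be an integrable
Lagrangian deformation of `H` over `(ℂ^k,0)`.  Then every cohomology module
`H^j(C_F)` of the Lagrange complex of `F` is a finitely generated
`𝒪_k`-module: finitely many cocycles generate it modulo coboundaries. -/
theorem lagrangian_cohomology_finite {k n : ℕ}
    (H : Fin n → Og (PhaseC n)) (hH : IsMomentMap H)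
    (hred : IsReducedLagrangianCI H) (hpyr : IsPyramidal H)
    (F : Fin n → Og ((Fin k → ℂ) × PhaseC n)) (hF : IsIntegrableDef H F) :
    ∀ j : ℕ, ∃ (N : ℕ) (g : Fin N → LagC (Fin k → ℂ) n j),
      (∀ a, g a ∈ lagCocycle F j) ∧
      ∀ m ∈ lagCocycle F j, ∃ c : Fin N → Og (Fin k → ℂ),
        (m - ∑ a, fun s => lift1 (c a) * g a s) ∈ lagCoboundary F j := by
  intro j
  obtain ⟨N, g, hg, hgen⟩ := LagFin.exists_generators H hred hpyr F hF
  refine ⟨N, fun a s => g a s.1, fun a s => ?_, fun m hm => ?_⟩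
  · rw [LagFin.lagDiff_restrict]
    exact hg a s.1
  · obtain ⟨c, w, hw⟩ := hgen (LagFin.extC m) (LagFin.dkos_extC_mem F hm)
    refine ⟨c, ?_⟩
    cases j with
    | zero =>
      intro s
      have h1 := hw s.1
      rw [LagFin.dkos_hamP_apply, Finset.card_eq_zero.1 s.2, Finset.sum_empty, sub_zero,
        ← Finset.card_eq_zero.1 s.2, LagFin.extC_coe] at h1
      rw [Pi.sub_apply, Finset.sum_apply]
      exact h1
    | succ j =>
      refine ⟨fun t => w t.1, fun s => ?_⟩
      have h1 := hw s.1
      rw [LagFin.extC_coe] at h1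
      rw [Pi.sub_apply, Finset.sum_apply, LagFin.lagDiff_restrict]
      exact h1
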